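/- Property q₁ (growth of the differences along a ray): for every m ∈ M̄ and every n ≥ 1, the difference d_m(n) = p^{n+1}(m) − pⁿ(m) satisfies d_m(n) > pⁿ(m)·(ln pⁿ(m) − 1), where ln denotes the natural logarithm. -/

import Mathlib

/-- `p n` is the `n`-th prime number, indexed from 1: `p 1 = 2`, `p 2 = 3`, `p 3 = 5`, … -/
noncomputable def p (n : ℕ) : ℕ := Nat.nth Nat.Prime (n - 1)

section

open Complex Filter Topology

/-- Error of the trapezoid rule for `x ↦ x ^ (-s)` on `[n, n+1]`, multiplied by `s - 1`. -/
noncomputable def zetaTrap (n : ℕ) (s : ℂ) : ℂ :=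
  (s - 1) / 2 * ((n : ℂ) ^ (-s) + ((n : ℂ) + 1) ^ (-s)) + ((n : ℂ) + 1) ^ (1 - s) - (n : ℂ) ^ (1 - s)

lemma zetaTrap_norm_le (n : ℕ) (hn : 1 ≤ n) (s : ℂ) (hs : 0 < s.re) :
    ‖zetaTrap n s‖ ≤ ‖s - 1‖ * ‖s‖ * ‖s + 1‖ / 12 * (n : ℝ) ^ (-s.re - 2) := by
  have hn0 : (0:ℝ) < n := by exact_mod_cast hn
  have hpow : ∀ (r : ℂ) (x : ℝ), 0 < x →
      HasDerivAt (fun y : ℝ ↦ (y : ℂ) ^ r) (r * (x : ℂ) ^ (r - 1)) x := by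
    intro r x hx
    have h := (hasDerivAt_id (x:ℂ)).cpow_const (c := r) (by left; simpa using hx)
    simpa using h.comp_ofReal
  let B : ℝ → ℂ := fun x ↦ (s - 1) * (((x - n) * (n + 1 - x) / 2 : ℝ) * (-s * (x : ℂ) ^ (-s - 1))
      - ((2 * n + 1 - 2 * x) / 2 : ℝ) * (x : ℂ) ^ (-s)) + (x : ℂ) ^ (1 - s)
  let B' : ℝ → ℂ := fun x ↦ ((x - n) * (n + 1 - x) / 2 : ℝ) * ((s - 1) * s * (s + 1) * (x : ℂ) ^ (-s - 2))
  have hB : ∀ x : ℝ, 0 < x → HasDerivAt B (B' x) x := by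
    intro x hx
    have h1 := hpow (-s - 1) x hx
    have h2 := hpow (-s) x hx
    have h3 := hpow (1 - s) x hx
    have q1 : HasDerivAt (fun y : ℝ ↦ (((y - n) * (n + 1 - y) / 2 : ℝ) : ℂ)) (((2 * n + 1 - 2 * x) / 2 : ℝ) : ℂ) x := by
      apply HasDerivAt.ofReal_comp
      have := (((hasDerivAt_id x).sub_const (n:ℝ)).mul ((hasDerivAt_id x).const_sub ((n:ℝ) + 1))).div_const 2
      refine this.congr_deriv ?_
      simp; ring
    have q2 : HasDerivAt (fun y : ℝ ↦ (((2 * n + 1 - 2 * y) / 2 : ℝ) : ℂ)) ((-1 : ℝ) : ℂ) x := by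
      apply HasDerivAt.ofReal_comp
      have := (((hasDerivAt_id x).const_mul 2).const_sub (2 * (n:ℝ) + 1)).div_const 2
      refine this.congr_deriv ?_
      norm_num
    have := (((q1.mul (h1.const_mul (-s))).sub (q2.mul h2)).const_mul (s - 1)).add h3
    refine this.congr_deriv ?_
    simp only [B']
    have e1 : (-s - 1 - 1 : ℂ) = -s - 2 := by ring
    have e2 : (1 - s - 1 : ℂ) = -s := by ring
    rw [e1, e2]
    push_cast
    ring
  have hcont : ContinuousOn B' (Set.uIcc (n:ℝ) (n + 1)) := by
    intro x hx
    rw [Set.uIcc_of_le (by linarith)] at hx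
    have hx0 : 0 < x := lt_of_lt_of_le hn0 hx.1
    apply ContinuousAt.continuousWithinAt
    have h1 := (hpow (-s - 2) x hx0).continuousAt
    simp only [B']
    fun_prop
  have hInt : ∫ x in (n:ℝ)..(n + 1), B' x = B (n + 1) - B n := by
    apply intervalIntegral.integral_eq_sub_of_hasDerivAt
    · intro x hx
      rw [Set.uIcc_of_le (by linarith)] at hx
      exact hB x (lt_of_lt_of_le hn0 hx.1)
    · exact hcont.intervalIntegrable
  have hval : B (n + 1) - B n = zetaTrap n s := by
    simp only [B, zetaTrap]
    push_cast
    ring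
  rw [← hval, ← hInt]
  have hle : ‖∫ x in (n:ℝ)..(n + 1), B' x‖ ≤ ∫ x in (n:ℝ)..(n + 1), ((x - n) * (n + 1 - x) / 2) * (‖s - 1‖ * ‖s‖ * ‖s + 1‖ * (n : ℝ) ^ (-s.re - 2)) := by
    apply intervalIntegral.norm_integral_le_of_norm_le (by linarith)
    · refine Eventually.of_forall fun x hx ↦ ?_
      have hx0 : 0 < x := lt_trans hn0 hx.1
      simp only [B', norm_mul, Complex.norm_real]
      rw [Complex.norm_cpow_eq_rpow_re_of_pos hx0]
      have h0 : 0 ≤ (x - n) * (n + 1 - x) / 2 := by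
        have := mul_nonneg (sub_nonneg.2 hx.1.le) (sub_nonneg.2 hx.2)
        linarith
      rw [Real.norm_of_nonneg h0]
      gcongr
      have : (-s - 2 : ℂ).re = -s.re - 2 := by simp
      rw [this]
      exact Real.rpow_le_rpow_of_nonpos hn0 hx.1.le (by linarith)
    · apply Continuous.intervalIntegrable; fun_prop
  refine hle.trans (le_of_eq ?_)
  rw [intervalIntegral.integral_mul_const]
  have : ∫ x in (n:ℝ)..(n + 1), ((x - n) * (n + 1 - x) / 2) = 1 / 12 := by
    have := intervalIntegral.integral_eq_sub_of_hasDerivAt (f := fun x : ℝ ↦ (x - n)^2 / 4 - (x - n)^3 / 6)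
      (f' := fun x : ℝ ↦ (x - n) * (n + 1 - x) / 2) (a := n) (b := n + 1) ?_ ?_
    · rw [this]; norm_num
    · intro x _
      have := ((((hasDerivAt_id x).sub_const (n:ℝ)).pow 2).div_const 4).sub ((((hasDerivAt_id x).sub_const (n:ℝ)).pow 3).div_const 6)
      refine this.congr_deriv ?_
      simp; ring
    · apply Continuous.intervalIntegrable; fun_prop
  rw [this]; ring

lemma zetaTrap_sum (N : ℕ) (K : ℕ) (s : ℂ) :
    ∑ i ∈ Finset.range K, zetaTrap (N + i) s
      = (s - 1) * (∑ i ∈ Finset.range K, ((N + i : ℕ) : ℂ) ^ (-s) + ((N + K : ℕ) : ℂ) ^ (-s) / 2 - (N : ℂ) ^ (-s) / 2)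
        + ((N + K : ℕ) : ℂ) ^ (1 - s) - (N : ℂ) ^ (1 - s) := by
  induction K with
  | zero => simp
  | succ K ih =>
    rw [Finset.sum_range_succ, ih, Finset.sum_range_succ, zetaTrap]
    push_cast
    ring_nf

lemma zetaTrap_hasSum_of_one_lt {N : ℕ} (hN : 1 ≤ N) {s : ℂ} (hs : 1 < s.re) :
    (s - 1) * riemannZeta s = (s - 1) * (∑ n ∈ Finset.Ico 1 N, (n : ℂ) ^ (-s) + (N : ℂ) ^ (-s) / 2)
      + (N : ℂ) ^ (1 - s) + ∑' i, zetaTrap (N + i) s := by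
  have hs0 : s ≠ 0 := by rintro rfl; simp at hs; linarith
  have hsum : Summable fun n : ℕ ↦ (n : ℂ) ^ (-s) := by
    have := Complex.summable_one_div_nat_cpow.2 hs
    refine this.congr fun n ↦ ?_
    rw [Complex.cpow_neg, one_div]
  have hz : riemannZeta s = ∑' n : ℕ, (n : ℂ) ^ (-s) := by
    rw [zeta_eq_tsum_one_div_nat_cpow hs]
    refine tsum_congr fun n ↦ ?_
    rw [Complex.cpow_neg, one_div]
  have hz2 : riemannZeta s = ∑ n ∈ Finset.Ico 1 N, (n : ℂ) ^ (-s) + ∑' i : ℕ, ((N + i : ℕ) : ℂ) ^ (-s) := by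
    rw [hz, ← hsum.sum_add_tsum_nat_add N]
    congr 1
    · rw [Finset.range_eq_Ico, Finset.sum_eq_sum_Ico_succ_bot (by omega)]
      rw [Nat.cast_zero, Complex.zero_cpow (by simpa using hs0)]; simp
    · refine tsum_congr fun i ↦ ?_
      rw [add_comm]
  have hsumN : Summable fun i : ℕ ↦ ((N + i : ℕ) : ℂ) ^ (-s) := by
    have := (summable_nat_add_iff N).2 hsum
    refine this.congr fun i ↦ ?_
    rw [add_comm]
  have hS : Summable fun i ↦ zetaTrap (N + i) s := by
    have hb : Summable fun i : ℕ ↦ ‖s - 1‖ * ‖s‖ * ‖s + 1‖ / 12 * ((N + i : ℕ) : ℝ) ^ (-s.re - 2) := by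
      apply Summable.mul_left
      have := (Real.summable_nat_rpow (p := -s.re - 2)).2 (by linarith)
      refine ((summable_nat_add_iff N).2 this).congr fun i ↦ ?_
      rw [add_comm]
    exact Summable.of_norm_bounded hb fun i ↦ zetaTrap_norm_le _ (by omega) _ (by linarith)
  have hlim : Tendsto (fun K ↦ ∑ i ∈ Finset.range K, zetaTrap (N + i) s) atTop
      (𝓝 ((s - 1) * ((∑' i : ℕ, ((N + i : ℕ) : ℂ) ^ (-s)) + 0 / 2 - (N : ℂ) ^ (-s) / 2) + 0 - (N : ℂ) ^ (1 - s))) := by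
    simp_rw [zetaTrap_sum]
    have t1 := hsumN.hasSum.tendsto_sum_nat
    have hz0 : ∀ r : ℂ, r.re < 0 → Tendsto (fun K : ℕ ↦ ((N + K : ℕ) : ℂ) ^ r) atTop (𝓝 0) := by
      intro r hr
      rw [tendsto_zero_iff_norm_tendsto_zero]
      have h := (tendsto_rpow_neg_atTop (y := -r.re) (by linarith)).comp
        (tendsto_natCast_atTop_atTop (R := ℝ))
      have h2 := (tendsto_add_atTop_iff_nat N).2 h
      refine h2.congr fun K ↦ ?_
      rw [add_comm N K, Complex.norm_natCast_cpow_of_pos (by omega)]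
      simp
    have t2 := hz0 (-s) (by simp; linarith)
    have t3 := hz0 (1 - s) (by simp; linarith)
    exact (((((t1.add (t2.div_const 2)).sub_const _).const_mul _).add t3).sub_const _)
  have := tendsto_nhds_unique hS.hasSum.tendsto_sum_nat hlim
  rw [this, hz2]
  ring

lemma zetaTrap_hasSum {N : ℕ} (hN : 1 ≤ N) {s : ℂ} (hs : 0 < s.re) :
    riemannZeta₁ s = (s - 1) * (∑ n ∈ Finset.Ico 1 N, (n : ℂ) ^ (-s) + (N : ℂ) ^ (-s) / 2)
      + (N : ℂ) ^ (1 - s) + ∑' i, zetaTrap (N + i) s := by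
  set U : Set ℂ := {s : ℂ | 0 < s.re} with hU
  have hUo : IsOpen U := isOpen_lt continuous_const Complex.continuous_re
  have hpw : ∀ n : ℕ, 1 ≤ n → ∀ a : ℂ, Differentiable ℂ fun s : ℂ ↦ (n : ℂ) ^ (a - s) := by
    intro n hn a s
    apply DifferentiableAt.const_cpow (by fun_prop)
    left; exact_mod_cast (by omega : n ≠ 0)
  have hpw' : ∀ n : ℕ, 1 ≤ n → Differentiable ℂ fun s : ℂ ↦ (n : ℂ) ^ (-s) := by
    intro n hn
    simpa using hpw n hn 0
  have hTd : DifferentiableOn ℂ (fun s ↦ ∑' i, zetaTrap (N + i) s) U := by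
    intro s₀ hs₀
    have hs₀' : 0 < s₀.re := hs₀
    set V : Set ℂ := {s : ℂ | 0 < s.re} ∩ Metric.ball 0 (‖s₀‖ + 1) with hV
    have hVo : IsOpen V := hUo.inter Metric.isOpen_ball
    have hmem : s₀ ∈ V := ⟨hs₀, by simp⟩
    have hd : DifferentiableOn ℂ (fun s ↦ ∑' i, zetaTrap (N + i) s) V := by
      set R := ‖s₀‖ + 1
      have hR : 0 ≤ R := by positivity
      refine differentiableOn_tsum_of_summable_norm (u := fun i : ℕ ↦ (R + 1) * R * (R + 1) / 12 * ((N + i : ℕ) : ℝ) ^ (-2 : ℝ)) ?_ ?_ hVo ?_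
      · apply Summable.mul_left
        have := (Real.summable_nat_rpow (p := -2)).2 (by norm_num)
        refine ((summable_nat_add_iff N).2 this).congr fun i ↦ ?_
        rw [add_comm]
      · intro i
        have h1 := hpw' (N + i) (by omega)
        have h2 := hpw' (N + i + 1) (by omega)
        have h3 := hpw (N + i) (by omega) 1
        have h4 := hpw (N + i + 1) (by omega) 1
        unfold zetaTrap
        push_cast at *
        apply Differentiable.differentiableOn
        fun_prop
      · intro i s hs
        have hsr : 0 < s.re := hs.1
        have hsn : ‖s‖ ≤ R := by have := hs.2; simp at this; exact this.le
        refine (zetaTrap_norm_le (N + i) (by omega) s hsr).trans ?_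
        have h1 : ‖s - 1‖ ≤ R + 1 := (norm_sub_le _ _).trans (by simpa using hsn)
        have h2 : ‖s + 1‖ ≤ R + 1 := (norm_add_le _ _).trans (by simpa using hsn)
        have h3 : ((N + i : ℕ) : ℝ) ^ (-s.re - 2) ≤ ((N + i : ℕ) : ℝ) ^ (-2 : ℝ) := by
          apply Real.rpow_le_rpow_of_exponent_le
          · exact_mod_cast (by omega : 1 ≤ N + i)
          · linarith
        gcongr
    exact (hd.differentiableAt (hVo.mem_nhds hmem)).differentiableWithinAt
  have hA : AnalyticOnNhd ℂ (fun s ↦ (s - 1) * (∑ n ∈ Finset.Ico 1 N, (n : ℂ) ^ (-s) + (N : ℂ) ^ (-s) / 2)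
      + (N : ℂ) ^ (1 - s) + ∑' i, zetaTrap (N + i) s) U := by
    apply DifferentiableOn.analyticOnNhd _ hUo
    have h1 : Differentiable ℂ fun s : ℂ ↦ ∑ n ∈ Finset.Ico 1 N, (n : ℂ) ^ (-s) := by
      apply Differentiable.fun_sum
      intro n hn
      exact hpw' n (Finset.mem_Ico.1 hn).1
    have h2 := hpw' N hN
    have h3 := hpw N hN 1
    refine DifferentiableOn.add ?_ hTd
    apply Differentiable.differentiableOn
    fun_prop
  have hB : AnalyticOnNhd ℂ riemannZeta₁ U :=
    differentiable_riemannZeta₁.differentiableOn.analyticOnNhd hUo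
  have hpre : IsPreconnected U := (convex_halfSpace_re_gt 0).isPreconnected
  have h2U : (2 : ℂ) ∈ U := by simp [hU]
  refine hB.eqOn_of_preconnected_of_eventuallyEq hA hpre h2U ?_ hs
  have : ∀ᶠ s : ℂ in 𝓝 2, 1 < s.re :=
    (isOpen_lt continuous_const Complex.continuous_re).mem_nhds (by simp)
  filter_upwards [this] with s hs
  have hs1 : s ≠ 1 := by rintro rfl; simp at hs
  rw [← zetaTrap_hasSum_of_one_lt hN hs, riemannZeta_eq_inv_sub_mul hs1, mul_inv_cancel_left₀ (sub_ne_zero.2 hs1)]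

lemma sum_rpow_neg_le {v : ℝ} (hv : 0 < v) (hv1 : v ≤ 1) (N : ℕ) (hN : 1 ≤ N) :
    ∑ n ∈ Finset.Ico 1 N, (n : ℝ) ^ (v - 1) ≤ (N : ℝ) ^ v / v := by
  have key : ∀ n : ℕ, 1 ≤ n → (n : ℝ) ^ (v - 1) ≤ (n : ℝ) ^ v / v - ((n - 1 : ℕ) : ℝ) ^ v / v := by
    intro n hn
    have hn0 : (0:ℝ) < n := by exact_mod_cast hn
    have hb := rpow_one_add_le_one_add_mul_self (s := -1 / n) (p := v) (by
      rw [le_div_iff₀ hn0]; have : (1:ℝ) ≤ n := by exact_mod_cast hn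
      linarith) hv.le hv1
    have e : ((n - 1 : ℕ) : ℝ) = n * (1 + -1 / n) := by
      rw [Nat.cast_sub hn]; field_simp; push_cast; ring
    have hpos : 0 ≤ (1 + -1 / (n:ℝ)) := by
      rw [neg_div, ← sub_eq_add_neg, sub_nonneg, div_le_one hn0]; exact_mod_cast hn
    rw [e, Real.mul_rpow hn0.le hpos, Real.rpow_sub_one hn0.ne', ← sub_div, le_div_iff₀ hv]
    have hnv : 0 < (n:ℝ) ^ v := Real.rpow_pos_of_pos hn0 v
    have := mul_le_mul_of_nonneg_left hb hnv.le
    have e2 : (n:ℝ) ^ v * (1 + v * (-1 / n)) = (n:ℝ)^v - (n:ℝ)^v / n * v := by field_simp; ring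
    linarith
  have h2 : ∀ K : ℕ, ∑ n ∈ Finset.Ico 1 (K + 1), (n : ℝ) ^ (v - 1) ≤ (K : ℝ) ^ v / v := by
    intro K
    induction K with
    | zero => simp [hv.ne']
    | succ K ih =>
      rw [Finset.sum_Ico_succ_top (by omega)]
      have := key (K + 1) (by omega)
      simp only [Nat.add_sub_cancel] at this
      linarith
  obtain ⟨K, rfl⟩ : ∃ K, N = K + 1 := ⟨N - 1, by omega⟩
  refine (h2 K).trans ?_
  gcongr
  exact_mod_cast Nat.le_succ K

lemma sum_rpow_neg_two_le {N : ℕ} (hN : 1 ≤ N) {σ : ℝ} (hσ : 0 < σ) :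
    Summable (fun i : ℕ ↦ ((N + i : ℕ) : ℝ) ^ (-σ - 2)) ∧
    ∑' i : ℕ, ((N + i : ℕ) : ℝ) ^ (-σ - 2) ≤ (N : ℝ) ^ (-σ) * (1 / N ^ 2 + 1 / N) := by
  have hN0 : (0:ℝ) < N := by exact_mod_cast hN
  have hpart : ∀ K : ℕ, ∑ i ∈ Finset.range K, ((N + i : ℕ) : ℝ) ^ (-σ - 2) ≤
      (N : ℝ) ^ (-σ) * (1 / N ^ 2 + 1 / N) := by
    intro K
    have h1 : ∀ K : ℕ, ∑ i ∈ Finset.range (K + 1), 1 / ((N + i : ℕ) : ℝ) ^ 2 ≤ 1 / (N:ℝ) ^ 2 + 1 / (N:ℝ) - 1 / ((N:ℝ) + (K:ℝ)) := by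
      intro K
      induction K with
      | zero => simp
      | succ K ih =>
        rw [Finset.sum_range_succ]
        have : 1 / ((N + (K + 1) : ℕ) : ℝ) ^ 2 ≤ 1 / (N + K) - 1 / (N + (K + 1 : ℕ)) := by
          have hK : (0:ℝ) < N + K := by positivity
          push_cast
          rw [div_sub_div _ _ (by positivity) (by positivity), div_le_div_iff₀ (by positivity) (by positivity)]
          nlinarith
        push_cast at ih this ⊢
        linarith
    calc ∑ i ∈ Finset.range K, ((N + i : ℕ) : ℝ) ^ (-σ - 2)
        ≤ ∑ i ∈ Finset.range (K + 1), ((N + i : ℕ) : ℝ) ^ (-σ - 2) := by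
          apply Finset.sum_le_sum_of_subset_of_nonneg
          · intro i; simp; omega
          · intro i _ _; positivity
      _ ≤ ∑ i ∈ Finset.range (K + 1), (N : ℝ) ^ (-σ) * (1 / ((N + i : ℕ) : ℝ) ^ 2) := by
          apply Finset.sum_le_sum
          intro i _
          have hp : (0:ℝ) < (N + i : ℕ) := by exact_mod_cast (by omega)
          rw [show -σ - 2 = -σ + (-2 : ℤ) by push_cast; ring, Real.rpow_add hp, Real.rpow_intCast, zpow_neg]
          have : ((N + i : ℕ) : ℝ) ^ (-σ) ≤ (N : ℝ) ^ (-σ) := by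
            apply Real.rpow_le_rpow_of_nonpos hN0 _ (by linarith)
            exact_mod_cast (by omega : N ≤ N + i)
          rw [one_div]
          gcongr
          exact le_rfl
      _ = (N : ℝ) ^ (-σ) * ∑ i ∈ Finset.range (K + 1), (1 / ((N + i : ℕ) : ℝ) ^ 2) := by
          rw [Finset.mul_sum]
      _ ≤ _ := by
          gcongr
          refine (h1 K).trans ?_
          have : 0 < 1 / ((N:ℝ) + K) := by positivity
          linarith
  have hnn : ∀ i : ℕ, 0 ≤ ((N + i : ℕ) : ℝ) ^ (-σ - 2) := fun i ↦ by positivity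
  exact ⟨summable_of_sum_range_le hnn hpart, Real.tsum_le_of_sum_range_le hnn hpart⟩

lemma norm_riemannZeta_le {N : ℕ} (hN : 1000 ≤ N) {v : ℝ} (hv : 0 < v) (hv1 : v ≤ 1) {s : ℂ}
    (h1 : 1 - v ≤ s.re) (h0 : 0 < s.re) (h2 : s.re ≤ 1.1) (ht : 1.3 ≤ |s.im|) (ht2 : |s.im| ≤ 3 * N - 1) :
    ‖riemannZeta s‖ ≤ (N : ℝ) ^ v * (1 / v + 0.78) := by
  have hN0 : (1000:ℝ) ≤ N := by exact_mod_cast hN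
  have hN1 : 1 ≤ N := by omega
  have hs1 : s ≠ 1 := by rintro rfl; simp at ht; norm_num at ht
  set D := ‖s - 1‖ with hD
  have hDt : |s.im| ≤ D := by simpa using Complex.abs_im_le_norm (s - 1)
  have hDpos : 0 < D := by linarith
  set P := (N:ℝ) ^ v with hP
  have hPpos : 0 < P := Real.rpow_pos_of_pos (by linarith) _
  have hns : (N:ℝ) ^ (1 - s.re) ≤ P := Real.rpow_le_rpow_of_exponent_le (by linarith) (by linarith)
  have hns' : (N:ℝ) ^ (-s.re) ≤ P / N := by
    rw [show -s.re = (1 - s.re) - 1 by ring, Real.rpow_sub_one (by linarith)]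
    gcongr
  have hnorm : ‖riemannZeta₁ s‖ ≤ D * (P / v + P / N / 2) + P + ‖∑' i, zetaTrap (N + i) s‖ := by
    rw [zetaTrap_hasSum hN1 h0]
    refine (norm_add_le _ _).trans ?_
    gcongr
    refine (norm_add_le _ _).trans ?_
    have e1 : ‖(N:ℂ) ^ (1 - s)‖ ≤ P := by
      rw [Complex.norm_natCast_cpow_of_pos (by omega)]; simpa using hns
    gcongr
    rw [norm_mul]
    gcongr
    refine (norm_add_le _ _).trans ?_
    gcongr
    · refine (norm_sum_le _ _).trans (le_trans ?_ (sum_rpow_neg_le hv hv1 N hN1))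
      apply Finset.sum_le_sum
      intro n hn
      have hn := (Finset.mem_Ico.1 hn).1
      rw [Complex.norm_natCast_cpow_of_pos (by omega)]
      apply Real.rpow_le_rpow_of_exponent_le (by exact_mod_cast hn)
      simp; linarith
    · rw [norm_div, Complex.norm_natCast_cpow_of_pos (by omega)]
      simpa using div_le_div_of_nonneg_right hns' (zero_le_two (α := ℝ))
  have htail : ‖∑' i, zetaTrap (N + i) s‖ ≤ D * ‖s‖ * ‖s + 1‖ / 12 * (P / N * (1 / N ^ 2 + 1 / N)) := by
    obtain ⟨hs, hle⟩ := sum_rpow_neg_two_le hN1 h0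
    refine (tsum_of_norm_bounded (hs.mul_left (D * ‖s‖ * ‖s + 1‖ / 12)).hasSum
      (fun i ↦ zetaTrap_norm_le _ (by omega) _ h0)).trans ?_
    rw [tsum_mul_left]
    gcongr
    exact hle.trans (by gcongr)
  have ha : ‖s‖ ≤ |s.im| + 1.1 := by
    have := Complex.norm_le_abs_re_add_abs_im s
    rw [abs_of_pos h0] at this; linarith
  have hb : ‖s + 1‖ ≤ |s.im| + 2.1 := by
    have := Complex.norm_le_abs_re_add_abs_im (s + 1)
    simp only [add_re, one_re, add_im, one_im, add_zero] at this
    rw [abs_of_pos (by linarith)] at this; linarith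
  set t := |s.im| with htt
  have hab : ‖s‖ * ‖s + 1‖ ≤ (t + 1.1) * (t + 2.1) := by gcongr
  have hz : D * ‖riemannZeta s‖ = ‖riemannZeta₁ s‖ := by
    rw [riemannZeta_eq_inv_sub_mul hs1, norm_mul, norm_inv, mul_inv_cancel_left₀ hDpos.ne']
  have hPD : P ≤ D * (P / t) := by
    rw [mul_div_assoc', le_div_iff₀ (by linarith)]; nlinarith
  have hfin : 1 / (N:ℝ) / 2 + 1 / t + (t + 1.1) * (t + 2.1) / 12 * (1 / N * (1 / N ^ 2 + 1 / N)) ≤ 0.78 := by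
    have hinv : 1 / (N:ℝ) ≤ 1 / 1000 := by gcongr
    have hinv0 : 0 < 1 / (N:ℝ) := by positivity
    have e : (1 / (N:ℝ) * (1 / N ^ 2 + 1 / N)) = (1 / N) ^ 2 * (1 + 1 / N) := by field_simp; ring
    rw [e]
    have htN : t * (1 / (N:ℝ)) ≤ 3 - 1 / N := by
      rw [mul_one_div, div_le_iff₀ (by linarith), sub_mul, one_div_mul_cancel (by linarith)]; exact ht2
    set m := 1 / (N:ℝ) with hm
    by_cases h : t ≤ 100
    · have h1t : 1 / t ≤ 1 / 1.3 := by gcongr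
      have : (t + 1.1) * (t + 2.1) ≤ 10400 := by nlinarith
      have h2 : m ^ 2 * (1 + m) ≤ (1/1000)^2 * (1 + 1/1000) := by gcongr
      have : (t + 1.1) * (t + 2.1) / 12 * (m ^ 2 * (1 + m)) ≤ 10400 / 12 * ((1/1000)^2 * (1 + 1/1000)) := by gcongr
      norm_num at *
      linarith
    · push Not at h
      have h1t : 1 / t ≤ 1 / 100 := by gcongr
      have : (t + 1.1) * (t + 2.1) * m ^ 2 ≤ (3 + 0.1 * m) * (3 + 1.1 * m) := by
        have a1 : (t + 1.1) * m ≤ 3 + 0.1 * m := by linarith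
        have a2 : (t + 2.1) * m ≤ 3 + 1.1 * m := by linarith
        have a3 : 0 ≤ (t + 2.1) * m := by positivity
        have a4 : 0 ≤ 3 + 0.1 * m := by positivity
        calc _ = ((t + 1.1) * m) * ((t + 2.1) * m) := by ring
          _ ≤ _ := by gcongr
      have h4 : (t + 1.1) * (t + 2.1) / 12 * (m ^ 2 * (1 + m)) ≤ (3 + 0.1 * (1/1000)) * (3 + 1.1 * (1/1000)) / 12 * (1 + 1/1000) := by
        calc _ = ((t + 1.1) * (t + 2.1) * m ^ 2) / 12 * (1 + m) := by ring
          _ ≤ ((3 + 0.1 * m) * (3 + 1.1 * m)) / 12 * (1 + m) := by gcongr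
          _ ≤ _ := by gcongr
      norm_num at *
      linarith
  have hDz : D * ‖riemannZeta s‖ ≤ D * (P * (1 / v + 0.78)) := by
    rw [hz]
    calc _ ≤ D * (P / v + P / N / 2) + D * (P / t) + D * (P * ((t + 1.1) * (t + 2.1) / 12 * (1 / N * (1 / N ^ 2 + 1 / N)))) := by
          refine hnorm.trans ?_
          gcongr
          refine htail.trans ?_
          calc _ = D * (P * ((‖s‖ * ‖s + 1‖) / 12 * (1 / N * (1 / N ^ 2 + 1 / N)))) := by ring
            _ ≤ _ := by gcongr
      _ = D * (P * (1 / v + (1 / (N:ℝ) / 2 + 1 / t + (t + 1.1) * (t + 2.1) / 12 * (1 / N * (1 / N ^ 2 + 1 / N))))) := by ring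
      _ ≤ _ := by gcongr
  exact le_of_mul_le_mul_left hDz hDpos

end

section

open Complex Filter Topology Metric MeromorphicOn

lemma exists_zero_factorization {f : ℂ → ℂ} {r : ℝ} (hr : 0 < r)
    (hf : AnalyticOnNhd ℂ f (closedBall 0 r)) (h0 : f 0 ≠ 0) (hs : ∀ w ∈ sphere (0:ℂ) r, f w ≠ 0) :
    ∃ (S : Finset ℂ) (m : ℂ → ℕ) (g : ℂ → ℂ), AnalyticOnNhd ℂ g (closedBall 0 r) ∧
      (∀ w ∈ closedBall (0:ℂ) r, g w ≠ 0) ∧ (∀ u ∈ S, u ∈ ball (0:ℂ) r ∧ f u = 0 ∧ 1 ≤ m u) ∧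
      (∀ w ∈ closedBall (0:ℂ) r, f w = (∏ u ∈ S, (w - u) ^ m u) * g w) := by
  set U := closedBall (0:ℂ) r with hU
  have hm : MeromorphicOn f U := hf.meromorphicOn
  have h0U : (0:ℂ) ∈ U := by simp [hU, hr.le]
  have hconn : IsPreconnected U := (convex_closedBall 0 r).isPreconnected
  have hord : ∀ u : U, meromorphicOrderAt f u ≠ ⊤ := by
    rintro ⟨u, hu⟩ htop
    rw [(hf u hu).meromorphicOrderAt_eq] at htop
    have htop' : analyticOrderAt f u = ⊤ := by
      cases h : analyticOrderAt f u <;> simp_all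
    rw [analyticOrderAt_eq_top] at htop'
    exact h0 (hf.eqOn_zero_of_preconnected_of_eventuallyEq_zero hconn hu htop' h0U)
  have hfin : (divisor f U).support.Finite :=
    (divisor f U).finiteSupport (isCompact_closedBall 0 r)
  obtain ⟨g, hg, hg0, hfg⟩ := hm.extract_zeros_poles hord hfin
  have hnn : ∀ u, 0 ≤ divisor f U u := by
    intro u
    have := MeromorphicOn.AnalyticOnNhd.divisor_nonneg hf
    exact this u
  have hprod : (∏ᶠ u, (· - u) ^ divisor f U u : ℂ → ℂ) =
      fun w ↦ ∏ u ∈ hfin.toFinset, (w - u) ^ (divisor f U u).toNat := by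
    rw [finprod_eq_prod_of_mulSupport_subset (s := hfin.toFinset)]
    · ext w
      rw [Finset.prod_apply]
      refine Finset.prod_congr rfl fun u _ ↦ ?_
      simp only [Pi.pow_apply]
      conv_lhs => rw [← Int.toNat_of_nonneg (hnn u)]
      rw [zpow_natCast]
    · intro u hu
      simp only [Function.mem_mulSupport] at hu
      simp only [Set.Finite.coe_toFinset, Function.mem_support]
      rintro h
      rw [h] at hu; simp at hu
  rw [hprod] at hfg
  have hA : AnalyticOnNhd ℂ ((fun w ↦ ∏ u ∈ hfin.toFinset, (w - u) ^ (divisor f U u).toNat) • g) U := by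
    intro w hw
    refine AnalyticAt.smul ?_ (hg w hw)
    apply Finset.analyticAt_fun_prod
    intro u _; fun_prop
  have heq : ∀ w ∈ U, f w = (∏ u ∈ hfin.toFinset, (w - u) ^ (divisor f U u).toNat) * g w := by
    intro w hw
    have h1 : ∃ᶠ z in 𝓝[≠] w, f z = ((fun w ↦ ∏ u ∈ hfin.toFinset, (w - u) ^ (divisor f U u).toNat) • g) z := by
      have h2 := (mem_codiscreteWithin.1 hfg) w hw
      rw [Filter.disjoint_principal_right] at h2
      have h3 : ∃ᶠ z in 𝓝[≠] w, z ∈ U := by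
        have hacc : AccPt w (𝓟 U) := by
          have : Preperfect U := by
            refine IsPreconnected.preperfect_of_nontrivial ⟨0, h0U, (r : ℂ), ?_, ?_⟩ hconn
            · simp [hU, abs_of_pos hr]
            · exact_mod_cast hr.ne
          exact this w hw
        exact accPt_iff_frequently_nhdsNE.1 hacc
      refine (h3.and_eventually h2).mono ?_
      rintro z ⟨hz, hz2⟩
      simp only [Set.mem_sdiff, not_and, not_not] at hz2
      exact hz2 hz
    have h4 := ((hf w hw).frequently_eq_iff_eventually_eq (hA w hw)).1 h1
    simpa using h4.self_of_nhds
  refine ⟨hfin.toFinset, fun u ↦ (divisor f U u).toNat, g, hg, fun w hw ↦ hg0 ⟨w, hw⟩, ?_, heq⟩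
  intro u hu
  have hu' : divisor f U u ≠ 0 := by simpa using hu
  have huU : u ∈ U := (divisor f U).supportWithinDomain (by simpa using hu')
  have h1 : 1 ≤ (divisor f U u).toNat := by
    have := hnn u; omega
  have hfu : f u = 0 := by
    rw [heq u huU, Finset.prod_eq_zero hu (by simp; omega), zero_mul]
  refine ⟨?_, hfu, h1⟩
  rw [mem_ball_zero_iff]
  rcases (mem_closedBall_zero_iff.1 huU).lt_or_eq with h | h
  · exact h
  · exact absurd hfu (hs u (by simpa using h))

lemma exists_log_of_ne_zero {g : ℂ → ℂ} {r : ℝ} (hr : 0 < r)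
    (hg : AnalyticOnNhd ℂ g (closedBall 0 r)) (hg0 : ∀ w ∈ closedBall (0:ℂ) r, g w ≠ 0) :
    ∃ R > r, ∃ G : ℂ → ℂ, DifferentiableOn ℂ G (ball 0 R) ∧ (∀ w ∈ ball (0:ℂ) R, exp (G w) = g w) ∧
      (∀ w ∈ ball (0:ℂ) R, deriv G w = deriv g w / g w) := by
  have hV : {w | AnalyticAt ℂ g w ∧ g w ≠ 0} ∈ 𝓝ˢ (closedBall (0:ℂ) r) := by
    rw [mem_nhdsSet_iff_forall]
    intro w hw
    have h1 := (hg w hw).eventually_analyticAt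
    have h2 := (hg w hw).continuousAt.eventually_ne (hg0 w hw)
    exact h1.and h2
  obtain ⟨δ, hδ, hsub⟩ := (isCompact_closedBall (0:ℂ) r).exists_thickening_subset_open isOpen_interior
    (subset_interior_iff_mem_nhdsSet.2 hV)
  have hball : ball (0:ℂ) (r + δ) ⊆ {w | AnalyticAt ℂ g w ∧ g w ≠ 0} := by
    intro w hw
    apply interior_subset (hsub _)
    rw [thickening_closedBall hδ hr.le, add_comm]; exact hw
  refine ⟨r + δ, by linarith, ?_⟩
  have hd : DifferentiableOn ℂ (fun w ↦ deriv g w / g w) (ball 0 (r + δ)) := by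
    intro w hw
    have h := hball hw
    exact (h.1.deriv.differentiableAt.div h.1.differentiableAt h.2).differentiableWithinAt
  obtain ⟨G, hG⟩ := hd.isExactOn_ball
  have h0 : (0:ℂ) ∈ ball (0:ℂ) (r + δ) := by simp; linarith
  refine ⟨fun w ↦ G w - G 0 + log (g 0), ?_, ?_, ?_⟩
  · intro w hw
    exact (((hG w hw).differentiableAt.sub_const _).add_const _).differentiableWithinAt
  · have hdz : ∀ w ∈ ball (0:ℂ) (r + δ), HasDerivAt (fun w ↦ exp (-(G w - G 0 + log (g 0))) * g w) 0 w := by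
      intro w hw
      have h1 := ((((hG w hw).sub_const (G 0)).add_const (log (g 0))).neg.cexp).mul (hball hw).1.differentiableAt.hasDerivAt
      refine h1.congr_deriv ?_
      have := (hball hw).2
      field_simp
      ring
    have hconst : ∀ w ∈ ball (0:ℂ) (r + δ), exp (-(G w - G 0 + log (g 0))) * g w = 1 := by
      intro w hw
      have := (convex_ball (0:ℂ) (r + δ)).is_const_of_fderivWithin_eq_zero (𝕜 := ℂ)
        (f := fun w ↦ exp (-(G w - G 0 + log (g 0))) * g w)
        (fun z hz ↦ (hdz z hz).differentiableAt.differentiableWithinAt) (fun z hz ↦ by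
          rw [fderivWithin_of_isOpen isOpen_ball hz, (hdz z hz).hasFDerivAt.fderiv]
          ext; simp) hw h0
      rw [this]
      have h2 := (hball h0).2
      simp only [sub_self, zero_add]
      rw [exp_neg, exp_log h2, inv_mul_cancel₀ h2]
    intro w hw
    have := hconst w hw
    rw [exp_neg] at this
    have he := exp_ne_zero (G w - G 0 + log (g 0))
    field_simp at this
    exact this.symm
  · intro w hw
    rw [(((hG w hw).sub_const (G 0)).add_const (log (g 0))).deriv]

end

section

open Complex Filter Topology Metric

lemma re_deriv_eq_integral {G : ℂ → ℂ} {r : ℝ} (hr : 0 < r) (hG : DifferentiableOn ℂ G (closedBall 0 r)) :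
    (deriv G 0).re = 1 / (Real.pi * r) * ∫ θ in (0:ℝ)..(2 * Real.pi), Real.cos θ * (G (circleMap 0 r θ)).re := by
  have h1 := hG.deriv_eq_smul_circleIntegral hr
  have h2 : ∮ z in C(0, r), G z = 0 :=
    circleIntegral_eq_zero_of_differentiable_on_off_countable hr.le Set.countable_empty hG.continuousOn
      (fun z hz ↦ hG.differentiableAt (mem_nhds_iff.2 ⟨ball 0 r, ball_subset_closedBall, isOpen_ball, hz.1⟩))
  have hc : Continuous fun θ : ℝ ↦ G (circleMap 0 r θ) :=
    hG.continuousOn.comp_continuous (continuous_circleMap 0 r) fun θ ↦ circleMap_mem_closedBall 0 hr.le θ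
  have hr0 : (r:ℂ) ≠ 0 := by exact_mod_cast hr.ne'
  have h3 : (2 * (Real.pi:ℂ) * I) * deriv G 0 = ∫ θ in (0:ℝ)..(2 * Real.pi), (I / r * 2) * (Real.cos θ * G (circleMap 0 r θ)) := by
    simp only [smul_eq_mul] at h1
    rw [← h1]
    have h2' : (1 / (r:ℂ) ^ 2) * ∮ z in C(0, r), G z = 0 := by rw [h2, mul_zero]
    have h6 : ∮ z in C(0, r), 1 / (z - 0) ^ 2 * G z =
        (∮ z in C(0, r), 1 / (z - 0) ^ 2 * G z) + 1 / (r:ℂ) ^ 2 * ∮ z in C(0, r), G z := by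
      rw [h2', add_zero]
    rw [h6]
    simp only [circleIntegral, deriv_circleMap, smul_eq_mul]
    rw [← intervalIntegral.integral_const_mul, ← intervalIntegral.integral_add]
    · refine intervalIntegral.integral_congr fun θ _ ↦ ?_
      simp only [circleMap, zero_add, sub_zero, ofReal_cos, Complex.cos]
      have he := exp_ne_zero (θ * I)
      rw [neg_mul, exp_neg]
      field_simp
      ring
    · apply Continuous.intervalIntegrable
      have : ∀ θ : ℝ, circleMap 0 r θ - 0 ≠ 0 := fun θ ↦ by simpa using hr.ne'
      have hcm := continuous_circleMap 0 r
      have : Continuous fun θ : ℝ ↦ 1 / (circleMap 0 r θ - 0) ^ 2 := by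
        apply Continuous.div (by fun_prop) (by fun_prop)
        intro θ; exact pow_ne_zero _ (this θ)
      exact (hcm.mul continuous_const).mul (this.mul hc)
    · apply Continuous.intervalIntegrable
      have hcm := continuous_circleMap 0 r
      exact continuous_const.mul ((hcm.mul continuous_const).mul hc)
  rw [intervalIntegral.integral_const_mul] at h3
  have h4 : (∫ θ in (0:ℝ)..(2 * Real.pi), (Real.cos θ * G (circleMap 0 r θ) : ℂ)).re
      = ∫ θ in (0:ℝ)..(2 * Real.pi), Real.cos θ * (G (circleMap 0 r θ)).re := by
    have hi : IntervalIntegrable (fun θ : ℝ ↦ (Real.cos θ * G (circleMap 0 r θ) : ℂ)) MeasureTheory.volume 0 (2 * Real.pi) := by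
      apply Continuous.intervalIntegrable
      have : Continuous fun θ : ℝ ↦ ((Real.cos θ : ℝ) : ℂ) := by fun_prop
      exact this.mul hc
    have := reCLM.intervalIntegral_comp_comm hi
    simp only [reCLM_apply, re_ofReal_mul] at this
    exact this.symm
  rw [← h4]
  have hpi : (Real.pi : ℂ) ≠ 0 := by exact_mod_cast Real.pi_ne_zero
  have h5 : deriv G 0 = ((1 / (Real.pi * r) : ℝ) : ℂ) * ∫ θ in (0:ℝ)..(2 * Real.pi), (Real.cos θ * G (circleMap 0 r θ) : ℂ) := by
    have hI := I_ne_zero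
    rw [ofReal_div, ofReal_mul, ofReal_one]
    field_simp at h3 ⊢
    linear_combination h3
  rw [h5, re_ofReal_mul]

lemma norm_sub_eq_blaschke {r : ℝ} (hr : 0 < r) {u w : ℂ} (hw : ‖w‖ = r) :
    ‖((r:ℂ) ^ 2 - (starRingEnd ℂ) u * w) / r‖ = ‖w - u‖ := by
  have e : (r:ℂ) ^ 2 - (starRingEnd ℂ) u * w = w * (starRingEnd ℂ) (w - u) := by
    rw [map_sub, mul_sub, mul_conj, normSq_eq_norm_sq, hw]; push_cast; ring
  rw [e, norm_div, norm_mul, RCLike.norm_conj, hw, norm_real, Real.norm_of_nonneg hr.le]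
  field_simp

lemma re_logDeriv_eq {f g : ℂ → ℂ} {r : ℝ} (hr : 0 < r) {S : Finset ℂ} {m : ℂ → ℕ}
    (hg : AnalyticOnNhd ℂ g (closedBall 0 r)) (hg0 : ∀ w ∈ closedBall (0:ℂ) r, g w ≠ 0)
    (hS : ∀ u ∈ S, u ∈ ball (0:ℂ) r ∧ u ≠ 0)
    (hfg : ∀ w ∈ closedBall (0:ℂ) r, f w = (∏ u ∈ S, (w - u) ^ m u) * g w) :
    (deriv f 0 / f 0).re = 1 / (Real.pi * r) * (∫ θ in (0:ℝ)..(2 * Real.pi), Real.cos θ * Real.log ‖f (circleMap 0 r θ)‖)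
      - ∑ u ∈ S, m u * (u.re * (1 / ‖u‖ ^ 2 - 1 / r ^ 2)) := by
  have hr0 : (r:ℂ) ≠ 0 := by exact_mod_cast hr.ne'
  set b : ℂ → ℂ → ℂ := fun u w ↦ ((r:ℂ) ^ 2 - (starRingEnd ℂ) u * w) / r with hb
  have hbne : ∀ u ∈ S, ∀ w ∈ closedBall (0:ℂ) r, b u w ≠ 0 := by
    intro u hu w hw h
    have hu' := mem_ball_zero_iff.1 (hS u hu).1
    have hw' := mem_closedBall_zero_iff.1 hw
    have h1 : (r:ℂ) ^ 2 = (starRingEnd ℂ) u * w := by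
      simp only [hb, div_eq_zero_iff, hr0, or_false] at h
      exact sub_eq_zero.1 h
    have h2 := congrArg norm h1
    rw [norm_mul, RCLike.norm_conj, norm_pow, norm_real, Real.norm_of_nonneg hr.le] at h2
    nlinarith [norm_nonneg u, norm_nonneg w]
  set h : ℂ → ℂ := fun w ↦ (∏ u ∈ S, (b u w) ^ m u) * g w with hh
  have hha : AnalyticOnNhd ℂ h (closedBall 0 r) := by
    intro w hw
    refine AnalyticAt.mul ?_ (hg w hw)
    apply Finset.analyticAt_fun_prod
    intro u _; simp only [hb]; fun_prop
  have hh0 : ∀ w ∈ closedBall (0:ℂ) r, h w ≠ 0 := fun w hw ↦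
    mul_ne_zero (Finset.prod_ne_zero_iff.2 fun u hu ↦ pow_ne_zero _ (hbne u hu w hw)) (hg0 w hw)
  obtain ⟨R, hR, G, hGd, hGe, hGd'⟩ := exists_log_of_ne_zero hr hha hh0
  have h0m : (0:ℂ) ∈ closedBall (0:ℂ) r := by simp [hr.le]
  have h0R : (0:ℂ) ∈ ball (0:ℂ) R := by simp; linarith
  have key := re_deriv_eq_integral hr (hGd.mono (closedBall_subset_ball hR))
  have hInt : ∀ θ : ℝ, (G (circleMap 0 r θ)).re = Real.log ‖f (circleMap 0 r θ)‖ := by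
    intro θ
    have hmem := circleMap_mem_closedBall (0:ℂ) hr.le θ
    have h1 : ‖f (circleMap 0 r θ)‖ = ‖h (circleMap 0 r θ)‖ := by
      rw [hfg _ hmem, hh]
      simp only [norm_mul, norm_prod, norm_pow]
      congr 1
      refine Finset.prod_congr rfl fun u _ ↦ ?_
      rw [norm_sub_eq_blaschke hr (by simp [abs_of_pos hr])]
    rw [h1, ← hGe _ (closedBall_subset_ball hR hmem), norm_exp, Real.log_exp]
  simp_rw [hInt] at key
  rw [← key, hGd' 0 h0R]
  have hfe : f =ᶠ[𝓝 0] fun w ↦ (∏ u ∈ S, (w - u) ^ m u) * g w :=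
    (eventually_of_mem (closedBall_mem_nhds 0 hr) hfg)
  have e1 : deriv f 0 / f 0 = (∑ u ∈ S, m u * (1 / (0 - u))) + logDeriv g 0 := by
    rw [hfe.deriv_eq, hfe.self_of_nhds, ← logDeriv_apply (fun w ↦ (∏ u ∈ S, (w - u) ^ m u) * g w)]
    rw [logDeriv_mul _ _ (hg0 0 h0m) _ (hg 0 h0m).differentiableAt]
    · rw [logDeriv_prod]
      · congr 1
        refine Finset.sum_congr rfl fun u hu ↦ ?_
        rw [logDeriv_fun_pow (by fun_prop), logDeriv_apply]
        simp
      · intro u hu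
        exact pow_ne_zero _ (by simpa using (hS u hu).2)
      · intro u hu; fun_prop
    · exact Finset.prod_ne_zero_iff.2 fun u hu ↦ pow_ne_zero _ (by simpa using (hS u hu).2)
    · fun_prop
  have e2 : deriv h 0 / h 0 = (∑ u ∈ S, m u * (-(starRingEnd ℂ) u / r ^ 2)) + logDeriv g 0 := by
    rw [← logDeriv_apply h, hh]
    rw [logDeriv_mul _ _ (hg0 0 h0m) _ (hg 0 h0m).differentiableAt]
    · rw [logDeriv_prod]
      · congr 1
        refine Finset.sum_congr rfl fun u hu ↦ ?_
        rw [logDeriv_fun_pow (by simp only [hb]; fun_prop), logDeriv_apply]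
        have : HasDerivAt (b u) (-(starRingEnd ℂ) u / r) 0 := by
          have := (((hasDerivAt_id (0:ℂ)).const_mul ((starRingEnd ℂ) u)).const_sub ((r:ℂ)^2)).div_const (r:ℂ)
          refine this.congr_deriv ?_
          simp
        rw [this.deriv]
        simp only [hb]
        field_simp
        simp
      · intro u hu
        exact pow_ne_zero _ (hbne u hu 0 h0m)
      · intro u hu; simp only [hb]; fun_prop
    · exact Finset.prod_ne_zero_iff.2 fun u hu ↦ pow_ne_zero _ (hbne u hu 0 h0m)
    · simp only [hb]; fun_prop
  rw [e1, e2, add_re, add_re, re_sum, re_sum, add_sub_right_comm, ← Finset.sum_sub_distrib]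
  congr 1
  refine Finset.sum_congr rfl fun u hu ↦ ?_
  have a1 : ((m u : ℂ) * (1 / (0 - u))).re = m u * (- u.re / ‖u‖ ^ 2) := by
    rw [← ofReal_natCast, re_ofReal_mul, zero_sub, one_div, inv_re, normSq_eq_norm_sq, norm_neg, neg_re]
  have a2 : ((m u : ℂ) * (-(starRingEnd ℂ) u / r ^ 2)).re = m u * (- u.re / r ^ 2) := by
    rw [← ofReal_natCast, re_ofReal_mul, ← ofReal_pow, div_ofReal_re, neg_re, conj_re]
  rw [a1, a2]
  ring

lemma sum_rpow_neg_le_div {σ : ℝ} (hσ : 1 < σ) :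
    Summable (fun n : ℕ ↦ (n:ℝ) ^ (-σ)) ∧ ∑' n : ℕ, (n:ℝ) ^ (-σ) ≤ σ / (σ - 1) := by
  have hs1 : 0 < σ - 1 := by linarith
  have h2 : ∀ K : ℕ, ∑ n ∈ Finset.range (K + 2), (n : ℝ) ^ (-σ) ≤ σ / (σ - 1) - ((K + 1 : ℕ):ℝ) ^ (1 - σ) / (σ - 1) := by
    intro K
    induction K with
    | zero =>
      rw [Finset.sum_range_succ, Finset.sum_range_one]
      rw [Nat.cast_zero, Real.zero_rpow (by linarith)]
      simp
      rw [← sub_nonneg]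
      field_simp
      linarith
    | succ K ih =>
      rw [Finset.sum_range_succ]
      have hn0 : (0:ℝ) < ((K + 1 + 1 : ℕ) : ℝ) := by positivity
      have hk0 : (0:ℝ) < ((K + 1 : ℕ) : ℝ) := by positivity
      set n : ℝ := ((K + 1 + 1 : ℕ) : ℝ) with hn
      have hkn : ((K + 1 : ℕ) : ℝ) = n - 1 := by rw [hn]; push_cast; ring
      have e1 : (((K + 1 : ℕ) : ℝ)) ^ (1 - σ) = n ^ (1 - σ) * ((n - 1) / n) ^ (1 - σ) := by
        rw [← Real.mul_rpow hn0.le (by rw [← hkn]; positivity), hkn]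
        congr 1; field_simp
      have e2 : 1 + (σ - 1) / n ≤ ((n - 1) / n) ^ (1 - σ) := by
        have hp : 0 < (n - 1) / n := by rw [← hkn]; positivity
        rw [Real.rpow_def_of_pos hp]
        have l1 := Real.log_le_sub_one_of_pos hp
        have l2 := Real.add_one_le_exp (Real.log ((n - 1) / n) * (1 - σ))
        have l3 : (n - 1) / n - 1 = - (1 / n) := by field_simp; ring
        rw [l3] at l1
        have l4 := mul_le_mul_of_nonneg_right l1 hs1.le
        have : (σ - 1) / n = 1 / n * (σ - 1) := by ring
        linarith
      have e3 : n ^ (-σ) = n ^ (1 - σ) / n := by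
        rw [← Real.rpow_sub_one hn0.ne']; congr 1; ring
      have hnp : 0 < n ^ (1 - σ) := Real.rpow_pos_of_pos hn0 _
      have e4 := mul_le_mul_of_nonneg_left e2 hnp.le
      rw [← e1] at e4
      have e5 : n ^ (-σ) ≤ ((K + 1 : ℕ):ℝ) ^ (1 - σ) / (σ - 1) - n ^ (1 - σ) / (σ - 1) := by
        rw [e3, ← sub_div, le_div_iff₀ hs1]
        have : n ^ (1 - σ) / n * (σ - 1) = n ^ (1 - σ) * (1 + (σ - 1) / n) - n ^ (1 - σ) := by ring
        linarith
      linarith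
  have hpart : ∀ K : ℕ, ∑ n ∈ Finset.range K, (n : ℝ) ^ (-σ) ≤ σ / (σ - 1) := by
    intro K
    calc _ ≤ ∑ n ∈ Finset.range (K + 2), (n : ℝ) ^ (-σ) := by
          apply Finset.sum_le_sum_of_subset_of_nonneg
          · intro i; simp; omega
          · intro i _ _; positivity
      _ ≤ _ := (h2 K).trans (by
          have : 0 ≤ ((K + 1 : ℕ):ℝ) ^ (1 - σ) / (σ - 1) := by positivity
          linarith)
  have hsum : Summable (fun n : ℕ ↦ (n:ℝ) ^ (-σ)) := summable_of_sum_range_le (fun n ↦ by positivity) hpart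
  exact ⟨hsum, Real.tsum_le_of_sum_range_le (fun n ↦ by positivity) hpart⟩

lemma norm_LSeries_le {f : ℕ → ℂ} (hf : ∀ n, ‖f n‖ ≤ 1) {s : ℂ} (hs : 1 < s.re) :
    ‖LSeries f s‖ ≤ s.re / (s.re - 1) := by
  obtain ⟨h1, h2⟩ := sum_rpow_neg_le_div hs
  refine (tsum_of_norm_bounded h1.hasSum fun n ↦ ?_).trans h2
  rw [LSeries.norm_term_eq]
  split_ifs with h
  · positivity
  · rw [Real.rpow_neg (by positivity), div_eq_mul_inv]
    exact mul_le_of_le_one_left (by positivity) (hf n)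

lemma norm_riemannZeta_le_of_one_lt {s : ℂ} (hs : 1 < s.re) :
    ‖riemannZeta s‖ ≤ s.re / (s.re - 1) := by
  rw [← LSeries_one_eq_riemannZeta hs]
  exact norm_LSeries_le (fun n ↦ by simp) hs

lemma le_norm_riemannZeta {s : ℂ} (hs : 1 < s.re) :
    (s.re - 1) / s.re ≤ ‖riemannZeta s‖ := by
  have h := ArithmeticFunction.LSeries_zeta_mul_Lseries_moebius hs
  rw [ArithmeticFunction.LSeries_zeta_eq_riemannZeta hs] at h
  have h1 : ‖LSeries (fun n ↦ ((ArithmeticFunction.moebius n : ℤ) : ℂ)) s‖ ≤ s.re / (s.re - 1) :=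
    norm_LSeries_le (fun n ↦ by
      rw [norm_intCast]
      exact_mod_cast ArithmeticFunction.abs_moebius_le_one) hs
  have h2 := congrArg norm h
  rw [norm_mul, norm_one] at h2
  have h3 : 1 ≤ ‖riemannZeta s‖ * (s.re / (s.re - 1)) := by
    exact h2.symm.le.trans (mul_le_mul_of_nonneg_left h1 (norm_nonneg _))
  have h4 : 0 < s.re - 1 := by linarith
  rw [div_le_iff₀ (by linarith)]
  rw [mul_div_assoc', le_div_iff₀ h4] at h3
  linarith

lemma integral_cos_mul_log_cos_half :
    ∫ θ in (0:ℝ)..(Real.pi / 2), Real.cos θ * Real.log (Real.cos θ) = Real.log 2 - 1 := by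
  have hpi := Real.pi_pos
  have hxlx : Continuous fun θ : ℝ ↦ Real.cos θ * Real.log (Real.cos θ) :=
    Real.continuous_mul_log.comp Real.continuous_cos
  have hsin : ∀ x ∈ Set.Icc (0:ℝ) (Real.pi / 2), 1 + Real.sin x ≠ 0 := by
    intro x hx
    have := Real.sin_nonneg_of_nonneg_of_le_pi hx.1 (by linarith [hx.2])
    positivity
  have h := intervalIntegral.integral_eq_sub_of_hasDerivAt_of_le (a := 0) (b := Real.pi / 2) (by positivity)
    (f := fun θ ↦ - (Real.cos θ / (1 + Real.sin θ)) * (Real.cos θ * Real.log (Real.cos θ)) - Real.sin θ + Real.log (1 + Real.sin θ))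
    (f' := fun θ ↦ Real.cos θ * Real.log (Real.cos θ)) ?_ ?_ (hxlx.intervalIntegrable _ _)
  · rw [h]; simp; norm_num; ring
  · refine ((ContinuousOn.mul (ContinuousOn.neg (ContinuousOn.div (by fun_prop) (by fun_prop) hsin)) hxlx.continuousOn).sub (by fun_prop)).add
      (ContinuousOn.log (by fun_prop) hsin)
  · intro x hx
    have hc : 0 < Real.cos x := Real.cos_pos_of_mem_Ioo ⟨by linarith [hx.1], hx.2⟩
    have hs := hsin x ⟨hx.1.le, hx.2.le⟩
    have d1 := Real.hasDerivAt_cos x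
    have d2 := Real.hasDerivAt_sin x
    have d3 := d2.const_add 1
    have d4 := d1.log hc.ne'
    have d5 := d3.log hs
    have d6 := (((d1.div d3 hs).neg.mul (d1.mul d4)).sub d2).add d5
    refine d6.congr_deriv ?_
    simp only [Pi.div_apply, Pi.mul_apply, Pi.neg_apply]
    have e : Real.cos x ^ 2 = 1 - Real.sin x ^ 2 := by rw [Real.cos_sq']
    field_simp
    generalize Real.log (Real.cos x) = l
    generalize Real.cos x = c at *
    generalize Real.sin x = s at *
    linear_combination ((l * (-s)  + 2 * l*s + l + 1+s+ (-l-1)) - s + l * (1 - s)) * e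

lemma integral_cos_mul_log_cos :
    ∫ θ in (-(Real.pi / 2))..(Real.pi / 2), Real.cos θ * Real.log (Real.cos θ) = 2 * (Real.log 2 - 1) := by
  have hxlx : Continuous fun θ : ℝ ↦ Real.cos θ * Real.log (Real.cos θ) :=
    Real.continuous_mul_log.comp Real.continuous_cos
  rw [← intervalIntegral.integral_add_adjacent_intervals (b := 0) (hxlx.intervalIntegrable _ _) (hxlx.intervalIntegrable _ _)]
  have h := intervalIntegral.integral_comp_neg (a := 0) (b := Real.pi / 2) (fun θ : ℝ ↦ Real.cos θ * Real.log (Real.cos θ))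
  simp only [Real.cos_neg, neg_zero] at h
  rw [← h, integral_cos_mul_log_cos_half]; ring

lemma neg_integral_cos_mul_le {f : ℝ → ℝ} (hf : Continuous f) (hper : Function.Periodic f (2 * Real.pi))
    {r : ℝ} (hr : 0.99 ≤ r) {A : ℝ}
    (h : ∀ θ, 0 < Real.cos θ → f (θ + Real.pi) - f θ ≤
      r * Real.cos θ * A - 2 * Real.log (r * Real.cos θ) + 0.17 + 1.16 * (r * Real.cos θ)) :
    - (1 / (Real.pi * r) * ∫ θ in (0:ℝ)..(2 * Real.pi), Real.cos θ * f θ) ≤ A / 2 + 1.1 := by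
  have hpi := Real.pi_pos
  have hr0 : 0 < r := by linarith
  have hxlx : Continuous fun θ : ℝ ↦ Real.cos θ * Real.log (Real.cos θ) :=
    Real.continuous_mul_log.comp Real.continuous_cos
  have hcf : Continuous fun θ ↦ Real.cos θ * f θ := Real.continuous_cos.mul hf
  have e1 : ∫ θ in (0:ℝ)..(2 * Real.pi), Real.cos θ * f θ =
      ∫ θ in (-(Real.pi/2))..(Real.pi / 2), Real.cos θ * (f θ - f (θ + Real.pi)) := by
    have hp : Function.Periodic (fun θ ↦ Real.cos θ * f θ) (2 * Real.pi) := Real.cos_periodic.mul hper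
    have := hp.intervalIntegral_add_eq 0 (-(Real.pi/2))
    rw [zero_add] at this
    rw [this, ← intervalIntegral.integral_add_adjacent_intervals (b := Real.pi / 2) (hcf.intervalIntegrable _ _) (hcf.intervalIntegrable _ _)]
    have e2 := intervalIntegral.integral_comp_add_right (a := -(Real.pi/2)) (b := Real.pi/2) (fun θ ↦ Real.cos θ * f θ) Real.pi
    rw [show -(Real.pi/2) + 2 * Real.pi = Real.pi / 2 + Real.pi by ring,
      show ∫ x in (Real.pi/2)..(Real.pi / 2 + Real.pi), Real.cos x * f x = ∫ x in (-(Real.pi/2) + Real.pi)..(Real.pi / 2 + Real.pi), Real.cos x * f x by congr 1; ring,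
      ← e2, ← intervalIntegral.integral_add (hcf.intervalIntegrable _ _)]
    · apply intervalIntegral.integral_congr
      intro x _
      simp only [Real.cos_add_pi]; ring
    · exact (hcf.comp (continuous_id.add continuous_const)).intervalIntegrable _ _
  have e3 : ∫ θ in (-(Real.pi/2))..(Real.pi / 2), Real.cos θ * (f (θ + Real.pi) - f θ) ≤
      ∫ θ in (-(Real.pi/2))..(Real.pi / 2), ((r * (A + 1.16)) * Real.cos θ ^ 2 + (0.17 - 2 * Real.log r) * Real.cos θ - 2 * (Real.cos θ * Real.log (Real.cos θ))) := by
    apply intervalIntegral.integral_mono_on (by linarith)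
    · exact (Real.continuous_cos.mul ((hf.comp (continuous_id.add continuous_const)).sub hf)).intervalIntegrable _ _
    · exact Continuous.intervalIntegrable (by fun_prop) _ _
    · intro x hx
      have hc := Real.cos_nonneg_of_mem_Icc hx
      rcases hc.eq_or_lt with hc | hc
      · rw [← hc]; simp
      · have := mul_le_mul_of_nonneg_left (h x hc) hc.le
        rw [Real.log_mul hr0.ne' hc.ne'] at this
        linarith
  have e4 : ∫ θ in (-(Real.pi/2))..(Real.pi / 2), ((r * (A + 1.16)) * Real.cos θ ^ 2 + (0.17 - 2 * Real.log r) * Real.cos θ - 2 * (Real.cos θ * Real.log (Real.cos θ)))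
      = r * (A + 1.16) * (Real.pi / 2) + (0.17 - 2 * Real.log r) * 2 - 2 * (2 * (Real.log 2 - 1)) := by
    rw [intervalIntegral.integral_sub, intervalIntegral.integral_add, intervalIntegral.integral_const_mul, intervalIntegral.integral_const_mul,
      intervalIntegral.integral_const_mul, integral_cos_mul_log_cos, integral_cos_sq, integral_cos]
    · simp; ring_nf; tauto
    all_goals exact Continuous.intervalIntegrable (by fun_prop) _ _
  have e5 : ∫ θ in (0:ℝ)..(2 * Real.pi), Real.cos θ * f θ = - ∫ θ in (-(Real.pi/2))..(Real.pi / 2), Real.cos θ * (f (θ + Real.pi) - f θ) := by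
    rw [e1, ← intervalIntegral.integral_neg]; congr 1; ext x; ring
  rw [e4] at e3
  rw [e5, mul_neg, neg_neg, one_div_mul_eq_div, div_le_iff₀ (by positivity)]
  refine e3.trans ?_
  have hl2 := Real.log_two_gt_d9
  have hlr : -0.0102 ≤ Real.log r := by
    have := Real.one_sub_inv_le_log_of_pos hr0
    have h2 : r⁻¹ ≤ 1.0102 := by
      rw [inv_le_comm₀ hr0 (by norm_num)]; norm_num at hr ⊢; linarith
    linarith
  have hpi2 := Real.pi_gt_d2
  nlinarith

lemma one_add_mul_le_exp {v : ℝ} (hv : 0 ≤ v) (hv1 : v ≤ 1) :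
    (1 + 0.78 * v) * (1 + v) ≤ Real.exp (0.17 + 1.16 * v) := by
  have h1 : 1.185 ≤ Real.exp 0.17 := by
    have := Real.sum_le_exp_of_nonneg (x := 0.17) (by norm_num) 4
    refine le_trans ?_ this
    norm_num [Finset.sum_range_succ, Nat.factorial]
  have h2 : 1 + 1.16 * v + (1.16 * v) ^ 2 / 2 + (1.16 * v) ^ 3 / 6 + (1.16 * v) ^ 4 / 24 ≤ Real.exp (1.16 * v) := by
    have := Real.sum_le_exp_of_nonneg (x := 1.16 * v) (by positivity) 5
    simpa [Finset.sum_range_succ, Nat.factorial] using this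
  rw [Real.exp_add]
  have h3 : (0:ℝ) ≤ 1 + 1.16 * v := by positivity
  refine le_trans ?_ (mul_le_mul h1 h2 (by positivity) (by positivity))
  have hv2 : 0 ≤ v * (1 - v) := mul_nonneg hv (by linarith)
  nlinarith [sq_nonneg (v - 0.6), sq_nonneg (v^2 - 0.36), mul_nonneg hv (sq_nonneg (v-0.6)), mul_nonneg hv2 hv]

lemma exists_radius (s : ℂ) : ∃ r : ℝ, 0.99 < r ∧ r < 1 ∧ ∀ w ∈ sphere (0:ℂ) r, riemannZeta (s + w) ≠ 0 := by
  have hfin := (isCompact_closedBall s 1).inter_riemannZetaZeros_finite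
  have hfin2 := hfin.image (fun z ↦ ‖z - s‖)
  obtain ⟨r, hr, hr2⟩ := (Set.Ioo_infinite (show (0.99:ℝ) < 1 by norm_num)).exists_notMem_finite hfin2
  refine ⟨r, hr.1, hr.2, fun w hw h ↦ hr2 ⟨s + w, ⟨?_, h⟩, ?_⟩⟩
  · rw [mem_sphere_zero_iff_norm] at hw
    simp [hw, hr.2.le]
  · simpa using hw

lemma exists_zeta_disc {N : ℕ} (hN : 1000 ≤ N) {a t : ℝ} (ha : 0 < a) (ha1 : a ≤ 0.05) (ht : 2.3 ≤ |t|)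
    (ht2 : |t| + 1 ≤ 3 * N - 1) {s₀ : ℂ} (hs₀ : s₀ = ⟨1 + a, t⟩) :
    ∃ r : ℝ, 0.99 < r ∧ r < 1 ∧ ∃ (S : Finset ℂ) (m : ℂ → ℕ) (g : ℂ → ℂ),
      AnalyticOnNhd ℂ g (closedBall 0 r) ∧
      (∀ w ∈ closedBall (0:ℂ) r, g w ≠ 0) ∧
      (∀ u ∈ S, u ∈ ball (0:ℂ) r ∧ riemannZeta (s₀ + u) = 0 ∧ u.re < -a ∧ 1 ≤ m u) ∧
      (∀ w ∈ closedBall (0:ℂ) r, riemannZeta (s₀ + w) = (∏ u ∈ S, (w - u) ^ m u) * g w) ∧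
      ∑ u ∈ S, m u * (-u.re * (1 / ‖u‖ ^ 2 - 1 / r ^ 2)) ≤
        (deriv riemannZeta s₀ / riemannZeta s₀).re + Real.log N / 2 + 1.1 := by
  have hN0 : (1000:ℝ) ≤ N := by exact_mod_cast hN
  obtain ⟨r, hr, hr1, hr0⟩ := exists_radius s₀
  refine ⟨r, hr, hr1, ?_⟩
  have hrp : 0 < r := by linarith
  have him : ∀ w : ℂ, ‖w‖ ≤ r → 1.3 ≤ |(s₀ + w).im| ∧ |(s₀ + w).im| ≤ 3 * N - 1 := by
    intro w hw
    have h1 : |w.im| ≤ 1 := (abs_im_le_norm w).trans (hw.trans hr1.le)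
    have e : (s₀ + w).im = t + w.im := by simp [hs₀]
    rw [e]
    constructor
    · have := abs_sub_abs_le_abs_sub t (-w.im)
      rw [abs_neg, sub_neg_eq_add] at this
      linarith
    · have := abs_add_le t w.im
      linarith
  have hne1 : ∀ w : ℂ, ‖w‖ ≤ r → s₀ + w ≠ 1 := by
    intro w hw h
    have := (him w hw).1
    rw [h] at this
    norm_num at this
  have hA : AnalyticOnNhd ℂ (fun w ↦ riemannZeta (s₀ + w)) (closedBall 0 r) := by
    intro w hw
    have h1 : AnalyticAt ℂ riemannZeta (s₀ + w) :=
      analyticOn_riemannZeta _ (hne1 w (mem_closedBall_zero_iff.1 hw))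
    exact h1.comp_of_eq (f := fun w ↦ s₀ + w) (by fun_prop) rfl
  have h00 : riemannZeta (s₀ + 0) ≠ 0 := by
    rw [add_zero]
    apply riemannZeta_ne_zero_of_one_le_re
    simp [hs₀, ha.le]
  obtain ⟨S, m, g, hg, hg0, hS, hfg⟩ := exists_zero_factorization hrp hA h00 hr0
  have hS' : ∀ u ∈ S, u.re < - a := by
    intro u hu
    by_contra! h
    refine riemannZeta_ne_zero_of_one_le_re (s := s₀ + u) ?_ (hS u hu).2.1
    simp [hs₀]; linarith
  refine ⟨S, m, g, hg, hg0, fun u hu ↦ ⟨(hS u hu).1, (hS u hu).2.1, hS' u hu, (hS u hu).2.2⟩, hfg, ?_⟩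
  have key := re_logDeriv_eq hrp hg hg0 (fun u hu ↦ ⟨(hS u hu).1, fun h ↦ by
    have := hS' u hu
    rw [h] at this; simp at this; linarith⟩) hfg
  have hd : deriv (fun w ↦ riemannZeta (s₀ + w)) 0 = deriv riemannZeta s₀ := by
    rw [deriv_comp_const_add, add_zero]
  rw [hd, add_zero] at key
  have hcont : Continuous fun θ : ℝ ↦ Real.log ‖riemannZeta (s₀ + circleMap 0 r θ)‖ := by
    have : Continuous fun θ : ℝ ↦ riemannZeta (s₀ + circleMap 0 r θ) :=
      hA.continuousOn.comp_continuous (continuous_circleMap 0 r) fun θ ↦ circleMap_mem_closedBall 0 hrp.le θ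
    refine Continuous.log this.norm fun θ ↦ ?_
    rw [norm_ne_zero_iff]
    exact hr0 _ (circleMap_mem_sphere 0 hrp.le θ)
  have hInt := neg_integral_cos_mul_le (f := fun θ ↦ Real.log ‖riemannZeta (s₀ + circleMap 0 r θ)‖) hcont
    (fun θ ↦ by simp only [periodic_circleMap 0 r θ]) hr.le (A := Real.log N) (by
      intro θ hθ
      set c := Real.cos θ with hc
      have hc1 : c ≤ 1 := Real.cos_le_one θ
      set v := r * c with hv
      have hvp : 0 < v := by positivity
      have hv1 : v < 1 := by
        calc v ≤ r * 1 := mul_le_mul_of_nonneg_left hc1 hrp.le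
          _ < 1 := by linarith
      have hnorm : ∀ θ, ‖circleMap 0 r θ‖ ≤ r := fun θ ↦ by simp [norm_circleMap_zero, abs_of_pos hrp]
      have e1 : (circleMap 0 r θ).re = v := by
        simp [circleMap, exp_ofReal_mul_I_re, exp_ofReal_mul_I_im, hv, hc]
      have e2 : (circleMap 0 r (θ + Real.pi)).re = -v := by
        simp [circleMap, add_mul, exp_add, hv, hc, exp_ofReal_mul_I_re]
      have up : ‖riemannZeta (s₀ + circleMap 0 r (θ + Real.pi))‖ ≤ (N:ℝ) ^ v * (1 / v + 0.78) := by
        have hi := him _ (hnorm (θ + Real.pi))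
        apply norm_riemannZeta_le hN hvp hv1.le _ _ _ hi.1 hi.2
        all_goals rw [add_re, e2, hs₀]; dsimp only; linarith
      have lo : v / (1 + v) ≤ ‖riemannZeta (s₀ + circleMap 0 r θ)‖ := by
        have e3 : (s₀ + circleMap 0 r θ).re = 1 + a + v := by rw [add_re, e1, hs₀]
        refine le_trans ?_ (le_norm_riemannZeta (by rw [e3]; linarith))
        rw [e3, div_le_div_iff₀ (by positivity) (by positivity)]
        nlinarith
      have hupne : 0 < ‖riemannZeta (s₀ + circleMap 0 r (θ + Real.pi))‖ :=
        norm_pos_iff.2 (hr0 _ (circleMap_mem_sphere 0 hrp.le _))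
      have l1 := Real.log_le_log hupne up
      have l2 := Real.log_le_log (by positivity) lo
      rw [Real.log_mul (by positivity) (by positivity), Real.log_rpow (by positivity)] at l1
      have e4 : 1 / v + 0.78 = (1 + 0.78 * v) / v := by field_simp
      rw [e4, Real.log_div (by positivity) hvp.ne'] at l1
      rw [Real.log_div hvp.ne' (by positivity)] at l2
      have l3 := Real.log_le_log (by positivity) (one_add_mul_le_exp hvp.le hv1.le)
      rw [Real.log_exp, Real.log_mul (by positivity) (by positivity)] at l3
      linarith)
  have e5 : ∑ u ∈ S, (m u:ℝ) * (-u.re * (1 / ‖u‖ ^ 2 - 1 / r ^ 2)) = - ∑ u ∈ S, (m u:ℝ) * (u.re * (1 / ‖u‖ ^ 2 - 1 / r ^ 2)) := by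
    rw [← Finset.sum_neg_distrib]; congr 1; ext u; ring
  rw [e5]
  linarith

lemma norm_riemannZeta₁_sub_le {N : ℕ} (hN : 1 ≤ N) {s : ℂ} (hs : 0 < s.re) :
    ‖riemannZeta₁ s - ((s - 1) * (∑ n ∈ Finset.Ico 1 N, (n:ℂ) ^ (-s) + (N:ℂ) ^ (-s) / 2) + (N:ℂ) ^ (1 - s))‖ ≤
      ‖s - 1‖ * ‖s‖ * ‖s + 1‖ / 12 * ((N:ℝ) ^ (-s.re) * (1 / N ^ 2 + 1 / N)) := by
  rw [zetaTrap_hasSum hN hs, add_sub_cancel_left]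
  obtain ⟨h1, h2⟩ := sum_rpow_neg_two_le hN hs
  refine (tsum_of_norm_bounded (h1.mul_left (‖s - 1‖ * ‖s‖ * ‖s + 1‖ / 12)).hasSum fun i ↦ ?_).trans ?_
  · exact zetaTrap_norm_le (N + i) (by omega) s hs
  · rw [tsum_mul_left]
    exact mul_le_mul_of_nonneg_left h2 (by positivity)

lemma norm_riemannZeta₁_sub_le_one {s : ℂ} (hs : 0 < s.re) :
    ‖riemannZeta₁ s - (s + 1) / 2‖ ≤ ‖s - 1‖ * ‖s‖ * ‖s + 1‖ / 6 := by
  have := norm_riemannZeta₁_sub_le (N := 1) le_rfl hs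
  simp at this
  calc _ = ‖riemannZeta₁ s - ((s - 1) * (1 / 2) + 1)‖ := by congr 1; ring
    _ ≤ _ := by norm_num at this ⊢; linarith

lemma norm_le_of_sq_le {s : ℂ} {C : ℝ} (hC : 0 ≤ C) (h : s.re ^ 2 + s.im ^ 2 ≤ C ^ 2) : ‖s‖ ≤ C := by
  apply le_of_sq_le_sq _ hC
  rw [← normSq_eq_norm_sq, normSq_apply]; linarith

lemma le_norm_riemannZeta₁ {s : ℂ} (h1 : 0.99 ≤ s.re) (h2 : s.re ≤ 1.01) (ht : |s.im| ≤ 3) :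
    0.1 ≤ ‖riemannZeta₁ s‖ := by
  have hs : 0 < s.re := by linarith
  set T := |s.im| with hT
  have hT0 : 0 ≤ T := abs_nonneg _
  have hT2 : s.im ^ 2 = T ^ 2 := by rw [hT, sq_abs]
  rcases le_total T 1.4 with h | h
  · have hb := norm_riemannZeta₁_sub_le_one hs
    have n1 : ‖s - 1‖ ≤ 1.401 := norm_le_of_sq_le (by norm_num) (by simp [hT2]; nlinarith)
    have n2 : ‖s‖ ≤ 1.73 := norm_le_of_sq_le (by norm_num) (by simp only [hT2]; nlinarith)
    have n3 : 1.98 ≤ ‖s + 1‖ := by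
      refine le_trans ?_ (re_le_norm _)
      simp; linarith
    have n4 : ‖s - 1‖ * ‖s‖ ≤ 1.401 * 1.73 := mul_le_mul n1 n2 (norm_nonneg _) (by norm_num)
    have n5 := norm_sub_norm_le ((s + 1) / 2) ((s + 1) / 2 - riemannZeta₁ s)
    rw [sub_sub_cancel, norm_sub_rev ((s+1)/2) (riemannZeta₁ s)] at n5
    have n6 : ‖(s + 1) / 2‖ = ‖s + 1‖ / 2 := by simp
    nlinarith
  · have hb := norm_riemannZeta₁_sub_le (N := 2) (by norm_num) hs
    have e1 : (s - 1) * (∑ n ∈ Finset.Ico (1:ℕ) 2, (n:ℂ) ^ (-s) + ((2:ℕ):ℂ) ^ (-s) / 2) + ((2:ℕ):ℂ) ^ (1 - s) =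
        (s - 1) + (2:ℂ) ^ (1 - s) * ((s + 3) / 4) := by
      have : (2:ℂ) ^ (1 - s) = 2 * (2:ℂ) ^ (-s) := by
        rw [sub_eq_add_neg, cpow_add _ _ two_ne_zero, cpow_one]
      simp [this]; ring
    rw [e1] at hb
    have p1 : ‖(2:ℂ) ^ (1 - s)‖ ≤ 1.007 := by
      have := norm_natCast_cpow_of_pos (n := 2) (by norm_num) (1 - s)
      rw [Nat.cast_ofNat] at this
      rw [this]
      calc ((2:ℕ):ℝ) ^ (1 - s).re ≤ ((2:ℕ):ℝ) ^ (0.01:ℝ) := by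
            apply Real.rpow_le_rpow_of_exponent_le (by norm_num)
            simp; linarith
        _ ≤ 1.007 := by
            rw [show (0.01:ℝ) = 1 / (100:ℕ) by norm_num, one_div]
            rw [Real.rpow_inv_le_iff_of_pos (by norm_num) (by norm_num) (by norm_num)]
            rw [Real.rpow_natCast]; norm_num
    have p2 : ((2:ℕ):ℝ) ^ (-s.re) * (1 / ((2:ℕ):ℝ) ^ 2 + 1 / ((2:ℕ):ℝ)) ≤ 0.378 := by
      have : ((2:ℕ):ℝ) ^ (-s.re) ≤ 0.504 := by
        calc ((2:ℕ):ℝ) ^ (-s.re) ≤ ((2:ℕ):ℝ) ^ (0.01 - 1:ℝ) := by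
              apply Real.rpow_le_rpow_of_exponent_le (by norm_num)
              linarith
          _ = ((2:ℕ):ℝ) ^ (0.01:ℝ) / 2 := by rw [Real.rpow_sub_one (by norm_num)]; norm_num
          _ ≤ 0.504 := by
              have : ((2:ℕ):ℝ) ^ (0.01:ℝ) ≤ 1.007 := by
                rw [show (0.01:ℝ) = 1 / (100:ℕ) by norm_num, one_div]
                rw [Real.rpow_inv_le_iff_of_pos (by norm_num) (by norm_num) (by norm_num)]
                rw [Real.rpow_natCast]; norm_num
              linarith
      norm_num at this ⊢
      linarith
    have n1 : ‖s - 1‖ ≤ T + 0.01 := norm_le_of_sq_le (by positivity) (by simp [hT2]; nlinarith)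
    have n1' : T ≤ ‖s - 1‖ := by
      refine le_trans ?_ (abs_im_le_norm _)
      simp [hT]
    have n2 : ‖s‖ ≤ (6.7801 + T ^ 2) / 4.8 := norm_le_of_sq_le (by positivity) (by
      have h3 : s.re ^ 2 ≤ 1.0201 := by nlinarith
      have h4 : ((6.7801 + T ^ 2) / 4.8) ^ 2 = 1.0201 + T ^ 2 + ((T ^ 2 - 4.7399) / 4.8) ^ 2 := by ring
      rw [hT2, h4]; linarith [sq_nonneg ((T ^ 2 - 4.7399) / 4.8)])
    have n3 : ‖s + 1‖ ≤ (13.0401 + T ^ 2) / 6 := norm_le_of_sq_le (by positivity) (by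
      simp only [add_re, one_re, add_im, one_im, add_zero]
      rw [hT2]; nlinarith [sq_nonneg (T ^ 2 - 4.9599)])
    have n4 : ‖(s + 3) / 4‖ ≤ 1.0025 + T ^ 2 / 32 := by
      rw [norm_div, show ‖(4:ℂ)‖ = 4 by norm_num, div_le_iff₀ (by norm_num)]
      refine norm_le_of_sq_le (by positivity) ?_
      simp [hT2]; nlinarith [sq_nonneg (T^2)]
    have m1 : ‖(2:ℂ) ^ (1 - s) * ((s + 3) / 4)‖ ≤ 1.007 * (1.0025 + T ^ 2 / 32) := by
      rw [norm_mul]; exact mul_le_mul p1 n4 (norm_nonneg _) (by norm_num)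
    have m2 : ‖s - 1‖ * ‖s‖ * ‖s + 1‖ / 12 * (((2:ℕ):ℝ) ^ (-s.re) * (1 / ((2:ℕ):ℝ) ^ 2 + 1 / ((2:ℕ):ℝ))) ≤
        (T + 0.01) * ((6.7801 + T ^ 2) / 4.8) * ((13.0401 + T ^ 2) / 6) / 12 * 0.378 := by
      gcongr
    have m3 := norm_sub_norm_le (s - 1) (s - 1 - riemannZeta₁ s)
    have m4 : ‖s - 1 - riemannZeta₁ s‖ ≤ ‖riemannZeta₁ s - (s - 1 + (2:ℂ) ^ (1 - s) * ((s + 3) / 4))‖ + ‖(2:ℂ) ^ (1 - s) * ((s + 3) / 4)‖ := by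
      rw [← norm_neg]
      refine le_trans (le_of_eq ?_) (norm_add_le _ _)
      congr 1; ring
    rw [sub_sub_cancel] at m3
    have key : 0.1 ≤ T - 1.007 * (1.0025 + T ^ 2 / 32) - (T + 0.01) * ((6.7801 + T ^ 2) / 4.8) * ((13.0401 + T ^ 2) / 6) / 12 * 0.378 := by
      have e : (T + 0.01) * ((6.7801 + T ^ 2) / 4.8) * ((13.0401 + T ^ 2) / 6) / 12 * 0.378 =
          0.00109375 * ((T + 0.01) * (6.7801 + T ^ 2) * (13.0401 + T ^ 2)) := by ring
      rw [e]
      have hq : 0 ≤ (T - 1.4) * (3 - T) := mul_nonneg (by linarith) (by linarith)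
      linarith [mul_nonneg hq hT0, mul_nonneg hq (sq_nonneg T), mul_nonneg hq (pow_nonneg hT0 3), hq]
    linarith

lemma norm_deriv_riemannZeta₁_le {s : ℂ} (h1 : 0.99 ≤ s.re) (h2 : s.re ≤ 1.01) (ht : |s.im| ≤ 3) :
    ‖deriv riemannZeta₁ s‖ ≤ 30 := by
  have h := Complex.norm_deriv_le_of_forall_mem_sphere_norm_le (c := s) (R := 0.5) (C := 15) (f := riemannZeta₁) (by norm_num)
    differentiable_riemannZeta₁.diffContOnCl ?_
  · norm_num at h; exact h
  intro z hz
  have hz' : ‖z - s‖ = 0.5 := by simpa [dist_eq_norm] using hz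
  have r1 := abs_re_le_norm (z - s)
  have r2 := abs_im_le_norm (z - s)
  rw [hz', abs_le] at r1 r2
  simp at r1 r2
  rw [abs_le] at ht
  have hb := norm_riemannZeta₁_sub_le_one (s := z) (by linarith)
  have n1 : ‖z - 1‖ ≤ 3.6 := norm_le_of_sq_le (by norm_num) (by simp; nlinarith)
  have n2 : ‖z‖ ≤ 3.82 := norm_le_of_sq_le (by norm_num) (by nlinarith)
  have n3 : ‖z + 1‖ ≤ 4.31 := norm_le_of_sq_le (by norm_num) (by simp; nlinarith)
  have n4 : ‖riemannZeta₁ z‖ ≤ ‖riemannZeta₁ z - (z + 1) / 2‖ + ‖(z + 1) / 2‖ := by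
    refine le_trans (le_of_eq ?_) (norm_add_le _ _)
    congr 1; ring
  have n5 : ‖(z + 1) / 2‖ = ‖z + 1‖ / 2 := by simp
  have n6 : ‖z - 1‖ * ‖z‖ * ‖z + 1‖ / 6 ≤ 3.6 * 3.82 * 4.31 / 6 := by gcongr
  norm_num at n6 ⊢
  linarith

lemma re_logDeriv_riemannZeta₁_nonneg {a : ℝ} (ha : 0 < a) (ha1 : a ≤ 0.022) :
    0 ≤ (deriv riemannZeta₁ (1 + a) / riemannZeta₁ (1 + a)).re := by
  set s : ℂ := 1 + a with hs
  have hsre : s.re = 1 + a := by simp [hs]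
  have hsim : s.im = 0 := by simp [hs]
  have hd : ‖deriv (fun z ↦ riemannZeta₁ z - (z + 1) / 2) s‖ ≤ 0.073 / 0.15 := by
    apply Complex.norm_deriv_le_of_forall_mem_sphere_norm_le (by norm_num)
    · exact Differentiable.diffContOnCl (differentiable_riemannZeta₁.sub (by fun_prop))
    intro z hz
    have hz' : ‖z - s‖ = 0.15 := by simpa [dist_eq_norm] using hz
    have r1 := abs_re_le_norm (z - s)
    rw [hz', abs_le] at r1
    simp [hsre] at r1
    have na : ‖(a:ℂ)‖ ≤ 0.022 := by simpa [abs_of_pos ha] using ha1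
    have hb := norm_riemannZeta₁_sub_le_one (s := z) (by linarith)
    have n1 : ‖z - 1‖ ≤ 0.172 := by
      calc ‖z - 1‖ = ‖(z - s) + a‖ := by rw [hs]; congr 1; ring
        _ ≤ _ := (norm_add_le _ _).trans (by linarith)
    have n2 : ‖z‖ ≤ 1.172 := by
      calc ‖z‖ = ‖(z - 1) + 1‖ := by congr 1; ring
        _ ≤ _ := (norm_add_le _ _).trans (by rw [norm_one]; linarith)
    have n3 : ‖z + 1‖ ≤ 2.172 := (norm_add_le _ _).trans (by rw [norm_one]; linarith)
    have n6 : ‖z - 1‖ * ‖z‖ * ‖z + 1‖ / 6 ≤ 0.172 * 1.172 * 2.172 / 6 := by gcongr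
    norm_num at n6 ⊢
    linarith
  have hd2 : deriv (fun z ↦ riemannZeta₁ z - (z + 1) / 2) s = deriv riemannZeta₁ s - 1 / 2 := by
    rw [deriv_fun_sub differentiable_riemannZeta₁.differentiableAt (by fun_prop)]
    simp
  rw [hd2] at hd
  have hb := norm_riemannZeta₁_sub_le_one (s := s) (by linarith)
  have hb2 : ‖s - 1‖ * ‖s‖ * ‖s + 1‖ / 6 ≤ 0.022 * 1.022 * 2.022 / 6 := by
    have na : ‖(a:ℂ)‖ ≤ 0.022 := by simpa [abs_of_pos ha] using ha1
    have n1 : ‖s - 1‖ ≤ 0.022 := by rw [hs, add_sub_cancel_left]; exact na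
    have n2 : ‖s‖ ≤ 1.022 := (norm_add_le _ _).trans (by rw [norm_one]; linarith)
    have n3 : ‖s + 1‖ ≤ 2.022 := (norm_add_le _ _).trans (by rw [norm_one]; linarith)
    gcongr
  have hb3 := hb.trans hb2
  have q1 := (abs_re_le_norm _).trans hd
  have q2 := (abs_im_le_norm _).trans hd
  have q3 := (abs_re_le_norm _).trans hb3
  have q4 := (abs_im_le_norm _).trans hb3
  rw [abs_le] at q1 q2 q3 q4
  simp [hsre, hsim] at q1 q2 q3 q4
  norm_num at q1 q2 q3 q4
  rw [Complex.div_re, ← add_div]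
  apply div_nonneg _ (normSq_nonneg _)
  have w1 : 0.013 * 0.98 ≤ (deriv riemannZeta₁ s).re * (riemannZeta₁ s).re :=
    mul_le_mul (by norm_num; linarith) (by norm_num; linarith) (by norm_num) (by linarith)
  have w2 : |(deriv riemannZeta₁ s).im * (riemannZeta₁ s).im| ≤ 0.487 * 0.0077 := by
    rw [abs_mul]
    exact mul_le_mul (abs_le.2 ⟨by norm_num; linarith, by norm_num; linarith⟩) (abs_le.2 ⟨by norm_num; linarith, by norm_num; linarith⟩)
      (abs_nonneg _) (by norm_num)
  have w3 := (abs_le.1 w2).1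
  norm_num at w1 w3
  linarith

lemma logDeriv_riemannZeta_eq {s : ℂ} (hs : s ≠ 1) (h0 : riemannZeta s ≠ 0) :
    deriv riemannZeta s / riemannZeta s = - (s - 1)⁻¹ + deriv riemannZeta₁ s / riemannZeta₁ s := by
  have h1 : s - 1 ≠ 0 := sub_ne_zero.2 hs
  have e := riemannZeta_eq_inv_sub_mul hs
  have h2 : riemannZeta₁ s ≠ 0 := by
    intro h; rw [h, mul_zero] at e; exact h0 e
  rw [deriv_riemannZeta_eq_neg_inv_sub_sq_mul_add hs, e]
  field_simp

lemma hasSum_re_vonMangoldt {σ t : ℝ} (hσ : 1 < σ) :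
    HasSum (fun n : ℕ ↦ ArithmeticFunction.vonMangoldt n * (n:ℝ) ^ (-σ) * Real.cos (t * Real.log n))
      (-(deriv riemannZeta ⟨σ, t⟩ / riemannZeta ⟨σ, t⟩)).re := by
  set s : ℂ := ⟨σ, t⟩ with hs
  have h1 : 1 < s.re := by simpa [hs] using hσ
  have h := (ArithmeticFunction.LSeriesSummable_vonMangoldt h1).LSeriesHasSum
  rw [ArithmeticFunction.LSeries_vonMangoldt_eq_deriv_riemannZeta_div h1] at h
  have h2 := Complex.hasSum_re h
  rw [neg_div] at h2
  convert h2 using 1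
  ext n
  rcases Nat.eq_zero_or_pos n with rfl | hn
  · simp
  · rw [LSeries.term_of_ne_zero hn.ne']
    have hn0 : (0:ℝ) < n := by exact_mod_cast hn
    have e : ((n:ℂ) ^ s)⁻¹ = (((n:ℝ) ^ (-σ) : ℝ) : ℂ) * Complex.exp ((-(t * Real.log n) : ℝ) * I) := by
      rw [← cpow_neg, cpow_def_of_ne_zero (by exact_mod_cast hn.ne'), Real.rpow_def_of_pos hn0, ofReal_exp, ← Complex.exp_add,
        ← natCast_log]
      congr 1
      have : s = σ + t * I := by rw [hs]; apply Complex.ext <;> simp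
      rw [this]; push_cast; ring
    rw [div_eq_mul_inv, e, ← mul_assoc, ← ofReal_mul, re_ofReal_mul, exp_ofReal_mul_I_re, Real.cos_neg]

lemma re_logDeriv_zeta_combination {σ t : ℝ} (hσ : 1 < σ) :
    0 ≤ 5 * (-(deriv riemannZeta ⟨σ, 0⟩ / riemannZeta ⟨σ, 0⟩)).re + 8 * (-(deriv riemannZeta ⟨σ, t⟩ / riemannZeta ⟨σ, t⟩)).re
      + 4 * (-(deriv riemannZeta ⟨σ, 2 * t⟩ / riemannZeta ⟨σ, 2 * t⟩)).re
      + (-(deriv riemannZeta ⟨σ, 3 * t⟩ / riemannZeta ⟨σ, 3 * t⟩)).re := by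
  have h := (((hasSum_re_vonMangoldt (t := 0) hσ).mul_left 5).add ((hasSum_re_vonMangoldt (t := t) hσ).mul_left 8)).add
    ((hasSum_re_vonMangoldt (t := 2 * t) hσ).mul_left 4) |>.add (hasSum_re_vonMangoldt (t := 3 * t) hσ)
  refine h.nonneg fun n ↦ ?_
  have hL : 0 ≤ ArithmeticFunction.vonMangoldt n * (n:ℝ) ^ (-σ) :=
    mul_nonneg ArithmeticFunction.vonMangoldt_nonneg (by positivity)
  set L := ArithmeticFunction.vonMangoldt n * (n:ℝ) ^ (-σ)
  have e2 : Real.cos (2 * t * Real.log n) = 2 * Real.cos (t * Real.log n) ^ 2 - 1 := by rw [mul_assoc, Real.cos_two_mul]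
  have e3 : Real.cos (3 * t * Real.log n) = 4 * Real.cos (t * Real.log n) ^ 3 - 3 * Real.cos (t * Real.log n) := by rw [mul_assoc, Real.cos_three_mul]
  rw [e2, e3, zero_mul, Real.cos_zero]
  set c := Real.cos (t * Real.log n)
  have hc : -1 ≤ c := Real.neg_one_le_cos _
  have : 0 ≤ L * ((1 + c) * (1 + 2 * c) ^ 2) := mul_nonneg hL (mul_nonneg (by linarith) (sq_nonneg _))
  linarith

lemma blaschke_term_nonneg {r : ℝ} {u : ℂ} (hu : u ∈ ball (0:ℂ) r) (hre : u.re < 0) :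
    0 ≤ -u.re * (1 / ‖u‖ ^ 2 - 1 / r ^ 2) := by
  have hu' := mem_ball_zero_iff.1 hu
  have hu0 : 0 < ‖u‖ := norm_pos_iff.2 (by rintro rfl; simp at hre)
  apply mul_nonneg (by linarith)
  rw [sub_nonneg]
  exact one_div_le_one_div_of_le (by positivity) (by gcongr)

lemma neg_re_logDeriv_zeta_le {N : ℕ} (hN : 1000 ≤ N) {a t : ℝ} (ha : 0 < a) (ha1 : a ≤ 0.05) (ht : 2.3 ≤ |t|)
    (ht2 : |t| + 1 ≤ 3 * N - 1) :
    (-(deriv riemannZeta ⟨1 + a, t⟩ / riemannZeta ⟨1 + a, t⟩)).re ≤ Real.log N / 2 + 1.1 := by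
  obtain ⟨r, hr, hr1, S, m, g, hg, hg0, hS, hfg, hsum⟩ := exists_zeta_disc hN ha ha1 ht ht2 rfl
  have : 0 ≤ ∑ u ∈ S, m u * (-u.re * (1 / ‖u‖ ^ 2 - 1 / r ^ 2)) := by
    apply Finset.sum_nonneg
    intro u hu
    exact mul_nonneg (Nat.cast_nonneg _) (blaschke_term_nonneg (hS u hu).1 (by linarith [(hS u hu).2.2.1]))
  rw [neg_re]
  linarith

lemma neg_re_logDeriv_zeta_le_of_zero {N : ℕ} (hN : 1000 ≤ N) {a t w : ℝ} (ha : 0 < a) (ha1 : a ≤ 0.05) (ht : 2.3 ≤ |t|)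
    (ht2 : |t| + 1 ≤ 3 * N - 1) (hw0 : 0 < w) (hw : w ≤ 0.99) (hz : riemannZeta ⟨1 + a - w, t⟩ = 0) :
    (-(deriv riemannZeta ⟨1 + a, t⟩ / riemannZeta ⟨1 + a, t⟩)).re + (1 / w - w / 0.98) ≤ Real.log N / 2 + 1.1 := by
  obtain ⟨r, hr, hr1, S, m, g, hg, hg0, hS, hfg, hsum⟩ := exists_zeta_disc hN ha ha1 ht ht2 rfl
  have hrp : 0 < r := by linarith
  have hwr : (-(w:ℂ)) ∈ closedBall (0:ℂ) r := by simp [abs_of_pos hw0]; linarith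
  have hmem : (-(w:ℂ)) ∈ S := by
    have h1 := hfg _ hwr
    have e : (⟨1 + a, t⟩ : ℂ) + -(w:ℂ) = ⟨1 + a - w, t⟩ := by apply Complex.ext <;> simp [sub_eq_add_neg]
    rw [e, hz, eq_comm, mul_eq_zero, or_iff_left (hg0 _ hwr), Finset.prod_eq_zero_iff] at h1
    obtain ⟨u, hu, hu2⟩ := h1
    have := (pow_eq_zero_iff (by rintro h; rw [h] at hu2; simp at hu2)).1 hu2
    rw [sub_eq_zero] at this
    rwa [this]
  have h2 := Finset.single_le_sum (f := fun u : ℂ ↦ (m u : ℝ) * (-u.re * (1 / ‖u‖ ^ 2 - 1 / r ^ 2))) (fun u hu ↦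
    mul_nonneg (Nat.cast_nonneg _) (blaschke_term_nonneg (hS u hu).1 (by linarith [(hS u hu).2.2.1]))) hmem
  have hm : (1:ℝ) ≤ m (-(w:ℂ)) := by exact_mod_cast (hS _ hmem).2.2.2
  have h3 := blaschke_term_nonneg (hS _ hmem).1 (by simp [hw0])
  have h4 := le_mul_of_one_le_left h3 hm
  have e5 : -(-(w:ℂ)).re * (1 / ‖-(w:ℂ)‖ ^ 2 - 1 / r ^ 2) = 1 / w - w / r ^ 2 := by
    simp [abs_of_pos hw0]; field_simp
  have h6 : w / r ^ 2 ≤ w / 0.98 := by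
    apply div_le_div_of_nonneg_left hw0.le (by norm_num); nlinarith
  rw [e5] at h4 h2
  rw [neg_re]
  linarith

lemma log_thousand_gt : 6.83 < Real.log 1000 := by
  have h : Real.log ((2:ℝ) ^ 69) ≤ Real.log (1000 ^ 7) := Real.log_le_log (by norm_num) (by norm_num)
  rw [Real.log_pow, Real.log_pow] at h
  have := Real.log_two_gt_d9
  norm_num at h ⊢
  linarith

lemma log_three_lt : Real.log 3 < 1.11 := by
  have h : Real.log ((3:ℝ) ^ 5) ≤ Real.log (2 ^ 8) := Real.log_le_log (by norm_num) (by norm_num)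
  rw [Real.log_pow, Real.log_pow] at h
  have := Real.log_two_lt_d9
  norm_num at h ⊢
  linarith

lemma neg_re_logDeriv_zeta_real_le {a : ℝ} (ha : 0 < a) (ha1 : a ≤ 0.022) :
    (-(deriv riemannZeta ⟨1 + a, 0⟩ / riemannZeta ⟨1 + a, 0⟩)).re ≤ 1 / a := by
  have e : (⟨1 + a, 0⟩ : ℂ) = 1 + a := by apply Complex.ext <;> simp
  have hne : (1 + a : ℂ) ≠ 1 := by simp [ha.ne']
  rw [e, logDeriv_riemannZeta_eq hne (riemannZeta_ne_zero_of_one_le_re (by simp [ha.le]))]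
  have := re_logDeriv_riemannZeta₁_nonneg ha ha1
  have e2 : ((1 + (a:ℂ) - 1)⁻¹).re = 1 / a := by
    rw [add_sub_cancel_left, ← ofReal_inv, ofReal_re, one_div]
  rw [neg_re, add_re, neg_re, e2]
  linarith

lemma riemannZeta_ne_zero_of_near_one {N : ℕ} (hN : 1000 ≤ N) {s : ℂ} (hs : |s.im| + 2 ≤ 3 * N)
    (hre : 1 - 0.3508 / (6.5 * Real.log N + 16.5) ≤ s.re) (h1 : s ≠ 1) : riemannZeta s ≠ 0 := by
  intro hz
  have hs1 : s.re < 1 := by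
    by_contra! h
    exact riemannZeta_ne_zero_of_one_le_re h hz
  have hN0 : (1000:ℝ) ≤ N := by exact_mod_cast hN
  have hlN : 6.83 < Real.log N := log_thousand_gt.trans_le (Real.log_le_log (by norm_num) hN0)
  set Q := 6.5 * Real.log N + 16.5 with hQ
  have hQ1 : 60.89 < Q := by rw [hQ]; norm_num at hlN ⊢; linarith
  have hQ0 : 0 < Q := by linarith
  have hq : 0.3508 / Q ≤ 0.00577 := by
    rw [div_le_iff₀ hQ0]; norm_num at hQ1 ⊢; linarith
  rcases le_total |s.im| 3 with h3 | h3
  · have := le_norm_riemannZeta₁ (s := s) (by norm_num at hq hre ⊢; linarith) (by linarith) h3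
    rw [riemannZeta_eq_inv_sub_mul h1, mul_eq_zero, or_iff_right (inv_ne_zero (sub_ne_zero.2 h1))] at hz
    rw [hz] at this
    norm_num at this
  set a := 1.3246 / Q with ha
  have ha0 : 0 < a := by positivity
  have ha1 : a ≤ 0.022 := by
    rw [ha, div_le_iff₀ hQ0]; norm_num at hQ1 ⊢; linarith
  set w := 1 + a - s.re with hw
  have hw0 : 0 < w := by linarith
  have hw1 : w ≤ 1.6754 / Q := by
    have : 1.6754 / Q = 0.3508 / Q + 1.3246 / Q := by rw [← add_div]; norm_num
    linarith
  have hw2 : w ≤ 0.028 := by linarith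
  have hz' : riemannZeta ⟨1 + a - w, s.im⟩ = 0 := by
    rw [← hz]; congr 1; apply Complex.ext <;> simp [hw]
  have c0 := neg_re_logDeriv_zeta_real_le ha0 ha1
  have c1 := neg_re_logDeriv_zeta_le_of_zero hN ha0 (by linarith) (by linarith) (by linarith) hw0 (by linarith) hz'
  have c2 := neg_re_logDeriv_zeta_le (N := 2 * N) (a := a) (t := 2 * s.im) (by omega) ha0 (by linarith)
    (by rw [abs_mul, abs_two]; linarith) (by rw [abs_mul, abs_two]; push_cast; linarith)
  have c3 := neg_re_logDeriv_zeta_le (N := 3 * N) (a := a) (t := 3 * s.im) (by omega) ha0 (by linarith)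
    (by rw [abs_mul, abs_of_pos (show (0:ℝ) < 3 by norm_num)]; linarith)
    (by rw [abs_mul, abs_of_pos (show (0:ℝ) < 3 by norm_num)]; push_cast; linarith)
  have c := re_logDeriv_zeta_combination (σ := 1 + a) (t := s.im) (by linarith)
  have hNne : (N:ℝ) ≠ 0 := by positivity
  rw [Nat.cast_mul, Real.log_mul (by norm_num) hNne] at c2 c3
  push_cast at c2 c3
  have l2 := Real.log_two_lt_d9
  have l3 := log_three_lt
  have k : 8 * (1 / w) ≤ 5 * (1 / a) + Q := by
    rw [hQ]
    norm_num at *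
    linarith
  have e1 : 1 / a = Q / 1.3246 := by rw [ha, one_div_div]
  have e2 : Q / 1.6754 ≤ 1 / w := by
    rw [← one_div_div]; exact one_div_le_one_div_of_le hw0 hw1
  rw [e1] at k
  norm_num at *
  linarith

lemma norm_logDeriv_le_of_norm_le {h : ℂ → ℂ} {r B A : ℝ} (hr : 0.48 < r) (hh : AnalyticOnNhd ℂ h (closedBall 0 r))
    (h0 : ∀ w ∈ closedBall (0:ℂ) 0.48, h w ≠ 0) (hB : ∀ w ∈ closedBall (0:ℂ) 0.48, ‖h w‖ ≤ B)
    (hA : 0 < A) (hBA : Real.log B - Real.log ‖h 0‖ ≤ A) {w : ℂ} (hw : ‖w‖ ≤ 0.026) :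
    ‖deriv h w / h w‖ ≤ 7.5 * A := by
  have hh' : AnalyticOnNhd ℂ h (closedBall 0 0.48) := hh.mono (closedBall_subset_closedBall hr.le)
  obtain ⟨R, hR, G, hG, hexp, hderiv⟩ := exists_log_of_ne_zero (by norm_num) hh' h0
  have hsub : ball (0:ℂ) 0.48 ⊆ ball 0 R := ball_subset_ball hR.le
  have hBC : ∀ z : ℂ, ‖z‖ ≤ 0.126 → ‖G z - G 0‖ ≤ 0.712 * A := by
    intro z hz
    have hz2 : z ∈ ball (0:ℂ) 0.48 := by rw [mem_ball_zero_iff]; norm_num at hz ⊢; linarith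
    have := borelCaratheodory_zero (f := fun z ↦ G z - G 0) (R := 0.48) (z := z) hA ((hG.mono hsub).sub (differentiableOn_const _)) ?_ (by norm_num) hz2 (by simp)
    · refine this.trans ?_
      rw [div_le_iff₀ (by norm_num at hz ⊢; linarith)]
      have hp : 0 ≤ A * (0.126 - ‖z‖) := mul_nonneg hA.le (by linarith)
      norm_num at hp ⊢
      nlinarith
    · intro x hx
      have hx' : x ∈ closedBall (0:ℂ) 0.48 := ball_subset_closedBall hx
      have e : ∀ y ∈ ball (0:ℂ) R, (G y).re = Real.log ‖h y‖ := fun y hy ↦ by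
        rw [← hexp y hy, norm_exp, Real.log_exp]
      simp only [Set.mem_ofPred_eq, sub_re]
      rw [e x (hsub hx), e 0 (mem_ball_self (by norm_num at hR; linarith))]
      have := Real.log_le_log (norm_pos_iff.2 (h0 x hx')) (hB x hx')
      linarith
  have hwR : w ∈ ball (0:ℂ) R := by rw [mem_ball_zero_iff]; norm_num at hw hR ⊢; linarith
  rw [← hderiv w hwR]
  have hd : deriv (fun z ↦ G z - G 0) w = deriv G w := by rw [deriv_sub_const]
  rw [← hd]
  have := Complex.norm_deriv_le_of_forall_mem_sphere_norm_le (c := w) (R := 0.1) (C := 0.712 * A) (f := fun z ↦ G z - G 0) (by norm_num) ?_ ?_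
  · refine this.trans ?_
    norm_num; linarith
  · have hs : closedBall w 0.1 ⊆ ball 0 R := by
      intro z hz
      rw [mem_closedBall, dist_eq_norm] at hz
      rw [mem_ball_zero_iff]
      have := norm_le_norm_sub_add z w
      norm_num at *; linarith
    refine DifferentiableOn.diffContOnCl ?_
    rw [closure_ball _ (by norm_num)]
    exact (hG.mono hs).sub (differentiableOn_const _)
  · intro z hz
    apply hBC
    rw [mem_sphere, dist_eq_norm] at hz
    have := norm_le_norm_sub_add z w
    norm_num at *; linarith

lemma norm_inv_sub_inv_le {u : ℂ} {β δ x β₁ : ℝ} (hu : u.re = -x) (hδ : 0 < δ) (hβ : 0 ≤ β) (hβ₁ : β ≤ β₁) (hx : β + δ ≤ x) :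
    ‖1 / (-(β:ℂ) - u) - 1 / (0 - u)‖ ≤ β₁ / δ * (-u.re * (1 / ‖u‖ ^ 2)) := by
  have hx0 : 0 < x := by linarith
  have hu0 : u ≠ 0 := by rintro rfl; simp at hu; linarith
  have hw : -(β:ℂ) - u ≠ 0 := by
    intro h
    have := congrArg re h
    simp [hu] at this; linarith
  have e : 1 / (-(β:ℂ) - u) - 1 / (0 - u) = -β / ((-(β:ℂ) - u) * u) := by
    field_simp; ring
  have hun : 0 < ‖u‖ := norm_pos_iff.2 hu0
  have hwn : 0 < ‖-(β:ℂ) - u‖ := norm_pos_iff.2 hw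
  rw [e, norm_div, norm_mul, norm_neg, norm_real, Real.norm_of_nonneg hβ, hu, neg_neg]
  have key : ‖u‖ * δ ≤ x * ‖-(β:ℂ) - u‖ := by
    apply le_of_sq_le_sq _ (by positivity)
    rw [mul_pow, mul_pow, ← normSq_eq_norm_sq, ← normSq_eq_norm_sq, normSq_apply, normSq_apply]
    simp [hu]
    have h1 : δ ^ 2 ≤ (x - β) ^ 2 := by gcongr; linarith
    have h2 : δ ^ 2 ≤ x ^ 2 := by gcongr; linarith
    nlinarith [mul_le_mul_of_nonneg_left h1 (sq_nonneg x), mul_le_mul_of_nonneg_left h2 (sq_nonneg u.im)]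
  have e2 : β₁ / δ * (x * (1 / ‖u‖ ^ 2)) = β₁ * x / (δ * ‖u‖ ^ 2) := by field_simp
  rw [e2, div_le_div_iff₀ (by positivity) (by positivity)]
  calc β * (δ * ‖u‖ ^ 2) = β * (‖u‖ * δ) * ‖u‖ := by ring
    _ ≤ β₁ * (x * ‖-(β:ℂ) - u‖) * ‖u‖ := by gcongr; linarith
    _ = _ := by ring

lemma norm_logDeriv_zeta_le {a t : ℝ} (ha : 0 < a) (ha1 : a ≤ 0.022) :
    ‖deriv riemannZeta ⟨1 + a, t⟩ / riemannZeta ⟨1 + a, t⟩‖ ≤ 1 / a := by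
  refine le_trans ?_ (neg_re_logDeriv_zeta_real_le ha ha1)
  have h0 := hasSum_re_vonMangoldt (σ := 1 + a) (t := 0) (by linarith)
  have h1 : 1 < (⟨1 + a, t⟩ : ℂ).re := by simp [ha]
  rw [← norm_neg, ← neg_div, ← ArithmeticFunction.LSeries_vonMangoldt_eq_deriv_riemannZeta_div h1]
  refine tsum_of_norm_bounded h0 fun n ↦ ?_
  rw [LSeries.norm_term_eq]
  rcases Nat.eq_zero_or_pos n with rfl | hn
  · simp
  · rw [if_neg hn.ne', norm_real, Real.norm_of_nonneg ArithmeticFunction.vonMangoldt_nonneg, Real.rpow_neg (by positivity)]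
    simp [div_eq_mul_inv]

lemma norm_logDeriv_sub_sum_le {f g : ℂ → ℂ} {r B A : ℝ} (hr : 0.99 < r) {S : Finset ℂ} {m : ℂ → ℕ}
    (hg : AnalyticOnNhd ℂ g (closedBall 0 r)) (hg0 : ∀ w ∈ closedBall (0:ℂ) r, g w ≠ 0)
    (hu0 : ∀ u ∈ S, u ≠ 0)
    (hfg : ∀ w ∈ closedBall (0:ℂ) r, f w = (∏ u ∈ S, (w - u) ^ m u) * g w)
    (hB : ∀ w ∈ sphere (0:ℂ) r, ‖f w‖ ≤ B) (hA : 0 < A) (hBA : Real.log B - Real.log ‖f 0‖ ≤ A)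
    {w : ℂ} (hw : ‖w‖ ≤ 0.026) (hwS : ∀ u ∈ S, w ≠ u) :
    ‖(logDeriv f w - logDeriv f 0) - ∑ u ∈ S with ‖u‖ ≤ 0.49, (m u : ℂ) * (1 / (w - u) - 1 / (0 - u))‖ ≤ 15 * A := by
  classical
  set S₁ := S.filter (fun u ↦ ‖u‖ ≤ 0.49) with hS₁
  set S₂ := S.filter (fun u ↦ ¬ ‖u‖ ≤ 0.49) with hS₂
  set P : ℂ → ℂ := fun w ↦ ∏ u ∈ S₁, (w - u) ^ m u with hP
  set k : ℂ → ℂ := fun w ↦ (∏ u ∈ S₂, (w - u) ^ m u) * g w with hk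
  have hrp : 0 < r := by norm_num at hr; linarith
  have hf : ∀ w ∈ closedBall (0:ℂ) r, f w = P w * k w := by
    intro w hw
    rw [hfg w hw, hP, hk, ← mul_assoc, hS₁, hS₂]
    simp only
    rw [Finset.prod_filter_mul_prod_filter_not]
  have hkA : AnalyticOnNhd ℂ k (closedBall 0 r) := by
    intro z hz
    refine AnalyticAt.mul ?_ (hg z hz)
    exact Finset.analyticAt_fun_prod _ fun u _ ↦ (analyticAt_id.sub analyticAt_const).pow _
  have hk0 : ∀ z ∈ closedBall (0:ℂ) 0.49, k z ≠ 0 := by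
    intro z hz
    have hz' := mem_closedBall_zero_iff.1 hz
    refine mul_ne_zero ?_ (hg0 z (closedBall_subset_closedBall (by norm_num at hr ⊢; linarith) hz))
    refine Finset.prod_ne_zero_iff.2 fun u hu ↦ pow_ne_zero _ (sub_ne_zero.2 ?_)
    rintro rfl
    exact (Finset.mem_filter.1 hu).2 hz'
  set c := P 0 with hc
  have hc0 : c ≠ 0 := by
    refine Finset.prod_ne_zero_iff.2 fun u hu ↦ pow_ne_zero _ (sub_ne_zero.2 ?_)
    exact (hu0 u (Finset.mem_filter.1 hu).1).symm
  have hlog : ∀ z : ℂ, ‖z‖ ≤ 0.026 → (∀ u ∈ S, z ≠ u) →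
      logDeriv f z = ∑ u ∈ S₁, (m u : ℂ) * (1 / (z - u)) + deriv (fun w ↦ c * k w) z / (c * k z) := by
    intro z hz hzS
    have hz1 : z ∈ ball (0:ℂ) r := by rw [mem_ball_zero_iff]; norm_num at hz hr ⊢; linarith
    have hz2 : z ∈ closedBall (0:ℂ) 0.49 := by rw [mem_closedBall_zero_iff]; norm_num at hz ⊢; linarith
    have hev : f =ᶠ[𝓝 z] fun w ↦ P w * k w := by
      filter_upwards [isOpen_ball.mem_nhds hz1] with y hy using hf y (ball_subset_closedBall hy)
    rw [(logDeriv_congr_nhds hev).eq_of_nhds]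
    have hPz : P z ≠ 0 := Finset.prod_ne_zero_iff.2 fun u hu ↦ pow_ne_zero _
      (sub_ne_zero.2 (hzS u (Finset.mem_filter.1 hu).1))
    rw [logDeriv_mul z hPz (hk0 z hz2) (by fun_prop) (hkA z (ball_subset_closedBall hz1)).differentiableAt,
      ← logDeriv_apply, logDeriv_const_mul z c hc0]
    congr 1
    rw [hP, logDeriv_prod (f := fun u w ↦ (w - u) ^ m u)]
    · refine Finset.sum_congr rfl fun u hu ↦ ?_
      rw [logDeriv_fun_pow (f := fun w ↦ w - u) (by fun_prop)]
      simp [logDeriv_apply]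
    · exact fun u hu ↦ pow_ne_zero _ (sub_ne_zero.2 (hzS u (Finset.mem_filter.1 hu).1))
    · intro u _; fun_prop
  have hB' : ∀ w ∈ closedBall (0:ℂ) r, ‖c * k w‖ ≤ B := by
    intro w hw
    refine Complex.norm_le_of_forall_mem_frontier_norm_le (f := fun w ↦ c * k w) (U := ball (0:ℂ) r) isBounded_ball ?_ ?_ ?_
    · refine DifferentiableOn.diffContOnCl ?_
      rw [closure_ball _ hrp.ne']
      exact (hkA.differentiableOn).const_mul c
    · intro z hz
      rw [frontier_ball _ hrp.ne'] at hz
      refine le_trans ?_ (hB z hz)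
      rw [hf z (sphere_subset_closedBall hz), norm_mul]
      simp only [norm_mul]
      refine mul_le_mul_of_nonneg_right ?_ (norm_nonneg _)
      rw [hc, hP]
      simp only [norm_prod, norm_pow, zero_sub, norm_neg]
      gcongr with u hu
      have h1 := (Finset.mem_filter.1 hu).2
      have h2 := norm_sub_norm_le z u
      rw [mem_sphere_zero_iff_norm.1 hz] at h2
      norm_num at *; linarith
    · rwa [closure_ball _ hrp.ne']
  have hf0 : f 0 = c * k 0 := hf 0 (by simp [hrp.le])
  have hmain : ∀ z : ℂ, ‖z‖ ≤ 0.026 → ‖deriv (fun w ↦ c * k w) z / (c * k z)‖ ≤ 7.5 * A := by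
    intro z hz
    refine norm_logDeriv_le_of_norm_le (h := fun w ↦ c * k w) (r := r) (B := B) (A := A) (by norm_num at hr ⊢; linarith) (fun y hy ↦ analyticAt_const.mul (hkA y hy)) ?_ ?_ hA ?_ hz
    · intro y hy
      exact mul_ne_zero hc0 (hk0 y (closedBall_subset_closedBall (by norm_num) hy))
    · intro y hy
      exact hB' y (closedBall_subset_closedBall (by norm_num at hr ⊢; linarith) hy)
    · simpa [← hf0] using hBA
  rw [hlog w hw hwS, hlog 0 (by norm_num) (fun u hu ↦ (hu0 u hu).symm)]
  have e : ∀ X Y a b : ℂ, X + a - (Y + b) - (X - Y) = a - b := by intros; ring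
  simp only [mul_sub, Finset.sum_sub_distrib]
  rw [e]
  refine (norm_sub_le _ _).trans ?_
  have h1 := hmain w hw
  have h2 := hmain 0 (by norm_num)
  linarith

lemma log_bound_const : Real.log 1.78 + Real.log 51 ≤ 4.55 := by
  have h : Real.log ((1.78 * 51) ^ 2) ≤ Real.log (2 ^ 13 * 1.01) := Real.log_le_log (by norm_num) (by norm_num)
  rw [Real.log_pow, Real.log_mul (by norm_num) (by norm_num), Real.log_mul (by norm_num) (by norm_num), Real.log_pow] at h
  have := Real.log_two_lt_d9
  have h2 := Real.log_le_sub_one_of_pos (x := 1.01) (by norm_num)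
  norm_num at h h2 ⊢
  linarith

lemma norm_logDeriv_riemannZeta_le {N : ℕ} (hN : 1000 ≤ N) {σ t δ : ℝ} (ht : 3 ≤ |t|) (ht2 : |t| + 3 ≤ 3 * N)
    (hδ : 0 < δ) (h : 1 - σ + δ ≤ 0.3508 / (6.5 * Real.log N + 16.5)) (hσ : σ ≤ 1.02) :
    ‖deriv riemannZeta ⟨σ, t⟩ / riemannZeta ⟨σ, t⟩‖ ≤
      50 + 0.026 / δ * (1.325 * (51.1 + Real.log N / 2)) + 15 * (Real.log N + 4.55) := by
  have hN0 : (1000:ℝ) ≤ N := by exact_mod_cast hN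
  have hlN : 6.83 < Real.log N := log_thousand_gt.trans_le (Real.log_le_log (by norm_num) hN0)
  set b₀ := 0.3508 / (6.5 * Real.log N + 16.5) with hb₀
  have hb₀1 : b₀ ≤ 0.0058 := by
    rw [hb₀, div_le_iff₀ (by linarith)]; norm_num at hlN ⊢; linarith
  set s₀ : ℂ := ⟨1 + 0.02, t⟩ with hs₀
  obtain ⟨r, hr, hr1, S, m, g, hg, hg0, hS, hfg, hsum⟩ := exists_zeta_disc hN (a := 0.02) (t := t) (by norm_num) (by norm_num)
    (by norm_num at ht ⊢; linarith) (by linarith) hs₀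
  have hrp : 0 < r := by norm_num at hr; linarith
  have hL0 := norm_logDeriv_zeta_le (a := 0.02) (t := t) (by norm_num) (by norm_num)
  have hzre : ∀ u ∈ S, 0.02 + b₀ < - u.re := by
    intro u hu
    obtain ⟨h1, h2, h3, h4⟩ := hS u hu
    by_contra! hcon
    have hu1 : |u.im| ≤ 1 := (abs_im_le_norm u).trans ((mem_ball_zero_iff.1 h1).le.trans hr1.le)
    have him : (s₀ + u).im = t + u.im := by simp [hs₀]
    have h5 := abs_add_le t u.im
    have h6 := abs_sub_abs_le_abs_sub t (-u.im)
    rw [abs_neg, sub_neg_eq_add] at h6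
    refine riemannZeta_ne_zero_of_near_one hN (s := s₀ + u) ?_ ?_ ?_ h2
    · rw [him]; linarith
    · simp only [hs₀, add_re]; rw [← hb₀]; linarith
    · intro h7
      rw [h7] at him
      simp at him
      rw [← him] at h6; simp at h6; linarith
  have hu0 : ∀ u ∈ S, u ≠ 0 := by
    rintro u hu rfl
    have := (hS 0 hu).2.2.1
    norm_num at this
  set β := 1.02 - σ with hβ
  have hβ0 : 0 ≤ β := by linarith
  have hβ1 : β ≤ 0.026 := by norm_num at *; linarith
  have hw : ‖(-(β:ℂ))‖ ≤ 0.026 := by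
    rw [norm_neg, norm_real, Real.norm_of_nonneg hβ0]; exact hβ1
  have hwS : ∀ u ∈ S, -(β:ℂ) ≠ u := by
    rintro u hu rfl
    have := hzre _ hu
    simp at this; norm_num at *; linarith
  have hs0n : 0.02 / 1.02 ≤ ‖riemannZeta s₀‖ := by
    have := le_norm_riemannZeta (s := s₀) (by simp [hs₀]; norm_num)
    norm_num [hs₀] at this ⊢; exact this
  have hkey := norm_logDeriv_sub_sum_le (f := fun w ↦ riemannZeta (s₀ + w)) (g := g) (r := r) (B := 1.78 * N)
    (A := Real.log N + 4.55) hr hg hg0 hu0 hfg ?_ (by norm_num at hlN ⊢; linarith) ?_ hw hwS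
  rotate_left
  · intro w hw
    have hw' : ‖w‖ ≤ 1 := by rw [mem_sphere_zero_iff_norm.1 hw]; exact hr1.le
    have h1 : |w.im| ≤ 1 := (abs_im_le_norm w).trans hw'
    have h2 : |w.re| ≤ r := (abs_re_le_norm w).trans (mem_sphere_zero_iff_norm.1 hw).le
    have him : (s₀ + w).im = t + w.im := by simp [hs₀]
    have hre : (s₀ + w).re = 1 + 0.02 + w.re := by simp [hs₀]
    have h5 := abs_add_le t w.im
    have h6 := abs_sub_abs_le_abs_sub t (-w.im)
    rw [abs_neg, sub_neg_eq_add] at h6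
    have h7 := abs_le.1 h2
    rcases le_total (s₀ + w).re 1.1 with h3 | h3
    · have := norm_riemannZeta_le hN (v := 1) (by norm_num) le_rfl (s := s₀ + w) (by rw [hre]; norm_num; linarith)
        (by rw [hre]; norm_num; linarith) h3 (by rw [him]; norm_num at *; linarith) (by rw [him]; linarith)
      rw [Real.rpow_one] at this
      norm_num at this ⊢; linarith
    · have h4 : 1 < (s₀ + w).re := by norm_num at h3 ⊢; linarith
      refine (norm_riemannZeta_le_of_one_lt h4).trans ?_
      rw [div_le_iff₀ (by linarith)]
      norm_num at h3 ⊢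
      nlinarith
  · simp only [add_zero]
    rw [Real.log_mul (by norm_num) (by linarith)]
    have h1 := Real.log_le_log (by norm_num) hs0n
    have h2 : Real.log (0.02 / 1.02) = - Real.log 51 := by
      rw [← Real.log_inv]; norm_num
    have := log_bound_const
    linarith
  have hld : ∀ w : ℂ, logDeriv (fun w ↦ riemannZeta (s₀ + w)) w = deriv riemannZeta (s₀ + w) / riemannZeta (s₀ + w) := by
    intro w
    rw [logDeriv_apply, deriv_comp_const_add]
  have hsw : s₀ + -(β:ℂ) = ⟨σ, t⟩ := by
    apply Complex.ext <;> simp [hs₀, hβ]; norm_num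
  rw [hld, hld, hsw, add_zero] at hkey
  have hS1 : ‖∑ u ∈ S with ‖u‖ ≤ 0.49, (m u : ℂ) * (1 / (-(β:ℂ) - u) - 1 / (0 - u))‖ ≤
      0.026 / δ * (1.325 * (51.1 + Real.log N / 2)) := by
    have h1 : ∑ u ∈ S with ‖u‖ ≤ 0.49, (m u * (-u.re * (1 / ‖u‖ ^ 2 - 1 / r ^ 2))) ≤ 51.1 + Real.log N / 2 := by
      have h2 : (deriv riemannZeta s₀ / riemannZeta s₀).re ≤ 50 := by
        refine (re_le_norm _).trans (hL0.trans ?_); norm_num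
      refine le_trans (Finset.sum_le_sum_of_subset_of_nonneg (Finset.filter_subset _ _) ?_) (hsum.trans ?_)
      · intro u hu _
        have := hS u hu
        exact mul_nonneg (Nat.cast_nonneg _) (blaschke_term_nonneg this.1 (by norm_num at this ⊢; linarith [this.2.2.1]))
      · norm_num at h2 ⊢; linarith
    refine le_trans (norm_sum_le_of_le (f := fun u ↦ (m u : ℂ) * (1 / (-(β:ℂ) - u) - 1 / (0 - u))) _ (n := fun u ↦ 0.026 / δ * (1.325 * (m u * (-u.re * (1 / ‖u‖ ^ 2 - 1 / r ^ 2))))) ?_) ?_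
    · intro u hu
      obtain ⟨huS, hu49⟩ := Finset.mem_filter.1 hu
      have hx := hzre u huS
      have h3 := norm_inv_sub_inv_le (u := u) (β := β) (δ := δ) (x := -u.re) (β₁ := 0.026) (by ring) hδ hβ0 hβ1
        (by norm_num at *; linarith)
      have hun : 0 < ‖u‖ := norm_pos_iff.2 (hu0 u huS)
      have h4 : 1 / ‖u‖ ^ 2 ≤ 1.325 * (1 / ‖u‖ ^ 2 - 1 / r ^ 2) := by
        have h5 : 1 / r ^ 2 ≤ 1 / 0.99 ^ 2 := one_div_le_one_div_of_le (by norm_num) (by gcongr)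
        have h6 : 1 / 0.49 ^ 2 ≤ 1 / ‖u‖ ^ 2 := one_div_le_one_div_of_le (by positivity) (by gcongr)
        norm_num at h5 h6 ⊢
        linarith
      rw [norm_mul, norm_natCast]
      have hxp : 0 ≤ -u.re := by norm_num at *; linarith
      have hN1 : 0 < Real.log N := by norm_num at hlN; linarith
      calc (m u : ℝ) * ‖1 / (-(β:ℂ) - u) - 1 / (0 - u)‖ ≤ m u * (0.026 / δ * (-u.re * (1 / ‖u‖ ^ 2))) := by gcongr
        _ ≤ m u * (0.026 / δ * (-u.re * (1.325 * (1 / ‖u‖ ^ 2 - 1 / r ^ 2)))) := by gcongr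
        _ = _ := by ring
    · rw [← Finset.mul_sum, ← Finset.mul_sum]
      gcongr
  have hfin : ∀ X Y Z : ℂ, ‖X‖ ≤ ‖Y‖ + ‖Z‖ + ‖X - Y - Z‖ := by
    intro X Y Z
    have : X = Y + Z + (X - Y - Z) := by ring
    calc ‖X‖ = ‖Y + Z + (X - Y - Z)‖ := by rw [← this]
      _ ≤ _ := norm_add₃_le
  refine le_trans (hfin _ _ _) (add_le_add (add_le_add (hL0.trans ?_) hS1) hkey)
  norm_num

lemma riemannZeta_eq_zero_of_riemannZeta₁_eq_zero {s : ℂ} (hs : s ≠ 1) (h : riemannZeta₁ s = 0) : riemannZeta s = 0 := by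
  rw [riemannZeta_eq_inv_sub_mul hs, h, mul_zero]

lemma norm_logDeriv_riemannZeta₁_le {N : ℕ} (hN : 1000 ≤ N) {σ t δ : ℝ} (ht2 : |t| + 3 ≤ 3 * N)
    (hδ : 0 < δ) (h : 1 - σ + δ ≤ 0.3508 / (6.5 * Real.log N + 16.5)) (hσ : σ ≤ 1.01) :
    riemannZeta₁ ⟨σ, t⟩ ≠ 0 ∧ ‖deriv riemannZeta₁ ⟨σ, t⟩ / riemannZeta₁ ⟨σ, t⟩‖ ≤
      51 + 0.026 / δ * (1.325 * (51.1 + Real.log N / 2)) + 15 * (Real.log N + 4.55) := by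
  have hN0 : (1000:ℝ) ≤ N := by exact_mod_cast hN
  have hlN : 6.83 < Real.log N := log_thousand_gt.trans_le (Real.log_le_log (by norm_num) hN0)
  have hb₀1 : 0.3508 / (6.5 * Real.log N + 16.5) ≤ 0.0058 := by
    rw [div_le_iff₀ (by linarith)]; norm_num at hlN ⊢; linarith
  rcases le_total 3 |t| with ht | ht
  · have hs1 : (⟨σ, t⟩ : ℂ) ≠ 1 := by
      intro h
      have := congrArg im h
      simp at this
      rw [this] at ht; norm_num at ht
    have hz : riemannZeta ⟨σ, t⟩ ≠ 0 :=
      riemannZeta_ne_zero_of_near_one hN (s := ⟨σ, t⟩) (by simp; linarith) (by simp; linarith) hs1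
    refine ⟨fun h ↦ hz (riemannZeta_eq_zero_of_riemannZeta₁_eq_zero hs1 h), ?_⟩
    have h1 := norm_logDeriv_riemannZeta_le hN ht ht2 hδ h (by linarith)
    have h2 := logDeriv_riemannZeta_eq hs1 hz
    rw [eq_comm, ← eq_sub_iff_add_eq', sub_neg_eq_add] at h2
    rw [h2]
    have h3 : ‖((⟨σ, t⟩ : ℂ) - 1)⁻¹‖ ≤ 1 := by
      rw [norm_inv]
      apply inv_le_one_of_one_le₀
      refine le_trans ?_ (abs_im_le_norm _)
      simp; linarith
    refine (norm_add_le _ _).trans ?_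
    linarith
  · have h1 := le_norm_riemannZeta₁ (s := ⟨σ, t⟩) (by norm_num at *; linarith) hσ ht
    have h2 := norm_deriv_riemannZeta₁_le (s := ⟨σ, t⟩) (by norm_num at *; linarith) hσ ht
    have h0 : 0 < ‖riemannZeta₁ ⟨σ, t⟩‖ := by norm_num at h1; linarith
    refine ⟨norm_pos_iff.1 h0, ?_⟩
    rw [norm_div, div_le_iff₀ h0]
    have h3 : 115 ≤ 0.026 / δ * (1.325 * (51.1 + Real.log N / 2)) := by
      have h4 : 0.026 / 0.0158 ≤ 0.026 / δ := by
        apply div_le_div_of_nonneg_left (by norm_num) hδ; norm_num at *; linarith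
      have h5 : (1.325 * 54.5 : ℝ) ≤ 1.325 * (51.1 + Real.log N / 2) := by norm_num at *; linarith
      refine le_trans ?_ (mul_le_mul h4 h5 (by norm_num) (by positivity))
      norm_num
    have h4 : 300 ≤ 51 + 0.026 / δ * (1.325 * (51.1 + Real.log N / 2)) + 15 * (Real.log N + 4.55) := by
      norm_num at *; linarith
    refine h2.trans ?_
    norm_num at h1 h4 ⊢
    nlinarith

end

section

open Complex Filter Topology Metric MeasureTheory Set

/-- The relative error `ψ(eᵗ)e⁻ᵗ - 1` in the prime number theorem, on a logarithmic scale. -/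
noncomputable def psiErr (t : ℝ) : ℝ := Chebyshev.psi (Real.exp t) * Real.exp (-t) - 1

lemma abs_psiErr_le (t : ℝ) : |psiErr t| ≤ 5 := by
  have h1 := Chebyshev.psi_nonneg (Real.exp t)
  have h2 := Chebyshev.psi_le_const_mul_self (Real.exp_pos t).le
  have h3 : Real.log 4 ≤ 2 := by
    rw [show (4:ℝ) = 2 ^ 2 by norm_num, Real.log_pow]
    have := Real.log_two_lt_d9
    norm_num at this ⊢; linarith
  have h4 : 0 < Real.exp (-t) := Real.exp_pos _
  have h5 : Real.exp t * Real.exp (-t) = 1 := by rw [← Real.exp_add]; simp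
  have h6 : Chebyshev.psi (Real.exp t) * Real.exp (-t) ≤ 6 := by
    calc _ ≤ (Real.log 4 + 4) * Real.exp t * Real.exp (-t) := by gcongr
      _ = Real.log 4 + 4 := by rw [mul_assoc, h5, mul_one]
      _ ≤ 6 := by linarith
  have h7 := mul_nonneg h1 h4.le
  rw [abs_le, psiErr]
  constructor <;> linarith

lemma measurable_psiErr : Measurable psiErr := by
  have := Chebyshev.psi_mono.measurable
  unfold psiErr
  fun_prop

lemma neg_one_le_psiErr (t : ℝ) : -1 ≤ psiErr t := by
  have := mul_nonneg (Chebyshev.psi_nonneg (Real.exp t)) (Real.exp_pos (-t)).le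
  rw [psiErr]; linarith

lemma integrableOn_psiErr_mul_cexp {z : ℂ} (hz : 0 < z.re) :
    IntegrableOn (fun t : ℝ ↦ (psiErr t : ℂ) * cexp (-z * t)) (Ioi 0) := by
  refine (integrableOn_exp_mul_complex_Ioi (a := -z) (by simpa using hz) 0).bdd_mul (c := 5) ?_ ?_
  · exact (measurable_ofReal.comp measurable_psiErr).aestronglyMeasurable
  · filter_upwards with t
    rw [norm_real]; exact abs_psiErr_le t

lemma norm_integral_psiErr_le {z : ℂ} (hz : 0 < z.re) :
    ‖∫ t in Ioi (0:ℝ), (psiErr t : ℂ) * cexp (-z * t)‖ ≤ 5 / z.re := by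
  have h1 : IntegrableOn (fun t : ℝ ↦ Real.exp (-z.re * t)) (Ioi 0) := integrableOn_exp_mul_Ioi (by linarith) 0
  refine (norm_integral_le_of_norm_le (h1.const_mul 5) ?_).trans ?_
  · filter_upwards with t
    rw [norm_mul, norm_real, norm_exp]
    simp only [neg_mul, neg_re, re_mul_ofReal]
    gcongr
    exact abs_psiErr_le t
  · rw [integral_const_mul, integral_exp_mul_Ioi (by linarith)]
    simp [div_eq_mul_inv]

lemma integral_psi_eq {s : ℂ} (hs : 1 < s.re) :
    -deriv riemannZeta s / riemannZeta s = s * ∫ t in Ioi (1:ℝ), (Chebyshev.psi t : ℂ) * (t:ℂ) ^ (-(s + 1)) := by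
  rw [← ArithmeticFunction.LSeries_vonMangoldt_eq_deriv_riemannZeta_div hs,
    LSeries_eq_mul_integral_of_nonneg (fun n ↦ ArithmeticFunction.vonMangoldt n) zero_le_one hs ?_
      (fun _ ↦ ArithmeticFunction.vonMangoldt_nonneg)]
  · congr 1
    refine integral_congr_ae (Eventually.of_forall fun t ↦ ?_)
    simp only [Chebyshev.psi]
    push_cast
    rfl
  · refine Asymptotics.IsBigO.of_bound (Real.log 4 + 4) (Eventually.of_forall fun n ↦ ?_)
    have h := Chebyshev.psi_le_const_mul_self (Nat.cast_nonneg (α := ℝ) n)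
    have h0 := Chebyshev.psi_nonneg (n:ℝ)
    have e : Chebyshev.psi n = ∑ k ∈ Finset.Icc 1 n, ArithmeticFunction.vonMangoldt k := by
      rw [Chebyshev.psi, Nat.floor_natCast]; rfl
    rw [← e, Real.norm_of_nonneg h0, Real.rpow_one, Real.norm_of_nonneg (by positivity)]
    exact h

lemma integral_psiErr_eq {z : ℂ} (hz : 0 < z.re) :
    ∫ t in Ioi (0:ℝ), (psiErr t : ℂ) * cexp (-z * t) =
      (-1 - deriv riemannZeta₁ (1 + z) / riemannZeta₁ (1 + z)) / (1 + z) := by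
  have hz0 : z ≠ 0 := by rintro rfl; simp at hz
  have hs : 1 < (1 + z).re := by simpa using hz
  have h1z : 1 + z ≠ 0 := by intro h; rw [h] at hs; simp at hs; linarith
  have hne : 1 + z ≠ 1 := by simpa using hz0
  have hexp : ∀ t : ℝ, cexp (t:ℂ) ≠ 0 := fun t ↦ exp_ne_zero _
  have h1 := integral_psi_eq hs
  have h2 := integral_comp_exp_Ioi (fun t : ℝ ↦ (Chebyshev.psi t : ℂ) * (t:ℂ) ^ (-((1 + z) + 1))) 0
  rw [Real.exp_zero] at h2
  have h3 : ∀ t : ℝ, Real.exp t • ((Chebyshev.psi (Real.exp t) : ℂ) * ((Real.exp t : ℝ) : ℂ) ^ (-((1 + z) + 1))) =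
      (psiErr t : ℂ) * cexp (-z * t) + cexp (-z * t) := by
    intro t
    rw [real_smul, cpow_def_of_ne_zero (by simp), ← ofReal_log (Real.exp_pos t).le, Real.log_exp, psiErr]
    push_cast
    rw [show (t:ℂ) * (-((1 + z) + 1)) = -(t:ℂ) + -(t:ℂ) + -z * t by ring, Complex.exp_add, Complex.exp_add, sub_mul]
    have := exp_neg (t:ℂ)
    rw [this]
    field_simp [hexp t]
    ring
  rw [integral_congr_ae (Eventually.of_forall h3), integral_add (integrableOn_psiErr_mul_cexp hz)
    (integrableOn_exp_mul_complex_Ioi (a := -z) (by simpa using hz) 0), integral_exp_mul_complex_Ioi (by simpa using hz)] at h2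
  rw [← h2, neg_div, logDeriv_riemannZeta_eq hne (riemannZeta_ne_zero_of_one_le_re hs.le)] at h1
  rw [eq_div_iff h1z]
  have e : (1 + z - 1) = z := by ring
  rw [e] at h1
  simp only [ofReal_zero, mul_zero, Complex.exp_zero] at h1
  set J := ∫ t in Ioi (0:ℝ), (psiErr t : ℂ) * cexp (-z * t)
  have hzi : z⁻¹ * z = 1 := inv_mul_cancel₀ hz0
  rw [neg_div_neg_eq, one_div] at h1
  linear_combination -h1 - hzi

lemma integral_cexp_vertical {c v u : ℝ} (hv : 0 < v) :
    ∫ y : ℝ, cexp ((c + y * I) * u + v * (c + y * I) ^ 2 / 2) =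
      ((2 * Real.pi * ((√(2 * Real.pi * v))⁻¹ * Real.exp (-u ^ 2 / (2 * v))) : ℝ) : ℂ) := by
  have h := integral_cexp_quadratic (b := -(v / 2 : ℂ)) (by simpa using hv) (I * (v * c + u)) (v * c ^ 2 / 2 + c * u)
  have e : ∀ y : ℝ, cexp ((c + y * I) * u + v * (c + y * I) ^ 2 / 2) =
      cexp (-(v / 2 : ℂ) * y ^ 2 + I * (v * c + u) * y + (v * c ^ 2 / 2 + c * u)) := by
    intro y
    congr 1
    linear_combination (v * y ^ 2 / 2 : ℂ) * I_sq
  simp_rw [e]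
  rw [h]
  have hv' : (v:ℂ) ≠ 0 := ofReal_ne_zero.2 hv.ne'
  have e1 : (v * c ^ 2 / 2 + c * u - (I * (v * c + u)) ^ 2 / (4 * -(v / 2)) : ℂ) = ((-u ^ 2 / (2 * v) : ℝ) : ℂ) := by
    push_cast
    rw [mul_pow, I_sq]
    field_simp
    ring
  have e2 : (Real.pi / - -(v / 2) : ℂ) ^ (1 / 2 : ℂ) = ((2 * Real.pi * (√(2 * Real.pi * v))⁻¹ : ℝ) : ℂ) := by
    have h1 : (Real.pi / - -(v / 2) : ℂ) = ((Real.pi / (v / 2) : ℝ) : ℂ) := by push_cast; rw [neg_neg]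
    rw [h1, show (1 / 2 : ℂ) = ((1 / 2 : ℝ) : ℂ) by push_cast; rfl, ← ofReal_cpow (by positivity), ← Real.sqrt_eq_rpow]
    congr 1
    have hp := Real.pi_pos
    rw [← div_eq_mul_inv, eq_div_iff (by positivity), ← Real.sqrt_mul (by positivity)]
    rw [show Real.pi / (v / 2) * (2 * Real.pi * v) = (2 * Real.pi) ^ 2 by field_simp]
    exact Real.sqrt_sq (by positivity)
  rw [e1, e2, ← ofReal_exp, ← ofReal_mul, mul_assoc]

lemma integral_psiErr_gaussian {X c v : ℝ} (hc : 0 < c) (hv : 0 < v) :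
    ((2 * Real.pi * ∫ t in Ioi (0:ℝ), psiErr t * ((√(2 * Real.pi * v))⁻¹ * Real.exp (-(X - t) ^ 2 / (2 * v))) : ℝ) : ℂ) =
      ∫ y : ℝ, (∫ t in Ioi (0:ℝ), (psiErr t : ℂ) * cexp (-(c + y * I) * t)) * cexp ((c + y * I) * X + v * (c + y * I) ^ 2 / 2) := by
  rw [← MeasureTheory.integral_const_mul, ← integral_complex_ofReal]
  have e : ∀ t : ℝ, ((2 * Real.pi * (psiErr t * ((√(2 * Real.pi * v))⁻¹ * Real.exp (-(X - t) ^ 2 / (2 * v)))) : ℝ) : ℂ) =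
      ∫ y : ℝ, (psiErr t : ℂ) * cexp (-(c + y * I) * t) * cexp ((c + y * I) * X + v * (c + y * I) ^ 2 / 2) := by
    intro t
    rw [show 2 * Real.pi * (psiErr t * ((√(2 * Real.pi * v))⁻¹ * Real.exp (-(X - t) ^ 2 / (2 * v)))) =
      psiErr t * (2 * Real.pi * ((√(2 * Real.pi * v))⁻¹ * Real.exp (-(X - t) ^ 2 / (2 * v)))) by ring]
    rw [ofReal_mul, ← integral_cexp_vertical (c := c) hv, ← integral_const_mul]
    refine integral_congr_ae (Eventually.of_forall fun y ↦ ?_)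
    simp only
    rw [mul_assoc, ← Complex.exp_add]
    congr 2
    push_cast
    ring
  refine (integral_congr_ae (Eventually.of_forall e)).trans ?_
  rw [integral_integral_swap]
  · simp only [integral_mul_const]
  · have h1 : Integrable (fun t : ℝ ↦ (5 * Real.exp (-c * t))) (volume.restrict (Ioi 0)) :=
      (integrableOn_exp_mul_Ioi (by linarith) 0).const_mul 5
    have h2 : Integrable (fun y : ℝ ↦ ‖cexp ((c + y * I) * X + v * (c + y * I) ^ 2 / 2)‖) := by
      have := (integrable_cexp_quadratic (b := (v / 2 : ℂ)) (by simpa using hv) (I * (v * c + X)) (v * c ^ 2 / 2 + c * X)).norm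
      refine this.congr (Eventually.of_forall fun y ↦ ?_)
      simp only
      congr 2
      linear_combination (-v * y ^ 2 / 2 : ℂ) * I_sq
    refine (h1.mul_prod h2).mono' ?_ ?_
    · refine Measurable.aestronglyMeasurable ?_
      have := measurable_psiErr
      simp only [Function.uncurry_def]
      fun_prop
    · refine Eventually.of_forall fun ⟨t, y⟩ ↦ ?_
      simp only [Function.uncurry]
      rw [norm_mul, norm_mul, norm_real, norm_exp (-_ * _)]
      simp only [neg_mul, neg_re, add_re, ofReal_re, mul_re, I_re, I_im, ofReal_im]
      simp only [mul_zero, sub_zero, add_zero, zero_mul]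
      gcongr
      exact abs_psiErr_le t

lemma norm_cexp_gaussian (X v σ y : ℝ) :
    ‖cexp ((σ + y * I) * X + v * (σ + y * I) ^ 2 / 2)‖ = Real.exp (σ * X + v * σ ^ 2 / 2) * Real.exp (-(v / 2) * y ^ 2) := by
  rw [norm_exp, ← Real.exp_add]
  congr 1
  have : ((σ + y * I) * X + v * (σ + y * I) ^ 2 / 2 : ℂ) =
      ((σ * X + v * σ ^ 2 / 2 + -(v / 2) * y ^ 2 : ℝ) : ℂ) + ((y * X + v * σ * y : ℝ) : ℂ) * I := by
    push_cast
    linear_combination (v * y ^ 2 / 2 : ℂ) * I_sq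
  rw [this, add_re, ofReal_re, re_ofReal_mul, I_re, mul_zero, add_zero]

lemma norm_integral_sub_interval_le {f : ℝ → ℂ} {A v T : ℝ} (hf : Integrable f) (hA : 0 ≤ A) (hv : 0 < v) (hT : 0 ≤ T)
    (h : ∀ y, ‖f y‖ ≤ A * Real.exp (-(v / 2) * y ^ 2)) :
    ‖∫ y, f y‖ ≤ ‖∫ y in (-T)..T, f y‖ + A * Real.exp (-(0.45 * v * T ^ 2)) * √(20 * Real.pi / v) := by
  have h0 : Integrable (fun y : ℝ ↦ Real.exp (-(v / 20) * y ^ 2)) := integrable_exp_neg_mul_sq (by positivity)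
  have h1 : ‖∫ y in (Ioc (-T) T)ᶜ, f y‖ ≤ A * Real.exp (-(0.45 * v * T ^ 2)) * √(20 * Real.pi / v) := by
    have := norm_integral_le_of_norm_le (f := f) (μ := volume.restrict (Ioc (-T) T)ᶜ)
      (h0.restrict.const_mul (A * Real.exp (-(0.45 * v * T ^ 2)))) ?_
    · refine this.trans ?_
      rw [MeasureTheory.integral_const_mul]
      refine mul_le_mul_of_nonneg_left ?_ (by positivity)
      refine (setIntegral_le_integral h0 (Eventually.of_forall fun _ ↦ (Real.exp_pos _).le)).trans ?_
      rw [integral_gaussian]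
      apply Real.sqrt_le_sqrt
      apply le_of_eq
      field_simp
    · filter_upwards [ae_restrict_mem measurableSet_Ioc.compl] with y hy
      refine (h y).trans ?_
      rw [mul_assoc, ← Real.exp_add]
      gcongr
      have : T ^ 2 ≤ y ^ 2 := by
        rw [mem_compl_iff, mem_Ioc, not_and_or, not_lt, not_le] at hy
        rcases hy with hy | hy <;> nlinarith
      nlinarith
  rw [intervalIntegral.integral_of_le (by linarith), ← integral_add_compl measurableSet_Ioc hf]
  exact (norm_add_le _ _).trans (add_le_add_right h1 _)

lemma integral_inv_add_abs_le {a T : ℝ} (ha : 0 < a) (hT : 0 ≤ T) :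
    ∫ y in (-T)..T, (a + |y|)⁻¹ = 2 * Real.log (1 + T / a) := by
  have hc : Continuous fun y : ℝ ↦ (a + |y|)⁻¹ := by
    refine Continuous.inv₀ (by fun_prop) fun y ↦ by positivity
  rw [← intervalIntegral.integral_add_adjacent_intervals (b := 0) (hc.intervalIntegrable _ _) (hc.intervalIntegrable _ _)]
  have h1 : ∫ y in (0:ℝ)..T, (a + |y|)⁻¹ = Real.log (1 + T / a) := by
    have : ∫ y in (0:ℝ)..T, (a + |y|)⁻¹ = ∫ y in (0:ℝ)..T, (a + y)⁻¹ := by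
      refine intervalIntegral.integral_congr fun y hy ↦ ?_
      rw [uIcc_of_le hT] at hy
      simp only [abs_of_nonneg hy.1]
    rw [this, intervalIntegral.integral_comp_add_left (fun x ↦ x⁻¹), integral_inv_of_pos (by linarith) (by linarith)]
    congr 1
    field_simp
    ring
  have h2 : ∫ y in (-T)..0, (a + |y|)⁻¹ = ∫ y in (0:ℝ)..T, (a + |y|)⁻¹ := by
    have := intervalIntegral.integral_comp_neg (a := 0) (b := T) (fun y : ℝ ↦ (a + |y|)⁻¹)
    rw [neg_zero] at this
    rw [← this]
    simp
  rw [h2, h1]; ring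

lemma two_pi_abs_integral_psiErr_le {X b c v T M E : ℝ} (hb : 0 < b) (hb1 : b < 1) (hc : 0 < c) (hv : 0 < v) (hT : 0 < T)
    (hM : ∀ σ y : ℝ, -b ≤ σ → σ ≤ c → |y| ≤ T → riemannZeta₁ (1 + (σ + y * I)) ≠ 0 ∧
      ‖-1 - deriv riemannZeta₁ (1 + (σ + y * I)) / riemannZeta₁ (1 + (σ + y * I))‖ ≤ M)
    (hE : ∀ σ : ℝ, -b ≤ σ → σ ≤ c → σ * X + v * σ ^ 2 / 2 ≤ E) :
    2 * Real.pi * |∫ t in Ioi (0:ℝ), psiErr t * ((√(2 * Real.pi * v))⁻¹ * Real.exp (-(X - t) ^ 2 / (2 * v)))| ≤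
      5 / c * Real.exp E * Real.exp (-(0.45 * v * T ^ 2)) * √(20 * Real.pi / v) +
      2 * (b + c) * (M / T * Real.exp (E - v * T ^ 2 / 2)) +
      Real.exp (-b * X + v * b ^ 2 / 2) * (√2 * M) * (2 * Real.log (1 + T / (1 - b))) := by
  set G : ℂ → ℂ := fun z ↦ (-1 - deriv riemannZeta₁ (1 + z) / riemannZeta₁ (1 + z)) / (1 + z) with hG
  set W : ℂ → ℂ := fun z ↦ G z * cexp (z * X + v * z ^ 2 / 2) with hW
  have hM0 : 0 ≤ M := (norm_nonneg _).trans (hM 0 0 (by linarith) hc.le (by simpa using hT.le)).2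
  have hre : ∀ σ y : ℝ, (1 + (σ + y * I)).re = 1 + σ := by intro σ y; simp
  have him : ∀ σ y : ℝ, (1 + (σ + y * I)).im = y := by intro σ y; simp
  have hdiff : DifferentiableOn ℂ W (uIcc (-b) c ×ℂ uIcc (-T) T) := by
    intro z hz
    rw [mem_reProdIm, uIcc_of_le (by linarith), uIcc_of_le (by linarith)] at hz
    have h0 := (hM z.re z.im hz.1.1 hz.1.2 (abs_le.2 hz.2)).1
    rw [re_add_im] at h0
    have h1 : (1 + z) ≠ 0 := by
      intro h
      have := congrArg re h
      simp only [add_re, one_re, zero_re] at this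
      linarith [hz.1.1]
    have h2 : DifferentiableAt ℂ (fun z ↦ riemannZeta₁ (1 + z)) z :=
      (differentiable_riemannZeta₁ _).comp z (by fun_prop)
    have h3 : DifferentiableAt ℂ (fun z ↦ deriv riemannZeta₁ (1 + z)) z :=
      ((differentiable_riemannZeta₁.deriv) _).comp z (by fun_prop)
    refine DifferentiableAt.differentiableWithinAt ?_
    exact (((h3.div h2 h0).const_sub _).div (by fun_prop) h1).mul (by fun_prop)
  have hrect := integral_boundary_rect_eq_zero_of_differentiableOn W (-b + (-T : ℝ) * I) (c + T * I) (by simpa using hdiff)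
  have hWn : ∀ σ y : ℝ, -b ≤ σ → σ ≤ c → |y| ≤ T → ‖W (σ + y * I)‖ ≤
      M / ‖(1 + (σ + y * I) : ℂ)‖ * (Real.exp (σ * X + v * σ ^ 2 / 2) * Real.exp (-(v / 2) * y ^ 2)) := by
    intro σ y h1 h2 h3
    rw [hW, norm_mul, norm_cexp_gaussian, hG, norm_div]
    gcongr
    exact (hM σ y h1 h2 h3).2
  have hhor : ∀ y : ℝ, |y| = T → ‖∫ x : ℝ in (-b)..c, W (x + y * I)‖ ≤ (b + c) * (M / T * Real.exp (E - v * T ^ 2 / 2)) := by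
    intro y hy
    have := intervalIntegral.norm_integral_le_of_norm_le_const (a := -b) (b := c) (f := fun x : ℝ ↦ W (x + y * I))
      (C := M / T * Real.exp (E - v * T ^ 2 / 2)) ?_
    · rw [abs_of_nonneg (by linarith)] at this
      linarith
    · intro x hx
      rw [uIoc_of_le (by linarith)] at hx
      refine (hWn x y hx.1.le hx.2 hy.le).trans ?_
      have h1 : T ≤ ‖(1 + (x + y * I) : ℂ)‖ := by
        have := abs_im_le_norm (1 + (x + y * I) : ℂ)
        rwa [him, hy] at this
      rw [← Real.exp_add]
      have := hE x hx.1.le hx.2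
      have h2 : y ^ 2 = T ^ 2 := by rw [← hy, sq_abs]
      gcongr
      rw [h2]; linarith
  have hleft : ‖∫ y : ℝ in (-T)..T, W ((-b : ℝ) + y * I)‖ ≤
      Real.exp (-b * X + v * b ^ 2 / 2) * (√2 * M) * (2 * Real.log (1 + T / (1 - b))) := by
    rw [← integral_inv_add_abs_le (sub_pos.2 hb1) hT.le, ← intervalIntegral.integral_const_mul]
    have hc : Continuous fun y : ℝ ↦ (1 - b + |y|)⁻¹ := by
      refine Continuous.inv₀ (by fun_prop) fun y ↦ ?_
      have := abs_nonneg y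
      linarith
    refine intervalIntegral.norm_integral_le_of_norm_le (by linarith) ?_ ((hc.const_mul _).intervalIntegrable _ _)
    refine Eventually.of_forall fun y hy ↦ ?_
    refine (hWn (-b) y le_rfl (by linarith) (abs_le.2 ⟨hy.1.le, hy.2⟩)).trans ?_
    have hy0 := abs_nonneg y
    have h1 : (1 - b + |y|) / √2 ≤ ‖(1 + ((-b : ℝ) + y * I) : ℂ)‖ := by
      rw [norm_eq_sqrt_sq_add_sq, hre, him]
      refine Real.le_sqrt_of_sq_le ?_
      rw [div_pow, Real.sq_sqrt (by norm_num), ← sq_abs y]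
      nlinarith [sq_nonneg (1 - b - |y|)]
    have h2 : M / ‖(1 + ((-b : ℝ) + y * I) : ℂ)‖ ≤ √2 * M * (1 - b + |y|)⁻¹ := by
      have h3 : 0 < 1 - b + |y| := by linarith
      refine (div_le_div_of_nonneg_left hM0 (by positivity) h1).trans (le_of_eq ?_)
      field_simp
    have h3 : Real.exp (-(v / 2) * y ^ 2) ≤ 1 := Real.exp_le_one_iff.2 (by nlinarith [sq_nonneg y])
    calc _ ≤ √2 * M * (1 - b + |y|)⁻¹ * (Real.exp (-b * X + v * b ^ 2 / 2) * 1) := by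
          rw [neg_sq]
          gcongr
      _ = _ := by ring
  have htail : ∀ y : ℝ, ‖W (c + y * I)‖ ≤ 5 / c * Real.exp E * Real.exp (-(v / 2) * y ^ 2) := by
    intro y
    rw [hW, norm_mul, norm_cexp_gaussian, ← mul_assoc]
    have hz : 0 < (c + y * I : ℂ).re := by simpa using hc
    have h1 := norm_integral_psiErr_le hz
    rw [integral_psiErr_eq hz] at h1
    rw [show (c + y * I : ℂ).re = c by simp] at h1
    have := hE c (by linarith) le_rfl
    gcongr
  have hInt : Integrable (fun y : ℝ ↦ W (c + y * I)) := by
    refine ((integrable_exp_neg_mul_sq (b := v / 2) (by positivity)).const_mul _).mono' ?_ (Eventually.of_forall htail)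
    have h1 : Measurable riemannZeta₁ := differentiable_riemannZeta₁.continuous.measurable
    have h2 : Measurable (deriv riemannZeta₁) := differentiable_riemannZeta₁.deriv.continuous.measurable
    have h3 : Measurable W := by simp only [hW, hG]; fun_prop
    exact (h3.comp (by fun_prop : Measurable fun y : ℝ ↦ (c + y * I : ℂ))).aestronglyMeasurable
  have hkey : ((2 * Real.pi * ∫ t in Ioi (0:ℝ), psiErr t * ((√(2 * Real.pi * v))⁻¹ * Real.exp (-(X - t) ^ 2 / (2 * v))) : ℝ) : ℂ) = ∫ y : ℝ, W (c + y * I) := by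
    rw [integral_psiErr_gaussian hc hv]
    refine integral_congr_ae (Eventually.of_forall fun y ↦ ?_)
    simp only [hW, hG]
    rw [integral_psiErr_eq (by simpa using hc)]
  have h1 := norm_integral_sub_interval_le hInt (by positivity) hv hT.le htail
  rw [← hkey, norm_real, Real.norm_eq_abs, abs_mul, abs_of_pos (by positivity)] at h1
  refine h1.trans ?_
  have h2 : ‖∫ y : ℝ in (-T)..T, W (c + y * I)‖ ≤ ‖∫ x : ℝ in (-b)..c, W (x + (-T : ℝ) * I)‖ + ‖∫ x : ℝ in (-b)..c, W (x + T * I)‖ +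
      ‖∫ y : ℝ in (-T)..T, W ((-b : ℝ) + y * I)‖ := by
    have e : I * (∫ y : ℝ in (-T)..T, W (c + y * I)) = -(∫ x : ℝ in (-b)..c, W (x + (-T : ℝ) * I)) + (∫ x : ℝ in (-b)..c, W (x + T * I)) +
      I * ∫ y : ℝ in (-T)..T, W ((-b : ℝ) + y * I) := by
      simp at hrect ⊢
      linear_combination hrect
    have := congrArg norm e
    rw [norm_mul, norm_I, one_mul] at this
    rw [this]
    refine (norm_add_le _ _).trans ?_
    rw [norm_mul, norm_I, one_mul]
    gcongr
    refine (norm_add_le _ _).trans ?_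
    rw [norm_neg]
  have h3 := hhor (-T) (by rw [abs_neg, abs_of_pos hT])
  have h4 := hhor T (abs_of_pos hT)
  linarith

lemma le_integral_psiErr_gaussian {L z τ : ℝ} (hL : 0 ≤ L) (hτ : 0 < τ) (hz : τ ≤ z) :
    (psiErr L + 1) * (1 - z * τ - Real.exp (-z ^ 2 / 2)) - 1 ≤
      ∫ t in Ioi (0:ℝ), psiErr t * ((√(2 * Real.pi * τ ^ 2))⁻¹ * Real.exp (-(L + z * τ - t) ^ 2 / (2 * τ ^ 2))) := by
  set r := psiErr L + 1 with hr
  have hr0 : 0 ≤ r := by linarith [neg_one_le_psiErr L]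
  set l := z / τ with hl
  have hl1 : 1 ≤ l := by rw [hl, le_div_iff₀ hτ]; linarith
  set v : NNReal := ⟨τ ^ 2, by positivity⟩ with hv
  have hv0 : v ≠ 0 := by
    intro h
    have := congrArg NNReal.toReal h
    exact (pow_pos hτ 2).ne' this
  have hvc : (v : ℝ) = τ ^ 2 := rfl
  set μ := L + z * τ with hμ
  set F : ℝ → ℝ := fun t ↦ r * (1 + L - t - Real.exp (l * L) * Real.exp (-l * t)) - 1 with hF
  have hpdf : ∀ t, (√(2 * Real.pi * τ ^ 2))⁻¹ * Real.exp (-(μ - t) ^ 2 / (2 * τ ^ 2)) = ProbabilityTheory.gaussianPDFReal μ v t := by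
    intro t
    rw [ProbabilityTheory.gaussianPDFReal, hvc]
    congr 3
    ring
  have i1 : Integrable (fun t : ℝ ↦ t) (ProbabilityTheory.gaussianReal μ v) :=
    (ProbabilityTheory.memLp_id_gaussianReal 1).integrable le_rfl
  have i2 : Integrable (fun t : ℝ ↦ Real.exp (-l * t)) (ProbabilityTheory.gaussianReal μ v) :=
    ProbabilityTheory.integrable_exp_mul_gaussianReal _
  have j1 : Integrable (fun t ↦ 1 + L - t) (ProbabilityTheory.gaussianReal μ v) := (integrable_const (μ := ProbabilityTheory.gaussianReal μ v) (1 + L)).sub i1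
  have j2 := i2.const_mul (Real.exp (l * L))
  have j3 : Integrable (fun t ↦ r * (1 + L - t - Real.exp (l * L) * Real.exp (-l * t))) (ProbabilityTheory.gaussianReal μ v) := (j1.sub j2).const_mul r
  have hFi : Integrable F (ProbabilityTheory.gaussianReal μ v) := by
    exact j3.sub (integrable_const 1)
  have hFint : ∫ t, F t ∂(ProbabilityTheory.gaussianReal μ v) = r * (1 - z * τ - Real.exp (-z ^ 2 / 2)) - 1 := by
    have h1 : ∫ t, t ∂(ProbabilityTheory.gaussianReal μ v) = μ := ProbabilityTheory.integral_id_gaussianReal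
    have h2 : ∫ t, Real.exp (-l * t) ∂(ProbabilityTheory.gaussianReal μ v) = Real.exp (μ * (-l) + v * (-l) ^ 2 / 2) := by
      have := congrFun (ProbabilityTheory.mgf_id_gaussianReal (μ := μ) (v := v)) (-l)
      simpa [ProbabilityTheory.mgf] using this
    simp only [hF]
    rw [integral_sub j3 (integrable_const 1), MeasureTheory.integral_const_mul, integral_sub j1 j2, integral_sub (integrable_const _) i1,
      MeasureTheory.integral_const_mul, h1, h2, ← Real.exp_add]
    simp only [integral_const, probReal_univ, one_smul]
    rw [show l * L + (μ * -l + v * (-l) ^ 2 / 2) = -z ^ 2 / 2 by rw [hvc, hμ, hl]; field_simp; ring]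
    rw [hμ]
    ring
  rw [← hFint, ProbabilityTheory.integral_gaussianReal_eq_integral_smul hv0]
  simp only [hpdf, smul_eq_mul]
  have hFi' : Integrable (fun t ↦ ProbabilityTheory.gaussianPDFReal μ v t * F t) := by
    rw [ProbabilityTheory.gaussianReal_of_var_ne_zero _ hv0] at hFi
    rw [integrable_withDensity_iff_integrable_smul' (ProbabilityTheory.measurable_gaussianPDF μ v) (Eventually.of_forall fun _ ↦ ENNReal.ofReal_lt_top)] at hFi
    simpa [ProbabilityTheory.toReal_gaussianPDF] using hFi
  have hq : ∀ t ≤ L, F t ≤ -1 := by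
    intro t ht
    simp only [hF]
    rw [← Real.exp_add]
    have := Real.add_one_le_exp (l * L + -l * t)
    have h2 : 1 + L - t - Real.exp (l * L + -l * t) ≤ 0 := by nlinarith
    nlinarith
  have hpos := ProbabilityTheory.gaussianPDFReal_nonneg μ v
  have hle : ∀ t, F t ≤ psiErr t := by
    intro t
    rcases le_total t L with h | h
    · exact (hq t h).trans (neg_one_le_psiErr t)
    · have h1 : 1 + L - t ≤ Real.exp (L - t) := by linarith [Real.add_one_le_exp (L - t)]
      have h2 : r * Real.exp (L - t) ≤ psiErr t + 1 := by
        rw [hr]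
        simp only [psiErr, sub_add_cancel]
        rw [mul_assoc, ← Real.exp_add, show -L + (L - t) = -t by ring]
        gcongr
      have h3 : 0 ≤ r * (Real.exp (l * L) * Real.exp (-l * t)) := by positivity
      simp only [hF]
      nlinarith [mul_le_mul_of_nonneg_left h1 hr0]
  rw [← integral_add_compl (measurableSet_Ioi (a := (0:ℝ))) hFi']
  have h1 : ∫ t in (Ioi (0:ℝ))ᶜ, ProbabilityTheory.gaussianPDFReal μ v t * F t ≤ 0 := by
    refine setIntegral_nonpos measurableSet_Ioi.compl fun t ht ↦ ?_
    rw [compl_Ioi, mem_Iic] at ht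
    have := hq t (ht.trans hL)
    nlinarith [hpos t]
  have h2 : ∫ t in Ioi (0:ℝ), ProbabilityTheory.gaussianPDFReal μ v t * F t ≤ ∫ t in Ioi (0:ℝ), psiErr t * ProbabilityTheory.gaussianPDFReal μ v t := by
    refine setIntegral_mono hFi'.integrableOn ?_ fun t ↦ ?_
    · refine ((ProbabilityTheory.integrable_gaussianPDFReal μ v).integrableOn).bdd_mul (c := 5) measurable_psiErr.aestronglyMeasurable ?_
      exact Eventually.of_forall abs_psiErr_le
    · rw [mul_comm]
      exact mul_le_mul_of_nonneg_right (hle t) (hpos t)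
  linarith

lemma log_le_div_eight {x : ℝ} (hx : 0 < x) : Real.log x ≤ 0.125 * x + 1.0795 := by
  have h1 := Real.log_le_sub_one_of_pos (show 0 < x / 8 by positivity)
  rw [Real.log_div hx.ne' (by norm_num), show (8:ℝ) = 2 ^ 3 by norm_num, Real.log_pow] at h1
  have := Real.log_two_lt_d9
  push_cast at h1
  linarith

lemma exp_eight_gt : 4395 < Real.exp 8.39 := by
  have h : Real.exp 8.39 = Real.exp 1 ^ 8 * Real.exp 0.39 := by
    rw [← Real.exp_nat_mul, ← Real.exp_add]; norm_num
  have h1 := Real.exp_one_gt_d9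
  have h2 : 1.4756 ≤ Real.exp 0.39 := by
    refine le_trans ?_ (Real.sum_le_exp_of_nonneg (by norm_num) 5)
    norm_num [Finset.sum_range_succ, Nat.factorial]
  rw [h]
  calc (4395:ℝ) < 2.7182818283 ^ 8 * 1.4756 := by norm_num
    _ ≤ _ := by gcongr

lemma exp_eight_lt : Real.exp 8.39 < 4407 := by
  have h : Real.exp 8.39 = Real.exp 1 ^ 8 * Real.exp 0.39 := by
    rw [← Real.exp_nat_mul, ← Real.exp_add]; norm_num
  have h1 := Real.exp_one_lt_d9
  have h2 : Real.exp 0.39 ≤ 1.477 := by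
    refine (Real.exp_bound' (by norm_num) (by norm_num) (n := 6) (by norm_num)).trans ?_
    norm_num [Finset.sum_range_succ, Nat.factorial]
  rw [h]
  calc _ ≤ (2.7182818286:ℝ) ^ 8 * 1.477 := by gcongr
    _ < 4407 := by norm_num

lemma logDeriv_bound_of_le {l : ℝ} (hl : 8.39 ≤ l) {σ y : ℝ} (hσ : -(0.33326 / (7.3125 * l + 16.565)) ≤ σ) (hσ1 : σ ≤ 0.01)
    (hy : |y| ≤ l * Real.exp l) : riemannZeta₁ (1 + (σ + y * I)) ≠ 0 ∧
      ‖-1 - deriv riemannZeta₁ (1 + (σ + y * I)) / riemannZeta₁ (1 + (σ + y * I))‖ ≤ 126 * l ^ 2 := by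
  set L := Real.exp l with hL
  set Q := 7.3125 * l + 16.565 with hQ
  have hL0 : 4395 < L := exp_eight_gt.trans_le (Real.exp_le_exp.2 hl)
  set N := ⌈l * L / 3 + 1⌉₊ with hN
  have hN1 : l * L / 3 + 1 ≤ N := Nat.le_ceil _
  have hN2 : (N:ℝ) < l * L / 3 + 1 + 1 := Nat.ceil_lt_add_one (by positivity)
  have hlL : 36800 ≤ l * L := by nlinarith
  have hN3 : (1000:ℝ) ≤ N := by linarith
  have hlog : Real.log N ≤ 1.125 * l + 0.01 := by
    have h1 : (N:ℝ) ≤ 0.34 * (l * L) := by linarith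
    have h2 := Real.log_le_log (by linarith) h1
    rw [Real.log_mul (by norm_num) (by positivity), Real.log_mul (by positivity) (by positivity), hL, Real.log_exp] at h2
    have h3 := log_le_div_eight (x := l) (by linarith)
    have h4 : Real.log 0.34 ≤ -1.07 := by
      rw [Real.log_le_iff_le_exp (by norm_num), Real.exp_neg, le_inv_comm₀ (by norm_num) (Real.exp_pos _)]
      refine (Real.exp_bound_div_one_sub_of_interval' (x := 0.07) (by norm_num) (by norm_num)).le |> fun h ↦ ?_
      rw [show (1.07:ℝ) = 1 + 0.07 by norm_num, Real.exp_add]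
      have h1 := Real.exp_one_lt_d9
      calc _ ≤ (2.7182818286:ℝ) * (1 / (1 - 0.07)) := by gcongr
        _ ≤ _ := by norm_num
    linarith
  have hQ0 : 0 < Q := by rw [hQ]; linarith
  have hlN0 : 0 < Real.log N := Real.log_pos (by linarith)
  obtain ⟨h1, h2⟩ := norm_logDeriv_riemannZeta₁_le (N := N) (by exact_mod_cast hN3) (σ := 1 + σ) (t := y) (δ := 0.01754 / Q)
    (by linarith) (by positivity) (by
      calc _ ≤ 0.33326 / Q + 0.01754 / Q := by linarith
        _ = 0.3508 / Q := by ring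
        _ ≤ _ := by
          apply div_le_div_of_nonneg_left (by norm_num) (by positivity)
          rw [hQ]; linarith) (by linarith)
  have e : (⟨1 + σ, y⟩ : ℂ) = 1 + (σ + y * I) := by
    apply Complex.ext <;> simp
  rw [e] at h1 h2
  refine ⟨h1, (norm_sub_le _ _).trans ?_⟩
  rw [norm_neg, norm_one]
  have h3 : 0.026 / (0.01754 / Q) ≤ 1.48233 * Q := by
    rw [div_div_eq_mul_div, div_le_iff₀ (by norm_num)]
    linarith
  have h4 : 0.026 / (0.01754 / Q) * (1.325 * (51.1 + Real.log N / 2)) ≤ 1.48233 * Q * (1.325 * (51.1 + (1.125 * l + 0.01) / 2)) := by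
    gcongr
  rw [hQ] at h4
  nlinarith

lemma cube_mul_exp_le {l : ℝ} (hl : 8.39 ≤ l) :
    l ^ 3 * Real.exp l * Real.exp (-(0.33326 / (7.3125 * l + 16.565) * Real.exp l)) ≤ 0.0181 := by
  obtain ⟨x, hx, rfl⟩ : ∃ x, 0 ≤ x ∧ l = 8.39 + x := ⟨l - 8.39, by linarith, by ring⟩
  have h1 : Real.exp (8.39 + x) = Real.exp 8.39 * Real.exp x := Real.exp_add _ _
  have h2 : 8.39 + x ≤ 8.39 * Real.exp (x / 8.39) := by
    have := Real.add_one_le_exp (x / 8.39)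
    have h : 8.39 * (x / 8.39) = x := by field_simp
    linarith
  have h3 : (8.39 + x) ^ 3 ≤ 8.39 ^ 3 * Real.exp (3 / 8.39 * x) := by
    calc _ ≤ (8.39 * Real.exp (x / 8.39)) ^ 3 := by gcongr
      _ = _ := by
        rw [mul_pow, ← Real.exp_nat_mul]
        congr 2
        push_cast; ring
  have h4 : 18.79 * (1 + 0.9 * x) ≤ 0.33326 / (7.3125 * (8.39 + x) + 16.565) * Real.exp (8.39 + x) := by
    have h5 := Real.quadratic_le_exp_of_nonneg hx
    rw [h1, div_mul_eq_mul_div, le_div_iff₀ (by positivity)]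
    have := exp_eight_gt
    calc _ ≤ 0.33326 * (4395 * (1 + x + x ^ 2 / 2)) := by nlinarith
      _ ≤ _ := by gcongr
  have h6 := exp_eight_lt
  calc _ ≤ (8.39 ^ 3 * Real.exp (3 / 8.39 * x)) * (4407 * Real.exp x) * Real.exp (-(18.79 * (1 + 0.9 * x))) := by
        rw [h1] at h4 ⊢
        gcongr
    _ = 8.39 ^ 3 * 4407 * (Real.exp (-18.79) * Real.exp ((3 / 8.39 + 1 - 18.79 * 0.9) * x)) := by
        rw [← Real.exp_add]
        have : Real.exp (3 / 8.39 * x) * Real.exp x * Real.exp (-(18.79 * (1 + 0.9 * x))) = Real.exp (-18.79 + (3 / 8.39 + 1 - 18.79 * 0.9) * x) := by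
          rw [← Real.exp_add, ← Real.exp_add]
          congr 1; ring
        rw [← this]; ring
    _ ≤ 8.39 ^ 3 * 4407 * (0.00000000695 * 1) := by
        gcongr
        · rw [Real.exp_neg, inv_le_comm₀ (Real.exp_pos _) (by norm_num)]
          have h : Real.exp 18.79 = Real.exp 1 ^ 18 * Real.exp 0.79 := by
            rw [← Real.exp_nat_mul, ← Real.exp_add]; norm_num
          have h1 := Real.exp_one_gt_d9
          have h2 : 2.2 ≤ Real.exp 0.79 := by
            refine le_trans ?_ (Real.sum_le_exp_of_nonneg (by norm_num) 6)
            norm_num [Finset.sum_range_succ, Nat.factorial]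
          rw [h]
          calc _ ≤ (2.718281828:ℝ) ^ 18 * 2.2 := by norm_num
            _ ≤ _ := by gcongr; linarith
        · rw [Real.exp_le_one_iff]
          nlinarith
    _ ≤ _ := by norm_num

lemma le_exp_div {l : ℝ} (hl : 8.39 ≤ l) : l ≤ Real.exp l / 500 := by
  have h := Real.add_one_le_exp (l - 8.39)
  have h1 : Real.exp l = Real.exp 8.39 * Real.exp (l - 8.39) := by rw [← Real.exp_add]; congr 1; ring
  have := exp_eight_gt
  have : 4395 * (l - 8.39 + 1) ≤ Real.exp l := by rw [h1]; gcongr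
  linarith

lemma sq_le_exp_div {l : ℝ} (hl : 8.39 ≤ l) : l ^ 2 ≤ Real.exp l / 60 := by
  have h := Real.quadratic_le_exp_of_nonneg (x := l - 8.39) (by linarith)
  have h1 : Real.exp l = Real.exp 8.39 * Real.exp (l - 8.39) := by rw [← Real.exp_add]; congr 1; ring
  have := exp_eight_gt
  have : 4395 * (1 + (l - 8.39) + (l - 8.39) ^ 2 / 2) ≤ Real.exp l := by rw [h1]; gcongr
  nlinarith

lemma vertical_tail_le {l : ℝ} (hl : 8.39 ≤ l) :
    5 / (Real.exp l)⁻¹ * Real.exp 1.01 * Real.exp (-(0.45 * (Real.exp l)⁻¹ ^ 2 * (l * Real.exp l) ^ 2)) *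
      √(20 * Real.pi / (Real.exp l)⁻¹ ^ 2) ≤ 0.2 / Real.exp l := by
  have hL0 := Real.exp_pos l
  have h1 : 0.45 * (Real.exp l)⁻¹ ^ 2 * (l * Real.exp l) ^ 2 = 0.45 * l ^ 2 := by field_simp
  have h2 : √(20 * Real.pi / (Real.exp l)⁻¹ ^ 2) ≤ 7.93 * Real.exp l := by
    refine Real.sqrt_le_iff.2 ⟨by positivity, ?_⟩
    rw [inv_pow, div_inv_eq_mul, mul_pow]
    gcongr
    linarith [Real.pi_lt_d4]
  have h3 : Real.exp 1.01 ≤ 2.75 := by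
    rw [show (1.01:ℝ) = 1 + 0.01 by norm_num, Real.exp_add]
    have h1 := Real.exp_one_lt_d9
    have h2 := (Real.exp_bound_div_one_sub_of_interval' (x := 0.01) (by norm_num) (by norm_num)).le
    calc _ ≤ (2.7182818286:ℝ) * (1 / (1 - 0.01)) := by gcongr
      _ ≤ _ := by norm_num
  rw [h1, le_div_iff₀ hL0, div_inv_eq_mul]
  calc _ ≤ 5 * Real.exp l * 2.75 * Real.exp (-(0.45 * l ^ 2)) * (7.93 * Real.exp l) * Real.exp l := by gcongr
    _ = 109.0375 * (Real.exp (3 * l) * Real.exp (-(0.45 * l ^ 2))) := by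
      rw [show 3 * l = l + l + l by ring, Real.exp_add, Real.exp_add]; ring
    _ ≤ 109.0375 * Real.exp (-6.5) := by
      rw [← Real.exp_add]
      gcongr
      nlinarith
    _ ≤ 109.0375 * 0.0016 := by
      gcongr
      rw [Real.exp_neg, inv_le_comm₀ (Real.exp_pos _) (by norm_num)]
      have h : Real.exp 6.5 = Real.exp 1 ^ 6 * Real.exp 0.5 := by
        rw [← Real.exp_nat_mul, ← Real.exp_add]; norm_num
      have h1 := Real.exp_one_gt_d9
      have h2 : 1.6 ≤ Real.exp 0.5 := by
        refine le_trans ?_ (Real.sum_le_exp_of_nonneg (by norm_num) 4)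
        norm_num [Finset.sum_range_succ, Nat.factorial]
      rw [h]
      calc _ ≤ (2.718:ℝ) ^ 6 * 1.6 := by norm_num
        _ ≤ _ := by gcongr; linarith
    _ ≤ _ := by norm_num

lemma horizontal_le {l a : ℝ} (hl : 8.39 ≤ l) (ha : a ≤ 0.0047) :
    2 * a * (126 * l ^ 2 / (l * Real.exp l) * Real.exp (1.01 - (Real.exp l)⁻¹ ^ 2 * (l * Real.exp l) ^ 2 / 2)) ≤
      0.01 / Real.exp l := by
  have hL0 := Real.exp_pos l
  have h1 : (Real.exp l)⁻¹ ^ 2 * (l * Real.exp l) ^ 2 = l ^ 2 := by field_simp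
  rw [h1, le_div_iff₀ hL0]
  have h2 : l ≤ Real.exp l := by linarith [Real.add_one_le_exp l]
  calc _ = 2 * a * 126 * l * Real.exp (1.01 - l ^ 2 / 2) := by field_simp
    _ ≤ 2 * 0.0047 * 126 * Real.exp l * Real.exp (1.01 - l ^ 2 / 2) := by gcongr
    _ = 2 * 0.0047 * 126 * Real.exp (l + (1.01 - l ^ 2 / 2)) := by rw [Real.exp_add l]; ring
    _ ≤ 2 * 0.0047 * 126 * Real.exp (-7) := by
      gcongr
      nlinarith
    _ ≤ 2 * 0.0047 * 126 * 0.002 := by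
      gcongr
      rw [Real.exp_neg, inv_le_comm₀ (Real.exp_pos _) (by norm_num), show (7:ℝ) = (7:ℕ) * 1 by norm_num, Real.exp_nat_mul]
      have h1 := Real.exp_one_gt_d9
      calc _ ≤ (2.5:ℝ) ^ 7 := by norm_num
        _ ≤ _ := by gcongr; linarith
    _ ≤ _ := by norm_num

lemma left_side_le {l z : ℝ} (hl : 8.39 ≤ l) (hz : 1 ≤ z) :
    Real.exp (-(0.33326 / (7.3125 * l + 16.565)) * (Real.exp l + z * (Real.exp l)⁻¹) +
      (Real.exp l)⁻¹ ^ 2 * (0.33326 / (7.3125 * l + 16.565)) ^ 2 / 2) * (√2 * (126 * l ^ 2)) *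
      (2 * Real.log (1 + l * Real.exp l / (1 - 0.33326 / (7.3125 * l + 16.565)))) ≤ 8.12 / Real.exp l := by
  have hL0 := Real.exp_pos l
  have hL1 : 4395 < Real.exp l := exp_eight_gt.trans_le (Real.exp_le_exp.2 hl)
  set b := 0.33326 / (7.3125 * l + 16.565) with hb
  have hb0 : 0 < b := by positivity
  have hb1 : b ≤ 0.0044 := by
    rw [hb, div_le_iff₀ (by linarith)]; linarith
  have hi0 : 0 < (Real.exp l)⁻¹ := by positivity
  have hi1 : (Real.exp l)⁻¹ ≤ 1 := by
    rw [inv_le_one₀ hL0]; linarith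
  have h1 : -b * (Real.exp l + z * (Real.exp l)⁻¹) + (Real.exp l)⁻¹ ^ 2 * b ^ 2 / 2 ≤ -(b * Real.exp l) := by
    have h2 : 0 ≤ b * (Real.exp l)⁻¹ * (z - (Real.exp l)⁻¹ * b / 2) := by
      have : (Real.exp l)⁻¹ * b ≤ 1 * 0.0044 := by gcongr
      have : 0 ≤ z - (Real.exp l)⁻¹ * b / 2 := by linarith
      positivity
    nlinarith
  have hlL : 36800 ≤ l * Real.exp l := by nlinarith
  have h2 : Real.log (1 + l * Real.exp l / (1 - b)) ≤ 1.255 * l := by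
    have h3 : 1 + l * Real.exp l / (1 - b) ≤ 1.005 * (l * Real.exp l) := by
      have : l * Real.exp l / (1 - b) ≤ 1.00443 * (l * Real.exp l) := by
        rw [div_le_iff₀ (by linarith)]
        nlinarith
      linarith
    have h4 : 0 ≤ l * Real.exp l / (1 - b) := div_nonneg (by positivity) (by linarith)
    have h5 := Real.log_le_log (by linarith) h3
    rw [Real.log_mul (by norm_num) (by positivity), Real.log_mul (by positivity) (by positivity), Real.log_exp] at h5
    have h6 := log_le_div_eight (x := l) (by linarith)
    have h7 := Real.log_le_sub_one_of_pos (show (0:ℝ) < 1.005 by norm_num)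
    linarith
  have h3 : √2 ≤ 1.4143 := Real.sqrt_le_iff.2 ⟨by norm_num, by norm_num⟩
  have h4 := cube_mul_exp_le hl
  rw [← hb] at h4
  rw [le_div_iff₀ hL0]
  calc _ ≤ Real.exp (-(b * Real.exp l)) * (1.4143 * (126 * l ^ 2)) * (2 * (1.255 * l)) * Real.exp l := by
          have h5 : 0 ≤ Real.log (1 + l * Real.exp l / (1 - b)) :=
            Real.log_nonneg (le_add_of_nonneg_right (div_nonneg (by positivity) (by linarith)))
          gcongr
    _ = 1.4143 * 126 * 2 * 1.255 * (l ^ 3 * Real.exp l * Real.exp (-(b * Real.exp l))) := by ring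
    _ ≤ 1.4143 * 126 * 2 * 1.255 * 0.0181 := by gcongr
    _ ≤ _ := by norm_num

lemma le_of_mul_le {l z r : ℝ} (hl : 8.39 ≤ l) (hs : z ≤ l - 4.2)
    (h : (r + 1) * (1 - z * (Real.exp l)⁻¹ - (Real.exp l)⁻¹) - 1 ≤ 1.35 / Real.exp l) : r ≤ (l - 1.1) / Real.exp l := by
  have hl2 := sq_le_exp_div hl
  have hl8 := le_exp_div hl
  set L := Real.exp l with hL
  have hL0 : 4395 < L := exp_eight_gt.trans_le (Real.exp_le_exp.2 hl)
  rw [le_div_iff₀ (by linarith)]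
  have hA : (r + 1) * (L - z - 1) ≤ L + 1.35 := by
    have h1 : (r + 1) * (1 - z * L⁻¹ - L⁻¹) * L = (r + 1) * (L - z - 1) := by field_simp
    have h2 : (1 + 1.35 / L) * L = L + 1.35 := by field_simp
    rw [← h1, ← h2]
    gcongr
    linarith
  by_contra hcon
  rw [not_le] at hcon
  have h1 : 0 < L - z - 1 := by linarith
  have h2 : (l - 1.1 + L) * (L - z - 1) ≤ (r + 1) * L * (L - z - 1) :=
    mul_le_mul_of_nonneg_right (by linarith) h1.le
  have h3 : (r + 1) * L * (L - z - 1) ≤ (L + 1.35) * L := by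
    calc _ = (r + 1) * (L - z - 1) * L := by ring
      _ ≤ _ := by gcongr
  have h4 : (l - 1.1) * (z + 1) ≤ l ^ 2 := by nlinarith
  nlinarith

theorem psiErr_exp_le {l : ℝ} (hl : 8.39 ≤ l) : psiErr (Real.exp l) ≤ (l - 1.1) / Real.exp l := by
  set L := Real.exp l with hL
  have hL0 : 4395 < L := exp_eight_gt.trans_le (Real.exp_le_exp.2 hl)
  set Q := 7.3125 * l + 16.565 with hQ
  have hQ0 : 77 ≤ Q := by rw [hQ]; linarith
  set z := √(2 * l) with hz
  have hz2 : z ^ 2 = 2 * l := Real.sq_sqrt (by linarith)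
  have hz1 : 4 ≤ z := Real.le_sqrt_of_sq_le (by linarith)
  have hzl : z ≤ l / 2 := Real.sqrt_le_iff.2 ⟨by linarith, by nlinarith⟩
  have hl8 : l ≤ L / 500 := le_exp_div hl
  have hb0 : 0 < 0.33326 / Q := by positivity
  have hb1 : 0.33326 / Q ≤ 0.0044 := by
    rw [div_le_iff₀ (by linarith)]; linarith
  have hL1 : L⁻¹ ≤ 0.0003 := by
    rw [inv_le_comm₀ (by linarith) (by norm_num)]; norm_num; linarith
  have hLi : L⁻¹ * L = 1 := inv_mul_cancel₀ (by linarith)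
  have hLi0 : 0 < L⁻¹ := by positivity
  have hE : ∀ σ : ℝ, -(0.33326 / Q) ≤ σ → σ ≤ L⁻¹ → σ * (L + z * L⁻¹) + (L⁻¹) ^ 2 * σ ^ 2 / 2 ≤ 1.01 := by
    intro σ h1 h2
    have h3 : σ * (L + z * L⁻¹) ≤ 1 + L⁻¹ := by
      have h5 : z * L⁻¹ ≤ 1 := by rw [← hLi, mul_comm]; gcongr; linarith
      have : σ * (L + z * L⁻¹) ≤ L⁻¹ * (L + z * L⁻¹) := by gcongr
      nlinarith
    have h4 : σ ^ 2 ≤ 1 := by nlinarith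
    nlinarith
  have key := two_pi_abs_integral_psiErr_le (X := L + z * L⁻¹) (b := 0.33326 / Q) (c := L⁻¹) (v := (L⁻¹) ^ 2) (T := l * L)
    (M := 126 * l ^ 2) (E := 1.01) hb0 (by linarith) hLi0 (by positivity) (by positivity)
    (fun σ y h1 h2 h3 ↦ logDeriv_bound_of_le hl h1 (by linarith) h3) hE
  have low := le_integral_psiErr_gaussian (L := L) (z := z) (τ := L⁻¹) (by linarith) hLi0 (by linarith)
  rw [show -z ^ 2 / 2 = -l by rw [neg_div, hz2]; ring, Real.exp_neg, ← hL] at low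
  have hvT : L⁻¹ ^ 2 * (l * L) ^ 2 = l ^ 2 := by field_simp
  have e1 := vertical_tail_le hl
  have e2 := horizontal_le hl (a := 0.33326 / Q + L⁻¹) (by linarith)
  have e3 := left_side_le hl (z := z) (by linarith)
  rw [← hL] at e1 e2 e3
  rw [← hQ] at e3
  have hη : |∫ t in Ioi (0:ℝ), psiErr t * ((√(2 * Real.pi * L⁻¹ ^ 2))⁻¹ * Real.exp (-(L + z * L⁻¹ - t) ^ 2 / (2 * L⁻¹ ^ 2)))| ≤ 1.35 / L := by
    have h1 := Real.pi_gt_d2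
    have h2 : 8.33 / L ≤ 6.2 * (1.35 / L) := by
      rw [← mul_div_assoc]; gcongr; norm_num
    have h3 : 0.2 / L + 0.01 / L + 8.12 / L = 8.33 / L := by ring
    have h4 := key.trans (add_le_add_three e1 e2 e3)
    rw [h3] at h4
    replace h4 := h4.trans h2
    by_contra hcon
    rw [not_le] at hcon
    have h5 : 0 < 1.35 / L := by positivity
    nlinarith
  have hη' := low.trans ((le_abs_self _).trans hη)
  exact le_of_mul_le hl (Real.sqrt_le_iff.2 ⟨by linarith, by nlinarith⟩) hη'

end

open Chebyshev in
lemma sum_psi_div (n : ℕ) : ∑ k ∈ Finset.Ioc 0 n, psi ((n / k : ℕ) : ℝ) = Real.log (n.factorial) := by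
  have h1 := ArithmeticFunction.sum_Ioc_mul_eq_sum_sum (R := ℝ) (ArithmeticFunction.zeta : ArithmeticFunction ℝ) ArithmeticFunction.vonMangoldt n
  have h2 : ((ArithmeticFunction.zeta : ArithmeticFunction ℝ) * ArithmeticFunction.vonMangoldt) = ArithmeticFunction.log := by
    rw [mul_comm]; exact ArithmeticFunction.vonMangoldt_mul_zeta
  rw [h2] at h1
  have h3 : ∑ k ∈ Finset.Ioc 0 n, (ArithmeticFunction.log k) = Real.log n.factorial := by
    induction n with
    | zero => simp
    | succ n ih =>
      have : ∀ m, ∑ k ∈ Finset.Ioc 0 m, (ArithmeticFunction.log k) = Real.log m.factorial := by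
        intro m
        induction m with
        | zero => simp
        | succ m ih =>
          rw [← Finset.insert_Ioc_right_eq_Ioc_add_one (by omega), Finset.sum_insert (by simp), ih, Nat.factorial_succ,
            ArithmeticFunction.log_apply, Nat.cast_mul, Real.log_mul (by positivity) (by positivity)]
      exact this _
  rw [← h3, h1]
  refine Finset.sum_congr rfl fun k hk ↦ ?_
  rw [Finset.mem_Ioc] at hk
  rw [ArithmeticFunction.natCoe_apply, ArithmeticFunction.zeta_apply_ne (by omega), Nat.cast_one, one_mul, psi,
    Nat.floor_natCast]

/-- The error term of the prime number theorem, cut off below `1`. -/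
noncomputable def psiRem (v : ℝ) : ℝ := if 1 ≤ v then Chebyshev.psi v - v else 0

lemma log_factorial_ge {n : ℕ} (hn : 1 ≤ n) : n * Real.log n - n ≤ Real.log n.factorial := by
  have h := Stirling.le_log_factorial_stirling (n := n) (by omega)
  have h1 : 0 ≤ Real.log n := Real.log_nonneg (by exact_mod_cast hn)
  have h2 : 0 ≤ Real.log (2 * Real.pi) := Real.log_nonneg (by linarith [Real.pi_gt_three])
  linarith

lemma log_factorial_le {n : ℕ} (hn : 1 ≤ n) :
    Real.log n.factorial ≤ n * Real.log n - n + Real.log n + 1 := by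
  induction n, hn using Nat.le_induction with
  | base => simp
  | succ n hn ih =>
    have hn0 : (0:ℝ) < n := by exact_mod_cast hn
    rw [Nat.factorial_succ, Nat.cast_mul, Real.log_mul (by positivity) (by positivity)]
    have h := Real.one_sub_inv_le_log_of_pos (x := ((n:ℝ)+1)/n) (by positivity)
    rw [Real.log_div (by positivity) (by positivity)] at h
    have e : 1 - (((n:ℝ)+1)/n)⁻¹ = 1 / (n+1) := by field_simp; ring
    rw [e, div_le_iff₀ (by positivity)] at h
    push_cast
    nlinarith

lemma floor_div_eq (t : ℝ) (k : ℕ) : ⌊t / k⌋₊ = ⌊t⌋₊ / k := Nat.floor_div_natCast t k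

lemma sum_psiRem_div {t : ℝ} (ht : 0 ≤ t) {K : ℕ} (hK : ⌊t⌋₊ ≤ K) :
    ∑ k ∈ Finset.Ioc 0 K, psiRem (t / k) =
      Real.log (⌊t⌋₊.factorial) - t * (harmonic ⌊t⌋₊ : ℝ) := by
  have h1 : ∑ k ∈ Finset.Ioc 0 K, psiRem (t / k) = ∑ k ∈ Finset.Ioc 0 ⌊t⌋₊, psiRem (t / k) := by
    symm
    apply Finset.sum_subset (Finset.Ioc_subset_Ioc_right hK)
    intro k hk hk2
    simp only [Finset.mem_Ioc] at hk hk2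
    have h3 : ⌊t⌋₊ < k := by omega
    have h4 := (Nat.floor_lt ht).mp h3
    have hk0 : (0:ℝ) < k := by exact_mod_cast hk.1
    rw [psiRem, if_neg]
    rw [not_le, div_lt_one hk0]; exact h4
  rw [h1, ← sum_psi_div, harmonic_eq_sum_Icc, Rat.cast_sum, Finset.mul_sum,
    show Finset.Icc 1 ⌊t⌋₊ = Finset.Ioc 0 ⌊t⌋₊ from rfl, ← Finset.sum_sub_distrib]
  refine Finset.sum_congr rfl fun k hk ↦ ?_
  rw [Finset.mem_Ioc] at hk
  have hk0 : (0:ℝ) < k := by exact_mod_cast hk.1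
  have h3 := (Nat.le_floor_iff ht).mp hk.2
  rw [psiRem, if_pos ((one_le_div hk0).mpr h3), Chebyshev.psi_eq_psi_coe_floor, floor_div_eq]
  push_cast
  rw [div_eq_mul_inv]

lemma abs_sum_psiRem_div_le {t : ℝ} (ht : 0 ≤ t) {K : ℕ} (hK : ⌊t⌋₊ ≤ K) :
    |∑ k ∈ Finset.Ioc 0 K, psiRem (t / k) + (1 + Real.eulerMascheroniConstant) * t| ≤
      2 + Real.log (t + 1) := by
  rw [sum_psiRem_div ht hK]
  have hg1 := Real.one_half_lt_eulerMascheroniConstant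
  have hg2 := Real.eulerMascheroniConstant_lt_two_thirds
  set γ := Real.eulerMascheroniConstant
  rcases lt_or_ge t 1 with h | h
  · have h0 : ⌊t⌋₊ = 0 := Nat.floor_eq_zero.mpr h
    have := Real.log_nonneg (show 1 ≤ t + 1 by linarith)
    rw [h0]
    simp only [Nat.factorial_zero, Nat.cast_one, Real.log_one, harmonic_zero, Rat.cast_zero, mul_zero, sub_zero, zero_add]
    rw [abs_of_nonneg (by positivity)]
    nlinarith
  · set n := ⌊t⌋₊ with hn
    have hn1 : 1 ≤ n := Nat.one_le_floor_iff t |>.mpr h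
    have hnt : (n:ℝ) ≤ t := Nat.floor_le ht
    have htn : t < n + 1 := Nat.lt_floor_add_one t
    have hn0 : (1:ℝ) ≤ n := by exact_mod_cast hn1
    have a1 := log_factorial_ge hn1
    have a2 := log_factorial_le hn1
    have b1 := Real.eulerMascheroniSeq_lt_eulerMascheroniConstant n
    have b2 := Real.eulerMascheroniConstant_lt_eulerMascheroniSeq' n
    rw [Real.eulerMascheroniSeq] at b1
    rw [Real.eulerMascheroniSeq', if_neg (by omega)] at b2
    have l0 : 0 ≤ Real.log n := Real.log_nonneg hn0
    have l1 : Real.log n ≤ Real.log (n + 1) := Real.log_le_log (by linarith) (by linarith)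
    have l2 : Real.log (n + 1) ≤ Real.log (t + 1) := Real.log_le_log (by linarith) (by linarith)
    have l3 := Real.log_le_sub_one_of_pos (x := ((n:ℝ)+1)/n) (by positivity)
    rw [Real.log_div (by positivity) (by positivity)] at l3
    have e : ((n:ℝ)+1)/n - 1 = 1 / n := by field_simp; ring
    rw [e, le_div_iff₀ (by positivity)] at l3
    set H := (harmonic n : ℝ)
    set a := Real.log n
    set b := Real.log (n + 1)
    set c := Real.log (n.factorial)
    rw [abs_le]
    constructor
    · have : t * H ≤ t * (b + γ) := by gcongr; linarith
      have : t * b ≤ (n+1) * b := by gcongr; linarith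
      nlinarith
    · have : t * (a + γ) ≤ t * H := by gcongr; linarith
      have : n * a ≤ t * a := by gcongr
      nlinarith

section

open MeasureTheory

lemma measurable_psiRem : Measurable psiRem := by
  unfold psiRem
  exact Measurable.ite measurableSet_Ici (Chebyshev.psi_mono.measurable.sub measurable_id) measurable_const

lemma abs_psiRem_le {v : ℝ} (hv : 0 ≤ v) : |psiRem v| ≤ 6 * v := by
  unfold psiRem
  split_ifs
  · have h1 := Chebyshev.psi_nonneg v
    have h2 := Chebyshev.psi_le_const_mul_self hv
    have h3 : Real.log 4 < 2 := by
      rw [show (4:ℝ) = 2 ^ 2 by norm_num, Real.log_pow]; push_cast; linarith [Real.log_two_lt_d9]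
    have : (Real.log 4 + 4) * v ≤ 6 * v := by gcongr; linarith
    rw [abs_le]; constructor <;> linarith
  · simpa using hv

lemma abs_psiRem_div_le (v : ℝ) : |psiRem v / v| ≤ 6 := by
  rcases lt_or_ge v 1 with h | h
  · rw [psiRem, if_neg (by linarith)]; simp
  · rw [abs_div, abs_of_pos (by linarith : 0 < v), div_le_iff₀ (by linarith)]
    exact abs_psiRem_le (by linarith)

lemma measurable_psiRem_div : Measurable (fun v ↦ psiRem v / v) := measurable_psiRem.div measurable_id

lemma integrableOn_psiRem_div_mul {s : Set ℝ} (hs : volume s ≠ ⊤) {f : ℝ → ℝ} (hf : Measurable f) {C : ℝ}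
    (hC : ∀ v, |f v| ≤ C) : IntegrableOn (fun v ↦ psiRem v / v * f v) s := by
  have h0 : 0 ≤ C := (abs_nonneg _).trans (hC 0)
  refine Measure.integrableOn_of_bounded (M := 6 * C) hs
    (measurable_psiRem_div.mul hf).aestronglyMeasurable (Filter.Eventually.of_forall fun v ↦ ?_)
  rw [norm_mul, Real.norm_eq_abs, Real.norm_eq_abs]
  exact mul_le_mul (abs_psiRem_div_le v) (hC v) (abs_nonneg _) (by norm_num)

/-- `∑ ν i ⌊n / d i⌋`. -/
def floorSum (s : Finset ℕ) (ν : ℕ → ℤ) (d : ℕ → ℕ) (n : ℕ) : ℤ := ∑ i ∈ s, ν i * ((n / d i : ℕ) : ℤ)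

lemma integral_psiRem_div_nat {x q : ℝ} (hx : 0 < x) (hq : 1 ≤ q) {m : ℕ} (hm : 0 < m) :
    ∫ t in x..q * x, psiRem (t / m) / t =
      ∫ v in Set.Ioc 0 (q * x), psiRem v / v * (Set.Ioc (x / m) (q * x / m)).indicator 1 v := by
  have hm0 : (0:ℝ) < m := by exact_mod_cast hm
  have h1 : ∀ t : ℝ, psiRem (t / m) / t = (fun v ↦ (m:ℝ)⁻¹ * (psiRem v / v)) (t / m) := by
    intro t
    simp only
    field_simp
  rw [intervalIntegral.integral_congr (fun t _ ↦ h1 t),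
    intervalIntegral.integral_comp_div (fun v ↦ (m:ℝ)⁻¹ * (psiRem v / v)) hm0.ne', smul_eq_mul, intervalIntegral.integral_const_mul,
    mul_inv_cancel_left₀ hm0.ne', intervalIntegral.integral_of_le (by gcongr; nlinarith)]
  have h2 : ∀ v, psiRem v / v * (Set.Ioc (x / m) (q * x / m)).indicator 1 v =
      (Set.Ioc (x / m) (q * x / m)).indicator (fun v ↦ psiRem v / v) v := by
    intro v
    by_cases h : v ∈ Set.Ioc (x / m) (q * x / m) <;> simp [h]
  simp_rw [h2]
  rw [setIntegral_indicator measurableSet_Ioc]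
  congr 2
  symm
  apply Set.inter_eq_right.mpr
  intro v hv
  refine ⟨(by positivity : 0 < x / m).trans hv.1, hv.2.trans ?_⟩
  apply div_le_self (by positivity)
  exact_mod_cast hm

lemma sum_indicator_eq {x y v : ℝ} (hx : 0 ≤ x) (hxy : x ≤ y) (hv : 0 < v) {d K : ℕ} (hd : 0 < d)
    (hK : ⌊y / v⌋₊ / d ≤ K) :
    ∑ k ∈ Finset.Ioc 0 K, (Set.Ioc (x / (d * k : ℕ)) (y / (d * k : ℕ))).indicator (1 : ℝ → ℝ) v =
      ((⌊y / v⌋₊ / d : ℕ) : ℝ) - ((⌊x / v⌋₊ / d : ℕ) : ℝ) := by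
  have hy : 0 ≤ y := hx.trans hxy
  have hle : ⌊x / v⌋₊ / d ≤ ⌊y / v⌋₊ / d := by gcongr
  have h1 : ∀ k ∈ Finset.Ioc 0 K, (Set.Ioc (x / (d * k : ℕ)) (y / (d * k : ℕ))).indicator (1 : ℝ → ℝ) v =
      if k ∈ Finset.Ioc (⌊x / v⌋₊ / d) (⌊y / v⌋₊ / d) then 1 else 0 := by
    intro k hk
    rw [Finset.mem_Ioc] at hk
    have hm : 0 < d * k := by have := hk.1; positivity
    have hm0 : (0:ℝ) < (d * k : ℕ) := by exact_mod_cast hm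
    rw [Set.indicator_apply]
    congr 1
    rw [Set.mem_Ioc, Finset.mem_Ioc, Nat.div_lt_iff_lt_mul hd, Nat.le_div_iff_mul_le hd, eq_iff_iff,
      Nat.floor_lt (by positivity), Nat.le_floor_iff (by positivity), div_lt_iff₀ hm0, le_div_iff₀ hm0,
      div_lt_iff₀ hv, le_div_iff₀ hv, mul_comm d k, mul_comm v]
  rw [Finset.sum_congr rfl h1, ← Finset.sum_filter, Finset.sum_const, nsmul_eq_mul, mul_one]
  have h2 : (Finset.Ioc 0 K).filter (· ∈ Finset.Ioc (⌊x / v⌋₊ / d) (⌊y / v⌋₊ / d)) =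
      Finset.Ioc (⌊x / v⌋₊ / d) (⌊y / v⌋₊ / d) := by
    ext k
    simp only [Finset.mem_filter, Finset.mem_Ioc]
    exact ⟨fun h ↦ h.2, fun h ↦ ⟨⟨(Nat.zero_le _).trans_lt h.1, h.2.trans hK⟩, h⟩⟩
  rw [h2, Nat.card_Ioc, Nat.cast_sub hle]

lemma integral_sum_psiRem_eq (s : Finset ℕ) (ν : ℕ → ℤ) (d : ℕ → ℕ) (hd : ∀ i ∈ s, 0 < d i)
    {x q : ℝ} (hx : 0 < x) (hq : 1 ≤ q) {K : ℕ} (hK : ⌊q * x⌋₊ ≤ K) :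
    ∫ t in x..q * x, (∑ i ∈ s, (ν i : ℝ) * ∑ k ∈ Finset.Ioc 0 K, psiRem (t / d i / k)) / t =
      ∫ v in Set.Ioc 0 (q * x), psiRem v / v *
        ((floorSum s ν d ⌊q * x / v⌋₊ - floorSum s ν d ⌊x / v⌋₊ : ℤ) : ℝ) := by
  have hxq : x ≤ q * x := by nlinarith
  have hII : ∀ m : ℕ, IntervalIntegrable (fun t ↦ psiRem (t / m) / t) volume x (q * x) := by
    intro m
    rw [intervalIntegrable_iff_integrableOn_Ioc_of_le hxq]
    refine Measure.integrableOn_of_bounded (M := 6) (by simp)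
      ((measurable_psiRem.comp (measurable_id.div_const _)).div measurable_id).aestronglyMeasurable ?_
    rw [ae_restrict_iff' measurableSet_Ioc]
    refine Filter.Eventually.of_forall fun t ht ↦ ?_
    have ht0 : 0 < t := hx.trans ht.1
    rw [Real.norm_eq_abs, abs_div, abs_of_pos ht0, div_le_iff₀ ht0]
    refine (abs_psiRem_le (by positivity)).trans ?_
    gcongr
    rcases Nat.eq_zero_or_pos m with rfl | hm
    · simp [ht0.le]
    · exact div_le_self ht0.le (by exact_mod_cast hm)
  have e1 : ∀ t : ℝ, (∑ i ∈ s, (ν i : ℝ) * ∑ k ∈ Finset.Ioc 0 K, psiRem (t / d i / k)) / t =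
      ∑ i ∈ s, ∑ k ∈ Finset.Ioc 0 K, (ν i : ℝ) * (psiRem (t / (d i * k : ℕ)) / t) := by
    intro t
    rw [Finset.sum_div]
    refine Finset.sum_congr rfl fun i _ ↦ ?_
    rw [mul_div_assoc, Finset.sum_div, Finset.mul_sum]
    refine Finset.sum_congr rfl fun k _ ↦ ?_
    rw [Nat.cast_mul, div_div]
  simp_rw [e1]
  rw [intervalIntegral.integral_finsetSum (f := fun i t ↦ ∑ k ∈ Finset.Ioc 0 K, (ν i : ℝ) * (psiRem (t / (d i * k : ℕ)) / t))
    (fun i _ ↦ by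
      simpa only [Finset.sum_fn] using IntervalIntegrable.sum (Finset.Ioc 0 K)
        (f := fun k t ↦ (ν i : ℝ) * (psiRem (t / (d i * k : ℕ)) / t)) (fun k _ ↦ (hII (d i * k)).const_mul (ν i : ℝ)))]
  simp_rw [intervalIntegral.integral_finsetSum (fun k _ ↦ (hII _).const_mul _), intervalIntegral.integral_const_mul]
  have hInt : ∀ m : ℕ, IntegrableOn (fun v ↦ psiRem v / v * (Set.Ioc (x / m) (q * x / m)).indicator 1 v)
      (Set.Ioc 0 (q * x)) := by
    intro m
    refine integrableOn_psiRem_div_mul (by simp) (measurable_one.indicator measurableSet_Ioc) (C := 1) fun v ↦ ?_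
    by_cases h : v ∈ Set.Ioc (x / m) (q * x / m) <;> simp [h]
  have e2 : ∀ i ∈ s, ∀ k ∈ Finset.Ioc 0 K, (ν i : ℝ) * ∫ t in x..q * x, psiRem (t / (d i * k : ℕ)) / t =
      (ν i : ℝ) * ∫ v in Set.Ioc 0 (q * x), psiRem v / v *
        (Set.Ioc (x / (d i * k : ℕ)) (q * x / (d i * k : ℕ))).indicator 1 v := by
    intro i hi k hk
    rw [integral_psiRem_div_nat hx hq (Nat.mul_pos (hd i hi) (Finset.mem_Ioc.mp hk).1)]
  rw [Finset.sum_congr rfl fun i hi ↦ Finset.sum_congr rfl (e2 i hi)]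
  simp_rw [← integral_const_mul]
  simp_rw [← integral_finsetSum (Finset.Ioc 0 K) (fun k _ ↦ (hInt _).const_mul _)]
  rw [← integral_finsetSum s (fun i _ ↦ integrable_finsetSum _ fun k _ ↦ (hInt _).const_mul _)]
  refine setIntegral_congr_fun measurableSet_Ioc fun v hv ↦ ?_
  rcases lt_or_ge v 1 with h | h
  · rw [psiRem, if_neg (by linarith)]; simp
  · have hv0 : 0 < v := by linarith
    simp only [floorSum, Int.cast_sub, Int.cast_sum, Int.cast_mul, Int.cast_natCast]
    rw [← Finset.sum_sub_distrib, Finset.mul_sum]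
    refine Finset.sum_congr rfl fun i hi ↦ ?_
    rw [← Finset.mul_sum, ← Finset.mul_sum, sum_indicator_eq hx.le hxq hv0 (hd i hi)]
    · ring
    · refine (Nat.div_le_self _ _).trans (le_trans ?_ hK)
      exact Nat.floor_le_floor (div_le_self (by positivity) h)

/-- The continuous periodic antiderivative of `fract - 1 / 2`. -/
noncomputable def sawInt (u : ℝ) : ℝ := (Int.fract u ^ 2 - Int.fract u) / 2

lemma continuous_sawInt : Continuous sawInt :=
  ContinuousOn.comp_fract'' (f := fun t : ℝ ↦ (t ^ 2 - t) / 2) (by fun_prop) (by norm_num)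

lemma sawInt_nonpos (u : ℝ) : sawInt u ≤ 0 := by
  have h1 := Int.fract_nonneg u
  have h2 := Int.fract_lt_one u
  unfold sawInt; nlinarith

lemma sawInt_ge (u : ℝ) : -1 / 8 ≤ sawInt u := by
  unfold sawInt; nlinarith [sq_nonneg (Int.fract u - 1 / 2)]

lemma hasDerivAt_sawInt {u : ℝ} (hu : u ∉ Set.range ((↑) : ℤ → ℝ)) :
    HasDerivAt sawInt (Int.fract u - 1 / 2) u := by
  have h1 : HasDerivAt (fun t : ℝ ↦ ((t - ⌊u⌋) ^ 2 - (t - ⌊u⌋)) / 2) (Int.fract u - 1 / 2) u := by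
    have := ((((hasDerivAt_id u).sub_const (⌊u⌋:ℝ)).pow 2).sub ((hasDerivAt_id u).sub_const (⌊u⌋:ℝ))).div_const 2
    refine this.congr_deriv ?_
    simp only [id, Nat.cast_ofNat, Nat.add_one_sub_one, pow_one, mul_one, ← Int.self_sub_floor]
    ring
  refine h1.congr_of_eventuallyEq ?_
  have h2 : (⌊u⌋:ℝ) < u := lt_of_le_of_ne (Int.floor_le u) fun h ↦ hu ⟨_, h⟩
  filter_upwards [Ioo_mem_nhds h2 (Int.lt_floor_add_one u)] with t ht
  have : ⌊t⌋ = ⌊u⌋ := Int.floor_eq_iff.mpr ⟨ht.1.le, ht.2⟩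
  rw [sawInt, Int.fract, this]

lemma abs_integral_saw_le {a b w : ℝ} (ha : 0 < a) (hab : a ≤ b) (hw : 0 < w) {ρ ρ' : ℝ → ℝ}
    (hρ : ∀ v, HasDerivAt ρ (ρ' v) v) (hc : Continuous ρ') (h0 : ∀ v, 0 < v → 0 ≤ ρ' v) (ha0 : 0 ≤ ρ a) :
    |∫ v in a..b, ρ v / v ^ 2 * (Int.fract (w / v) - 1 / 2)| ≤ ρ b / (8 * w) := by
  have hρc : Continuous ρ := continuous_iff_continuousAt.mpr fun v ↦ (hρ v).continuousAt
  have hdivc : ContinuousOn (fun v : ℝ ↦ w / v) (Set.Icc a b) :=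
    continuousOn_const.div continuousOn_id fun v hv ↦ (ha.trans_le hv.1).ne'
  have hPc : ContinuousOn (fun v ↦ ρ v * sawInt (w / v) / w) (Set.Icc a b) :=
    (hρc.continuousOn.mul (continuous_sawInt.comp_continuousOn hdivc)).div_const w
  have i1 : IntervalIntegrable (fun v ↦ ρ' v * sawInt (w / v) / w) volume a b :=
    ContinuousOn.intervalIntegrable_of_Icc hab
      ((hc.continuousOn.mul (continuous_sawInt.comp_continuousOn hdivc)).div_const w)
  have i2 : IntervalIntegrable (fun v ↦ ρ v / v ^ 2 * (Int.fract (w / v) - 1 / 2)) volume a b := by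
    have hb : IntervalIntegrable (fun v : ℝ ↦ Int.fract (w / v) - 1 / 2) volume a b := by
      rw [intervalIntegrable_iff_integrableOn_Ioc_of_le hab]
      refine Measure.integrableOn_of_bounded (M := 1) (by simp)
        ((measurable_fract.comp (measurable_const.div measurable_id)).sub_const _).aestronglyMeasurable
        (Filter.Eventually.of_forall fun v ↦ ?_)
      have h1 := Int.fract_nonneg (w / v)
      have h2 := Int.fract_lt_one (w / v)
      rw [Real.norm_eq_abs, abs_le]
      constructor <;> linarith
    refine hb.continuousOn_mul ?_
    rw [Set.uIcc_of_le hab]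
    exact hρc.continuousOn.div (by fun_prop) fun v hv ↦ by have := ha.trans_le hv.1; positivity
  have h1 := MeasureTheory.integral_eq_of_hasDerivAt_off_countable_of_le
    (fun v ↦ ρ v * sawInt (w / v) / w)
    (fun v ↦ ρ' v * sawInt (w / v) / w - ρ v / v ^ 2 * (Int.fract (w / v) - 1 / 2)) hab
    (s := Set.range fun n : ℤ ↦ w / n) (Set.countable_range _) hPc
    (fun v hv ↦ by
      have hv0 : 0 < v := ha.trans hv.1.1
      have hu : w / v ∉ Set.range ((↑) : ℤ → ℝ) := by
        rintro ⟨n, hn⟩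
        refine hv.2 ⟨n, ?_⟩
        simp only [hn]
        field_simp
      have hd : HasDerivAt (fun v : ℝ ↦ w / v) (-w / v ^ 2) v := by
        exact ((hasDerivAt_const v w).fun_div (hasDerivAt_id' v) hv0.ne').congr_deriv (by ring)
      refine (((hρ v).mul ((hasDerivAt_sawInt hu).comp v hd)).div_const w).congr_deriv ?_
      simp only [Function.comp]
      field_simp
      ring) (i1.sub i2)
  rw [intervalIntegral.integral_sub i1 i2] at h1
  have h2 : ∫ v in a..b, ρ' v * sawInt (w / v) / w ≤ 0 := by
    have := intervalIntegral.integral_mono_on hab i1 (intervalIntegrable_const (c := (0:ℝ))) fun v hv ↦ by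
      have := mul_nonneg (h0 v (ha.trans_le hv.1)) (neg_nonneg.mpr (sawInt_nonpos (w / v)))
      exact div_nonpos_of_nonpos_of_nonneg (by linarith) hw.le
    simpa using this
  have h3 : -(ρ b - ρ a) / (8 * w) ≤ ∫ v in a..b, ρ' v * sawInt (w / v) / w := by
    have e : ∫ v in a..b, ρ' v * (-1 / (8 * w)) = (ρ b - ρ a) * (-1 / (8 * w)) := by
      rw [intervalIntegral.integral_mul_const, intervalIntegral.integral_eq_sub_of_hasDerivAt (fun v _ ↦ hρ v)
        (hc.intervalIntegrable _ _)]
    have := intervalIntegral.integral_mono_on hab ((hc.mul continuous_const).intervalIntegrable a b) i1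
      (f := fun v ↦ ρ' v * (-1 / (8 * w))) fun v hv ↦ by
        rw [mul_div_assoc]
        refine mul_le_mul_of_nonneg_left ?_ (h0 v (ha.trans_le hv.1))
        rw [le_div_iff₀ hw]
        refine le_trans (le_of_eq ?_) (sawInt_ge _)
        field_simp
    rw [e] at this
    refine le_trans (le_of_eq ?_) this
    field_simp
  have hmono : ρ a ≤ ρ b := by
    have := intervalIntegral.integral_nonneg (μ := volume) hab fun v hv ↦ h0 v (ha.trans_le hv.1)
    rw [intervalIntegral.integral_eq_sub_of_hasDerivAt (fun v _ ↦ hρ v) (hc.intervalIntegrable _ _)] at this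
    linarith
  have hbd : ∀ v, 0 ≤ ρ v → -(ρ v / (8 * w)) ≤ ρ v * sawInt (w / v) / w ∧ ρ v * sawInt (w / v) / w ≤ 0 := by
    intro v hv
    have h5 := mul_le_mul_of_nonneg_left (sawInt_ge (w / v)) hv
    have h6 := mul_nonneg hv (neg_nonneg.mpr (sawInt_nonpos (w / v)))
    constructor
    · rw [le_div_iff₀ hw]
      refine le_trans (le_of_eq ?_) h5
      field_simp
    · exact div_nonpos_of_nonpos_of_nonneg (by linarith) hw.le
  have h4 := hbd a ha0
  have h5 := hbd b (ha0.trans hmono)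
  have e : -(ρ b - ρ a) / (8 * w) = -(ρ b / (8 * w)) + ρ a / (8 * w) := by ring
  rw [abs_le]
  constructor <;> linarith

lemma measurable_saw (w : ℝ) : Measurable (fun v : ℝ ↦ Int.fract (w / v) - 1 / 2) :=
  (measurable_fract.comp (measurable_const.div measurable_id)).sub_const _

lemma abs_saw_le (u : ℝ) : |Int.fract u - 1 / 2| ≤ 1 := by
  have h1 := Int.fract_nonneg u
  have h2 := Int.fract_lt_one u
  rw [abs_le]
  constructor <;> linarith

lemma intervalIntegrable_saw_div (w : ℝ) {a V : ℝ} (ha : 1 ≤ a) (haV : a ≤ V) :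
    IntervalIntegrable (fun v ↦ v / v ^ 2 * (Int.fract (w / v) - 1 / 2)) volume a V := by
  rw [intervalIntegrable_iff_integrableOn_Ioc_of_le haV]
  refine Measure.integrableOn_of_bounded (M := 1) (by simp)
    ((measurable_id.div (measurable_id.pow_const 2)).mul (measurable_saw w)).aestronglyMeasurable ?_
  rw [ae_restrict_iff' measurableSet_Ioc]
  refine Filter.Eventually.of_forall fun v hv ↦ ?_
  have hv0 : 0 < v := by linarith [hv.1]
  rw [norm_mul, Real.norm_eq_abs, Real.norm_eq_abs]
  refine mul_le_one₀ ?_ (abs_nonneg _) (abs_saw_le _)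
  simp only [abs_div, abs_pow]
  rw [abs_of_pos hv0, div_le_one (by positivity)]
  nlinarith [hv.1]

lemma psi_eq_sum_indicator {v V : ℝ} (hv : 0 ≤ v) (hV : v ≤ V) : Chebyshev.psi v =
    ∑ n ∈ Finset.Ioc 0 ⌊V⌋₊, ArithmeticFunction.vonMangoldt n * (Set.Ici (n:ℝ)).indicator (1 : ℝ → ℝ) v := by
  have hsub : Finset.Ioc 0 ⌊v⌋₊ ⊆ Finset.Ioc 0 ⌊V⌋₊ := Finset.Ioc_subset_Ioc_right (Nat.floor_le_floor hV)
  rw [Chebyshev.psi, ← Finset.sum_subset hsub]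
  · refine Finset.sum_congr rfl fun n hn ↦ ?_
    have : (n:ℝ) ≤ v := (Nat.le_floor_iff hv).mp (Finset.mem_Ioc.mp hn).2
    simp [this]
  · intro n hn hn2
    rw [Finset.mem_Ioc] at hn hn2
    have : v < n := (Nat.floor_lt hv).mp (by omega)
    simp [this]

lemma abs_integral_psi_saw_le {w V : ℝ} (hw : 0 < w) (hV : 1 ≤ V) :
    |∫ v in 1..V, Chebyshev.psi v * (v / v ^ 2 * (Int.fract (w / v) - 1 / 2))| ≤
      Chebyshev.psi V * (V / (8 * w)) := by
  set g : ℝ → ℝ := fun v ↦ v / v ^ 2 * (Int.fract (w / v) - 1 / 2) with hg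
  have hgi : IntegrableOn g (Set.Ioc 1 V) := by
    rw [← intervalIntegrable_iff_integrableOn_Ioc_of_le hV]
    exact intervalIntegrable_saw_div w le_rfl hV
  have e1 : ∫ v in 1..V, Chebyshev.psi v * g v = ∫ v in Set.Ioc 1 V, ∑ n ∈ Finset.Ioc 0 ⌊V⌋₊,
      ArithmeticFunction.vonMangoldt n * (Set.Ici (n:ℝ)).indicator g v := by
    rw [intervalIntegral.integral_of_le hV]
    refine setIntegral_congr_fun measurableSet_Ioc fun v hv ↦ ?_
    rw [psi_eq_sum_indicator (by linarith [hv.1]) hv.2, Finset.sum_mul]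
    refine Finset.sum_congr rfl fun n _ ↦ ?_
    by_cases h : v ∈ Set.Ici (n:ℝ) <;> simp [h]
  have e2 : ∀ n ∈ Finset.Ioc 0 ⌊V⌋₊, ∫ v in Set.Ioc 1 V,
      ArithmeticFunction.vonMangoldt n * (Set.Ici (n:ℝ)).indicator g v =
        ArithmeticFunction.vonMangoldt n * ∫ v in (n:ℝ)..V, g v := by
    intro n hn
    rw [Finset.mem_Ioc, Nat.le_floor_iff (by linarith)] at hn
    have hn1 : (1:ℝ) ≤ n := by exact_mod_cast hn.1
    rw [integral_const_mul, setIntegral_indicator measurableSet_Ici, intervalIntegral.integral_of_le hn.2]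
    congr 1
    apply setIntegral_congr_set
    have h1 : (Set.Ioc 1 V ∩ Set.Ici (n:ℝ) : Set ℝ) =ᵐ[volume] (Set.Ioc 1 V ∩ Set.Ioi (n:ℝ) : Set ℝ) :=
      (ae_eq_refl _).inter Ioi_ae_eq_Ici.symm
    have h2 : (Set.Ioc 1 V ∩ Set.Ioi (n:ℝ) : Set ℝ) = Set.Ioc (n:ℝ) V := by
      ext v
      simp only [Set.mem_inter_iff, Set.mem_Ioc, Set.mem_Ioi]
      exact ⟨fun h ↦ ⟨h.2, h.1.2⟩, fun h ↦ ⟨⟨hn1.trans_lt h.1, h.2⟩, h.1⟩⟩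
    rwa [h2] at h1
  rw [e1, integral_finsetSum _ fun n _ ↦ (hgi.indicator measurableSet_Ici).const_mul _, Finset.sum_congr rfl e2,
    Chebyshev.psi, Finset.sum_mul]
  refine (Finset.abs_sum_le_sum_abs _ _).trans (Finset.sum_le_sum fun n hn ↦ ?_)
  rw [Finset.mem_Ioc, Nat.le_floor_iff (by linarith)] at hn
  have hn0 : (0:ℝ) < n := by exact_mod_cast hn.1
  rw [abs_mul, abs_of_nonneg ArithmeticFunction.vonMangoldt_nonneg]
  refine mul_le_mul_of_nonneg_left ?_ ArithmeticFunction.vonMangoldt_nonneg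
  exact abs_integral_saw_le hn0 hn.2 hw (fun v ↦ hasDerivAt_id' v) continuous_const (fun _ _ ↦ zero_le_one) hn0.le

lemma intervalIntegrable_psiRem_saw (w : ℝ) {V : ℝ} (hV : 1 ≤ V) :
    IntervalIntegrable (fun v ↦ psiRem v / v * (Int.fract (w / v) - 1 / 2)) volume 1 V := by
  rw [intervalIntegrable_iff_integrableOn_Ioc_of_le hV]
  exact integrableOn_psiRem_div_mul (by simp) (measurable_saw w) fun v ↦ abs_saw_le _

lemma abs_integral_psiRem_saw_le {w V : ℝ} (hw : 0 < w) (hV : 1 ≤ V) :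
    |∫ v in 1..V, psiRem v / v * (Int.fract (w / v) - 1 / 2)| ≤ (Chebyshev.psi V + V) * (V / (8 * w)) := by
  have i2 : IntervalIntegrable (fun v ↦ v ^ 2 / v ^ 2 * (Int.fract (w / v) - 1 / 2)) volume 1 V := by
    rw [intervalIntegrable_iff_integrableOn_Ioc_of_le hV]
    refine Measure.integrableOn_of_bounded (M := 1) (by simp)
      (((measurable_id.pow_const 2).div (measurable_id.pow_const 2)).mul (measurable_saw w)).aestronglyMeasurable
      (Filter.Eventually.of_forall fun v ↦ ?_)
    rw [norm_mul, Real.norm_eq_abs, Real.norm_eq_abs]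
    refine mul_le_one₀ ?_ (abs_nonneg _) (abs_saw_le _)
    rw [abs_of_nonneg (by positivity : (0:ℝ) ≤ v ^ 2 / v ^ 2)]
    exact div_self_le_one _
  have e : ∀ v ∈ Set.uIcc 1 V, psiRem v / v * (Int.fract (w / v) - 1 / 2) =
      Chebyshev.psi v * (v / v ^ 2 * (Int.fract (w / v) - 1 / 2)) -
        v ^ 2 / v ^ 2 * (Int.fract (w / v) - 1 / 2) := by
    intro v hv
    rw [Set.uIcc_of_le hV] at hv
    have : 0 < v := by linarith [hv.1]
    rw [psiRem, if_pos hv.1]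
    field_simp
  have i1 : IntervalIntegrable (fun v ↦ Chebyshev.psi v * (v / v ^ 2 * (Int.fract (w / v) - 1 / 2))) volume 1 V := by
    have := (intervalIntegrable_psiRem_saw w hV).add i2
    refine this.congr fun v hv ↦ ?_
    rw [e v (Set.uIoc_subset_uIcc hv)]
    ring
  rw [intervalIntegral.integral_congr e, intervalIntegral.integral_sub i1 i2]
  have h1 := abs_integral_psi_saw_le hw hV
  have h2 := abs_integral_saw_le one_pos hV hw (ρ := fun v ↦ v ^ 2) (ρ' := fun v ↦ 2 * v)
    (fun v ↦ by simpa using hasDerivAt_pow 2 v) (by fun_prop) (fun v hv ↦ by positivity) (by norm_num)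
  refine (abs_sub _ _).trans ?_
  have e3 : (Chebyshev.psi V + V) * (V / (8 * w)) = Chebyshev.psi V * (V / (8 * w)) + V ^ 2 / (8 * w) := by ring
  rw [e3]
  exact add_le_add h1 h2

lemma integral_psiRem_eq {V : ℝ} (hV : 1 ≤ V) (G : ℝ → ℝ) :
    ∫ v in Set.Ioc 0 V, psiRem v / v * G v = ∫ v in 1..V, psiRem v / v * G v := by
  rw [intervalIntegral.integral_of_le hV]
  have h2 : Set.Ioc 1 V =ᵐ[volume] (Set.Icc 1 V : Set ℝ) := Ioc_ae_eq_Icc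
  rw [setIntegral_congr_set h2]
  apply setIntegral_eq_of_subset_of_forall_sdiff_eq_zero measurableSet_Ioc
  · intro v hv; exact ⟨by linarith [hv.1], hv.2⟩
  · intro v hv
    have : v < 1 := by
      by_contra h
      exact hv.2 ⟨not_lt.mp h, hv.1.2⟩
    rw [psiRem, if_neg (by linarith)]; simp

lemma natFloor_div_cast {u : ℝ} (hu : 0 ≤ u) (d : ℕ) :
    ((⌊u⌋₊ / d : ℕ) : ℝ) = u / d - Int.fract (u / d) := by
  rw [← floor_div_eq, Int.fract, ← natCast_floor_eq_intCast_floor (by positivity)]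
  ring

lemma floorSum_eq (s : Finset ℕ) (ν : ℕ → ℤ) (d : ℕ → ℕ) {u : ℝ} (hu : 0 ≤ u) :
    (floorSum s ν d ⌊u⌋₊ : ℝ) = u * ∑ i ∈ s, (ν i : ℝ) / d i - ∑ i ∈ s, (ν i : ℝ) * Int.fract (u / d i) := by
  rw [floorSum, Finset.mul_sum, ← Finset.sum_sub_distrib]
  simp only [Int.cast_sum, Int.cast_mul, Int.cast_natCast]
  refine Finset.sum_congr rfl fun i _ ↦ ?_
  rw [natFloor_div_cast hu (d i)]
  ring

lemma abs_integral_tail_le (s : Finset ℕ) (ν : ℕ → ℤ) (d : ℕ → ℕ) (hd : ∀ i ∈ s, 0 < d i)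
    {x q V : ℝ} (hx : 0 < x) (hq : 1 ≤ q) (hV : 1 ≤ V) :
    |∫ v in Set.Ioc 0 V, psiRem v / v * ((floorSum s ν d ⌊q * x / v⌋₊ - floorSum s ν d ⌊x / v⌋₊ : ℤ) : ℝ)| ≤
      6 * |∑ i ∈ s, (ν i : ℝ) / d i| * ((q - 1) * x) * Real.log V +
        (∑ i ∈ s, |(ν i : ℝ)| * d i) * ((Chebyshev.psi V + V) * V / (4 * x)) := by
  rw [integral_psiRem_eq hV]
  set η := ∑ i ∈ s, (ν i : ℝ) / d i with hη
  have e : ∀ v ∈ Set.uIcc 1 V, psiRem v / v *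
      ((floorSum s ν d ⌊q * x / v⌋₊ - floorSum s ν d ⌊x / v⌋₊ : ℤ) : ℝ) =
      psiRem v / v * ((q - 1) * x * η / v) + ∑ i ∈ s, ((ν i : ℝ) * (psiRem v / v * (Int.fract (x / d i / v) - 1 / 2)) -
        (ν i : ℝ) * (psiRem v / v * (Int.fract (q * x / d i / v) - 1 / 2))) := by
    intro v hv
    rw [Set.uIcc_of_le hV] at hv
    have hv0 : 0 < v := by linarith [hv.1]
    rw [Int.cast_sub, floorSum_eq s ν d (by positivity), floorSum_eq s ν d (by positivity), Finset.sum_sub_distrib,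
      ← Finset.sum_sub_distrib]
    have : ∀ i ∈ s, (ν i : ℝ) * (psiRem v / v * (Int.fract (x / d i / v) - 1 / 2)) -
        (ν i : ℝ) * (psiRem v / v * (Int.fract (q * x / d i / v) - 1 / 2)) =
        psiRem v / v * ((ν i : ℝ) * Int.fract (x / v / d i)) - psiRem v / v * ((ν i : ℝ) * Int.fract (q * x / v / d i)) := by
      intro i _
      rw [div_right_comm x, div_right_comm (q * x)]
      ring
    rw [Finset.sum_congr rfl this, Finset.sum_sub_distrib, ← Finset.mul_sum, ← Finset.mul_sum, ← hη]
    ring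
  have iη : IntervalIntegrable (fun v ↦ psiRem v / v * ((q - 1) * x * η / v)) volume 1 V := by
    have h := intervalIntegral.intervalIntegrable_inv (f := fun v : ℝ ↦ v) (μ := volume) (a := 1) (b := V)
      (fun v hv ↦ by rw [Set.uIcc_of_le hV] at hv; linarith [hv.1]) continuousOn_id
    rw [intervalIntegrable_iff_integrableOn_Ioc_of_le hV] at h ⊢
    exact Integrable.bdd_mul (c := 6) (h.const_mul ((q - 1) * x * η)) measurable_psiRem_div.aestronglyMeasurable
      (Filter.Eventually.of_forall fun v ↦ by rw [Real.norm_eq_abs]; exact abs_psiRem_div_le v)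
  have ii : ∀ i ∈ s, IntervalIntegrable (fun v ↦ (ν i : ℝ) * (psiRem v / v * (Int.fract (x / d i / v) - 1 / 2)) -
        (ν i : ℝ) * (psiRem v / v * (Int.fract (q * x / d i / v) - 1 / 2))) volume 1 V := fun i _ ↦
    ((intervalIntegrable_psiRem_saw _ hV).const_mul _).sub ((intervalIntegrable_psiRem_saw _ hV).const_mul _)
  rw [intervalIntegral.integral_congr e, intervalIntegral.integral_add iη
    (by simpa only [Finset.sum_fn] using IntervalIntegrable.sum s (fun i hi ↦ ii i hi)),
    intervalIntegral.integral_finsetSum ii]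
  refine (abs_add_le _ _).trans (add_le_add ?_ ?_)
  · have h := intervalIntegral.norm_integral_le_of_norm_le hV (g := fun v ↦ 6 * ((q - 1) * x * |η|) * v⁻¹)
      (f := fun v ↦ psiRem v / v * ((q - 1) * x * η / v)) (μ := volume) (Filter.Eventually.of_forall fun v hv ↦ by
        have hv0 : 0 < v := by linarith [hv.1]
        rw [norm_mul, Real.norm_eq_abs, Real.norm_eq_abs, abs_div (_ * _) v, abs_mul, abs_of_nonneg
          (mul_nonneg (by linarith) hx.le : 0 ≤ (q - 1) * x), abs_of_pos hv0]
        have hqx : 0 ≤ (q - 1) * x := mul_nonneg (by linarith) hx.le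
        refine (mul_le_mul_of_nonneg_right (abs_psiRem_div_le v)
          (div_nonneg (mul_nonneg hqx (abs_nonneg η)) hv0.le)).trans (le_of_eq (by rw [div_eq_mul_inv]; ring)))
      ((intervalIntegral.intervalIntegrable_inv (f := fun v : ℝ ↦ v)
        (fun v hv ↦ by rw [Set.uIcc_of_le hV] at hv; linarith [hv.1]) continuousOn_id).const_mul _)
    rw [intervalIntegral.integral_const_mul, integral_inv_of_pos one_pos (by linarith), div_one,
      Real.norm_eq_abs] at h
    refine h.trans (le_of_eq (by ring))
  · rw [Finset.sum_mul]
    refine (Finset.abs_sum_le_sum_abs _ _).trans (Finset.sum_le_sum fun i hi ↦ ?_)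
    have hdi : (0:ℝ) < d i := by exact_mod_cast hd i hi
    rw [intervalIntegral.integral_sub ((intervalIntegrable_psiRem_saw _ hV).const_mul _)
      ((intervalIntegrable_psiRem_saw _ hV).const_mul _), intervalIntegral.integral_const_mul,
      intervalIntegral.integral_const_mul, ← mul_sub, abs_mul, mul_assoc]
    refine mul_le_mul_of_nonneg_left ?_ (abs_nonneg _)
    have h1 := abs_integral_psiRem_saw_le (w := x / d i) (by positivity) hV
    have h2 := abs_integral_psiRem_saw_le (w := q * x / d i) (by positivity) hV
    have hp := Chebyshev.psi_nonneg V
    have h3 : (Chebyshev.psi V + V) * (V / (8 * (q * x / d i))) ≤ (Chebyshev.psi V + V) * (V / (8 * (x / d i))) := by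
      gcongr
      nlinarith
    refine (abs_sub _ _).trans ((add_le_add h1 (h2.trans h3)).trans (le_of_eq ?_))
    field_simp
    ring

/-- The contribution of the range `x / (i + 1) < v ≤ x / i` to the integral of
`|E ⌊(1 + 1 / M) x / v⌋ - E ⌊x / v⌋|`, bounded from above and divided by `x`. -/
noncomputable def cellWeight (E : ℕ → ℤ) (M i : ℕ) : ℝ :=
  ((((M - i % M : ℕ) : ℤ) * |E (i + i / M) - E i| + ((i % M + 1 : ℕ) : ℤ) * |E (i + i / M + 1) - E i| : ℤ) : ℝ) /
    ((M + 1) * i ^ 2)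

lemma cellWeight_nonneg (E : ℕ → ℤ) (M i : ℕ) : 0 ≤ cellWeight E M i := by
  unfold cellWeight
  exact div_nonneg (Int.cast_nonneg (by positivity)) (by positivity)

/-- The integrand of the smoothed identity. -/
noncomputable def remIntegrand (E : ℕ → ℤ) (q x v : ℝ) : ℝ :=
  psiRem v / v * ((E ⌊q * x / v⌋₊ - E ⌊x / v⌋₊ : ℤ) : ℝ)

lemma integrableOn_remIntegrand {E : ℕ → ℤ} {A : ℝ} (hE : ∀ n, |(E n : ℝ)| ≤ A * n) {q x : ℝ} (hq : 1 ≤ q)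
    (hx : 0 < x) : IntegrableOn (remIntegrand E q x) (Set.Ioc 0 (q * x)) := by
  have hA : 0 ≤ A := by have := (abs_nonneg _).trans (hE 1); simpa using this
  have hm : ∀ y : ℝ, Measurable fun v : ℝ ↦ ((E ⌊y / v⌋₊ : ℤ) : ℝ) := fun y ↦
    (measurable_from_nat (f := fun n ↦ ((E n : ℤ) : ℝ))).comp
      (Nat.measurable_floor.comp (measurable_const.div measurable_id))
  refine Measure.integrableOn_of_bounded (M := 6 * (2 * A * (q * x))) (by simp) ?_ ?_
  · unfold remIntegrand
    simp only [Int.cast_sub]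
    exact (measurable_psiRem_div.mul ((hm _).sub (hm _))).aestronglyMeasurable
  · rw [ae_restrict_iff' measurableSet_Ioc]
    refine Filter.Eventually.of_forall fun v hv ↦ ?_
    have hqx : 0 ≤ q * x := by positivity
    rcases lt_or_ge v 1 with h | h
    · rw [remIntegrand, psiRem, if_neg (by linarith)]
      simp only [zero_div, zero_mul, norm_zero]
      positivity
    · have hb : ∀ y : ℝ, 0 ≤ y → y ≤ q * x → |((E ⌊y / v⌋₊ : ℤ) : ℝ)| ≤ A * (q * x) := by
        intro y hy hyq
        refine (hE _).trans (mul_le_mul_of_nonneg_left ?_ hA)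
        exact (Nat.floor_le (by positivity)).trans ((div_le_self hy h).trans hyq)
      rw [remIntegrand, norm_mul, Real.norm_eq_abs, Real.norm_eq_abs, Int.cast_sub]
      refine mul_le_mul (abs_psiRem_div_le v) ?_ (abs_nonneg _) (by norm_num)
      refine (abs_sub _ _).trans ?_
      linarith [hb (q * x) hqx le_rfl, hb x hx.le (by nlinarith)]

lemma intervalIntegrable_remIntegrand {E : ℕ → ℤ} {A : ℝ} (hE : ∀ n, |(E n : ℝ)| ≤ A * n) {q x : ℝ} (hq : 1 ≤ q)
    (hx : 0 < x) {a b : ℝ} (ha : 0 ≤ a) (hab : a ≤ b) (hb : b ≤ q * x) :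
    IntervalIntegrable (remIntegrand E q x) volume a b := by
  rw [intervalIntegrable_iff_integrableOn_Ioc_of_le hab]
  exact (integrableOn_remIntegrand hE hq hx).mono_set (Set.Ioc_subset_Ioc ha hb)

lemma abs_integral_cell_le {E : ℕ → ℤ} {A : ℝ} (hE : ∀ n, |(E n : ℝ)| ≤ A * n) {M i : ℕ} (hM : 0 < M) (hi : 0 < i)
    {x ε : ℝ} (hx : 0 < x) (hε : ∀ v, x / (i + 1 : ℕ) < v → v ≤ x / i → |psiRem v / v| ≤ ε) :
    |∫ v in x / (i + 1 : ℕ)..x / i, remIntegrand E (1 + 1 / M) x v| ≤ ε * x * cellWeight E M i := by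
  have hM0 : (0:ℝ) < M := by exact_mod_cast hM
  have hi0 : (0:ℝ) < i := by exact_mod_cast hi
  set a := i / M with ha
  set r := i % M with hr
  have hir : i = M * a + r := (Nat.div_add_mod i M).symm
  have hrM : r < M := Nat.mod_lt i hM
  have hirR : (i:ℝ) = M * a + r := by exact_mod_cast hir
  have hrR : (r:ℝ) + 1 ≤ M := by exact_mod_cast hrM
  have hr0 : (0:ℝ) ≤ r := by positivity
  have ha0 : (0:ℝ) ≤ a := by positivity
  set c : ℝ := (1 + 1 / M) * x / (i + a + 1 : ℕ) with hc
  have hk : (M + 1) * (i:ℝ) ≤ M * (i + a + 1) := by nlinarith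
  have l1 : c - x / (i + 1 : ℕ) = x * (r + 1) / (M * (i + a + 1) * (i + 1)) := by
    rw [hc]; push_cast; field_simp; rw [hirR]; ring
  have l0 : x / i - c = x * (M - r) / (M * (i + a + 1) * i) := by
    rw [hc]; push_cast; field_simp; rw [hirR]; ring
  have b1 : c - x / (i + 1 : ℕ) ≤ x * ((r + 1) / ((M + 1) * i ^ 2)) := by
    rw [l1, mul_div_assoc]
    refine mul_le_mul_of_nonneg_left (div_le_div_of_nonneg_left (by positivity) (by positivity) ?_) hx.le
    nlinarith
  have b0 : x / i - c ≤ x * ((M - r) / ((M + 1) * i ^ 2)) := by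
    rw [l0, mul_div_assoc]
    have : (0:ℝ) ≤ M - r := by linarith
    refine mul_le_mul_of_nonneg_left (div_le_div_of_nonneg_left this (by positivity) ?_) hx.le
    nlinarith
  have c1 : x / (i + 1 : ℕ) ≤ c := by
    have : 0 ≤ c - x / (i + 1 : ℕ) := by rw [l1]; positivity
    linarith
  have c0 : c ≤ x / i := by
    have : 0 ≤ x / i - c := by
      have : (0:ℝ) ≤ M - r := by linarith
      rw [l0]; positivity
    linarith
  have hq : (1:ℝ) ≤ 1 + 1 / M := by have : 0 < 1 / (M:ℝ) := by positivity
                                    linarith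
  have hxq : x ≤ (1 + 1 / M) * x := by nlinarith
  have hxi : x / i ≤ (1 + 1 / M) * x := (div_le_self hx.le (by exact_mod_cast hi)).trans hxq
  have hx1 : (0:ℝ) ≤ x / (i + 1 : ℕ) := by positivity
  have hfl : ∀ v, x / (i + 1 : ℕ) < v → v ≤ x / i → ⌊x / v⌋₊ = i := by
    intro v h1 h2
    have hv : 0 < v := hx1.trans_lt h1
    rw [Nat.floor_eq_iff (by positivity)]
    constructor
    · rw [le_div_iff₀ hv]; rw [le_div_iff₀ hi0] at h2; linarith
    · rw [div_lt_iff₀ hv]; rw [div_lt_iff₀ (by positivity)] at h1; push_cast at h1; linarith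
  have hf1 : ∀ v, x / (i + 1 : ℕ) < v → v ≤ c → ⌊(1 + 1 / M) * x / v⌋₊ = i + a + 1 := by
    intro v h1 h2
    have hv : 0 < v := hx1.trans_lt h1
    rw [Nat.floor_eq_iff (by positivity)]
    constructor
    · rw [le_div_iff₀ hv]; rw [hc, le_div_iff₀ (by positivity)] at h2; linarith
    · rw [div_lt_iff₀ hv]; rw [div_lt_iff₀ (by positivity)] at h1; push_cast at h1 ⊢
      calc (1 + 1 / (M:ℝ)) * x < (1 + 1 / (M:ℝ)) * (v * (i + 1)) := by gcongr
        _ ≤ _ := by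
          rw [mul_comm v, ← mul_assoc]
          refine mul_le_mul_of_nonneg_right ?_ hv.le
          have : (1 + 1 / (M:ℝ)) * (i + 1) = ((M + 1) * (i + 1)) / M := by field_simp
          rw [this, div_le_iff₀ hM0]
          nlinarith
  have hf0 : ∀ v, c < v → v ≤ x / i → ⌊(1 + 1 / M) * x / v⌋₊ = i + a := by
    intro v h1 h2
    have hv : 0 < v := (hx1.trans c1).trans_lt h1
    rw [Nat.floor_eq_iff (by positivity)]
    constructor
    · rw [le_div_iff₀ hv]
      rw [le_div_iff₀ hi0] at h2
      calc ((i + a : ℕ) : ℝ) * v ≤ (1 + 1 / (M:ℝ)) * (v * i) := by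
            rw [mul_comm v, ← mul_assoc]
            refine mul_le_mul_of_nonneg_right ?_ hv.le
            have : (1 + 1 / (M:ℝ)) * i = ((M + 1) * i) / M := by field_simp
            rw [this, le_div_iff₀ hM0]
            push_cast
            nlinarith
        _ ≤ _ := by gcongr
    · rw [div_lt_iff₀ hv]; rw [hc, div_lt_iff₀ (by positivity)] at h1; push_cast at h1 ⊢; linarith
  have hε0 : 0 ≤ ε := (abs_nonneg _).trans (hε (x / i) (by gcongr; exact_mod_cast Nat.lt_succ_self i) le_rfl)
  rw [← intervalIntegral.integral_add_adjacent_intervals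
    (intervalIntegrable_remIntegrand hE hq hx hx1 c1 (c0.trans hxi))
    (intervalIntegrable_remIntegrand hE hq hx (hx1.trans c1) c0 hxi)]
  have h1 := intervalIntegral.norm_integral_le_of_norm_le_const (a := x / (i + 1 : ℕ)) (b := c)
    (f := remIntegrand E (1 + 1 / M) x) (C := ε * |((E (i + a + 1) - E i : ℤ) : ℝ)|) fun v hv ↦ by
      rw [Set.uIoc_of_le c1] at hv
      rw [remIntegrand, hf1 v hv.1 hv.2, hfl v hv.1 (hv.2.trans c0), norm_mul, Real.norm_eq_abs, Real.norm_eq_abs]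
      exact mul_le_mul_of_nonneg_right (hε v hv.1 (hv.2.trans c0)) (abs_nonneg _)
  have h0 := intervalIntegral.norm_integral_le_of_norm_le_const (a := c) (b := x / i)
    (f := remIntegrand E (1 + 1 / M) x) (C := ε * |((E (i + a) - E i : ℤ) : ℝ)|) fun v hv ↦ by
      rw [Set.uIoc_of_le c0] at hv
      rw [remIntegrand, hf0 v hv.1 hv.2, hfl v (c1.trans_lt hv.1) hv.2, norm_mul, Real.norm_eq_abs, Real.norm_eq_abs]
      exact mul_le_mul_of_nonneg_right (hε v (c1.trans_lt hv.1) hv.2) (abs_nonneg _)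
  rw [Real.norm_eq_abs] at h0 h1
  rw [abs_of_nonneg (sub_nonneg.mpr c1)] at h1
  rw [abs_of_nonneg (sub_nonneg.mpr c0)] at h0
  refine (abs_add_le _ _).trans ((add_le_add
    (h1.trans (mul_le_mul_of_nonneg_left b1 (by positivity)))
    (h0.trans (mul_le_mul_of_nonneg_left b0 (by positivity)))).trans (le_of_eq ?_))
  rw [cellWeight, ← ha, ← hr]
  push_cast [Nat.cast_sub hrM.le]
  field_simp
  ring

lemma abs_integral_main_le {E : ℕ → ℤ} {A : ℝ} (hE : ∀ n, |(E n : ℝ)| ≤ A * n) {M Y : ℕ} (hM : 0 < M) (hY : 0 < Y)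
    {x ε : ℝ} (hx : 0 < x) (hε : ∀ v, x / Y < v → v ≤ x → |psiRem v / v| ≤ ε) :
    |∫ v in x / Y..x, remIntegrand E (1 + 1 / M) x v| ≤ ε * x * ∑ i ∈ Finset.Ico 1 Y, cellWeight E M i := by
  induction Y, hY using Nat.le_induction with
  | base => simp
  | succ Y hY ih =>
    have hY0 : (0:ℝ) < Y := by exact_mod_cast hY
    have hle : x / (Y + 1 : ℕ) ≤ x / Y := by gcongr; exact_mod_cast Nat.le_succ Y
    have hYx : x / Y ≤ x := div_le_self hx.le (by exact_mod_cast hY)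
    have hq : (1:ℝ) ≤ 1 + 1 / M := by
      have hM0 : (0:ℝ) < M := by exact_mod_cast hM
      have : 0 < 1 / (M:ℝ) := by positivity
      linarith
    have hxq : x ≤ (1 + 1 / M) * x := by nlinarith
    rw [← intervalIntegral.integral_add_adjacent_intervals
      (intervalIntegrable_remIntegrand hE hq hx (by positivity) hle (hYx.trans hxq))
      (intervalIntegrable_remIntegrand hE hq hx (by positivity) hYx hxq), Finset.sum_Ico_succ_top hY, mul_add,
      add_comm (ε * x * _)]
    exact (abs_add_le _ _).trans (add_le_add
      (abs_integral_cell_le hE hM hY hx fun v h1 h2 ↦ hε v h1 (h2.trans hYx))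
      (ih fun v h1 h2 ↦ hε v (hle.trans_lt h1) h2))

lemma floorSum_zero (s : Finset ℕ) (ν : ℕ → ℤ) (d : ℕ → ℕ) : floorSum s ν d 0 = 0 := by simp [floorSum]

lemma abs_floorSum_le (s : Finset ℕ) (ν : ℕ → ℤ) (d : ℕ → ℕ) (n : ℕ) :
    |(floorSum s ν d n : ℝ)| ≤ (∑ i ∈ s, |(ν i : ℝ)|) * n := by
  rw [floorSum, Finset.sum_mul]
  simp only [Int.cast_sum, Int.cast_mul, Int.cast_natCast]
  refine (Finset.abs_sum_le_sum_abs _ _).trans (Finset.sum_le_sum fun i _ ↦ ?_)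
  rw [abs_mul, Nat.abs_cast]
  refine mul_le_mul_of_nonneg_left ?_ (abs_nonneg _)
  exact_mod_cast Nat.div_le_self _ _

lemma abs_integral_sum_psiRem_le (s : Finset ℕ) (ν : ℕ → ℤ) (d : ℕ → ℕ) (hd : ∀ i ∈ s, 0 < d i)
    {x q : ℝ} (hx : 0 < x) (hq : 1 ≤ q) :
    |∫ t in x..q * x, (∑ i ∈ s, (ν i : ℝ) * ∑ k ∈ Finset.Ioc 0 ⌊q * x⌋₊, psiRem (t / d i / k)) / t| ≤
      (q - 1) * (2 * |∑ i ∈ s, (ν i : ℝ) / d i| * x + (∑ i ∈ s, |(ν i : ℝ)|) * (2 + Real.log (q * x + 1))) := by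
  set η := ∑ i ∈ s, (ν i : ℝ) / d i with hη
  set A := ∑ i ∈ s, |(ν i : ℝ)| with hA
  have hxq : x ≤ q * x := by nlinarith
  have h := intervalIntegral.norm_integral_le_of_norm_le_const (a := x) (b := q * x)
    (f := fun t ↦ (∑ i ∈ s, (ν i : ℝ) * ∑ k ∈ Finset.Ioc 0 ⌊q * x⌋₊, psiRem (t / d i / k)) / t)
    (C := 2 * |η| + A * (2 + Real.log (q * x + 1)) / x) fun t ht ↦ by
      rw [Set.uIoc_of_le hxq] at ht
      have ht0 : 0 < t := hx.trans ht.1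
      have hA0 : 0 ≤ A := Finset.sum_nonneg fun _ _ ↦ abs_nonneg _
      have hlog : 0 ≤ Real.log (q * x + 1) := Real.log_nonneg (by linarith)
      have h1 : ∀ i ∈ s, |∑ k ∈ Finset.Ioc 0 ⌊q * x⌋₊, psiRem (t / d i / k) +
          (1 + Real.eulerMascheroniConstant) * (t / d i)| ≤ 2 + Real.log (q * x + 1) := by
        intro i hi
        have hd1 : t / d i ≤ t := div_le_self ht0.le (by exact_mod_cast hd i hi)
        have h2 := abs_sum_psiRem_div_le (t := t / d i) (by positivity)
          (Nat.floor_le_floor (hd1.trans ht.2))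
        refine h2.trans ?_
        gcongr
        exact hd1.trans ht.2
      have e : ∑ i ∈ s, (ν i : ℝ) * ∑ k ∈ Finset.Ioc 0 ⌊q * x⌋₊, psiRem (t / d i / k) =
          ∑ i ∈ s, (ν i : ℝ) * (∑ k ∈ Finset.Ioc 0 ⌊q * x⌋₊, psiRem (t / d i / k) +
          (1 + Real.eulerMascheroniConstant) * (t / d i)) - (1 + Real.eulerMascheroniConstant) * η * t := by
        rw [hη, mul_right_comm, Finset.mul_sum, ← Finset.sum_sub_distrib]
        exact Finset.sum_congr rfl fun i _ ↦ by ring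
      rw [Real.norm_eq_abs, abs_div, abs_of_pos ht0, div_le_iff₀ ht0, e]
      refine (abs_sub _ _).trans ?_
      have h3 : |∑ i ∈ s, (ν i : ℝ) * (∑ k ∈ Finset.Ioc 0 ⌊q * x⌋₊, psiRem (t / d i / k) +
          (1 + Real.eulerMascheroniConstant) * (t / d i))| ≤ A * (2 + Real.log (q * x + 1)) := by
        rw [hA, Finset.sum_mul]
        refine (Finset.abs_sum_le_sum_abs _ _).trans (Finset.sum_le_sum fun i hi ↦ ?_)
        rw [abs_mul]
        exact mul_le_mul_of_nonneg_left (h1 i hi) (abs_nonneg _)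
      have hg1 := Real.one_half_lt_eulerMascheroniConstant
      have hg2 := Real.eulerMascheroniConstant_lt_two_thirds
      rw [abs_mul, abs_mul, abs_of_pos ht0,
        abs_of_pos (by linarith : 0 < 1 + Real.eulerMascheroniConstant)]
      have h4 : (1 + Real.eulerMascheroniConstant) * |η| * t ≤ 2 * |η| * t := by
        gcongr; linarith
      have h5 : A * (2 + Real.log (q * x + 1)) ≤ A * (2 + Real.log (q * x + 1)) / x * t := by
        rw [div_mul_eq_mul_div, le_div_iff₀ hx]
        exact mul_le_mul_of_nonneg_left ht.1.le (by positivity)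
      linarith
  rw [Real.norm_eq_abs, abs_of_nonneg (sub_nonneg.mpr hxq)] at h
  refine h.trans (le_of_eq ?_)
  field_simp

lemma abs_integral_window_le (s : Finset ℕ) (ν : ℕ → ℤ) (d : ℕ → ℕ) (hd : ∀ i ∈ s, 0 < d i)
    (h1 : floorSum s ν d 1 = 1) {M Y : ℕ} (hM : 2 ≤ M) (hY : 0 < Y) {x ε : ℝ} (hx : (Y : ℝ) ≤ x)
    (hε : ∀ v, x / Y < v → v ≤ x → |psiRem v / v| ≤ ε) :
    |∫ v in x..(1 + 1 / M) * x, psiRem v / v| ≤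
      ε * x * ∑ i ∈ Finset.Ico 1 Y, cellWeight (floorSum s ν d) M i +
      6 * |∑ i ∈ s, (ν i : ℝ) / d i| * (1 / M * x) * Real.log (x / Y) +
      (∑ i ∈ s, |(ν i : ℝ)| * d i) * ((Chebyshev.psi (x / Y) + x / Y) * (x / Y) / (4 * x)) +
      1 / M * (2 * |∑ i ∈ s, (ν i : ℝ) / d i| * x +
        (∑ i ∈ s, |(ν i : ℝ)|) * (2 + Real.log ((1 + 1 / M) * x + 1))) := by
  have hY0 : (0:ℝ) < Y := by exact_mod_cast hY
  have hx0 : 0 < x := hY0.trans_le hx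
  have hM2 : (2:ℝ) ≤ M := by exact_mod_cast hM
  have hM0 : (0:ℝ) < 1 / (M:ℝ) := by positivity
  have hM1 : 1 / (M:ℝ) ≤ 1 / 2 := by gcongr
  have hq : (1:ℝ) ≤ 1 + 1 / M := by linarith
  have hqM : (1:ℝ) + 1 / M - 1 = 1 / M := by ring
  have hV : 1 ≤ x / Y := (one_le_div hY0).mpr hx
  have hVx : x / Y ≤ x := div_le_self hx0.le (by exact_mod_cast hY)
  have hxq : x ≤ (1 + 1 / M) * x := by nlinarith
  have hE := abs_floorSum_le s ν d
  set E := floorSum s ν d with hEdef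
  have t1 := abs_integral_sum_psiRem_le s ν d hd hx0 hq
  rw [integral_sum_psiRem_eq s ν d hd hx0 hq le_rfl] at t1
  have t2 := abs_integral_tail_le s ν d hd hx0 hq hV
  have t3 := abs_integral_main_le hE (by omega : 0 < M) hY hx0 hε
  have e1 : ∫ v in Set.Ioc 0 ((1 + 1 / M) * x), psiRem v / v *
      ((floorSum s ν d ⌊(1 + 1 / M) * x / v⌋₊ - floorSum s ν d ⌊x / v⌋₊ : ℤ) : ℝ) =
      (∫ v in Set.Ioc 0 (x / Y), psiRem v / v *
      ((floorSum s ν d ⌊(1 + 1 / M) * x / v⌋₊ - floorSum s ν d ⌊x / v⌋₊ : ℤ) : ℝ)) +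
      (∫ v in x / Y..x, remIntegrand E (1 + 1 / M) x v) + ∫ v in x..(1 + 1 / M) * x, psiRem v / v := by
    change ∫ v in Set.Ioc 0 ((1 + 1 / M) * x), remIntegrand E (1 + 1 / M) x v =
      (∫ v in Set.Ioc 0 (x / Y), remIntegrand E (1 + 1 / M) x v) + _ + _
    have e2 : ∫ v in x..(1 + 1 / M) * x, psiRem v / v =
        ∫ v in x..(1 + 1 / M) * x, remIntegrand E (1 + 1 / M) x v := by
      rw [intervalIntegral.integral_of_le hxq, intervalIntegral.integral_of_le hxq]
      refine setIntegral_congr_fun measurableSet_Ioc fun v hv ↦ ?_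
      have hv0 : 0 < v := hx0.trans hv.1
      have f1 : ⌊x / v⌋₊ = 0 := by
        rw [Nat.floor_eq_zero, div_lt_one hv0]; exact hv.1
      have f2 : ⌊(1 + 1 / M) * x / v⌋₊ = 1 := by
        rw [Nat.floor_eq_iff (by positivity)]
        constructor
        · rw [le_div_iff₀ hv0]; push_cast; linarith [hv.2]
        · rw [div_lt_iff₀ hv0]; push_cast; nlinarith [hv.1]
      change _ = psiRem v / v * _
      rw [f1, f2, h1, hEdef, floorSum_zero]
      simp
    rw [e2, ← intervalIntegral.integral_of_le (by positivity), ← intervalIntegral.integral_of_le (by positivity),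
      intervalIntegral.integral_add_adjacent_intervals, intervalIntegral.integral_add_adjacent_intervals] <;>
    apply intervalIntegrable_remIntegrand hE hq hx0 <;> first | positivity | linarith
  rw [e1] at t1
  rw [hqM] at t1 t2
  have h5 := abs_le.mp t1
  have h6 := abs_le.mp t2
  have h7 := abs_le.mp t3
  rw [abs_le]
  constructor <;> linarith [h5.1, h5.2, h6.1, h6.2, h7.1, h7.2]

lemma intervalIntegrable_psiRem_div {a b : ℝ} (hab : a ≤ b) :
    IntervalIntegrable (fun v ↦ psiRem v / v) volume a b := by
  rw [intervalIntegrable_iff_integrableOn_Ioc_of_le hab]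
  exact Measure.integrableOn_of_bounded (M := 6) (by simp) measurable_psiRem_div.aestronglyMeasurable
    (Filter.Eventually.of_forall fun v ↦ abs_psiRem_div_le v)

lemma integral_sub_psi_div (c : ℝ) {x y : ℝ} (hx : 0 < x) (hxy : x ≤ y) :
    ∫ v in x..y, (c * v⁻¹ - 1) = c * Real.log (y / x) - (y - x) := by
  have hi : IntervalIntegrable (fun v : ℝ ↦ c * v⁻¹) volume x y :=
    (intervalIntegral.intervalIntegrable_inv (f := fun v : ℝ ↦ v)
      (fun v hv ↦ by rw [Set.uIcc_of_le hxy] at hv; linarith [hv.1]) continuousOn_id).const_mul _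
  rw [intervalIntegral.integral_sub hi intervalIntegrable_const, intervalIntegral.integral_const_mul,
    integral_inv_of_pos hx (hx.trans_le hxy)]
  simp

lemma psi_mul_log_le {x y : ℝ} (hx : 1 ≤ x) (hxy : x ≤ y) :
    Chebyshev.psi x * Real.log (y / x) - (y - x) ≤ ∫ v in x..y, psiRem v / v := by
  rw [← integral_sub_psi_div _ (by linarith) hxy]
  refine intervalIntegral.integral_mono_on hxy ?_ (intervalIntegrable_psiRem_div hxy) fun v hv ↦ ?_
  · exact ((intervalIntegral.intervalIntegrable_inv (f := fun v : ℝ ↦ v)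
      (fun v hv ↦ by rw [Set.uIcc_of_le hxy] at hv; linarith [hv.1]) continuousOn_id).const_mul _).sub
      intervalIntegrable_const
  · have hv0 : 0 < v := by linarith [hv.1]
    rw [psiRem, if_pos (hx.trans hv.1), sub_div, div_self hv0.ne', div_eq_mul_inv]
    have := Chebyshev.psi_mono hv.1
    gcongr

lemma le_psi_mul_log {x y : ℝ} (hx : 1 ≤ x) (hxy : x ≤ y) :
    ∫ v in x..y, psiRem v / v ≤ Chebyshev.psi y * Real.log (y / x) - (y - x) := by
  rw [← integral_sub_psi_div _ (by linarith) hxy]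
  refine intervalIntegral.integral_mono_on hxy (intervalIntegrable_psiRem_div hxy) ?_ fun v hv ↦ ?_
  · exact ((intervalIntegral.intervalIntegrable_inv (f := fun v : ℝ ↦ v)
      (fun v hv ↦ by rw [Set.uIcc_of_le hxy] at hv; linarith [hv.1]) continuousOn_id).const_mul _).sub
      intervalIntegrable_const
  · have hv0 : 0 < v := by linarith [hv.1]
    rw [psiRem, if_pos (hx.trans hv.1), sub_div, div_self hv0.ne', div_eq_mul_inv]
    have := Chebyshev.psi_mono hv.2
    gcongr

lemma abs_psiRem_le_of_window {M : ℕ} (hM : 2 ≤ M) {b y : ℝ} (hy : 2 ≤ y) (hb : 0 ≤ b)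
    (h1 : |∫ v in y..(1 + 1 / M) * y, psiRem v / v| ≤ b * y)
    (h2 : |∫ v in y / (1 + 1 / M)..y, psiRem v / v| ≤ b * y) :
    |psiRem y / y| ≤ b * (M + 1 / 2) + 1 / (2 * M) := by
  have hM2 : (2:ℝ) ≤ M := by exact_mod_cast hM
  have hM0 : (0:ℝ) < 1 / (M:ℝ) := by positivity
  have hM1 : 1 / (M:ℝ) ≤ 1 / 2 := by gcongr
  set q : ℝ := 1 + 1 / M with hq
  have hq1 : 1 < q := by linarith
  have hq0 : 0 < q := by linarith
  have hy0 : 0 < y := by linarith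
  have hl1 : 2 / (2 * M + 1) ≤ Real.log q := by
    refine le_trans (le_of_eq ?_) (Real.le_log_one_add_of_nonneg hM0.le)
    field_simp
    ring
  have hlog : 0 < Real.log q := Real.log_pos hq1
  have hl2 : 2 * Real.log q ≤ q - 1 / q := by
    have := Real.self_le_sinh_iff.mpr hlog.le
    rw [Real.sinh_log hq0] at this
    rw [one_div]; linarith
  have u := (psi_mul_log_le (x := y) (y := q * y) (by linarith) (by nlinarith)).trans ((le_abs_self _).trans h1)
  rw [mul_div_assoc, div_self hy0.ne', mul_one] at u
  have hyq : y / q ≤ y := div_le_self hy0.le hq1.le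
  have hyq1 : 1 ≤ y / q := by rw [one_le_div hq0]; linarith
  have l := (neg_le_of_abs_le h2).trans (le_psi_mul_log hyq1 hyq)
  rw [div_div_cancel₀ hy0.ne'] at l
  have hc : q - 1 - Real.log q ≤ (1 / (2 * M)) * Real.log q := by
    have : q - 1 - 1 / (2 * M) * (2 / (2 * M + 1)) ≤ 2 / (2 * M + 1) := by
      rw [hq]
      apply le_of_eq
      field_simp
      ring
    nlinarith [mul_le_mul_of_nonneg_left hl1 (by positivity : (0:ℝ) ≤ 1 / (2 * M))]
  have hbb : b ≤ b * (M + 1 / 2) * Real.log q := by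
    have : b * (M + 1 / 2) * (2 / (2 * M + 1)) = b := by field_simp
    calc b = b * (M + 1 / 2) * (2 / (2 * M + 1)) := this.symm
      _ ≤ _ := by gcongr
  rw [abs_div, abs_of_pos hy0, div_le_iff₀ hy0, psiRem, if_pos (by linarith)]
  have key : (b + (q - 1 - Real.log q)) * y ≤ ((b * (M + 1 / 2) + 1 / (2 * M)) * y) * Real.log q := by
    calc (b + (q - 1 - Real.log q)) * y
        ≤ (b * (M + 1 / 2) * Real.log q + (1 / (2 * M)) * Real.log q) * y := by gcongr
      _ = _ := by ring
  have hyq2 : y / q = 1 / q * y := by ring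
  rw [hyq2] at l
  rw [abs_le]
  constructor
  · refine le_of_mul_le_mul_right (a := Real.log q) ?_ hlog
    nlinarith
  · refine le_of_mul_le_mul_right (a := Real.log q) ?_ hlog
    nlinarith

end

lemma log_factorial_div_eq (n d : ℕ) :
    Real.log ((n / d).factorial) = ∑ m ∈ Finset.Ioc 0 n, ArithmeticFunction.vonMangoldt m * ((n / m / d : ℕ) : ℝ) := by
  have h3 : ∀ n : ℕ, ∑ k ∈ Finset.Ioc 0 n, ArithmeticFunction.log k = Real.log n.factorial := by
    intro n
    induction n with
    | zero => simp
    | succ n ih =>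
      rw [← Finset.insert_Ioc_right_eq_Ioc_add_one (by omega), Finset.sum_insert (by simp), ih, Nat.factorial_succ,
        ArithmeticFunction.log_apply, Nat.cast_mul, Real.log_mul (by positivity) (by positivity)]
  have h1 := ArithmeticFunction.sum_Ioc_mul_zeta_eq_sum (R := ℝ) ArithmeticFunction.vonMangoldt (n / d)
  rw [ArithmeticFunction.vonMangoldt_mul_zeta, h3] at h1
  rw [h1, ← Finset.sum_subset (Finset.Ioc_subset_Ioc_right (Nat.div_le_self n d) :
    Finset.Ioc 0 (n / d) ⊆ Finset.Ioc 0 n)]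
  · refine Finset.sum_congr rfl fun m _ ↦ ?_
    rw [Nat.div_div_eq_div_mul, Nat.div_div_eq_div_mul, mul_comm m]
  · intro m hm hm2
    rw [Finset.mem_Ioc] at hm hm2
    have h4 : n / d < m := by omega
    have h5 : n / m / d = 0 := by
      rw [Nat.div_div_eq_div_mul, mul_comm m, ← Nat.div_div_eq_div_mul]
      exact Nat.div_eq_of_lt h4
    rw [h5]; simp

lemma psi_div_eq_sum (n d : ℕ) (hd : 0 < d) :
    Chebyshev.psi ((n / d : ℕ) : ℝ) =
      ∑ m ∈ Finset.Ioc 0 n, ArithmeticFunction.vonMangoldt m * (if d ≤ n / m then 1 else 0) := by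
  rw [Chebyshev.psi, Nat.floor_natCast, ← Finset.sum_subset (Finset.Ioc_subset_Ioc_right (Nat.div_le_self n d) :
    Finset.Ioc 0 (n / d) ⊆ Finset.Ioc 0 n)]
  · refine Finset.sum_congr rfl fun m hm ↦ ?_
    rw [Finset.mem_Ioc] at hm
    rw [if_pos, mul_one]
    rw [Nat.le_div_iff_mul_le hm.1, mul_comm]
    exact (Nat.le_div_iff_mul_le hd).mp hm.2
  · intro m hm hm2
    rw [Finset.mem_Ioc] at hm hm2
    rw [if_neg, mul_zero]
    rw [Nat.le_div_iff_mul_le hm.1, mul_comm, ← Nat.le_div_iff_mul_le hd]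
    omega

/-- Chebyshev's combination of logarithms of factorials. -/
noncomputable def chebComb (n : ℕ) : ℝ :=
  Real.log (n / 1).factorial - Real.log (n / 2).factorial - Real.log (n / 3).factorial - Real.log (n / 5).factorial +
    Real.log (n / 30).factorial

lemma chebComb_eq (n : ℕ) : chebComb n = ∑ m ∈ Finset.Ioc 0 n, ArithmeticFunction.vonMangoldt m *
    (((n / m / 1 : ℕ) : ℝ) - ((n / m / 2 : ℕ) : ℝ) - ((n / m / 3 : ℕ) : ℝ) - ((n / m / 5 : ℕ) : ℝ) +
      ((n / m / 30 : ℕ) : ℝ)) := by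
  simp only [chebComb, log_factorial_div_eq, ← Finset.sum_sub_distrib, ← Finset.sum_add_distrib, mul_sub, mul_add]

lemma chebComb_le_psi (n : ℕ) : chebComb n ≤ Chebyshev.psi n := by
  rw [chebComb_eq, Chebyshev.psi, Nat.floor_natCast]
  refine Finset.sum_le_sum fun m _ ↦ ?_
  refine mul_le_of_le_one_right ArithmeticFunction.vonMangoldt_nonneg ?_
  have : n / m / 1 + n / m / 30 ≤ 1 + n / m / 2 + n / m / 3 + n / m / 5 := by omega
  have : ((n / m / 1 : ℕ) : ℝ) + ((n / m / 30 : ℕ) : ℝ) ≤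
    1 + ((n / m / 2 : ℕ) : ℝ) + ((n / m / 3 : ℕ) : ℝ) + ((n / m / 5 : ℕ) : ℝ) := by exact_mod_cast this
  linarith

lemma psi_le_chebComb (n : ℕ) : Chebyshev.psi n ≤
    chebComb n + Chebyshev.psi ((n / 6 : ℕ) : ℝ) - Chebyshev.psi ((n / 7 : ℕ) : ℝ) +
      Chebyshev.psi ((n / 10 : ℕ) : ℝ) := by
  rw [chebComb_eq, psi_div_eq_sum n 6 (by norm_num), psi_div_eq_sum n 7 (by norm_num),
    psi_div_eq_sum n 10 (by norm_num), Chebyshev.psi, Nat.floor_natCast, ← Finset.sum_add_distrib,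
    ← Finset.sum_sub_distrib, ← Finset.sum_add_distrib]
  refine Finset.sum_le_sum fun m hm ↦ ?_
  rw [Finset.mem_Ioc] at hm
  rw [← mul_add, ← mul_sub, ← mul_add]
  refine le_mul_of_one_le_right ArithmeticFunction.vonMangoldt_nonneg ?_
  have h1 : 1 ≤ n / m := (Nat.one_le_div_iff hm.1).mpr hm.2
  generalize n / m = k at h1
  have : k / 2 + k / 3 + k / 5 + (if 7 ≤ k then 1 else 0) + 1 ≤
      k / 1 + k / 30 + (if 6 ≤ k then 1 else 0) + (if 10 ≤ k then 1 else 0) := by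
    split_ifs <;> omega
  have : ((k / 2 : ℕ) : ℝ) + ((k / 3 : ℕ) : ℝ) + ((k / 5 : ℕ) : ℝ) + (if 7 ≤ k then 1 else 0) + 1 ≤
      ((k / 1 : ℕ) : ℝ) + ((k / 30 : ℕ) : ℝ) + (if 6 ≤ k then 1 else 0) + (if 10 ≤ k then 1 else 0) := by
    exact_mod_cast this
  linarith

lemma abs_log_factorial_floor_le {t : ℝ} (ht : 1 ≤ t) :
    |Real.log (⌊t⌋₊.factorial) - (t * Real.log t - t)| ≤ Real.log (t + 1) + 1 := by
  have ht0 : 0 < t := by linarith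
  have hn1 : 1 ≤ ⌊t⌋₊ := Nat.le_floor (by exact_mod_cast ht)
  have hnt : (⌊t⌋₊:ℝ) ≤ t := Nat.floor_le ht0.le
  have htn : t < ⌊t⌋₊ + 1 := Nat.lt_floor_add_one t
  set n := ⌊t⌋₊
  have hn0 : (0:ℝ) < n := by exact_mod_cast hn1
  have hmono : ∀ a b : ℝ, 1 ≤ a → a ≤ b → a * Real.log a - a ≤ b * Real.log b - b := by
    intro a b ha hab
    have ha0 : 0 < a := by linarith
    have hb0 : 0 < b := by linarith
    have h := Real.one_sub_inv_le_log_of_pos (x := b / a) (div_pos hb0 ha0)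
    rw [Real.log_div hb0.ne' ha0.ne', inv_div] at h
    have h2 := mul_le_mul_of_nonneg_left h (by linarith : 0 ≤ b)
    have e : b * (1 - a / b) = b - a := by
      have : b ≠ 0 := by linarith
      field_simp
    rw [e] at h2
    nlinarith [Real.log_nonneg ha]
  have h1 := log_factorial_le hn1
  have h2 := log_factorial_ge (n := n + 1) (by omega)
  rw [Nat.factorial_succ, Nat.cast_mul, Real.log_mul (by positivity) (by positivity)] at h2
  push_cast at h2
  have h3 := hmono n t (by exact_mod_cast hn1) hnt
  have h4 := hmono t (n + 1) ht htn.le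
  have h5 : Real.log n ≤ Real.log (t + 1) := Real.log_le_log hn0 (by linarith)
  have h6 : Real.log (n + 1) ≤ Real.log (t + 1) := Real.log_le_log (by positivity) (by linarith)
  rw [abs_le]
  constructor <;> linarith

lemma log_three_bounds : 1.0985 < Real.log 3 ∧ Real.log 3 < 1.0987 := by
  have h2 := Real.log_two_gt_d9
  have h2' := Real.log_two_lt_d9
  have e : 12 * Real.log 3 = 19 * Real.log 2 + Real.log (531441 / 524288) := by
    rw [Real.log_div (by norm_num) (by norm_num), show (531441:ℝ) = 3 ^ 12 by norm_num,
      show (524288:ℝ) = 2 ^ 19 by norm_num, Real.log_pow, Real.log_pow]; push_cast; ring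
  have u := Real.log_le_sub_one_of_pos (x := 531441 / 524288) (by norm_num)
  have l := Real.one_sub_inv_le_log_of_pos (x := 531441 / 524288) (by norm_num)
  norm_num at u l
  constructor <;> linarith

lemma log_five_bounds : 1.6092 < Real.log 5 ∧ Real.log 5 < 1.6096 := by
  have h2 := Real.log_two_gt_d9
  have h2' := Real.log_two_lt_d9
  have e : 3 * Real.log 5 = 7 * Real.log 2 + Real.log (125 / 128) := by
    rw [Real.log_div (by norm_num) (by norm_num), show (125:ℝ) = 5 ^ 3 by norm_num,
      show (128:ℝ) = 2 ^ 7 by norm_num, Real.log_pow, Real.log_pow]; push_cast; ring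
  have u := Real.log_le_sub_one_of_pos (x := 125 / 128) (by norm_num)
  have l := Real.one_sub_inv_le_log_of_pos (x := 125 / 128) (by norm_num)
  norm_num at u l
  constructor <;> linarith

lemma chebComb_bounds {x : ℝ} (hx : 30 ≤ x) :
    0.9212 * x - 5 * (Real.log (x + 1) + 1) ≤ chebComb ⌊x⌋₊ ∧
      chebComb ⌊x⌋₊ ≤ 0.9214 * x + 5 * (Real.log (x + 1) + 1) := by
  have hx0 : 0 < x := by linarith
  have key : ∀ d : ℕ, 0 < d → d ≤ 30 → |Real.log ((⌊x⌋₊ / d).factorial) - (x / d * (Real.log x - Real.log d) - x / d)| ≤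
      Real.log (x + 1) + 1 := by
    intro d hd hd2
    have hd0 : (0:ℝ) < d := by exact_mod_cast hd
    have hd3 : (d:ℝ) ≤ 30 := by exact_mod_cast hd2
    have h := abs_log_factorial_floor_le (t := x / d) ((one_le_div hd0).mpr (by linarith))
    rw [floor_div_eq, Real.log_div hx0.ne' hd0.ne'] at h
    refine h.trans ?_
    have : x / d ≤ x := div_le_self hx0.le (by exact_mod_cast hd)
    gcongr
  have k1 := abs_le.mp (key 1 (by norm_num) (by norm_num))
  have k2 := abs_le.mp (key 2 (by norm_num) (by norm_num))
  have k3 := abs_le.mp (key 3 (by norm_num) (by norm_num))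
  have k5 := abs_le.mp (key 5 (by norm_num) (by norm_num))
  have k30 := abs_le.mp (key 30 (by norm_num) (by norm_num))
  push_cast at k1 k2 k3 k5 k30
  have e30 : Real.log 30 = Real.log 2 + Real.log 3 + Real.log 5 := by
    rw [← Real.log_mul (by norm_num) (by norm_num), ← Real.log_mul (by norm_num) (by norm_num)]; norm_num
  rw [e30] at k30
  rw [Real.log_one] at k1
  have l3 := log_three_bounds
  have l5 := log_five_bounds
  have l2 := Real.log_two_gt_d9
  have l2' := Real.log_two_lt_d9
  have hA : 0.9212 ≤ Real.log 2 * (14 / 30) + Real.log 3 * (9 / 30) + Real.log 5 * (5 / 30) := by linarith [l3.1, l5.1]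
  have hB : Real.log 2 * (14 / 30) + Real.log 3 * (9 / 30) + Real.log 5 * (5 / 30) ≤ 0.9214 := by linarith [l3.2, l5.2]
  have hA' := mul_le_mul_of_nonneg_right hA hx0.le
  have hB' := mul_le_mul_of_nonneg_right hB hx0.le
  rw [chebComb]
  constructor
  · nlinarith [k1.1, k2.2, k3.2, k5.2, k30.1]
  · nlinarith [k1.2, k2.1, k3.1, k5.1, k30.2]

lemma psi_ge_cheb {x : ℝ} (hx : 30 ≤ x) : 0.9212 * x - 5 * (Real.log (x + 1) + 1) ≤ Chebyshev.psi x := by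
  rw [Chebyshev.psi_eq_psi_coe_floor]
  exact (chebComb_bounds hx).1.trans (chebComb_le_psi _)

lemma psi_le_cheb {x : ℝ} (hx : 30 ≤ x) : Chebyshev.psi x ≤
    0.9214 * x + 5 * (Real.log (x + 1) + 1) + Chebyshev.psi (x / 6) - Chebyshev.psi (x / 7) + Chebyshev.psi (x / 10) := by
  have h := psi_le_chebComb ⌊x⌋₊
  rw [← floor_div_eq, ← floor_div_eq, ← floor_div_eq, ← Chebyshev.psi_eq_psi_coe_floor,
    ← Chebyshev.psi_eq_psi_coe_floor, ← Chebyshev.psi_eq_psi_coe_floor, ← Chebyshev.psi_eq_psi_coe_floor] at h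
  push_cast at h
  linarith [(chebComb_bounds hx).2]

lemma log_six_bounds : 1.79 < Real.log 6 ∧ Real.log 6 < 1.793 := by
  rw [show (6:ℝ) = 2 * 3 by norm_num, Real.log_mul (by norm_num) (by norm_num)]
  constructor <;> linarith [log_three_bounds.1, log_three_bounds.2, Real.log_two_gt_d9, Real.log_two_lt_d9]

lemma log_ten_lt : Real.log 10 < 2.31 := by
  rw [show (10:ℝ) = 2 * 5 by norm_num, Real.log_mul (by norm_num) (by norm_num)]
  linarith [log_five_bounds.2, Real.log_two_lt_d9]

lemma log_add_one_le {x : ℝ} (hx : 50 ≤ x) : Real.log (x + 1) ≤ Real.log x + 0.02 := by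
  have hx0 : 0 < x := by linarith
  have e : x + 1 = x * (1 + 1 / x) := by field_simp
  rw [e, Real.log_mul hx0.ne' (by positivity)]
  have h := Real.log_le_sub_one_of_pos (x := 1 + 1 / x) (by positivity)
  have : 1 / x ≤ 0.02 := by rw [div_le_iff₀ hx0]; linarith
  linarith

lemma psi_le_rough {x : ℝ} (hx : 1 ≤ x) :
    Chebyshev.psi x ≤ 1.1057 * x + 2.5 * Real.log x ^ 2 + 330 := by
  suffices h : ∀ n : ℕ, ∀ x : ℝ, 1 ≤ x → x ≤ 60 * 6 ^ n →
      Chebyshev.psi x ≤ 1.1057 * x + 2.5 * Real.log x ^ 2 + 330 by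
    obtain ⟨n, hn⟩ := pow_unbounded_of_one_lt x (by norm_num : (1:ℝ) < 6)
    exact h n x hx (by linarith [pow_pos (show (0:ℝ) < 6 by norm_num) n])
  intro n
  induction n with
  | zero =>
    intro x hx hx2
    have h1 := Chebyshev.psi_le_const_mul_self (x := x) (by linarith)
    have h4 : Real.log 4 ≤ 1.4 := by
      rw [show (4:ℝ) = 2 ^ 2 by norm_num, Real.log_pow]; push_cast; linarith [Real.log_two_lt_d9]
    nlinarith [sq_nonneg (Real.log x)]
  | succ n ih =>
    intro x hx hx2
    by_cases hx3 : x ≤ 60 * 6 ^ n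
    · exact ih x hx hx3
    have h60 : 60 < x := by
      have : (1:ℝ) ≤ 6 ^ n := one_le_pow₀ (by norm_num)
      linarith
    have h := psi_le_cheb (x := x) (by linarith)
    have hm : Chebyshev.psi (x / 10) ≤ Chebyshev.psi (x / 7) := Chebyshev.psi_mono (by gcongr; norm_num)
    have h6 := ih (x / 6) (by linarith) (by rw [pow_succ] at hx2; linarith)
    rw [Real.log_div (by linarith) (by norm_num)] at h6
    have hl := log_add_one_le (x := x) (by linarith)
    have hlx : 4.09 ≤ Real.log x := by
      have := Real.log_le_log (by norm_num) h60.le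
      rw [show (60:ℝ) = 2 * 6 * 5 by norm_num, Real.log_mul (by norm_num) (by norm_num),
        Real.log_mul (by norm_num) (by norm_num)] at this
      linarith [log_six_bounds.1, log_five_bounds.1, Real.log_two_gt_d9]
    have := log_six_bounds
    nlinarith

lemma exp_ge_of_le {c : ℝ} (n : ℕ) (h : c ≤ 2.718 ^ n) : c ≤ Real.exp n := by
  refine h.trans ?_
  rw [← Real.exp_one_pow]
  gcongr
  linarith [Real.exp_one_gt_d9]

lemma ge_of_log_ge {c x : ℝ} (hx : 0 < x) (n : ℕ) (hn : (n:ℝ) ≤ Real.log x) (h : c ≤ 2.718 ^ n) : c ≤ x :=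
  (exp_ge_of_le n h).trans ((Real.le_log_iff_exp_le hx).mp hn)

lemma sq_log_le_mul {a x : ℝ} (n : ℕ) (hx : 0 < x) (hn : (n:ℝ) ≤ Real.log x) (hn3 : 3 ≤ n)
    (h : (n:ℝ) ^ 2 ≤ a * 2.718 ^ n) : Real.log x ^ 2 ≤ a * x := by
  set t := Real.log x with ht
  have ha : 0 < a := by
    have : (0:ℝ) < n ^ 2 := by positivity
    by_contra hc
    have : a * 2.718 ^ n ≤ 0 := mul_nonpos_of_nonpos_of_nonneg (by linarith) (by positivity)
    linarith
  have hn3' : (3:ℝ) ≤ n := by exact_mod_cast hn3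
  have hx2 : x = Real.exp n * Real.exp (t - n) := by
    rw [← Real.exp_add, add_sub_cancel, ht, Real.exp_log hx]
  have h1 := Real.quadratic_le_exp_of_nonneg (x := t - n) (by linarith)
  have h2 := exp_ge_of_le n (le_refl ((2.718:ℝ) ^ n))
  have h3 : t ^ 2 ≤ n ^ 2 * (1 + (t - n) + (t - n) ^ 2 / 2) := by
    nlinarith [mul_nonneg (sub_nonneg.mpr hn) (by nlinarith : (0:ℝ) ≤ n ^ 2 - 2 * n), mul_nonneg (sq_nonneg (t-n)) (by nlinarith : (0:ℝ) ≤ (n:ℝ) ^ 2 / 2 - 1)]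
  calc t ^ 2 ≤ n ^ 2 * (1 + (t - n) + (t - n) ^ 2 / 2) := h3
    _ ≤ (a * 2.718 ^ n) * (1 + (t - n) + (t - n) ^ 2 / 2) := by
        gcongr
    _ ≤ (a * Real.exp n) * Real.exp (t - n) := by gcongr
    _ = _ := by rw [hx2]; ring

lemma psi_le_of_log_ge_thirteen {x : ℝ} (hx : 0 < x) (h : 13 ≤ Real.log x) :
    Chebyshev.psi x ≤ 1.1075 * x := by
  have h1 := ge_of_log_ge (c := 440000) hx 13 (by exact_mod_cast h) (by norm_num)
  have h2 := sq_log_le_mul (a := 0.0004) 13 hx (by exact_mod_cast h) (by norm_num) (by norm_num)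
  have := psi_le_rough (x := x) (by linarith)
  linarith

lemma psi_ge_of_log_ge_ten {x : ℝ} (hx : 0 < x) (h : 10 ≤ Real.log x) :
    0.9164 * x ≤ Chebyshev.psi x := by
  have h1 := ge_of_log_ge (c := 22000) hx 10 (by exact_mod_cast h) (by norm_num)
  have h2 := sq_log_le_mul (a := 0.0046) 10 hx (by exact_mod_cast h) (by norm_num) (by norm_num)
  have := psi_ge_cheb (x := x) (by linarith)
  have := log_add_one_le (x := x) (by linarith)
  nlinarith

lemma psi_le_of_log_ge_fourteen {x : ℝ} (hx : 0 < x) (h : 14.8 ≤ Real.log x) :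
    Chebyshev.psi x ≤ 1.0862 * x := by
  have h1 := ge_of_log_ge (c := 1200000) hx 14 (by push_cast; linarith) (by norm_num)
  have h2 := sq_log_le_mul (a := 0.000165) 14 hx (by push_cast; linarith) (by norm_num) (by norm_num)
  have k := psi_le_cheb (x := x) (by linarith)
  have k6 := psi_le_rough (x := x / 6) (by linarith)
  have k10 := psi_le_rough (x := x / 10) (by linarith)
  have k7 := psi_ge_cheb (x := x / 7) (by linarith)
  have l1 := log_add_one_le (x := x) (by linarith)
  have l7 : Real.log (x / 7 + 1) ≤ Real.log (x + 1) := Real.log_le_log (by positivity) (by linarith)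
  have l6 : Real.log (x / 6) ≤ Real.log x := Real.log_le_log (by positivity) (by linarith)
  have l10 : Real.log (x / 10) ≤ Real.log x := Real.log_le_log (by positivity) (by linarith)
  have p6 : 0 ≤ Real.log (x / 6) := Real.log_nonneg (by linarith)
  have p10 : 0 ≤ Real.log (x / 10) := Real.log_nonneg (by linarith)
  have q6 : Real.log (x / 6) ^ 2 ≤ Real.log x ^ 2 := by gcongr
  have q10 : Real.log (x / 10) ^ 2 ≤ Real.log x ^ 2 := by gcongr
  nlinarith

lemma psi_le_of_log_ge_seventeen {x : ℝ} (hx : 0 < x) (h : 17.4 ≤ Real.log x) :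
    Chebyshev.psi x ≤ 1.0795 * x := by
  have h1 := ge_of_log_ge (c := 24000000) hx 17 (by push_cast; linarith) (by norm_num)
  have h2 := sq_log_le_mul (a := 0.0000125) 17 hx (by push_cast; linarith) (by norm_num) (by norm_num)
  have k := psi_le_cheb (x := x) (by linarith)
  have k6 := psi_le_of_log_ge_fourteen (x := x / 6) (by linarith)
    (by rw [Real.log_div hx.ne' (by norm_num)]; linarith [log_six_bounds.2])
  have k10 := psi_le_of_log_ge_fourteen (x := x / 10) (by linarith)
    (by rw [Real.log_div hx.ne' (by norm_num)]; linarith [log_ten_lt])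
  have k7 := psi_ge_cheb (x := x / 7) (by linarith)
  have l1 := log_add_one_le (x := x) (by linarith)
  have l7 : Real.log (x / 7 + 1) ≤ Real.log (x + 1) := Real.log_le_log (by positivity) (by linarith)
  nlinarith

section

open MeasureTheory

lemma exp_fifteen_ge : (1 + 1 / 800) * 3161600 ≤ Real.exp 15 := by
  have := Real.exp_one_gt_d9
  have h : Real.exp 15 = Real.exp 1 ^ 15 := by rw [← Real.exp_nat_mul]; norm_num
  rw [h]
  calc ((1 + 1 / 800) * 3161600 : ℝ) ≤ 2.7182818283 ^ 15 := by norm_num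
    _ ≤ _ := by gcongr

lemma window_bound (s : Finset ℕ) (ν : ℕ → ℤ) (d : ℕ → ℕ) (hd : ∀ i ∈ s, 0 < d i)
    (h1 : floorSum s ν d 1 = 1)
    (hκ : ∑ i ∈ Finset.Ico 1 3161600, cellWeight (floorSum s ν d) 800 i ≤ 0.00061)
    (hη : |∑ i ∈ s, (ν i : ℝ) / d i| ≤ 0.000000000001) (hT : ∑ i ∈ s, |(ν i : ℝ)| * d i ≤ 4930000)
    (hA : ∑ i ∈ s, |(ν i : ℝ)| ≤ 2500) {l ε : ℝ} (hl : 13 ≤ l) (hε0 : 0 ≤ ε)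
    (h : ∀ v, Real.exp l ≤ v → v ≤ Real.exp 5000 → |psiRem v / v| ≤ ε) {x y : ℝ}
    (hy : Real.exp (l + 15) ≤ y) (hy2 : y ≤ Real.exp 5000) (hx1 : y / (1 + 1 / 800) ≤ x) (hx2 : x ≤ y) :
    |∫ v in x..(1 + 1 / 800) * x, psiRem v / v| ≤ (0.00061 * ε + 0.00000026 + 0.000000001) * y := by
  have e15 := exp_fifteen_ge
  have hl0 := Real.exp_pos l
  have hl13 : 440000 ≤ Real.exp l := by
    refine (exp_ge_of_le (c := 440000) 13 (by norm_num)).trans ?_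
    gcongr; exact_mod_cast hl
  have hxl : 3161600 * Real.exp l ≤ x := by
    refine le_trans ?_ hx1
    rw [le_div_iff₀ (by norm_num)]
    refine le_trans ?_ hy
    rw [Real.exp_add]
    nlinarith
  have hx0 : 0 < x := by linarith
  have hxY : Real.exp l ≤ x / 3161600 := by
    rw [le_div_iff₀ (by norm_num)]; linarith
  have hxY0 : 0 < x / 3161600 := hl0.trans_le hxY
  have key := abs_integral_window_le s ν d hd h1 (M := 800) (Y := 3161600) (by norm_num) (by norm_num)
    (x := x) (ε := ε) (by push_cast; nlinarith)
    (fun v hv1 hv2 ↦ h v (hxY.trans (by push_cast at hv1; exact hv1.le)) (hv2.trans (hx2.trans hy2)))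
  push_cast at key
  have hlog : Real.log (x / 3161600) ≤ 5000 := by
    rw [Real.log_le_iff_le_exp hxY0]
    refine le_trans ?_ (hx2.trans hy2)
    exact div_le_self hx0.le (by norm_num)
  have hlog0 : 0 ≤ Real.log (x / 3161600) := Real.log_nonneg (by linarith)
  have hψ := psi_le_of_log_ge_thirteen hxY0 ((Real.le_log_iff_exp_le hxY0).mpr ((Real.exp_le_exp.mpr hl).trans hxY))
  have b1 : ε * x * ∑ i ∈ Finset.Ico 1 3161600, cellWeight (floorSum s ν d) 800 i ≤ ε * x * 0.00061 := by
    gcongr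
  have b2 : 6 * |∑ i ∈ s, (ν i : ℝ) / d i| * (1 / 800 * x) * Real.log (x / 3161600) ≤
      6 * 0.000000000001 * (1 / 800 * x) * 5000 := by gcongr
  have b3 : (∑ i ∈ s, |(ν i : ℝ)| * d i) * ((Chebyshev.psi (x / 3161600) + x / 3161600) * (x / 3161600) / (4 * x)) ≤
      4930000 * ((1.1075 * (x / 3161600) + x / 3161600) * (x / 3161600) / (4 * x)) := by
    have : 0 ≤ Chebyshev.psi (x / 3161600) := Chebyshev.psi_nonneg _
    gcongr
  have b3' : 4930000 * ((1.1075 * (x / 3161600) + x / 3161600) * (x / 3161600) / (4 * x)) ≤ 0.00000026 * x := by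
    have : 4930000 * ((1.1075 * (x / 3161600) + x / 3161600) * (x / 3161600) / (4 * x)) =
      (4930000 * 2.1075 / (4 * 3161600 ^ 2)) * x := by field_simp; norm_num
    rw [this]; gcongr; norm_num
  have b5 : Real.log ((1 + 1 / 800) * x + 1) ≤ 0.0000000001 * x := by
    have h27 : 10 ^ 12 ≤ x := by nlinarith
    have := Real.log_le_sub_one_of_pos (x := ((1 + 1 / 800) * x + 1) / (10^11 : ℝ)) (by positivity)
    rw [Real.log_div (by positivity) (by positivity), Real.log_pow] at this
    have := log_ten_lt
    push_cast at *
    nlinarith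
  have b4 : 1 / 800 * (2 * |∑ i ∈ s, (ν i : ℝ) / d i| * x +
        (∑ i ∈ s, |(ν i : ℝ)|) * (2 + Real.log ((1 + 1 / 800) * x + 1))) ≤
      1 / 800 * (2 * 0.000000000001 * x + 2500 * (2 + 0.0000000001 * x)) := by
    have : 0 ≤ Real.log ((1 + 1 / 800) * x + 1) := Real.log_nonneg (by nlinarith)
    gcongr
  have h27 : 10 ^ 12 ≤ x := by nlinarith
  have hc : 0 ≤ 0.00061 * ε + 0.00000026 + 0.000000001 := by positivity
  refine le_trans ?_ (mul_le_mul_of_nonneg_left hx2 hc)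
  nlinarith

lemma contraction_step (s : Finset ℕ) (ν : ℕ → ℤ) (d : ℕ → ℕ) (hd : ∀ i ∈ s, 0 < d i)
    (h1 : floorSum s ν d 1 = 1)
    (hκ : ∑ i ∈ Finset.Ico 1 3161600, cellWeight (floorSum s ν d) 800 i ≤ 0.00061)
    (hη : |∑ i ∈ s, (ν i : ℝ) / d i| ≤ 0.000000000001) (hT : ∑ i ∈ s, |(ν i : ℝ)| * d i ≤ 4930000)
    (hA : ∑ i ∈ s, |(ν i : ℝ)| ≤ 2500) {l ε : ℝ} (hl : 13 ≤ l) (hε0 : 0 ≤ ε)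
    (h : ∀ v, Real.exp l ≤ v → v ≤ Real.exp 5000 → |psiRem v / v| ≤ ε) {y : ℝ}
    (hy : Real.exp (l + 15) ≤ y) (hy2 : y ≤ Real.exp 5000) :
    |psiRem y / y| ≤ 0.48832 * ε + 0.000835 := by
  have hyp : 0 < y := (Real.exp_pos _).trans_le hy
  have hl13 : 440000 ≤ Real.exp (l + 15) := by
    refine (exp_ge_of_le (c := 440000) 13 (by norm_num)).trans ?_
    gcongr; push_cast; linarith
  have w1 := window_bound s ν d hd h1 hκ hη hT hA hl hε0 h hy hy2 (x := y) (div_le_self hyp.le (by norm_num)) le_rfl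
  have w2 := window_bound s ν d hd h1 hκ hη hT hA hl hε0 h hy hy2 le_rfl (div_le_self hyp.le (by norm_num))
  rw [mul_div_cancel₀ y (by norm_num : (1 + 1 / 800 : ℝ) ≠ 0)] at w2
  have := abs_psiRem_le_of_window (M := 800) (by norm_num) (b := 0.00061 * ε + 0.00000026 + 0.000000001) (y := y)
    (by linarith) (by positivity) (by push_cast; exact w1) (by push_cast; exact w2)
  push_cast at this
  nlinarith

lemma log_div_antitone {a b : ℝ} (ha : 13 ≤ a) (hab : a ≤ b) :
    (Real.log b - 1.1) / b ≤ (Real.log a - 1.1) / a := by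
  have ha0 : 0 < a := by linarith
  have hb0 : 0 < b := by linarith
  have h1 := Real.log_le_sub_one_of_pos (x := b / a) (by positivity)
  rw [Real.log_div (by positivity) (by positivity)] at h1
  have h2 : 2.1 ≤ Real.log a := by
    have := Real.log_le_log (by norm_num) (show (12:ℝ) ≤ a by linarith)
    rw [show (12:ℝ) = 2 * 6 by norm_num, Real.log_mul (by norm_num) (by norm_num)] at this
    linarith [log_six_bounds.1, Real.log_two_gt_d9]
  rw [div_le_div_iff₀ (by linarith) ha0]
  have h3 : a * (Real.log b - Real.log a) ≤ b - a := by
    have : a * (b / a - 1) = b - a := by field_simp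
    nlinarith
  nlinarith

lemma psiRem_div_eq {v : ℝ} (hv : 1 ≤ v) : psiRem v / v = Chebyshev.psi v / v - 1 := by
  unfold psiRem
  rw [if_pos hv, sub_div, div_self (by linarith)]

lemma psiRem_chain (s : Finset ℕ) (ν : ℕ → ℤ) (d : ℕ → ℕ) (hd : ∀ i ∈ s, 0 < d i)
    (h1 : floorSum s ν d 1 = 1)
    (hκ : ∑ i ∈ Finset.Ico 1 3161600, cellWeight (floorSum s ν d) 800 i ≤ 0.00061)
    (hη : |∑ i ∈ s, (ν i : ℝ) / d i| ≤ 0.000000000001) (hT : ∑ i ∈ s, |(ν i : ℝ)| * d i ≤ 4930000)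
    (hA : ∑ i ∈ s, |(ν i : ℝ)| ≤ 2500) (n : ℕ) {v : ℝ} (hv : Real.exp (13 + 15 * n) ≤ v)
    (hv2 : v ≤ Real.exp 5000) : |psiRem v / v| ≤ 0.1059 * 0.48832 ^ n + 0.001632 := by
  induction n generalizing v with
  | zero =>
    rw [Nat.cast_zero, mul_zero, add_zero] at hv
    have hv0 : 0 < v := (Real.exp_pos _).trans_le hv
    have hl : 13 ≤ Real.log v := (Real.le_log_iff_exp_le hv0).mpr hv
    have := psi_le_of_log_ge_thirteen hv0 hl
    have := psi_ge_of_log_ge_ten hv0 (by linarith)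
    rw [psiRem_div_eq (by linarith [Real.add_one_le_exp 13]), abs_le]
    constructor
    · have : 0.9164 ≤ Chebyshev.psi v / v := by rwa [le_div_iff₀ hv0]
      linarith
    · have : Chebyshev.psi v / v ≤ 1.1075 := by rwa [div_le_iff₀ hv0]
      linarith
  | succ n ih =>
    have := contraction_step s ν d hd h1 hκ hη hT hA (l := 13 + 15 * n)
      (by nlinarith [(Nat.cast_nonneg n : (0:ℝ) ≤ n)])
      (by positivity) (fun v h1 h2 ↦ ih h1 h2) (y := v) (by refine le_trans (le_of_eq ?_) hv; push_cast; ring_nf) hv2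
    rw [pow_succ]
    linarith

lemma psi_le_of_window_weights (s : Finset ℕ) (ν : ℕ → ℤ) (d : ℕ → ℕ) (hd : ∀ i ∈ s, 0 < d i)
    (h1 : floorSum s ν d 1 = 1)
    (hκ : ∑ i ∈ Finset.Ico 1 3161600, cellWeight (floorSum s ν d) 800 i ≤ 0.00061)
    (hη : |∑ i ∈ s, (ν i : ℝ) / d i| ≤ 0.000000000001) (hT : ∑ i ∈ s, |(ν i : ℝ)| * d i ≤ 4930000)
    (hA : ∑ i ∈ s, |(ν i : ℝ)| ≤ 2500) {x : ℝ} (hx : 0 < x) (hl : 13 ≤ Real.log x) :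
    Chebyshev.psi x ≤ (1 + (Real.log (Real.log x) - 1.1) / Real.log x) * x := by
  have l2 := Real.log_two_gt_d9
  have l3 := log_three_bounds
  have l5 := log_five_bounds
  have of_le {b c : ℝ} (hlb : Real.log x ≤ b) (hb : c * b ≤ Real.log b - 1.1) (hψ : Chebyshev.psi x ≤ (1 + c) * x) :
      Chebyshev.psi x ≤ (1 + (Real.log (Real.log x) - 1.1) / Real.log x) * x := by
    refine hψ.trans ?_
    have := log_div_antitone hl hlb
    have hb0 : 0 < b := by linarith
    have : c ≤ (Real.log b - 1.1) / b := by rwa [le_div_iff₀ hb0]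
    gcongr
    linarith
  have of_chain (n : ℕ) (hn : 13 + 15 * n ≤ Real.log x) (h5 : Real.log x ≤ 5000) :
      Chebyshev.psi x ≤ (1 + (0.1059 * 0.48832 ^ n + 0.001632)) * x := by
    have hx1 : 1 ≤ x := by
      have := Real.log_le_sub_one_of_pos hx
      linarith
    have := psiRem_chain s ν d hd h1 hκ hη hT hA n ((Real.le_log_iff_exp_le hx).mp hn) ((Real.log_le_iff_le_exp hx).mp h5)
    rw [psiRem_div_eq hx1, abs_le] at this
    have h2 : Chebyshev.psi x / x ≤ 1 + (0.1059 * 0.48832 ^ n + 0.001632) := by linarith [this.2]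
    rwa [div_le_iff₀ hx] at h2
  by_cases c1 : Real.log x ≤ 14.8
  · refine of_le c1 (c := 0.1075) ?_ ?_
    · have : Real.log 14.8 = Real.log 3 + Real.log 5 - Real.log (15 / 14.8) := by
        rw [← Real.log_mul (by norm_num) (by norm_num), ← Real.log_div (by norm_num) (by norm_num)]; norm_num
      have h := Real.log_le_sub_one_of_pos (x := 15 / 14.8) (by norm_num)
      rw [this]
      norm_num at h ⊢
      linarith [l3.1, l5.1]
    · linarith [psi_le_of_log_ge_thirteen hx hl]
  rw [not_le] at c1
  by_cases c2 : Real.log x ≤ 17.4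
  · refine of_le c2 (c := 0.0862) ?_ ?_
    · have := Real.log_le_log (by norm_num) (show (15:ℝ) ≤ 17.4 by norm_num)
      rw [show (15:ℝ) = 3 * 5 by norm_num, Real.log_mul (by norm_num) (by norm_num)] at this
      linarith [l3.1, l5.1]
    · linarith [psi_le_of_log_ge_fourteen hx c1.le]
  rw [not_le] at c2
  by_cases c3 : Real.log x ≤ 28.1
  · refine of_le c3 (c := 0.0795) ?_ ?_
    · have : Real.log 28.1 = Real.log (3 ^ 3) - Real.log (27 / 28.1) := by
        rw [← Real.log_div (by norm_num) (by norm_num)]; norm_num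
      have h := Real.log_le_sub_one_of_pos (x := 27 / 28.1) (by norm_num)
      rw [Real.log_pow] at this
      rw [this]
      norm_num at h ⊢
      linarith [l3.1]
    · linarith [psi_le_of_log_ge_seventeen hx c2.le]
  rw [not_le] at c3
  by_cases c4 : Real.log x ≤ 43
  · refine of_le c4 (c := 0.054) ?_ ?_
    · have := Real.log_le_log (by norm_num) (show (32:ℝ) ≤ 43 by norm_num)
      rw [show (32:ℝ) = 2 ^ 5 by norm_num, Real.log_pow] at this
      push_cast at this
      linarith
    · have := of_chain 1 (by norm_num; linarith) (by linarith)
      norm_num at this ⊢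
      linarith
  rw [not_le] at c4
  by_cases c5 : Real.log x ≤ 58
  · refine of_le c5 (c := 0.028) ?_ ?_
    · have := Real.log_le_log (by norm_num) (show (32:ℝ) ≤ 58 by norm_num)
      rw [show (32:ℝ) = 2 ^ 5 by norm_num, Real.log_pow] at this
      push_cast at this
      linarith
    · have := of_chain 2 (by norm_num; linarith) (by linarith)
      norm_num at this ⊢
      linarith
  rw [not_le] at c5
  by_cases c6 : Real.log x ≤ 300
  · refine of_le c6 (c := 0.0144) ?_ ?_
    · have := Real.log_le_log (by norm_num) (show (256:ℝ) ≤ 300 by norm_num)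
      rw [show (256:ℝ) = 2 ^ 8 by norm_num, Real.log_pow] at this
      push_cast at this
      linarith
    · have := of_chain 3 (by norm_num; linarith) (by linarith)
      norm_num at this ⊢
      linarith
  rw [not_le] at c6
  by_cases c7 : Real.log x ≤ Real.exp 8.39
  · refine of_le c7 (c := 0.00165) ?_ ?_
    · rw [Real.log_exp]
      linarith [exp_eight_lt]
    · have := of_chain 14 (by norm_num; linarith) (by linarith [exp_eight_lt])
      norm_num at this ⊢
      linarith
  rw [not_le] at c7
  have hlx : 0 < Real.log x := by linarith
  have h := psiErr_exp_le (l := Real.log (Real.log x)) ((Real.le_log_iff_exp_le hlx).mpr c7.le)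
  rw [Real.exp_log hlx, psiErr, Real.exp_log hx, Real.exp_neg, Real.exp_log hx] at h
  have h2 : Chebyshev.psi x * x⁻¹ ≤ 1 + (Real.log (Real.log x) - 1.1) / Real.log x := by linarith
  rwa [← div_eq_mul_inv, div_le_iff₀ hx] at h2

end

/-- The natural number with base-`2 ^ w` digits `f 0, …, f (n - 1)`, lowest first. -/
def pack (w : ℕ) (f : ℕ → ℕ) (n : ℕ) : ℕ := ∑ k ∈ Finset.range n, f k * 2 ^ (w * k)

lemma pack_zero (w : ℕ) (f : ℕ → ℕ) : pack w f 0 = 0 := rfl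

lemma pack_succ (w : ℕ) (f : ℕ → ℕ) (n : ℕ) : pack w f (n + 1) = pack w f n + f n * 2 ^ (w * n) :=
  Finset.sum_range_succ ..

lemma pack_congr {w n : ℕ} {f g : ℕ → ℕ} (h : ∀ k < n, f k = g k) : pack w f n = pack w g n :=
  Finset.sum_congr rfl fun k hk ↦ by rw [h k (Finset.mem_range.1 hk)]

lemma pack_add_index (w : ℕ) (f : ℕ → ℕ) (m n : ℕ) :
    pack w f (m + n) = pack w f m + 2 ^ (w * m) * pack w (fun k ↦ f (m + k)) n := by
  unfold pack
  rw [Finset.sum_range_add, Finset.mul_sum]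
  congr 1
  refine Finset.sum_congr rfl fun k _ ↦ ?_
  rw [mul_add, pow_add]
  ring

lemma pack_add (w : ℕ) (f g : ℕ → ℕ) (n : ℕ) :
    pack w (fun k ↦ f k + g k) n = pack w f n + pack w g n := by
  unfold pack
  rw [← Finset.sum_add_distrib]
  simp_rw [add_mul]

lemma pack_mul (w : ℕ) (c : ℕ) (f : ℕ → ℕ) (n : ℕ) :
    pack w (fun k ↦ c * f k) n = c * pack w f n := by
  unfold pack
  rw [Finset.mul_sum]
  simp_rw [mul_assoc]

lemma pack_sum {ι : Type*} (s : Finset ι) (w : ℕ) (f : ι → ℕ → ℕ) (n : ℕ) :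
    pack w (fun k ↦ ∑ i ∈ s, f i k) n = ∑ i ∈ s, pack w (f i) n := by
  unfold pack
  rw [Finset.sum_comm]
  simp_rw [Finset.sum_mul]

lemma pack_lt {w n : ℕ} {f : ℕ → ℕ} (h : ∀ k < n, f k < 2 ^ w) : pack w f n < 2 ^ (w * n) := by
  induction n with
  | zero => simp [pack_zero]
  | succ n ih =>
    have h1 := ih fun k hk ↦ h k (by omega)
    have h2 : f n + 1 ≤ 2 ^ w := h n (by omega)
    have h3 := Nat.mul_le_mul_right (2 ^ (w * n)) h2
    rw [pack_succ, mul_add, pow_add, mul_one, mul_comm (2 ^ (w * n))]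
    linarith

lemma pack_mod {w m n : ℕ} {f : ℕ → ℕ} (hmn : m ≤ n) (h : ∀ k < m, f k < 2 ^ w) :
    pack w f n % 2 ^ (w * m) = pack w f m := by
  obtain ⟨k, rfl⟩ := Nat.exists_eq_add_of_le hmn
  rw [pack_add_index, Nat.add_mul_mod_self_left, Nat.mod_eq_of_lt (pack_lt h)]

lemma pack_div {w m n : ℕ} {f : ℕ → ℕ} (h : ∀ k < m, f k < 2 ^ w) :
    pack w f (m + n) / 2 ^ (w * m) = pack w (fun k ↦ f (m + k)) n := by
  rw [pack_add_index, Nat.add_mul_div_left _ _ (by positivity), Nat.div_eq_of_lt (pack_lt h), zero_add]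

lemma pack_pack (w m : ℕ) (f : ℕ → ℕ) (n : ℕ) :
    pack (w * m) (fun u ↦ pack w (fun j ↦ f (m * u + j)) m) n = pack w f (m * n) := by
  induction n with
  | zero => rfl
  | succ n ih => rw [pack_succ, ih, mul_add, mul_one, pack_add_index, mul_comm (pack _ _ _), ← mul_assoc]

lemma and_add_mul_two_pow {w a b x y : ℕ} (ha : a < 2 ^ w) (hb : b < 2 ^ w) :
    (a + 2 ^ w * x) &&& (b + 2 ^ w * y) = (a &&& b) + 2 ^ w * (x &&& y) := by
  have hab : a &&& b < 2 ^ w := Nat.and_lt_two_pow _ hb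
  apply Nat.eq_of_testBit_eq
  intro i
  rw [Nat.testBit_and, add_comm a, add_comm b, add_comm (a &&& b), Nat.testBit_two_pow_mul_add _ ha,
    Nat.testBit_two_pow_mul_add _ hb, Nat.testBit_two_pow_mul_add _ hab]
  split_ifs <;> simp

lemma pack_and {w n : ℕ} {f g : ℕ → ℕ} (hf : ∀ k < n, f k < 2 ^ w) (hg : ∀ k < n, g k < 2 ^ w) :
    pack w f n &&& pack w g n = pack w (fun k ↦ f k &&& g k) n := by
  induction n generalizing f g with
  | zero => simp [pack_zero]
  | succ n ih =>
    rw [add_comm n 1, pack_add_index, pack_add_index, pack_add_index]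
    have e (f : ℕ → ℕ) : pack w f 1 = f 0 := by simp [pack]
    rw [e, e, e, mul_one, and_add_mul_two_pow (hf 0 (by omega)) (hg 0 (by omega)),
      ih (fun k hk ↦ hf _ (by omega)) (fun k hk ↦ hg _ (by omega))]

lemma pack_one_mul (w n : ℕ) : (2 ^ w - 1) * pack w (fun _ ↦ 1) n = 2 ^ (w * n) - 1 := by
  unfold pack
  simp_rw [one_mul, pow_mul]
  rw [mul_comm]
  exact geom_sum_mul_of_one_le Nat.one_le_two_pow n

/-- Call-by-value application: the kernel evaluates `v` to a literal before substituting it. -/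
def force (v : ℕ) (k : ℕ → ℕ) : ℕ := Nat.rec (k 0) (fun n _ ↦ k (Nat.succ n)) v

/-- Bit `t` is set when the odd divisor `2 * t + 1` has weight `1`. -/
def posMask : ℕ :=
  33167549315098540874642141535106073004723865004199674151074889997060246154000748550130187470823758634366777619534885641631695880615914531604313351502369808422180559197017160418024901349322809320974202498996810239081429298676952747805792266939777693043057250500237646079962002256784731932258243582909650019782556608841466764536335633203449991098152559312255903371824676678431004781204070609271950833526491869824314392288574966564491956886086474790525687535871730784518138183044955758700437006925819382608082862140478984566147537025017701955276853758376823281537600761971783468885821433067066938907886721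

/-- Bit `t` is set when the odd divisor `2 * t + 1` has weight `-1`. -/
def negMask : ℕ :=
  73553451839865021777253149729822610961811611106351225315989097659180351416061611623512734321382381603376269921013330971829592230956570865036997175875874845044048126268649778903327270943804040097240628920940061129892191477717539663658929643878634372094421300920357696955901295452629613131165145890957288942217533546140675308585565149370076112608484580471135769497052234235928167040578221564390602282766078521803489375336407677146503455779446476787194742874497965816534459297238940997304047533958240049677033090799367773137056877667443127970188677412644384619562798992018992904454589304562190292385844078

/-- The sum of `f` over `[t, t + 2 ^ j)`, evaluated as a balanced binary tree. -/
def treeSum (f : ℕ → ℕ) (j : ℕ) : ℕ → ℕ :=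
  Nat.rec (fun t ↦ f t) (fun j r t ↦ Nat.add (r t) (r (Nat.add t (Nat.shiftLeft 1 j)))) j

/-- `2 ^ c` ones, `D` bits apart. -/
def repBits (D c : ℕ) : ℕ :=
  Nat.rec 1 (fun j r ↦ Nat.add r (Nat.shiftLeft r (Nat.mul D (Nat.shiftLeft 1 j)))) c

/-- For odd `d`, the least `h` such that `d` divides `b + 2 * h`. -/
def startIdx (b d : ℕ) : ℕ := Nat.mod (Nat.mul (Nat.sub d (Nat.mod b d)) (Nat.div (Nat.succ d) 2)) d

/-- Ones in the 10-bit digits `h` for which `d` divides `b + 2 * h`. -/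
def progBits (b d c : ℕ) : ℕ := Nat.shiftLeft (repBits (Nat.mul 10 d) c) (Nat.mul 10 (startIdx b d))

def selBits (m b c t : ℕ) : ℕ := cond (Nat.testBit m t) (progBits b (Nat.succ (Nat.mul 2 t)) c) 0

/-- Divisor counts of `b + 2 * h`, over all divisors in the mask `m`. -/
def countOdd (K m b : ℕ) : ℕ :=
  Nat.rec (selBits m b K 0)
    (fun j r ↦ Nat.add r (treeSum (selBits m b (Nat.sub K (Nat.succ j))) j (Nat.shiftLeft 1 j))) 11

/-- Divisor counts of `b + 2 * h`, over the divisors in the mask `m` that exceed `2048`. -/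
def countEven (K m b : ℕ) : ℕ := treeSum (selBits m b (Nat.sub K 11)) 10 1024

def spreadStep (K s x : ℕ) : ℕ :=
  force x fun x ↦
  force (Nat.land x (Nat.mul (Nat.sub (Nat.shiftLeft 1 (Nat.shiftLeft 10 s)) 1)
    (repBits (Nat.shiftLeft 64 s) (Nat.sub (Nat.sub K s) 1)))) fun y ↦
  Nat.add y (Nat.shiftLeft (Nat.sub x y) (Nat.shiftLeft 22 s))

/-- Moves `2 ^ s` digits that are 10 bits apart to positions 32 bits apart. -/
def spread (K s : ℕ) : ℕ → ℕ := Nat.rec (fun x ↦ x) (fun s r x ↦ r (spreadStep K s x)) s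

def truncDigits (K x : ℕ) : ℕ := Nat.land x (Nat.sub (Nat.shiftLeft 1 (Nat.mul 10 (Nat.shiftLeft 1 K))) 1)

/-- The 16-bit divisor counts of `b, b + 1, …` for even `b`. -/
def eventPack (K m b : ℕ) : ℕ :=
  Nat.add (spread K K (truncDigits K (countEven K m b)))
    (Nat.shiftLeft (spread K K (truncDigits K (countOdd K m (Nat.succ b)))) 16)

def windowPack (K b : ℕ) : ℕ :=
  Nat.div (Nat.sub (Nat.add (eventPack K posMask b) (Nat.shiftLeft 8192 (Nat.shiftLeft 32 K)))
    (eventPack K negMask b)) 65535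

/-- The digitwise absolute difference of `l` and `r`; the digits of `hi` are `2 ^ 15`. -/
def absPack (hi l r : ℕ) : ℕ :=
  force (Nat.add l (Nat.sub hi r)) fun x ↦ force (Nat.land x hi) fun y ↦
  Nat.sub (Nat.add (Nat.mul 2 (Nat.land x (Nat.sub y (Nat.shiftRight y 15)))) r) l

/-- `s₀ + (2 ^ 32 - 1) * s₁`, the moments of the sums of adjacent digits of `z`. -/
def foldPack (ev z : ℕ) : ℕ :=
  force z fun z ↦ force (Nat.land z ev) fun y ↦
  Nat.mod (Nat.add y (Nat.shiftRight (Nat.sub z y) 16)) 18446744065119617025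

def pieceBound (M r i m0 m1 : ℕ) : ℕ :=
  Nat.succ (Nat.div (Nat.mul
    (Nat.add (Nat.sub (Nat.mul (Nat.sub M r) (Nat.mod m0 4294967295)) (Nat.mul 2 (Nat.div m0 4294967295)))
      (Nat.add (Nat.mul (Nat.add r 2) (Nat.mod m1 4294967295)) (Nat.mul 2 (Nat.div m1 4294967295))))
    1000000000000000000) (Nat.mul (Nat.succ M) (Nat.mul i i)))

def pieceSum (mask hi ev W M b a r : ℕ) : ℕ :=
  force (Nat.add (Nat.mul a M) r) fun i ↦
  force (Nat.shiftRight W (Nat.mul 16 (Nat.sub i b))) fun V ↦ force (Nat.land V mask) fun l ↦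
  force (Nat.shiftRight V (Nat.mul 16 a)) fun V ↦
  pieceBound M r i (foldPack ev (absPack hi l (Nat.land V mask)))
    (foldPack ev (absPack hi l (Nat.land (Nat.shiftRight V 16) mask)))

/-- Calls `k` with the constants that `pieceSum` needs for pieces of length `len`. -/
def withMasks (len : ℕ) (k : ℕ → ℕ → ℕ → ℕ) : ℕ :=
  force (Nat.sub (Nat.shiftLeft 1 (Nat.mul 16 len)) 1) fun mask ↦
  force (Nat.mul (Nat.div mask 65535) 32768) fun hi ↦
  force (Nat.mul (Nat.div mask 4294967295) 65535) fun ev ↦ k mask hi ev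

def blockSum (len mask hi ev W M b a q : ℕ) : ℕ :=
  Nat.rec 0 (fun t r ↦ Nat.add r (pieceSum mask hi ev W M b a (Nat.mul len t))) q

def blocksSum (len W M b q w a : ℕ) : ℕ :=
  withMasks len fun mask hi ev ↦
  Nat.rec 0 (fun t r ↦ Nat.add r (blockSum len mask hi ev W M b (Nat.add a t) q)) w

def chunkSum (K M len q w a : ℕ) : ℕ :=
  force (windowPack K (Nat.mul a M)) fun W ↦ blocksSum len W M (Nat.mul a M) q w a

def firstChunkSum (K : ℕ) : ℕ :=
  force (windowPack K 0) fun W ↦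
  Nat.add (blocksSum 100 W 800 0 8 75 1)
    (Nat.add (withMasks 798 fun mask hi ev ↦ pieceSum mask hi ev W 800 0 0 1)
      (withMasks 2 fun mask hi ev ↦ pieceSum mask hi ev W 800 0 0 798))

lemma force_eq (v : ℕ) (k : ℕ → ℕ) : force v k = k v := by cases v <;> rfl

lemma treeSum_eq (f : ℕ → ℕ) (j t : ℕ) : treeSum f j t = ∑ i ∈ Finset.range (2 ^ j), f (t + i) := by
  induction j generalizing t with
  | zero => simp [treeSum]
  | succ j ih =>
    change treeSum f j t + treeSum f j (t + 1 <<< j) = _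
    rw [ih, ih, pow_succ, mul_two, Finset.sum_range_add, Nat.one_shiftLeft]
    simp_rw [add_assoc]

lemma repBits_eq (D c : ℕ) : repBits D c = pack D (fun _ ↦ 1) (2 ^ c) := by
  induction c with
  | zero => simp [repBits, pack]
  | succ c ih =>
    change repBits D c + repBits D c <<< (D * (1 <<< c)) = _
    rw [pow_succ, mul_two, pack_add_index, ih, Nat.shiftLeft_eq, Nat.one_shiftLeft, mul_comm (2 ^ (D * 2 ^ c))]

lemma startIdx_spec (b : ℕ) {d : ℕ} (hd : Odd d) : startIdx b d < d ∧ d ∣ b + 2 * startIdx b d := by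
  have hd0 : 0 < d := hd.pos
  refine ⟨Nat.mod_lt _ hd0, ?_⟩
  obtain ⟨u, rfl⟩ := hd
  change 2 * u + 1 ∣ b + 2 * (((2 * u + 1) - b % (2 * u + 1)) * ((2 * u + 1 + 1) / 2) % (2 * u + 1))
  rw [show (2 * u + 1 + 1) / 2 = u + 1 by omega]
  set d := 2 * u + 1
  have hb : b % d < d := Nat.mod_lt _ hd0
  rw [← Nat.modEq_zero_iff_dvd]
  calc b + 2 * ((d - b % d) * (u + 1) % d)
      ≡ b % d + 2 * ((d - b % d) * (u + 1)) [MOD d] :=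
        Nat.ModEq.add (Nat.mod_modEq _ _).symm (Nat.ModEq.mul_left _ (Nat.mod_modEq _ _))
    _ = b % d + (d - b % d) + d * (d - b % d) := by
        have : 2 * (u + 1) = 1 + d := by simp only [d]; ring
        rw [show 2 * ((d - b % d) * (u + 1)) = (d - b % d) * (2 * (u + 1)) by ring, this]
        ring
    _ = d * (1 + (d - b % d)) := by rw [Nat.add_sub_cancel' hb.le]; ring
    _ ≡ 0 [MOD d] := (Nat.modEq_zero_iff_dvd.2 (dvd_mul_right _ _))

lemma progBits_eq (b c : ℕ) {d : ℕ} (hd : Odd d) :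
    progBits b d c = pack 10 (fun h ↦ if d ∣ b + 2 * h then 1 else 0) (startIdx b d + d * 2 ^ c) := by
  obtain ⟨h1, h2⟩ := startIdx_spec b hd
  change (repBits (10 * d) c) <<< (10 * startIdx b d) = _
  set h₀ := startIdx b d
  have hc : Nat.Coprime d 2 := Nat.coprime_two_right.2 hd
  have h0 : pack 10 (fun h ↦ if d ∣ b + 2 * h then 1 else 0) h₀ = 0 := by
    refine Finset.sum_eq_zero fun h hh ↦ ?_
    rw [Finset.mem_range] at hh
    beta_reduce
    rw [if_neg, zero_mul]
    intro h3
    have h4 := Nat.dvd_sub h2 h3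
    rw [show b + 2 * h₀ - (b + 2 * h) = (h₀ - h) * 2 by omega] at h4
    have h5 := Nat.le_of_dvd (by omega) (hc.dvd_of_dvd_mul_right h4)
    omega
  rw [pack_add_index, h0, zero_add, repBits_eq, Nat.shiftLeft_eq, mul_comm]
  congr 1
  rw [← pack_pack 10 d _ (2 ^ c)]
  refine pack_congr fun u _ ↦ ?_
  unfold pack
  rw [Finset.sum_eq_single 0]
  · beta_reduce
    rw [if_pos]
    · simp
    · rw [show b + 2 * (h₀ + (d * u + 0)) = b + 2 * h₀ + d * (2 * u) by ring]
      exact Dvd.dvd.add h2 (dvd_mul_right _ _)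
  · intro j hj hj0
    rw [Finset.mem_range] at hj
    beta_reduce
    rw [if_neg, zero_mul]
    intro h3
    rw [show b + 2 * (h₀ + (d * u + j)) = b + 2 * h₀ + d * (2 * u) + j * 2 by ring,
      Nat.dvd_add_right (Dvd.dvd.add h2 (dvd_mul_right _ _))] at h3
    exact absurd (Nat.le_of_dvd (by omega) (hc.dvd_of_dvd_mul_right h3)) (by omega)
  · intro h
    exact absurd (Finset.mem_range.2 hd.pos) h

lemma progBits_modEq (b c : ℕ) {d N : ℕ} (hd : Odd d) (hN : N ≤ d * 2 ^ c) :
    progBits b d c ≡ pack 10 (fun h ↦ if d ∣ b + 2 * h then 1 else 0) N [MOD 2 ^ (10 * N)] := by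
  have h : ∀ k < N, (if d ∣ b + 2 * k then 1 else 0) < 2 ^ 10 := fun k _ ↦ by split_ifs <;> norm_num
  rw [progBits_eq b c hd, Nat.ModEq, pack_mod (by omega) h, pack_mod le_rfl h]

lemma selBits_modEq (m b c : ℕ) {t N : ℕ} (hN : N ≤ (2 * t + 1) * 2 ^ c) :
    selBits m b c t ≡ pack 10 (fun h ↦ if m.testBit t ∧ 2 * t + 1 ∣ b + 2 * h then 1 else 0) N
      [MOD 2 ^ (10 * N)] := by
  change cond (m.testBit t) (progBits b (2 * t + 1) c) 0 ≡ _ [MOD _]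
  cases hm : m.testBit t
  · simp [pack, Nat.ModEq]
  · simpa using progBits_modEq b c (odd_two_mul_add_one t) hN

/-- The number of `t ∈ s` with bit `t` set in `m` and `2 * t + 1 ∣ n`. -/
def divisorCount (s : Finset ℕ) (m n : ℕ) : ℕ :=
  ∑ t ∈ s, if m.testBit t ∧ 2 * t + 1 ∣ n then 1 else 0

lemma modEq_sum {ι : Type*} {s : Finset ι} {f g : ι → ℕ} {n : ℕ} (h : ∀ i ∈ s, f i ≡ g i [MOD n]) :
    ∑ i ∈ s, f i ≡ ∑ i ∈ s, g i [MOD n] := by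
  classical
  induction s using Finset.induction_on with
  | empty => rfl
  | insert a s ha ih =>
    rw [Finset.sum_insert ha, Finset.sum_insert ha]
    exact (h a (Finset.mem_insert_self _ _)).add (ih fun i hi ↦ h i (Finset.mem_insert_of_mem hi))

lemma treeSum_modEq (m b c j t : ℕ) {N : ℕ} (hN : N ≤ (2 * t + 1) * 2 ^ c) :
    treeSum (selBits m b c) j t ≡ pack 10 (fun h ↦ divisorCount (Finset.Ico t (t + 2 ^ j)) m (b + 2 * h)) N
      [MOD 2 ^ (10 * N)] := by
  unfold divisorCount
  rw [treeSum_eq, pack_sum, Finset.sum_Ico_eq_sum_range, Nat.add_sub_cancel_left]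
  refine modEq_sum fun i _ ↦ selBits_modEq m b c (hN.trans ?_)
  gcongr
  omega

lemma countEven_modEq {K : ℕ} (hK : 11 ≤ K) (m b : ℕ) :
    countEven K m b ≡ pack 10 (fun h ↦ divisorCount (Finset.Ico 1024 2048) m (b + 2 * h)) (2 ^ K)
      [MOD 2 ^ (10 * 2 ^ K)] := by
  refine treeSum_modEq m b (K - 11) 10 1024 ?_
  calc 2 ^ K = 2 ^ 11 * 2 ^ (K - 11) := by rw [← pow_add, Nat.add_sub_cancel' hK]
    _ ≤ _ := by gcongr; norm_num

lemma countOdd_modEq {K : ℕ} (hK : 11 ≤ K) (m b : ℕ) :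
    countOdd K m b ≡ pack 10 (fun h ↦ divisorCount (Finset.range 2048) m (b + 2 * h)) (2 ^ K)
      [MOD 2 ^ (10 * 2 ^ K)] := by
  have key (i : ℕ) : i ≤ K → Nat.rec (selBits m b K 0)
      (fun j r ↦ Nat.add r (treeSum (selBits m b (Nat.sub K (Nat.succ j))) j (Nat.shiftLeft 1 j))) i ≡
      pack 10 (fun h ↦ divisorCount (Finset.range (2 ^ i)) m (b + 2 * h)) (2 ^ K) [MOD 2 ^ (10 * 2 ^ K)] := by
    induction i with
    | zero =>
      intro _
      simp only [divisorCount, pow_zero, Finset.range_one, Finset.sum_singleton]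
      exact selBits_modEq m b K (t := 0) (N := 2 ^ K) (by simp)
    | succ i ih =>
      intro hi
      have h1 := (ih (by omega)).add (treeSum_modEq m b (K - (i + 1)) i (1 <<< i) (N := 2 ^ K) (by
        rw [Nat.one_shiftLeft]
        calc 2 ^ K = 2 ^ (i + 1) * 2 ^ (K - (i + 1)) := by rw [← pow_add, Nat.add_sub_cancel' hi]
          _ ≤ _ := by gcongr; rw [pow_succ]; omega))
      rw [← pack_add] at h1
      refine h1.trans (congrArg (· % _) (pack_congr fun k _ ↦ ?_))
      rw [divisorCount, divisorCount, divisorCount, Nat.one_shiftLeft, pow_succ, mul_two,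
        ← Finset.sum_range_add_sum_Ico _ (Nat.le_add_right (2 ^ i) (2 ^ i))]
  exact key 11 hK

lemma pack_one (w : ℕ) (f : ℕ → ℕ) : pack w f 1 = f 0 := by simp [pack]

lemma pack_two (w : ℕ) (f : ℕ → ℕ) : pack w f 2 = f 0 + 2 ^ w * f 1 := by
  simp [pack, Finset.sum_range_succ, mul_comm]

lemma truncDigits_eq (K x : ℕ) : truncDigits K x = x % 2 ^ (10 * 2 ^ K) := by
  change x &&& (1 <<< (10 * (1 <<< K)) - 1) = _
  rw [Nat.one_shiftLeft, Nat.one_shiftLeft, Nat.and_two_pow_sub_one_eq_mod]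

lemma spreadStep_eq (K s : ℕ) (A B : ℕ → ℕ) (hA : ∀ u, A u < 2 ^ (10 * 2 ^ s))
    (hB : ∀ u, B u < 2 ^ (10 * 2 ^ s)) :
    spreadStep K s (pack (64 * 2 ^ s) (fun u ↦ A u + 2 ^ (10 * 2 ^ s) * B u) (2 ^ (K - s - 1))) =
      pack (64 * 2 ^ s) (fun u ↦ A u + 2 ^ (32 * 2 ^ s) * B u) (2 ^ (K - s - 1)) := by
  unfold spreadStep
  simp only [force_eq]
  set n := 2 ^ (K - s - 1) with hn
  set X := pack (64 * 2 ^ s) (fun u ↦ A u + 2 ^ (10 * 2 ^ s) * B u) n with hX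
  have hY : Nat.land X (Nat.mul (Nat.sub (Nat.shiftLeft 1 (Nat.shiftLeft 10 s)) 1)
      (repBits (Nat.shiftLeft 64 s) (Nat.sub (Nat.sub K s) 1))) = pack (64 * 2 ^ s) A n := by
    change X &&& ((1 <<< (10 <<< s) - 1) * repBits (64 <<< s) (K - s - 1)) = _
    rw [Nat.shiftLeft_eq 10, Nat.shiftLeft_eq 64, Nat.one_shiftLeft, repBits_eq, ← pack_mul, ← hn, hX]
    rw [pack_and]
    · refine pack_congr fun u _ ↦ ?_
      rw [mul_one, Nat.and_two_pow_sub_one_eq_mod, Nat.add_mul_mod_self_left, Nat.mod_eq_of_lt (hA u)]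
    · intro u _
      calc A u + 2 ^ (10 * 2 ^ s) * B u < 2 ^ (10 * 2 ^ s) * (B u + 1) := by have := hA u; linarith
        _ ≤ 2 ^ (10 * 2 ^ s) * 2 ^ (10 * 2 ^ s) := by gcongr; exact hB u
        _ ≤ 2 ^ (64 * 2 ^ s) := by rw [← pow_add]; gcongr <;> omega
    · intro u _
      calc (2 ^ (10 * 2 ^ s) - 1) * 1 < 2 ^ (10 * 2 ^ s) := by
            have : 0 < 2 ^ (10 * 2 ^ s) := by positivity
            omega
        _ ≤ 2 ^ (64 * 2 ^ s) := by gcongr <;> omega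
  rw [hY]
  change pack (64 * 2 ^ s) A n + (X - pack (64 * 2 ^ s) A n) <<< (22 <<< s) = _
  rw [hX, pack_add, Nat.add_sub_cancel_left, pack_add, pack_mul, pack_mul, Nat.shiftLeft_eq, Nat.shiftLeft_eq,
    mul_right_comm, ← pow_add, ← add_mul]

lemma spread_eq (K : ℕ) {s : ℕ} (hs : s ≤ K) {f : ℕ → ℕ} (hf : ∀ k, f k < 2 ^ 10) :
    spread K s (pack (32 * 2 ^ s) (fun u ↦ pack 10 (fun j ↦ f (2 ^ s * u + j)) (2 ^ s)) (2 ^ (K - s))) =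
      pack 32 f (2 ^ K) := by
  induction s with
  | zero =>
    change pack _ _ _ = _
    simp [pack_one]
  | succ s ih =>
    rw [← ih (by omega)]
    change spread K s (spreadStep K s _) = _
    congr 1
    have e1 : 32 * 2 ^ (s + 1) = 64 * 2 ^ s := by rw [pow_succ]; ring
    have e2 : K - (s + 1) = K - s - 1 := by omega
    have e3 : 2 ^ (K - s) = 2 * 2 ^ (K - s - 1) := by
      rw [← pow_succ', Nat.sub_add_cancel (by omega)]
    have h := spreadStep_eq K s (fun u ↦ pack 10 (fun j ↦ f (2 ^ (s + 1) * u + j)) (2 ^ s))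
      (fun u ↦ pack 10 (fun j ↦ f (2 ^ (s + 1) * u + (2 ^ s + j))) (2 ^ s))
      (fun u ↦ pack_lt fun k _ ↦ hf _) (fun u ↦ pack_lt fun k _ ↦ hf _)
    rw [e1, e2, e3, ← pack_pack, show 32 * 2 ^ s * 2 = 64 * 2 ^ s by ring]
    refine Eq.trans ?_ (h.trans ?_)
    · congr 1
      refine pack_congr fun u _ ↦ ?_
      rw [pow_succ 2 s, mul_two, pack_add_index]
    · refine pack_congr fun u _ ↦ ?_
      rw [pack_two]
      have e4 (j : ℕ) : 2 ^ (s + 1) * u + j = 2 ^ s * (2 * u + 0) + j := by rw [pow_succ]; ring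
      have e5 (j : ℕ) : 2 ^ (s + 1) * u + (2 ^ s + j) = 2 ^ s * (2 * u + 1) + j := by rw [pow_succ]; ring
      exact congrArg₂ (· + 2 ^ (32 * 2 ^ s) * ·) (pack_congr fun j _ ↦ congrArg f (e4 j)) (pack_congr fun j _ ↦ congrArg f (e5 j))

lemma spread_self (K : ℕ) {f : ℕ → ℕ} (hf : ∀ k, f k < 2 ^ 10) :
    spread K K (pack 10 f (2 ^ K)) = pack 32 f (2 ^ K) := by
  simpa [pack_one] using spread_eq K le_rfl hf

/-- The number of odd divisors of `n` in the mask `m`, only those above `2048` when `n` is even. -/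
def eventCount (m n : ℕ) : ℕ :=
  divisorCount (if n % 2 = 0 then Finset.Ico 1024 2048 else Finset.range 2048) m n

lemma divisorCount_lt {m : ℕ} (hm : treeSum (fun t ↦ (m.testBit t).toNat) 11 0 < 2 ^ 10) {s : Finset ℕ}
    (hs : s ⊆ Finset.range 2048) (n : ℕ) : divisorCount s m n < 2 ^ 10 := by
  refine lt_of_le_of_lt ?_ hm
  rw [treeSum_eq]
  simp_rw [zero_add]
  refine (Finset.sum_le_sum_of_subset hs).trans (Finset.sum_le_sum fun t _ ↦ ?_)
  cases m.testBit t <;> simp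
  split_ifs <;> simp

lemma Ico_subset_range_2048 : Finset.Ico 1024 2048 ⊆ Finset.range 2048 := by
  intro t ht
  simp at ht ⊢
  omega

lemma eventCount_lt {m : ℕ} (hm : treeSum (fun t ↦ (m.testBit t).toNat) 11 0 < 2 ^ 10) (n : ℕ) :
    eventCount m n < 2 ^ 10 := by
  unfold eventCount
  split_ifs
  · exact divisorCount_lt hm Ico_subset_range_2048 n
  · exact divisorCount_lt hm subset_rfl n

lemma eventPack_eq {K m b : ℕ} (hK : 11 ≤ K) (hb : b % 2 = 0)
    (hm : treeSum (fun t ↦ (m.testBit t).toNat) 11 0 < 2 ^ 10) :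
    eventPack K m b = pack 16 (fun k ↦ eventCount m (b + k)) (2 * 2 ^ K) := by
  have h1 := countEven_modEq hK m b
  have h2 := countOdd_modEq hK m (b + 1)
  have l1 := fun n ↦ divisorCount_lt hm Ico_subset_range_2048 n
  have l2 := fun n ↦ divisorCount_lt hm (s := Finset.range 2048) subset_rfl n
  rw [Nat.ModEq, ← truncDigits_eq, Nat.mod_eq_of_lt (pack_lt fun _ _ ↦ l1 _)] at h1
  rw [Nat.ModEq, ← truncDigits_eq, Nat.mod_eq_of_lt (pack_lt fun _ _ ↦ l2 _)] at h2
  change spread K K (truncDigits K (countEven K m b)) + (spread K K (truncDigits K (countOdd K m (b + 1)))) <<< 16 = _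
  rw [h1, h2, spread_self K fun _ ↦ l1 _, spread_self K fun _ ↦ l2 _, Nat.shiftLeft_eq, mul_comm, ← pack_mul,
    ← pack_add, ← pack_pack]
  refine pack_congr fun u _ ↦ ?_
  rw [pack_two, eventCount, eventCount, if_pos (by omega), if_neg (by omega)]
  congr 3
  ring

/-- The weight of the odd divisor `2 * t + 1`. -/
def oddWeight (t : ℕ) : ℤ := (posMask.testBit t).toNat - (negMask.testBit t).toNat

/-- The divisors `2 * t + 1` for `t < 2048`, followed by the doubles of the first `1024` of them. -/
def divisorAt (i : ℕ) : ℕ := if i < 2048 then 2 * i + 1 else 2 * (2 * (i - 2048) + 1)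

def weightAt (i : ℕ) : ℤ := if i < 2048 then oddWeight i else -oddWeight (i - 2048)

abbrev weightedFloor : ℕ → ℤ := floorSum (Finset.range 3072) weightAt divisorAt

lemma divisorAt_pos (i : ℕ) : 0 < divisorAt i := by
  unfold divisorAt
  split_ifs <;> omega

lemma sum_range_3072 {R : Type*} [AddCommMonoid R] (g : ℤ → ℕ → R) :
    ∑ i ∈ Finset.range 3072, g (weightAt i) (divisorAt i) =
      ∑ t ∈ Finset.range 2048, g (oddWeight t) (2 * t + 1) +
      ∑ t ∈ Finset.range 1024, g (-oddWeight t) (2 * (2 * t + 1)) := by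
  rw [← Finset.sum_range_add_sum_Ico _ (show 2048 ≤ 3072 by norm_num), Finset.sum_Ico_eq_sum_range]
  refine congrArg₂ (· + ·) ?_ ?_
  · refine Finset.sum_congr rfl fun t ht ↦ ?_
    rw [Finset.mem_range] at ht
    simp [weightAt, divisorAt, ht]
  · refine Finset.sum_congr rfl fun t ht ↦ ?_
    simp [weightAt, divisorAt]

lemma divisorCount_sub (s : Finset ℕ) (n : ℕ) :
    (divisorCount s posMask n : ℤ) - divisorCount s negMask n =
      ∑ t ∈ s, if 2 * t + 1 ∣ n then oddWeight t else 0 := by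
  unfold divisorCount oddWeight
  push_cast
  rw [← Finset.sum_sub_distrib]
  refine Finset.sum_congr rfl fun t _ ↦ ?_
  cases posMask.testBit t <;> cases negMask.testBit t <;> by_cases h : 2 * t + 1 ∣ n <;> simp [h]

lemma weightedFloor_succ (n : ℕ) :
    weightedFloor (n + 1) - weightedFloor n =
      (eventCount posMask (n + 1) : ℤ) - eventCount negMask (n + 1) := by
  have h1 : weightedFloor (n + 1) - weightedFloor n =
      ∑ i ∈ Finset.range 3072, if divisorAt i ∣ n + 1 then weightAt i else 0 := by
    unfold weightedFloor floorSum
    rw [← Finset.sum_sub_distrib]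
    refine Finset.sum_congr rfl fun i _ ↦ ?_
    rw [Nat.succ_div]
    split_ifs <;> push_cast <;> ring
  rw [h1, sum_range_3072 (fun w d ↦ if d ∣ n + 1 then w else 0), eventCount, eventCount, divisorCount_sub]
  have hc (t : ℕ) : Nat.Coprime (2 * t + 1) 2 := by simp
  split_ifs with h
  · have h2 (t : ℕ) : 2 * (2 * t + 1) ∣ n + 1 ↔ 2 * t + 1 ∣ n + 1 :=
      ⟨fun h ↦ (Dvd.intro_left _ rfl).trans h, fun h' ↦ (hc t).symm.mul_dvd_of_dvd_of_dvd (Nat.dvd_of_mod_eq_zero h) h'⟩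
    simp_rw [h2]
    rw [← Finset.sum_range_add_sum_Ico _ (show 1024 ≤ 2048 by norm_num), add_right_comm, ← Finset.sum_add_distrib]
    rw [Finset.sum_eq_zero, zero_add]
    intro t _
    split_ifs <;> simp
  · rw [Finset.sum_eq_zero (s := Finset.range 1024), add_zero]
    intro t _
    rw [if_neg]
    intro h2
    exact h (Nat.mod_eq_zero_of_dvd ((Dvd.intro _ rfl).trans h2))

lemma sum_pack_telescope (X : ℤ) (e F : ℕ → ℤ) (h : ∀ k, e (k + 1) = F k - F (k + 1)) (n : ℕ) :
    ∑ k ∈ Finset.range (n + 1), e k * X ^ k + F n * X ^ (n + 1) =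
      (X - 1) * ∑ k ∈ Finset.range (n + 1), F k * X ^ k + (F 0 + e 0) := by
  induction n with
  | zero => simp; ring
  | succ n ih =>
    rw [Finset.sum_range_succ, Finset.sum_range_succ _ (n + 1), mul_add, h]
    linear_combination ih

lemma windowPack_eq {K b Z : ℕ} (hK : 11 ≤ K) (hb : b % 2 = 0) (hZ : b + 2 * 2 ^ K ≤ Z)
    (hP : treeSum (fun t ↦ (posMask.testBit t).toNat) 11 0 < 2 ^ 10)
    (hN : treeSum (fun t ↦ (negMask.testBit t).toNat) 11 0 < 2 ^ 10)
    (hE : ∀ x ≤ Z, ∀ y ≤ Z, |weightedFloor x - weightedFloor y| ≤ 5000) :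
    windowPack K b = pack 16 (fun k ↦ (8192 + weightedFloor (b + (2 * 2 ^ K - 1)) - weightedFloor (b + k)).toNat)
      (2 * 2 ^ K) := by
  set n := 2 * 2 ^ K - 1 with hn
  have hn1 : 2 * 2 ^ K = n + 1 := by
    have : 0 < 2 ^ K := by positivity
    omega
  set F : ℕ → ℤ := fun k ↦ 8192 + weightedFloor (b + n) - weightedFloor (b + k) with hF
  have hF0 (k : ℕ) (hk : k < n + 1) : 3192 ≤ F k ∧ F k ≤ 13192 := by
    have := abs_le.1 (hE (b + n) (by omega) (b + k) (by omega))
    simp only [hF]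
    omega
  set e : ℕ → ℤ := fun k ↦ (eventCount posMask (b + k) : ℤ) - eventCount negMask (b + k) with he
  have key := sum_pack_telescope (2 ^ 16) e F (fun k ↦ by
    simp only [he, hF]
    have := weightedFloor_succ (b + k)
    rw [add_assoc] at this
    linarith) n
  have pc (f : ℕ → ℕ) : ((pack 16 f (n + 1) : ℕ) : ℤ) = ∑ k ∈ Finset.range (n + 1), (f k : ℤ) * (2 ^ 16) ^ k := by
    unfold pack
    simp only [Nat.cast_sum, Nat.cast_mul, Nat.cast_pow, Nat.cast_ofNat, pow_mul]
  have e0 := eventCount_lt hP b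
  have e1 := eventCount_lt hN b
  have ee : e 0 = (eventCount posMask b : ℤ) - eventCount negMask b := rfl
  change (eventPack K posMask b + 8192 <<< (32 <<< K) - eventPack K negMask b) / 65535 = _
  rw [eventPack_eq hK hb hP, eventPack_eq hK hb hN, hn1, Nat.shiftLeft_eq, Nat.shiftLeft_eq]
  have hS : 2 ^ (32 * 2 ^ K) = (2 ^ 16) ^ (n + 1) := by
    rw [← pow_mul, ← hn1]; ring_nf
  rw [hS]
  have hFn : F n = 8192 := by simp [hF]
  have h1 : ((pack 16 (fun k ↦ eventCount posMask (b + k)) (n + 1) + 8192 * (2 ^ 16) ^ (n + 1) : ℕ) : ℤ) -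
      (pack 16 (fun k ↦ eventCount negMask (b + k)) (n + 1) : ℕ) =
      65535 * (pack 16 (fun k ↦ (F k).toNat) (n + 1) : ℕ) + (F 0 + e 0) := by
    have hF1 : ∑ k ∈ Finset.range (n + 1), ((F k).toNat : ℤ) * (2 ^ 16) ^ k =
        ∑ k ∈ Finset.range (n + 1), F k * (2 ^ 16) ^ k := Finset.sum_congr rfl fun k hk ↦ by
      rw [Int.toNat_of_nonneg (by linarith [(hF0 k (Finset.mem_range.1 hk)).1])]
    rw [Nat.cast_add, Nat.cast_mul, Nat.cast_pow, pc, pc, pc, hF1]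
    simp only [Nat.cast_pow, Nat.cast_ofNat]
    rw [hFn] at key
    simp only [he, sub_mul, Finset.sum_sub_distrib] at key
    simp only [he]
    linear_combination key
  obtain ⟨r, hr⟩ : ∃ r : ℕ, (r : ℤ) = F 0 + e 0 := ⟨(F 0 + e 0).toNat, Int.toNat_of_nonneg (by
    have := hF0 0 (by omega)
    omega)⟩
  have hr2 : r < 65535 := by
    have := hF0 0 (by omega)
    omega
  have h2 : pack 16 (fun k ↦ eventCount posMask (b + k)) (n + 1) + 8192 * (2 ^ 16) ^ (n + 1) -
      pack 16 (fun k ↦ eventCount negMask (b + k)) (n + 1) = r + 65535 * pack 16 (fun k ↦ (F k).toNat) (n + 1) := by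
    rw [← hr] at h1
    generalize pack 16 (fun k ↦ eventCount negMask (b + k)) (n + 1) = a1 at *
    generalize pack 16 (fun k ↦ eventCount posMask (b + k)) (n + 1) + 8192 * (2 ^ 16) ^ (n + 1) = a2 at *
    omega
  rw [h2, Nat.add_mul_div_left _ _ (by norm_num), Nat.div_eq_of_lt hr2, zero_add]

lemma absPack_eq {n : ℕ} {f g : ℕ → ℕ} (hf : ∀ k < n, f k < 2 ^ 15) (hg : ∀ k < n, g k < 2 ^ 15) :
    absPack (pack 16 (fun _ ↦ 2 ^ 15) n) (pack 16 f n) (pack 16 g n) =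
      pack 16 (fun k ↦ f k - g k + (g k - f k)) n := by
  unfold absPack
  simp only [force_eq]
  set hi := pack 16 (fun _ ↦ 2 ^ 15) n with hhi
  set c : ℕ → ℕ := fun k ↦ if g k ≤ f k then 1 else 0 with hc
  have hx : Nat.add (pack 16 f n) (Nat.sub hi (pack 16 g n)) = pack 16 (fun k ↦ f k + (2 ^ 15 - g k)) n := by
    change pack 16 f n + (hi - pack 16 g n) = _
    have : hi = pack 16 (fun k ↦ 2 ^ 15 - g k) n + pack 16 g n := by
      rw [← pack_add]
      exact pack_congr fun k hk ↦ (Nat.sub_add_cancel (hg k hk).le).symm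
    rw [this, Nat.add_sub_cancel, ← pack_add]
  have hX (k : ℕ) (hk : k < n) : f k + (2 ^ 15 - g k) < 2 ^ 16 := by
    have := hf k hk
    omega
  rw [hx]
  set x := pack 16 (fun k ↦ f k + (2 ^ 15 - g k)) n with hxd
  have hy : Nat.land x hi = 2 ^ 15 * pack 16 c n := by
    change x &&& hi = _
    rw [hxd, hhi, pack_and hX (fun _ _ ↦ by norm_num), ← pack_mul]
    refine pack_congr fun k hk ↦ ?_
    have := hf k hk
    have := hg k hk
    rw [Nat.and_two_pow, Nat.testBit_eq_decide_div_mod_eq]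
    simp only [hc]
    split_ifs with h
    · rw [show (f k + (2 ^ 15 - g k)) / 2 ^ 15 = 1 by omega]
      simp
    · rw [show (f k + (2 ^ 15 - g k)) / 2 ^ 15 = 0 by omega]
      simp
  have hy2 : Nat.sub (Nat.land x hi) (Nat.shiftRight (Nat.land x hi) 15) = pack 16 (fun k ↦ (2 ^ 15 - 1) * c k) n := by
    rw [hy]
    change 2 ^ 15 * pack 16 c n - (2 ^ 15 * pack 16 c n) >>> 15 = _
    rw [Nat.shiftRight_eq_div_pow, Nat.mul_div_cancel_left _ (by positivity), pack_mul, Nat.sub_mul, one_mul]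
  have hz : Nat.land x (pack 16 (fun k ↦ (2 ^ 15 - 1) * c k) n) = pack 16 (fun k ↦ f k - g k) n := by
    change x &&& _ = _
    rw [hxd, pack_and hX (fun k _ ↦ by simp only [hc]; split_ifs <;> norm_num)]
    refine pack_congr fun k hk ↦ ?_
    have := hf k hk
    have := hg k hk
    simp only [hc]
    split_ifs with h
    · rw [mul_one, Nat.and_two_pow_sub_one_eq_mod]
      omega
    · rw [mul_zero, Nat.and_zero]
      omega
  rw [hy2, hz]
  change 2 * pack 16 (fun k ↦ f k - g k) n + pack 16 g n - pack 16 f n = _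
  rw [← pack_mul, ← pack_add, Nat.sub_eq_iff_eq_add, ← pack_add]
  · refine pack_congr fun k _ ↦ ?_
    omega
  · refine Finset.sum_le_sum fun k _ ↦ Nat.mul_le_mul_right _ ?_
    change f k ≤ 2 * (f k - g k) + g k
    omega

lemma one_add_pow_modEq (Q u : ℕ) : (Q + 1) ^ u ≡ 1 + u * Q [MOD Q ^ 2] := by
  induction u with
  | zero => simp [Nat.ModEq]
  | succ u ih =>
    rw [pow_succ]
    refine (ih.mul_right _).trans ?_
    rw [show (1 + u * Q) * (Q + 1) = 1 + (u + 1) * Q + Q ^ 2 * u by ring]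
    simp [Nat.ModEq]

lemma foldPack_eq {n : ℕ} (hn : n ≤ 400) {D : ℕ → ℕ} (hD : ∀ k < 2 * n, D k < 2 ^ 14) :
    foldPack (pack 32 (fun _ ↦ 65535) n) (pack 16 D (2 * n)) =
      ∑ u ∈ Finset.range n, (D (2 * u) + D (2 * u + 1)) +
        4294967295 * ∑ u ∈ Finset.range n, u * (D (2 * u) + D (2 * u + 1)) ∧
    ∑ u ∈ Finset.range n, (D (2 * u) + D (2 * u + 1)) < 4294967295 ∧
    ∑ u ∈ Finset.range n, u * (D (2 * u) + D (2 * u + 1)) < 4294967295 := by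
  set P : ℕ → ℕ := fun u ↦ D (2 * u) + D (2 * u + 1) with hP
  have hP2 (u : ℕ) (hu : u < n) : P u ≤ 2 ^ 15 := by
    have := hD (2 * u) (by omega)
    have := hD (2 * u + 1) (by omega)
    simp only [hP]
    omega
  have b0 : ∑ u ∈ Finset.range n, P u < 4294967295 := by
    have : ∑ u ∈ Finset.range n, P u ≤ (Finset.range n).card • 2 ^ 15 :=
      Finset.sum_le_card_nsmul _ P _ fun u hu ↦ hP2 u (Finset.mem_range.1 hu)
    rw [Finset.card_range, smul_eq_mul] at this
    omega
  have b1 : ∑ u ∈ Finset.range n, u * P u < 4294967295 := by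
    have h : ∑ u ∈ Finset.range n, u * P u ≤ ∑ u ∈ Finset.range n, u * 2 ^ 15 :=
      Finset.sum_le_sum fun u hu ↦ Nat.mul_le_mul_left _ (hP2 u (Finset.mem_range.1 hu))
    rw [← Finset.sum_mul] at h
    have h2 := Finset.sum_range_id_mul_two n
    have h3 : n * (n - 1) ≤ 400 * 399 := Nat.mul_le_mul hn (by omega)
    omega
  refine ⟨?_, b0, b1⟩
  unfold foldPack
  simp only [force_eq]
  have hz : pack 16 D (2 * n) = pack 32 (fun u ↦ D (2 * u) + 2 ^ 16 * D (2 * u + 1)) n := by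
    rw [← pack_pack]
    refine pack_congr fun u _ ↦ ?_
    rw [pack_two, add_zero]
  have hy : Nat.land (pack 16 D (2 * n)) (pack 32 (fun _ ↦ 65535) n) = pack 32 (fun u ↦ D (2 * u)) n := by
    change pack 16 D (2 * n) &&& pack 32 (fun _ ↦ 65535) n = _
    rw [hz, pack_and]
    · refine pack_congr fun u hu ↦ ?_
      have := hD (2 * u) (by omega)
      rw [show 65535 = 2 ^ 16 - 1 by norm_num, Nat.and_two_pow_sub_one_eq_mod]
      omega
    · intro u hu
      have := hD (2 * u) (by omega)
      have := hD (2 * u + 1) (by omega)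
      omega
    · intros
      norm_num
  rw [hy]
  change (pack 32 (fun u ↦ D (2 * u)) n + (pack 16 D (2 * n) - pack 32 (fun u ↦ D (2 * u)) n) >>> 16) %
    18446744065119617025 = _
  rw [hz, pack_add, Nat.add_sub_cancel_left, pack_mul, Nat.shiftRight_eq_div_pow, Nat.mul_div_cancel_left _ (by positivity),
    ← pack_add]
  have h : pack 32 P n ≡ ∑ u ∈ Finset.range n, P u + 4294967295 * ∑ u ∈ Finset.range n, u * P u
      [MOD 18446744065119617025] := by
    rw [Finset.mul_sum, ← Finset.sum_add_distrib]
    refine modEq_sum fun u _ ↦ ?_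
    have := (one_add_pow_modEq 4294967295 u).mul_left (P u)
    rw [show 4294967295 + 1 = 2 ^ 32 by norm_num, ← pow_mul,
      show 4294967295 ^ 2 = 18446744065119617025 by norm_num] at this
    refine this.trans (congrArg (· % _) ?_)
    ring
  rw [Nat.ModEq] at h
  rw [h, Nat.mod_eq_of_lt]
  omega

lemma shiftRight_and_eq {w n s len : ℕ} {F : ℕ → ℕ} (hF : ∀ k < n, F k < 2 ^ w) (h : s + len ≤ n) :
    (pack w F n >>> (w * s)) &&& (2 ^ (w * len) - 1) = pack w (fun k ↦ F (s + k)) len := by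
  obtain ⟨m, rfl⟩ := Nat.exists_eq_add_of_le h
  rw [Nat.shiftRight_eq_div_pow, add_assoc, pack_div fun k hk ↦ hF k (by omega), Nat.and_two_pow_sub_one_eq_mod,
    pack_mod (by omega) fun k hk ↦ hF _ (by omega)]

lemma withMasks_eq (n : ℕ) (k : ℕ → ℕ → ℕ → ℕ) :
    withMasks (2 * n) k =
      k (2 ^ (16 * (2 * n)) - 1) (pack 16 (fun _ ↦ 2 ^ 15) (2 * n)) (pack 32 (fun _ ↦ 65535) n) := by
  unfold withMasks
  simp only [force_eq]
  have h1 : Nat.sub (Nat.shiftLeft 1 (Nat.mul 16 (2 * n))) 1 = 2 ^ (16 * (2 * n)) - 1 := by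
    change 1 <<< (16 * (2 * n)) - 1 = _
    rw [Nat.one_shiftLeft]
  have e1 : (2 ^ (16 * (2 * n)) - 1) / 65535 = pack 16 (fun _ ↦ 1) (2 * n) := by
    rw [← pack_one_mul, show 2 ^ 16 - 1 = 65535 by norm_num, Nat.mul_div_cancel_left _ (by norm_num)]
  have e2 : (2 ^ (16 * (2 * n)) - 1) / 4294967295 = pack 32 (fun _ ↦ 1) n := by
    rw [show 16 * (2 * n) = 32 * n by ring, ← pack_one_mul, show 2 ^ 32 - 1 = 4294967295 by norm_num,
      Nat.mul_div_cancel_left _ (by norm_num)]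
  rw [h1]
  change k _ ((2 ^ (16 * (2 * n)) - 1) / 65535 * 32768) ((2 ^ (16 * (2 * n)) - 1) / 4294967295 * 65535) = _
  rw [e1, e2, mul_comm _ 32768, mul_comm _ 65535, ← pack_mul, ← pack_mul]
  norm_num

/-- The total numerator of the cell weights of a piece. -/
lemma sum_piece_le {M r n : ℕ} (h : r + 2 * n ≤ M) (D D' : ℕ → ℕ) :
    ∑ k ∈ Finset.range (2 * n), ((M - (r + k)) * D k + (r + k + 1) * D' k) ≤
      ((M - r) * ∑ u ∈ Finset.range n, (D (2 * u) + D (2 * u + 1)) -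
        2 * ∑ u ∈ Finset.range n, u * (D (2 * u) + D (2 * u + 1))) +
      ((r + 2) * ∑ u ∈ Finset.range n, (D' (2 * u) + D' (2 * u + 1)) +
        2 * ∑ u ∈ Finset.range n, u * (D' (2 * u) + D' (2 * u + 1))) := by
  rw [Finset.sum_add_distrib]
  refine Nat.add_le_add (Nat.le_sub_of_add_le ?_) ?_
  · induction n with
    | zero => simp
    | succ n ih =>
      have ih := ih (by omega)
      rw [show 2 * (n + 1) = 2 * n + 1 + 1 by ring, Finset.sum_range_succ, Finset.sum_range_succ,
        Finset.sum_range_succ _ n, Finset.sum_range_succ _ n]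
      obtain ⟨j, rfl⟩ := Nat.exists_eq_add_of_le h
      rw [show r + 2 * (n + 1) + j - (r + 2 * n) = j + 2 by omega,
        show r + 2 * (n + 1) + j - (r + (2 * n + 1)) = j + 1 by omega,
        show r + 2 * (n + 1) + j - r = j + 2 + 2 * n by omega] at *
      nlinarith
  · induction n with
    | zero => simp
    | succ n ih =>
      have ih := ih (by omega)
      rw [show 2 * (n + 1) = 2 * n + 1 + 1 by ring, Finset.sum_range_succ, Finset.sum_range_succ,
        Finset.sum_range_succ _ n, Finset.sum_range_succ _ n]
      nlinarith

lemma pieceSum_ge {W M b a r n N : ℕ} {E : ℕ → ℤ} {C : ℤ} (hn : n ≤ 400) (hr : r + 2 * n ≤ M)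
    (hab : b ≤ a * M + r) (hN : a * M + r - b + (2 * n + a + 1) ≤ N) (h0 : 0 < a * M + r)
    (hW : W = pack 16 (fun k ↦ (C - E (b + k)).toNat) N)
    (hE0 : ∀ k < N, 0 ≤ C - E (b + k)) (hE1 : ∀ k < N, C - E (b + k) < 2 ^ 14) :
    ∑ k ∈ Finset.range (2 * n), cellWeight E M (a * M + r + k) ≤
      (pieceSum (2 ^ (16 * (2 * n)) - 1) (pack 16 (fun _ ↦ 2 ^ 15) (2 * n)) (pack 32 (fun _ ↦ 65535) n)
        W M b a r : ℝ) / 10 ^ 18 := by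
  set i := a * M + r with hi
  set F : ℕ → ℕ := fun k ↦ (C - E (b + k)).toNat with hF
  have hF14 : ∀ k < N, F k < 2 ^ 14 := fun k hk ↦ by
    have := hE1 k hk
    simp only [hF]
    omega
  have hF16 : ∀ k < N, F k < 2 ^ 16 := fun k hk ↦ (hF14 k hk).trans (by norm_num)
  have hFE (k l : ℕ) (hk : k < N) (hl : l < N) :
      ((F k - F l + (F l - F k) : ℕ) : ℤ) = |E (b + l) - E (b + k)| := by
    have h1 := hE0 k hk
    have h2 := hE0 l hl
    simp only [hF]
    rcases abs_cases (E (b + l) - E (b + k)) with h | h <;> omega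
  set D : ℕ → ℕ := fun k ↦ F (i - b + k) - F (i - b + a + k) + (F (i - b + a + k) - F (i - b + k)) with hD
  set D' : ℕ → ℕ := fun k ↦ F (i - b + k) - F (i - b + a + 1 + k) + (F (i - b + a + 1 + k) - F (i - b + k)) with hD'
  have hDlt : ∀ k < 2 * n, D k < 2 ^ 14 := fun k hk ↦ by
    have := hF14 (i - b + k) (by omega)
    have := hF14 (i - b + a + k) (by omega)
    simp only [hD]
    omega
  have hDlt' : ∀ k < 2 * n, D' k < 2 ^ 14 := fun k hk ↦ by
    have := hF14 (i - b + k) (by omega)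
    have := hF14 (i - b + a + 1 + k) (by omega)
    simp only [hD']
    omega
  set S0 := ∑ u ∈ Finset.range n, (D (2 * u) + D (2 * u + 1)) with hS0
  set S1 := ∑ u ∈ Finset.range n, u * (D (2 * u) + D (2 * u + 1)) with hS1
  set T0 := ∑ u ∈ Finset.range n, (D' (2 * u) + D' (2 * u + 1)) with hT0
  set T1 := ∑ u ∈ Finset.range n, u * (D' (2 * u) + D' (2 * u + 1)) with hT1
  set Q := (M - r) * S0 - 2 * S1 + ((r + 2) * T0 + 2 * T1) with hQ
  have hps : pieceSum (2 ^ (16 * (2 * n)) - 1) (pack 16 (fun _ ↦ 2 ^ 15) (2 * n)) (pack 32 (fun _ ↦ 65535) n)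
      W M b a r = Q * 1000000000000000000 / ((M + 1) * (i * i)) + 1 := by
    have w1 : (W >>> (16 * (i - b))) &&& (2 ^ (16 * (2 * n)) - 1) = pack 16 (fun k ↦ F (i - b + k)) (2 * n) := by
      rw [hW, shiftRight_and_eq hF16 (by omega)]
    have w2 : (W >>> (16 * (i - b)) >>> (16 * a)) &&& (2 ^ (16 * (2 * n)) - 1) =
        pack 16 (fun k ↦ F (i - b + a + k)) (2 * n) := by
      rw [hW, ← Nat.shiftRight_add, ← mul_add, shiftRight_and_eq hF16 (by omega)]
    have w3 : (W >>> (16 * (i - b)) >>> (16 * a) >>> 16) &&& (2 ^ (16 * (2 * n)) - 1) =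
        pack 16 (fun k ↦ F (i - b + a + 1 + k)) (2 * n) := by
      rw [hW, ← Nat.shiftRight_add, ← Nat.shiftRight_add, show 16 * (i - b) + (16 * a + 16) = 16 * (i - b + a + 1) by ring,
        shiftRight_and_eq hF16 (by omega)]
    obtain ⟨f1, f2, f3⟩ := foldPack_eq hn hDlt
    obtain ⟨g1, g2, g3⟩ := foldPack_eq hn hDlt'
    have hlt (j k : ℕ) (hk : k < 2 * n) (hj : j ≤ i - b + a + 1) : F (j + k) < 2 ^ 15 :=
      (hF14 _ (by omega)).trans (by norm_num)
    have a1 : absPack (pack 16 (fun _ ↦ 2 ^ 15) (2 * n)) (pack 16 (fun k ↦ F (i - b + k)) (2 * n))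
        (pack 16 (fun k ↦ F (i - b + a + k)) (2 * n)) = pack 16 D (2 * n) :=
      absPack_eq (fun k hk ↦ hlt _ k hk (by omega)) (fun k hk ↦ hlt _ k hk (by omega))
    have a2 : absPack (pack 16 (fun _ ↦ 2 ^ 15) (2 * n)) (pack 16 (fun k ↦ F (i - b + k)) (2 * n))
        (pack 16 (fun k ↦ F (i - b + a + 1 + k)) (2 * n)) = pack 16 D' (2 * n) :=
      absPack_eq (fun k hk ↦ hlt _ k hk (by omega)) (fun k hk ↦ hlt _ k hk (by omega))
    unfold pieceSum
    simp only [force_eq]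
    change pieceBound M r i
      (foldPack _ (absPack _ ((W >>> (16 * (i - b))) &&& (2 ^ (16 * (2 * n)) - 1))
        ((W >>> (16 * (i - b)) >>> (16 * a)) &&& (2 ^ (16 * (2 * n)) - 1))))
      (foldPack _ (absPack _ ((W >>> (16 * (i - b))) &&& (2 ^ (16 * (2 * n)) - 1))
        ((W >>> (16 * (i - b)) >>> (16 * a) >>> 16) &&& (2 ^ (16 * (2 * n)) - 1)))) = _
    rw [w1, w2, w3, a1, a2, f1, g1]
    change ((M - r) * ((S0 + 4294967295 * S1) % 4294967295) - 2 * ((S0 + 4294967295 * S1) / 4294967295) +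
      ((r + 2) * ((T0 + 4294967295 * T1) % 4294967295) + 2 * ((T0 + 4294967295 * T1) / 4294967295))) *
      1000000000000000000 / ((M + 1) * (i * i)) + 1 = _
    rw [Nat.add_mul_mod_self_left, Nat.mod_eq_of_lt f2, Nat.add_mul_mod_self_left, Nat.mod_eq_of_lt g2,
      Nat.add_mul_div_left _ _ (by norm_num), Nat.add_mul_div_left _ _ (by norm_num), Nat.div_eq_of_lt f2,
      Nat.div_eq_of_lt g2, zero_add, zero_add]
  have hi0 : (0:ℝ) < i := by exact_mod_cast h0
  have hcell (k : ℕ) (hk : k < 2 * n) :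
      cellWeight E M (i + k) ≤ (((M - (r + k)) * D k + (r + k + 1) * D' k : ℕ) : ℝ) / ((M + 1) * (i * i)) := by
    have hM0 : 0 < M := by omega
    have d1 : (i + k) / M = a := by
      rw [hi, add_assoc, mul_comm, Nat.mul_add_div hM0, Nat.div_eq_of_lt (by omega), add_zero]
    have d2 : (i + k) % M = r + k := by
      rw [hi, add_assoc, mul_comm, Nat.mul_add_mod, Nat.mod_eq_of_lt (by omega)]
    have e1 := hFE (i - b + k) (i - b + a + k) (by omega) (by omega)
    have e2 := hFE (i - b + k) (i - b + a + 1 + k) (by omega) (by omega)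
    rw [show b + (i - b + a + k) = i + k + a by omega, show b + (i - b + k) = i + k by omega] at e1
    rw [show b + (i - b + a + 1 + k) = i + k + a + 1 by omega, show b + (i - b + k) = i + k by omega] at e2
    unfold cellWeight
    rw [d1, d2, ← e1, ← e2]
    have : ((((M - (r + k) : ℕ) : ℤ) * ((D k : ℕ) : ℤ) + ((r + k + 1 : ℕ) : ℤ) * ((D' k : ℕ) : ℤ) : ℤ) : ℝ) =
        (((M - (r + k)) * D k + (r + k + 1) * D' k : ℕ) : ℝ) := by
      rw [← Int.cast_natCast (R := ℝ) ((M - (r + k)) * D k + (r + k + 1) * D' k)]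
      push_cast
      rfl
    refine (congrArg (· / _) this).trans_le ?_
    push_cast
    gcongr
    nlinarith [Nat.cast_nonneg (α := ℝ) k]
  calc _ ≤ ∑ k ∈ Finset.range (2 * n), (((M - (r + k)) * D k + (r + k + 1) * D' k : ℕ) : ℝ) / ((M + 1) * (i * i)) :=
        Finset.sum_le_sum fun k hk ↦ hcell k (Finset.mem_range.1 hk)
    _ = ((∑ k ∈ Finset.range (2 * n), ((M - (r + k)) * D k + (r + k + 1) * D' k) : ℕ) : ℝ) / ((M + 1) * (i * i)) := by
        rw [Nat.cast_sum, Finset.sum_div]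
    _ ≤ (Q : ℝ) / ((M + 1) * (i * i)) := by
        gcongr
        exact sum_piece_le hr D D'
    _ ≤ _ := by
        rw [hps, le_div_iff₀ (by norm_num)]
        have h := Nat.lt_div_mul_add (a := Q * 1000000000000000000) (b := (M + 1) * (i * i)) (by positivity)
        have h' : ((Q * 1000000000000000000 : ℕ) : ℝ) <
            ((Q * 1000000000000000000 / ((M + 1) * (i * i)) * ((M + 1) * (i * i)) + (M + 1) * (i * i) : ℕ) : ℝ) := by
          exact_mod_cast h
        rw [div_mul_eq_mul_div, div_le_iff₀ (by positivity)]
        push_cast at h' ⊢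
        linarith

/-- `W` holds the 14-bit values of a shifted reflection of `E` on `[b, b + N)`. -/
def IsWindow (E : ℕ → ℤ) (b N W : ℕ) : Prop :=
  ∃ C : ℤ, W = pack 16 (fun k ↦ (C - E (b + k)).toNat) N ∧ ∀ k < N, 0 ≤ C - E (b + k) ∧ C - E (b + k) < 2 ^ 14

lemma isWindow_windowPack {K b Z : ℕ} (hK : 11 ≤ K) (hb : b % 2 = 0) (hZ : b + 2 * 2 ^ K ≤ Z)
    (hP : treeSum (fun t ↦ (posMask.testBit t).toNat) 11 0 < 2 ^ 10)
    (hN : treeSum (fun t ↦ (negMask.testBit t).toNat) 11 0 < 2 ^ 10)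
    (hE : ∀ x ≤ Z, ∀ y ≤ Z, |weightedFloor x - weightedFloor y| ≤ 5000) :
    IsWindow weightedFloor b (2 * 2 ^ K) (windowPack K b) := by
  refine ⟨_, windowPack_eq hK hb hZ hP hN hE, fun k hk ↦ ?_⟩
  have := abs_le.1 (hE (b + (2 * 2 ^ K - 1)) (by omega) (b + k) (by omega))
  omega

lemma withMasks_pieceSum_ge {W M b a r n N : ℕ} {E : ℕ → ℤ} (hW : IsWindow E b N W) (hn : n ≤ 400)
    (hr : r + 2 * n ≤ M) (hab : b ≤ a * M + r) (hN : a * M + r - b + (2 * n + a + 1) ≤ N) (h0 : 0 < a * M + r) :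
    ∑ k ∈ Finset.range (2 * n), cellWeight E M (a * M + r + k) ≤
      (withMasks (2 * n) fun mask hi ev ↦ pieceSum mask hi ev W M b a r : ℝ) / 10 ^ 18 := by
  obtain ⟨C, hC, hE⟩ := hW
  rw [withMasks_eq]
  exact pieceSum_ge hn hr hab hN h0 hC (fun k hk ↦ (hE k hk).1) fun k hk ↦ (hE k hk).2

lemma blockSum_ge {W M b a n N : ℕ} {E : ℕ → ℤ} (hW : IsWindow E b N W) (hn : n ≤ 400) (h0 : 0 < a * M)
    (hab : b ≤ a * M) (hN : a * M - b + (M + a + 1) ≤ N) {q : ℕ} (hq : 2 * n * q ≤ M) :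
    ∑ k ∈ Finset.range (2 * n * q), cellWeight E M (a * M + k) ≤
      (blockSum (2 * n) (2 ^ (16 * (2 * n)) - 1) (pack 16 (fun _ ↦ 2 ^ 15) (2 * n)) (pack 32 (fun _ ↦ 65535) n)
        W M b a q : ℝ) / 10 ^ 18 := by
  obtain ⟨C, hC, hE⟩ := hW
  induction q with
  | zero => simp [blockSum]
  | succ q ih =>
    rw [mul_add, mul_one] at hq ⊢
    rw [Finset.sum_range_add]
    have h := pieceSum_ge (a := a) (r := 2 * n * q) hn hq (by omega) (by omega) (by omega) hC
      (fun k hk ↦ (hE k hk).1) fun k hk ↦ (hE k hk).2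
    simp only [add_assoc] at h
    have := add_le_add (ih (by omega)) h
    rw [← add_div, ← Nat.cast_add] at this
    exact this

lemma blocksSum_ge {W M b a n N q : ℕ} {E : ℕ → ℤ} (hW : IsWindow E b N W) (hn : n ≤ 400) (hq : 2 * n * q = M)
    (h0 : 0 < a * M) (hab : b ≤ a * M) {w : ℕ} (hN : a * M + w * M - b + (a + w + 1) ≤ N) :
    ∑ k ∈ Finset.range (w * M), cellWeight E M (a * M + k) ≤ (blocksSum (2 * n) W M b q w a : ℝ) / 10 ^ 18 := by
  unfold blocksSum
  rw [withMasks_eq]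
  induction w with
  | zero => simp
  | succ w ih =>
    have e : (w + 1) * M = w * M + M := by ring
    rw [e] at hN ⊢
    rw [Finset.sum_range_add]
    have h := blockSum_ge (a := a + w) hW hn (by rw [add_mul]; omega) (by rw [add_mul]; omega)
      (by rw [add_mul]; omega) hq.le
    rw [hq] at h
    simp only [add_mul, add_assoc] at h
    have := add_le_add (ih (by omega)) h
    rw [← add_div, ← Nat.cast_add] at this
    exact this

lemma sum_Ico_chunk_le {Z a v : ℕ} (ha : a ≤ 4000) (hZ : a * 800 + 65536 ≤ Z)
    (hP : treeSum (fun t ↦ (posMask.testBit t).toNat) 11 0 < 2 ^ 10)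
    (hN : treeSum (fun t ↦ (negMask.testBit t).toNat) 11 0 < 2 ^ 10)
    (hE : ∀ x ≤ Z, ∀ y ≤ Z, |weightedFloor x - weightedFloor y| ≤ 5000) (h0 : 0 < a)
    (hv : Nat.ble (chunkSum 15 800 800 1 76 a) v = true) :
    ∑ i ∈ Finset.Ico (a * 800) ((a + 76) * 800), cellWeight weightedFloor 800 i ≤ v / 10 ^ 18 := by
  have hW := isWindow_windowPack (K := 15) (b := a * 800) (by norm_num) (by omega) hZ hP hN hE
  have h := blocksSum_ge (n := 400) (q := 1) (a := a) (w := 76) hW le_rfl rfl (by omega) le_rfl (by omega)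
  rw [Finset.sum_Ico_eq_sum_range, show (a + 76) * 800 - a * 800 = 76 * 800 by omega]
  refine h.trans ?_
  gcongr
  rw [chunkSum, force_eq] at hv
  exact Nat.le_of_ble_eq_true hv

lemma sum_Ico_firstChunk_le {Z v : ℕ} (hZ : 65536 ≤ Z)
    (hP : treeSum (fun t ↦ (posMask.testBit t).toNat) 11 0 < 2 ^ 10)
    (hN : treeSum (fun t ↦ (negMask.testBit t).toNat) 11 0 < 2 ^ 10)
    (hE : ∀ x ≤ Z, ∀ y ≤ Z, |weightedFloor x - weightedFloor y| ≤ 5000)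
    (hv : Nat.ble (firstChunkSum 15) v = true) :
    ∑ i ∈ Finset.Ico 1 60800, cellWeight weightedFloor 800 i ≤ v / 10 ^ 18 := by
  have hW := isWindow_windowPack (K := 15) (b := 0) (by norm_num) rfl hZ hP hN hE
  have h1 := withMasks_pieceSum_ge (M := 800) (a := 0) (r := 1) (n := 399) hW (by norm_num) (by norm_num)
    (by norm_num) (by norm_num) (by norm_num)
  have h2 := withMasks_pieceSum_ge (M := 800) (a := 0) (r := 798) (n := 1) hW (by norm_num) (by norm_num)
    (by norm_num) (by norm_num) (by norm_num)
  have h3 := blocksSum_ge (M := 800) (n := 50) (q := 8) (a := 1) (w := 75) hW (by norm_num) rfl (by norm_num)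
    (by norm_num) (by norm_num)
  rw [firstChunkSum, force_eq] at hv
  have hv : _ + (_ + _) ≤ v := Nat.le_of_ble_eq_true hv
  rw [← Finset.sum_Ico_consecutive _ (show 1 ≤ 800 by norm_num) (show 800 ≤ 60800 by norm_num),
    Finset.sum_Ico_eq_sum_range _ 800]
  have h4 : ∑ i ∈ Finset.Ico 1 800, cellWeight weightedFloor 800 i ≤
      ∑ k ∈ Finset.range (2 * 399), cellWeight weightedFloor 800 (0 * 800 + 1 + k) +
      ∑ k ∈ Finset.range (2 * 1), cellWeight weightedFloor 800 (0 * 800 + 798 + k) := by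
    rw [← Finset.sum_Ico_consecutive _ (show 1 ≤ 799 by norm_num) (show 799 ≤ 800 by norm_num),
      Finset.sum_Ico_eq_sum_range _ 1]
    refine add_le_add le_rfl ?_
    simpa [Finset.sum_range_succ] using cellWeight_nonneg _ _ _
  have hv' : ((_ + (_ + _) : ℕ) : ℝ) ≤ v := Nat.cast_le.2 hv
  push_cast at hv'
  have hv'' := div_le_div_of_nonneg_right hv' (show (0:ℝ) ≤ 10 ^ 18 by norm_num)
  rw [add_div, add_div] at hv''
  refine (add_le_add h4 h3).trans (le_trans ?_ hv'')
  rw [add_comm]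
  exact add_le_add le_rfl (add_le_add h1 h2)

/-- The sum of `g (2 * t + 1)` over the bits of `m`, plus that of `g (2 * (2 * t + 1))` over the first 1024 bits
of `m'`. -/
def maskSum (m m' : ℕ) (g : ℕ → ℕ) : ℕ :=
  Nat.add (treeSum (fun t ↦ cond (Nat.testBit m t) (g (Nat.succ (Nat.mul 2 t))) 0) 11 0)
    (treeSum (fun t ↦ cond (Nat.testBit m' t) (g (Nat.mul 2 (Nat.succ (Nat.mul 2 t)))) 0) 10 0)

lemma maskSum_eq (m m' : ℕ) (g : ℕ → ℕ) :
    maskSum m m' g = ∑ t ∈ Finset.range 2048, (m.testBit t).toNat * g (2 * t + 1) +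
      ∑ t ∈ Finset.range 1024, (m'.testBit t).toNat * g (2 * (2 * t + 1)) := by
  have h (x : ℕ) : ∀ b : Bool, cond b x 0 = b.toNat * x := by
    rintro (_ | _) <;> simp
  unfold maskSum
  rw [treeSum_eq, treeSum_eq, show 2 ^ 11 = 2048 by norm_num, show 2 ^ 10 = 1024 by norm_num]
  simp only [h, zero_add]
  rfl

lemma weighted_sum_eq (g : ℕ → ℕ) :
    ∑ i ∈ Finset.range 3072, weightAt i * (g (divisorAt i) : ℤ) =
      (maskSum posMask negMask g : ℤ) - maskSum negMask posMask g := by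
  rw [sum_range_3072 fun ν d ↦ ν * (g d : ℤ), maskSum_eq, maskSum_eq]
  push_cast
  simp only [oddWeight, sub_mul, neg_sub, Finset.sum_sub_distrib]
  ring

lemma abs_weighted_sum_le (g : ℕ → ℕ) :
    ∑ i ∈ Finset.range 3072, |(weightAt i : ℝ)| * g (divisorAt i) ≤
      (maskSum posMask negMask g + maskSum negMask posMask g : ℕ) := by
  rw [sum_range_3072 fun ν d ↦ |(ν : ℝ)| * g d, maskSum_eq, maskSum_eq]
  push_cast
  have h (t : ℕ) : |((oddWeight t : ℤ) : ℝ)| ≤ (posMask.testBit t).toNat + (negMask.testBit t).toNat := by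
    unfold oddWeight
    cases posMask.testBit t <;> cases negMask.testBit t <;> norm_num
  have h1 := Finset.sum_le_sum fun t (_ : t ∈ Finset.range 2048) ↦
    mul_le_mul_of_nonneg_right (h t) (Nat.cast_nonneg (α := ℝ) (g (2 * t + 1)))
  have h2 := Finset.sum_le_sum fun t (_ : t ∈ Finset.range 1024) ↦
    mul_le_mul_of_nonneg_right (h t) (Nat.cast_nonneg (α := ℝ) (g (2 * (2 * t + 1))))
  simp only [add_mul, Finset.sum_add_distrib] at h1 h2
  simp only [abs_neg]
  linarith

lemma popcount_posMask : treeSum (fun t ↦ (posMask.testBit t).toNat) 11 0 < 2 ^ 10 :=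
  Nat.le_of_ble_eq_true (by decide +kernel)

lemma popcount_negMask : treeSum (fun t ↦ (negMask.testBit t).toNat) 11 0 < 2 ^ 10 :=
  Nat.le_of_ble_eq_true (by decide +kernel)

lemma sum_abs_weightAt : ∑ i ∈ Finset.range 3072, |(weightAt i : ℝ)| ≤ 2448 := by
  have h : Nat.ble (maskSum posMask negMask (fun _ ↦ 1) + maskSum negMask posMask fun _ ↦ 1) 2448 = true := by
    decide +kernel
  have := abs_weighted_sum_le fun _ ↦ 1
  simp only [Nat.cast_one, mul_one] at this
  exact this.trans (by exact_mod_cast Nat.le_of_ble_eq_true h)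

lemma sum_abs_weightAt_mul : ∑ i ∈ Finset.range 3072, |(weightAt i : ℝ)| * divisorAt i ≤ 4930000 := by
  have h : Nat.ble (maskSum posMask negMask (fun d ↦ d) + maskSum negMask posMask fun d ↦ d) 4930000 = true := by
    decide +kernel
  exact (abs_weighted_sum_le fun d ↦ d).trans (by exact_mod_cast Nat.le_of_ble_eq_true h)

lemma weightedFloor_eq (n : ℕ) :
    weightedFloor n = (maskSum posMask negMask (n / ·) : ℤ) - maskSum negMask posMask (n / ·) :=
  weighted_sum_eq (n / ·)

lemma weightedFloor_one : weightedFloor 1 = 1 := by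
  rw [weightedFloor_eq, show maskSum posMask negMask (1 / ·) = maskSum negMask posMask (1 / ·) + 1 from
    Nat.eq_of_beq_eq_true (by decide +kernel)]
  push_cast
  ring

lemma abs_weightedFloor_sub_le (n : ℕ) :
    |(weightedFloor n : ℝ) - n * ∑ i ∈ Finset.range 3072, (weightAt i : ℝ) / divisorAt i| ≤ 2448 := by
  have h := floorSum_eq (Finset.range 3072) weightAt divisorAt (Nat.cast_nonneg (α := ℝ) n)
  rw [Nat.floor_natCast] at h
  rw [weightedFloor, h, sub_sub_cancel_left, abs_neg]
  refine (Finset.abs_sum_le_sum_abs _ _).trans (le_trans (Finset.sum_le_sum fun i _ ↦ ?_) sum_abs_weightAt)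
  rw [abs_mul, abs_of_nonneg (a := Int.fract _) (Int.fract_nonneg _)]
  exact mul_le_of_le_one_right (abs_nonneg _) (Int.fract_lt_one _).le

lemma abs_sum_weightAt_div : |∑ i ∈ Finset.range 3072, (weightAt i : ℝ) / divisorAt i| ≤ 0.000000000001 := by
  have h1 : Nat.ble (maskSum posMask negMask (100000000000000000000 / ·))
      (maskSum negMask posMask (100000000000000000000 / ·) + 90000000) = true := by decide +kernel
  have h2 : Nat.ble (maskSum negMask posMask (100000000000000000000 / ·))
      (maskSum posMask negMask (100000000000000000000 / ·) + 90000000) = true := by decide +kernel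
  have e := weightedFloor_eq 100000000000000000000
  have h3 : |weightedFloor 100000000000000000000| ≤ 90000000 := by
    have := Nat.le_of_ble_eq_true h1
    have := Nat.le_of_ble_eq_true h2
    rw [abs_le]
    omega
  have h4 : |(weightedFloor 100000000000000000000 : ℝ)| ≤ 90000000 := by exact_mod_cast h3
  have h := abs_le.1 (abs_weightedFloor_sub_le 100000000000000000000)
  have h4 := abs_le.1 h4
  rw [abs_le]
  push_cast at h
  constructor <;> linarith

lemma abs_weightedFloor_sub_weightedFloor_le (x : ℕ) (hx : x ≤ 10000000) (y : ℕ) (hy : y ≤ 10000000) :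
    |weightedFloor x - weightedFloor y| ≤ 5000 := by
  have hx' : (x:ℝ) ≤ 10000000 := by exact_mod_cast hx
  have hy' : (y:ℝ) ≤ 10000000 := by exact_mod_cast hy
  have h1 := abs_le.1 (abs_weightedFloor_sub_le x)
  have h2 := abs_le.1 (abs_weightedFloor_sub_le y)
  have h3 := abs_le.1 abs_sum_weightAt_div
  set η := ∑ i ∈ Finset.range 3072, (weightAt i : ℝ) / divisorAt i
  have hx0 : (0:ℝ) ≤ x := x.cast_nonneg
  have hy0 : (0:ℝ) ≤ y := y.cast_nonneg
  have : |((weightedFloor x - weightedFloor y : ℤ) : ℝ)| ≤ 5000 := by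
    push_cast
    rw [abs_le]
    constructor <;> nlinarith
  exact_mod_cast this

lemma sum_Ico_add_chunk_le {a b v S : ℕ} (h0 : 0 < a) (ha : a ≤ 4000) (hb : a + 76 = b)
    (hS : ∑ i ∈ Finset.Ico 1 (a * 800), cellWeight weightedFloor 800 i ≤ S / 10 ^ 18)
    (hv : Nat.ble (chunkSum 15 800 800 1 76 a) v = true) :
    ∑ i ∈ Finset.Ico 1 (b * 800), cellWeight weightedFloor 800 i ≤ (S + v : ℕ) / 10 ^ 18 := by
  subst hb
  have h2 := sum_Ico_chunk_le (Z := 10000000) ha (by omega) popcount_posMask popcount_negMask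
    abs_weightedFloor_sub_weightedFloor_le h0 hv
  rw [← Finset.sum_Ico_consecutive _ (show 1 ≤ a * 800 by omega) (show a * 800 ≤ (a + 76) * 800 by omega),
    Nat.cast_add, add_div]
  exact add_le_add hS h2

set_option maxHeartbeats 4000000 in
lemma sum_cellWeight_le : ∑ i ∈ Finset.Ico 1 3161600, cellWeight weightedFloor 800 i ≤ 0.00061 := by
  have h := sum_Ico_firstChunk_le (Z := 10000000) (v := 478966819586772) (by norm_num) popcount_posMask popcount_negMask
    abs_weightedFloor_sub_weightedFloor_le (by decide +kernel)
  change ∑ i ∈ Finset.Ico 1 (76 * 800), _ ≤ _ at h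
  have c76 : Nat.ble (chunkSum 15 800 800 1 76 76) 44549643618763 = true := by decide +kernel
  replace h := sum_Ico_add_chunk_le (a := 76) (b := 152) (by norm_num) (by norm_num) rfl h c76
  have c152 : Nat.ble (chunkSum 15 800 800 1 76 152) 18535444891818 = true := by decide +kernel
  replace h := sum_Ico_add_chunk_le (a := 152) (b := 228) (by norm_num) (by norm_num) rfl h c152
  have c228 : Nat.ble (chunkSum 15 800 800 1 76 228) 11435843395186 = true := by decide +kernel
  replace h := sum_Ico_add_chunk_le (a := 228) (b := 304) (by norm_num) (by norm_num) rfl h c228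
  have c304 : Nat.ble (chunkSum 15 800 800 1 76 304) 7884189816259 = true := by decide +kernel
  replace h := sum_Ico_add_chunk_le (a := 304) (b := 380) (by norm_num) (by norm_num) rfl h c304
  have c380 : Nat.ble (chunkSum 15 800 800 1 76 380) 5538929686354 = true := by decide +kernel
  replace h := sum_Ico_add_chunk_le (a := 380) (b := 456) (by norm_num) (by norm_num) rfl h c380
  have c456 : Nat.ble (chunkSum 15 800 800 1 76 456) 4105609212389 = true := by decide +kernel
  replace h := sum_Ico_add_chunk_le (a := 456) (b := 532) (by norm_num) (by norm_num) rfl h c456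
  have c532 : Nat.ble (chunkSum 15 800 800 1 76 532) 3330199357074 = true := by decide +kernel
  replace h := sum_Ico_add_chunk_le (a := 532) (b := 608) (by norm_num) (by norm_num) rfl h c532
  have c608 : Nat.ble (chunkSum 15 800 800 1 76 608) 2909700022805 = true := by decide +kernel
  replace h := sum_Ico_add_chunk_le (a := 608) (b := 684) (by norm_num) (by norm_num) rfl h c608
  have c684 : Nat.ble (chunkSum 15 800 800 1 76 684) 2478834015122 = true := by decide +kernel
  replace h := sum_Ico_add_chunk_le (a := 684) (b := 760) (by norm_num) (by norm_num) rfl h c684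
  have c760 : Nat.ble (chunkSum 15 800 800 1 76 760) 2142223575553 = true := by decide +kernel
  replace h := sum_Ico_add_chunk_le (a := 760) (b := 836) (by norm_num) (by norm_num) rfl h c760
  have c836 : Nat.ble (chunkSum 15 800 800 1 76 836) 1820989938485 = true := by decide +kernel
  replace h := sum_Ico_add_chunk_le (a := 836) (b := 912) (by norm_num) (by norm_num) rfl h c836
  have c912 : Nat.ble (chunkSum 15 800 800 1 76 912) 1455522216075 = true := by decide +kernel
  replace h := sum_Ico_add_chunk_le (a := 912) (b := 988) (by norm_num) (by norm_num) rfl h c912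
  have c988 : Nat.ble (chunkSum 15 800 800 1 76 988) 1213705569684 = true := by decide +kernel
  replace h := sum_Ico_add_chunk_le (a := 988) (b := 1064) (by norm_num) (by norm_num) rfl h c988
  have c1064 : Nat.ble (chunkSum 15 800 800 1 76 1064) 1152759061829 = true := by decide +kernel
  replace h := sum_Ico_add_chunk_le (a := 1064) (b := 1140) (by norm_num) (by norm_num) rfl h c1064
  have c1140 : Nat.ble (chunkSum 15 800 800 1 76 1140) 981335016365 = true := by decide +kernel
  replace h := sum_Ico_add_chunk_le (a := 1140) (b := 1216) (by norm_num) (by norm_num) rfl h c1140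
  have c1216 : Nat.ble (chunkSum 15 800 800 1 76 1216) 852353448915 = true := by decide +kernel
  replace h := sum_Ico_add_chunk_le (a := 1216) (b := 1292) (by norm_num) (by norm_num) rfl h c1216
  have c1292 : Nat.ble (chunkSum 15 800 800 1 76 1292) 878311423185 = true := by decide +kernel
  replace h := sum_Ico_add_chunk_le (a := 1292) (b := 1368) (by norm_num) (by norm_num) rfl h c1292
  have c1368 : Nat.ble (chunkSum 15 800 800 1 76 1368) 761495403959 = true := by decide +kernel
  replace h := sum_Ico_add_chunk_le (a := 1368) (b := 1444) (by norm_num) (by norm_num) rfl h c1368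
  have c1444 : Nat.ble (chunkSum 15 800 800 1 76 1444) 575316673365 = true := by decide +kernel
  replace h := sum_Ico_add_chunk_le (a := 1444) (b := 1520) (by norm_num) (by norm_num) rfl h c1444
  have c1520 : Nat.ble (chunkSum 15 800 800 1 76 1520) 515806992115 = true := by decide +kernel
  replace h := sum_Ico_add_chunk_le (a := 1520) (b := 1596) (by norm_num) (by norm_num) rfl h c1520
  have c1596 : Nat.ble (chunkSum 15 800 800 1 76 1596) 513005097701 = true := by decide +kernel
  replace h := sum_Ico_add_chunk_le (a := 1596) (b := 1672) (by norm_num) (by norm_num) rfl h c1596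
  have c1672 : Nat.ble (chunkSum 15 800 800 1 76 1672) 497113093843 = true := by decide +kernel
  replace h := sum_Ico_add_chunk_le (a := 1672) (b := 1748) (by norm_num) (by norm_num) rfl h c1672
  have c1748 : Nat.ble (chunkSum 15 800 800 1 76 1748) 389607977942 = true := by decide +kernel
  replace h := sum_Ico_add_chunk_le (a := 1748) (b := 1824) (by norm_num) (by norm_num) rfl h c1748
  have c1824 : Nat.ble (chunkSum 15 800 800 1 76 1824) 324247783170 = true := by decide +kernel
  replace h := sum_Ico_add_chunk_le (a := 1824) (b := 1900) (by norm_num) (by norm_num) rfl h c1824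
  have c1900 : Nat.ble (chunkSum 15 800 800 1 76 1900) 294547913134 = true := by decide +kernel
  replace h := sum_Ico_add_chunk_le (a := 1900) (b := 1976) (by norm_num) (by norm_num) rfl h c1900
  have c1976 : Nat.ble (chunkSum 15 800 800 1 76 1976) 279652471796 = true := by decide +kernel
  replace h := sum_Ico_add_chunk_le (a := 1976) (b := 2052) (by norm_num) (by norm_num) rfl h c1976
  have c2052 : Nat.ble (chunkSum 15 800 800 1 76 2052) 269029501075 = true := by decide +kernel
  replace h := sum_Ico_add_chunk_le (a := 2052) (b := 2128) (by norm_num) (by norm_num) rfl h c2052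
  have c2128 : Nat.ble (chunkSum 15 800 800 1 76 2128) 236974355089 = true := by decide +kernel
  replace h := sum_Ico_add_chunk_le (a := 2128) (b := 2204) (by norm_num) (by norm_num) rfl h c2128
  have c2204 : Nat.ble (chunkSum 15 800 800 1 76 2204) 217693855205 = true := by decide +kernel
  replace h := sum_Ico_add_chunk_le (a := 2204) (b := 2280) (by norm_num) (by norm_num) rfl h c2204
  have c2280 : Nat.ble (chunkSum 15 800 800 1 76 2280) 209349281825 = true := by decide +kernel
  replace h := sum_Ico_add_chunk_le (a := 2280) (b := 2356) (by norm_num) (by norm_num) rfl h c2280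
  have c2356 : Nat.ble (chunkSum 15 800 800 1 76 2356) 185244360385 = true := by decide +kernel
  replace h := sum_Ico_add_chunk_le (a := 2356) (b := 2432) (by norm_num) (by norm_num) rfl h c2356
  have c2432 : Nat.ble (chunkSum 15 800 800 1 76 2432) 165489955178 = true := by decide +kernel
  replace h := sum_Ico_add_chunk_le (a := 2432) (b := 2508) (by norm_num) (by norm_num) rfl h c2432
  have c2508 : Nat.ble (chunkSum 15 800 800 1 76 2508) 142401463371 = true := by decide +kernel
  replace h := sum_Ico_add_chunk_le (a := 2508) (b := 2584) (by norm_num) (by norm_num) rfl h c2508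
  have c2584 : Nat.ble (chunkSum 15 800 800 1 76 2584) 170938975977 = true := by decide +kernel
  replace h := sum_Ico_add_chunk_le (a := 2584) (b := 2660) (by norm_num) (by norm_num) rfl h c2584
  have c2660 : Nat.ble (chunkSum 15 800 800 1 76 2660) 157451525142 = true := by decide +kernel
  replace h := sum_Ico_add_chunk_le (a := 2660) (b := 2736) (by norm_num) (by norm_num) rfl h c2660
  have c2736 : Nat.ble (chunkSum 15 800 800 1 76 2736) 124662562663 = true := by decide +kernel
  replace h := sum_Ico_add_chunk_le (a := 2736) (b := 2812) (by norm_num) (by norm_num) rfl h c2736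
  have c2812 : Nat.ble (chunkSum 15 800 800 1 76 2812) 117719489975 = true := by decide +kernel
  replace h := sum_Ico_add_chunk_le (a := 2812) (b := 2888) (by norm_num) (by norm_num) rfl h c2812
  have c2888 : Nat.ble (chunkSum 15 800 800 1 76 2888) 112476141030 = true := by decide +kernel
  replace h := sum_Ico_add_chunk_le (a := 2888) (b := 2964) (by norm_num) (by norm_num) rfl h c2888
  have c2964 : Nat.ble (chunkSum 15 800 800 1 76 2964) 118875435675 = true := by decide +kernel
  replace h := sum_Ico_add_chunk_le (a := 2964) (b := 3040) (by norm_num) (by norm_num) rfl h c2964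
  have c3040 : Nat.ble (chunkSum 15 800 800 1 76 3040) 91937671029 = true := by decide +kernel
  replace h := sum_Ico_add_chunk_le (a := 3040) (b := 3116) (by norm_num) (by norm_num) rfl h c3040
  have c3116 : Nat.ble (chunkSum 15 800 800 1 76 3116) 115143799837 = true := by decide +kernel
  replace h := sum_Ico_add_chunk_le (a := 3116) (b := 3192) (by norm_num) (by norm_num) rfl h c3116
  have c3192 : Nat.ble (chunkSum 15 800 800 1 76 3192) 90967285968 = true := by decide +kernel
  replace h := sum_Ico_add_chunk_le (a := 3192) (b := 3268) (by norm_num) (by norm_num) rfl h c3192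
  have c3268 : Nat.ble (chunkSum 15 800 800 1 76 3268) 103213850984 = true := by decide +kernel
  replace h := sum_Ico_add_chunk_le (a := 3268) (b := 3344) (by norm_num) (by norm_num) rfl h c3268
  have c3344 : Nat.ble (chunkSum 15 800 800 1 76 3344) 82578672364 = true := by decide +kernel
  replace h := sum_Ico_add_chunk_le (a := 3344) (b := 3420) (by norm_num) (by norm_num) rfl h c3344
  have c3420 : Nat.ble (chunkSum 15 800 800 1 76 3420) 84694381863 = true := by decide +kernel
  replace h := sum_Ico_add_chunk_le (a := 3420) (b := 3496) (by norm_num) (by norm_num) rfl h c3420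
  have c3496 : Nat.ble (chunkSum 15 800 800 1 76 3496) 91716712380 = true := by decide +kernel
  replace h := sum_Ico_add_chunk_le (a := 3496) (b := 3572) (by norm_num) (by norm_num) rfl h c3496
  have c3572 : Nat.ble (chunkSum 15 800 800 1 76 3572) 77049634635 = true := by decide +kernel
  replace h := sum_Ico_add_chunk_le (a := 3572) (b := 3648) (by norm_num) (by norm_num) rfl h c3572
  have c3648 : Nat.ble (chunkSum 15 800 800 1 76 3648) 75030640969 = true := by decide +kernel
  replace h := sum_Ico_add_chunk_le (a := 3648) (b := 3724) (by norm_num) (by norm_num) rfl h c3648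
  have c3724 : Nat.ble (chunkSum 15 800 800 1 76 3724) 66825281066 = true := by decide +kernel
  replace h := sum_Ico_add_chunk_le (a := 3724) (b := 3800) (by norm_num) (by norm_num) rfl h c3724
  have c3800 : Nat.ble (chunkSum 15 800 800 1 76 3800) 65731227075 = true := by decide +kernel
  replace h := sum_Ico_add_chunk_le (a := 3800) (b := 3876) (by norm_num) (by norm_num) rfl h c3800
  have c3876 : Nat.ble (chunkSum 15 800 800 1 76 3876) 85410998997 = true := by decide +kernel
  replace h := sum_Ico_add_chunk_le (a := 3876) (b := 3952) (by norm_num) (by norm_num) rfl h c3876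
  refine h.trans ?_
  norm_num

/-- An explicit upper bound of prime number theorem strength for the Chebyshev function. -/
lemma psi_le_of_le_log {x : ℝ} (hx : 0 < x) (hl : 13 ≤ Real.log x) :
    Chebyshev.psi x ≤ (1 + (Real.log (Real.log x) - 1.1) / Real.log x) * x :=
  psi_le_of_window_weights (Finset.range 3072) weightAt divisorAt (fun i _ ↦ divisorAt_pos i) weightedFloor_one
    sum_cellWeight_le abs_sum_weightAt_div sum_abs_weightAt_mul (sum_abs_weightAt.trans (by norm_num)) hx hl

/-- The number of `n = 2 * i + 1` with `t ≤ i < t + 2 ^ j` that are coprime to `P`. -/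
def coprimeCount (P j t : ℕ) : ℕ :=
  treeSum (fun t ↦ cond (Nat.beq (Nat.gcd P (Nat.succ (Nat.mul 2 t))) 1) 1 0) j t

/-- Calls `r` with the block after `N` if `c * log c ≤ N`. -/
def scanStep (j : ℕ) (r : ℕ → ℕ → ℕ) (N c : ℕ) : ℕ :=
  cond (Nat.ble (Nat.mul (Nat.mul c (Nat.succ (Nat.log2 (Nat.pow c 64)))) 6931471808) (Nat.mul 640000000000 N))
    (r (Nat.add N (Nat.mul 2 (Nat.shiftLeft 1 j))) c) 0

/-- Extends the bound `c` for the number of primes up to `N` over `q` blocks of length `2 ^ (j + 1)`; the result is `0`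
unless at each block the new `c` satisfies `c * log c ≤ N`. -/
def sieveScan (P j q : ℕ) : ℕ → ℕ → ℕ :=
  Nat.rec (fun _ c ↦ c)
    (fun _ r N c ↦ force (Nat.add c (coprimeCount P j (Nat.div N 2))) (scanStep j r N)) q

def factorialScan (m j q N c : ℕ) : ℕ := force (Nat.factorial m) fun P ↦ sieveScan P j q N c

/-- `c` bounds the number of primes up to `N`, and the `k`-th prime exceeds `k * log k` up to `N`. -/
def VerifiedUpTo (N c : ℕ) : Prop :=
  Nat.count Nat.Prime (N + 1) ≤ c ∧
    ∀ p, p.Prime → p ≤ N → ((Nat.count Nat.Prime p + 1 : ℕ) : ℝ) * Real.log (Nat.count Nat.Prime p + 1 : ℕ) < p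

lemma log_le_log2_pow {c : ℕ} (hc : 0 < c) : Real.log c ≤ ((Nat.log2 (c ^ 64) + 1 : ℕ) : ℝ) / 64 * 0.6931471808 := by
  have h : ((c ^ 64 : ℕ) : ℝ) ≤ ((2 ^ (Nat.log2 (c ^ 64) + 1) : ℕ) : ℝ) := by
    exact_mod_cast Nat.lt_log2_self.le
  have h2 := Real.log_le_log (by positivity) h
  push_cast at h2
  rw [Real.log_pow, Real.log_pow] at h2
  have h3 := Real.log_two_lt_d9
  have h4 : ((Nat.log2 (c ^ 64) : ℝ) + 1) * Real.log 2 ≤ (Nat.log2 (c ^ 64) + 1) * 0.6931471808 := by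
    gcongr
  push_cast at h2 ⊢
  linarith

lemma count_prime_le {N m : ℕ} (hN : N % 2 = 0) (h2 : 2 ≤ N) (hm : m ≤ N) (L : ℕ) :
    Nat.count Nat.Prime (N + 1 + 2 * L) ≤ Nat.count Nat.Prime (N + 1) +
      ∑ i ∈ Finset.range L, cond (Nat.beq (Nat.gcd m.factorial (Nat.succ (Nat.mul 2 (N / 2 + i)))) 1) 1 0 := by
  induction L with
  | zero => simp
  | succ L ih =>
    rw [show N + 1 + 2 * (L + 1) = N + 1 + 2 * L + 1 + 1 by ring, Nat.count_succ, Nat.count_succ,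
      Finset.sum_range_succ]
    have h1 : ¬ (N + 1 + 2 * L + 1).Prime := fun hp ↦ by
      have := hp.eq_one_or_self_of_dvd 2 (by omega)
      omega
    rw [if_neg h1, add_zero, ← add_assoc]
    refine Nat.add_le_add ih ?_
    split_ifs with hp
    · have e : Nat.succ (Nat.mul 2 (N / 2 + L)) = N + 1 + 2 * L := by
        change 2 * (N / 2 + L) + 1 = _
        omega
      have h3 : Nat.gcd m.factorial (N + 1 + 2 * L) = 1 :=
        (hp.coprime_iff_not_dvd.2 fun h ↦ by have := hp.dvd_factorial.1 h; omega).symm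
      rw [e, h3]
      rfl
    · exact Nat.zero_le _

lemma VerifiedUpTo.step {N c c' L : ℕ} (h : VerifiedUpTo N c) (hN : N % 2 = 0)
    (hc : Nat.count Nat.Prime (N + 1 + 2 * L) ≤ c') (hcc : c' * Real.log c' ≤ N) :
    VerifiedUpTo (N + 2 * L) c' := by
  refine ⟨by rwa [add_right_comm], fun p hp hpN ↦ ?_⟩
  rcases le_or_gt p N with h1 | h1
  · exact h.2 p hp h1
  have h2 : Nat.count Nat.Prime p + 1 ≤ c' := by
    have : Nat.count Nat.Prime (p + 1) = Nat.count Nat.Prime p + 1 := by rw [Nat.count_succ, if_pos hp]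
    rw [← this]
    exact (Nat.count_monotone _ (by omega)).trans hc
  calc _ ≤ (c' : ℝ) * Real.log c' := by
        gcongr
    _ ≤ N := hcc
    _ < p := by exact_mod_cast h1

lemma scanStep_eq (j : ℕ) (r : ℕ → ℕ → ℕ) (N c : ℕ) :
    scanStep j r N c = cond (Nat.ble (c * (Nat.log2 (c ^ 64) + 1) * 6931471808) (640000000000 * N))
      (r (N + 2 * 2 ^ j) c) 0 := by
  have e : Nat.shiftLeft 1 j = 2 ^ j := Nat.one_shiftLeft j
  rw [scanStep, e]
  simp only [Nat.mul_eq, Nat.add_eq, Nat.pow_eq, Nat.succ_eq_add_one]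

lemma sieveScan_succ (P j q N c : ℕ) :
    sieveScan P j (q + 1) N c =
      scanStep j (sieveScan P j q) N (c + coprimeCount P j (N / 2)) := by
  have h : sieveScan P j (q + 1) N c =
    force (Nat.add c (coprimeCount P j (Nat.div N 2))) (scanStep j (sieveScan P j q) N) := rfl
  rw [h, force_eq]
  rfl

lemma VerifiedUpTo.sieveScan {N c m j q : ℕ} (h : VerifiedUpTo N c) (hN : N % 2 = 0) (h2 : 2 ≤ N) (hm : m ≤ N)
    (hs : sieveScan m.factorial j q N c ≠ 0) :
    VerifiedUpTo (N + q * (2 * 2 ^ j)) (sieveScan m.factorial j q N c) := by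
  induction q generalizing N c with
  | zero => simpa [_root_.sieveScan] using h
  | succ q ih =>
    set C := c + coprimeCount m.factorial j (N / 2) with hC
    have e := sieveScan_succ m.factorial j q N c
    rw [← hC, scanStep_eq] at e
    rw [e] at hs ⊢
    cases hb : Nat.ble (C * (Nat.log2 (C ^ 64) + 1) * 6931471808) (640000000000 * N) with
    | false => simp [hb] at hs
    | true =>
      rw [hb] at hs
      have hcount : Nat.count Nat.Prime (N + 1 + 2 * 2 ^ j) ≤ C := by
        refine (count_prime_le hN h2 hm _).trans ?_
        rw [hC, coprimeCount, treeSum_eq]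
        exact Nat.add_le_add_right h.1 _
      have hlog : C * Real.log C ≤ N := by
        have h1 : ((C * (Nat.log2 (C ^ 64) + 1) * 6931471808 : ℕ) : ℝ) ≤ ((640000000000 * N : ℕ) : ℝ) := by
          exact_mod_cast Nat.le_of_ble_eq_true hb
        rcases Nat.eq_zero_or_pos C with h0 | h0
        · simp [h0]
        · have := mul_le_mul_of_nonneg_left (log_le_log2_pow h0) (Nat.cast_nonneg (α := ℝ) C)
          push_cast at h1 this
          linarith
      have := ih (h.step hN hcount hlog) (by omega) (by omega) (by omega) hs
      rw [show N + (q + 1) * (2 * 2 ^ j) = N + 2 * 2 ^ j + q * (2 * 2 ^ j) by ring]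
      exact this

lemma VerifiedUpTo.factorialScan {N c N' c' : ℕ} (h : VerifiedUpTo N c) (m j q : ℕ) (hN : N % 2 = 0) (h2 : 2 ≤ N)
    (hm : m ≤ N) (hc : c' ≠ 0) (hN' : N + q * (2 * 2 ^ j) = N')
    (hs : Nat.beq (factorialScan m j q N c) c' = true) : VerifiedUpTo N' c' := by
  rw [_root_.factorialScan, force_eq] at hs
  have hs := Nat.eq_of_beq_eq_true hs
  have := h.sieveScan (j := j) (q := q) hN h2 hm (by rw [hs]; exact hc)
  rwa [hs, hN'] at this

lemma verifiedUpTo_two : VerifiedUpTo 2 1 := by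
  refine ⟨by decide, fun p hp h ↦ ?_⟩
  obtain rfl : p = 2 := le_antisymm h hp.two_le
  rw [show Nat.count Nat.Prime 2 = 0 by decide]
  norm_num

lemma verifiedUpTo_450888 : VerifiedUpTo 450888 37788 := by
  have h : VerifiedUpTo 8 4 := verifiedUpTo_two.factorialScan 2 0 3 rfl (by norm_num) (by norm_num) (by norm_num) rfl
    (by decide +kernel)
  replace h : VerifiedUpTo 24 9 := h.factorialScan 4 0 8 rfl (by norm_num) (by norm_num) (by norm_num) rfl
    (by decide +kernel)
  replace h : VerifiedUpTo 48 15 := h.factorialScan 6 0 12 rfl (by norm_num) (by norm_num) (by norm_num) rfl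
    (by decide +kernel)
  replace h : VerifiedUpTo 120 30 := h.factorialScan 10 0 36 rfl (by norm_num) (by norm_num) (by norm_num) rfl
    (by decide +kernel)
  replace h : VerifiedUpTo 840 146 := h.factorialScan 28 0 360 rfl (by norm_num) (by norm_num) (by norm_num) rfl
    (by decide +kernel)
  replace h : VerifiedUpTo 1352 217 := h.factorialScan 719 5 8 rfl (by norm_num) (by norm_num) (by norm_num) rfl
    (by decide +kernel)
  replace h : VerifiedUpTo 2376 351 := h.factorialScan 719 6 8 rfl (by norm_num) (by norm_num) (by norm_num) rfl
    (by decide +kernel)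
  replace h : VerifiedUpTo 4424 602 := h.factorialScan 719 7 8 rfl (by norm_num) (by norm_num) (by norm_num) rfl
    (by decide +kernel)
  replace h : VerifiedUpTo 8520 1061 := h.factorialScan 719 8 8 rfl (by norm_num) (by norm_num) (by norm_num) rfl
    (by decide +kernel)
  replace h : VerifiedUpTo 16712 1933 := h.factorialScan 719 9 8 rfl (by norm_num) (by norm_num) (by norm_num) rfl
    (by decide +kernel)
  replace h : VerifiedUpTo 33096 3548 := h.factorialScan 719 10 8 rfl (by norm_num) (by norm_num) (by norm_num) rfl
    (by decide +kernel)
  replace h : VerifiedUpTo 74056 7306 := h.factorialScan 719 11 10 rfl (by norm_num) (by norm_num) (by norm_num) rfl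
    (by decide +kernel)
  exact h.factorialScan 719 12 46 rfl (by norm_num) (by norm_num) (by norm_num) rfl (by decide +kernel)

/-- A lower model for `∑ i ≤ t, log (i * log i)`. -/
noncomputable def sumLogModel (t : ℝ) : ℝ := t * (Real.log t + Real.log (Real.log t) - 1 - 1.4 / Real.log t)

lemma hasDerivAt_sumLogModel {t : ℝ} (ht : 1 < t) :
    HasDerivAt sumLogModel (Real.log t + Real.log (Real.log t) - 0.4 / Real.log t + 1.4 / Real.log t ^ 2) t := by
  have h0 : t ≠ 0 := by positivity
  have hl : 0 < Real.log t := Real.log_pos ht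
  have h1 := Real.hasDerivAt_log h0
  have h2 := h1.log hl.ne'
  have h3 := (h1.inv hl.ne').const_mul 1.4
  have h4 := (hasDerivAt_id t).mul (((h1.add h2).sub_const 1).sub h3)
  refine (h4.congr_of_eventuallyEq (Filter.Eventually.of_forall fun s ↦ ?_)).congr_deriv ?_
  · simp [sumLogModel, div_eq_mul_inv]
  · simp only [id, Pi.add_apply, Pi.sub_apply, Pi.inv_apply]
    field_simp
    ring

lemma log_thirtyFour_bounds : 3.5 ≤ Real.log 34 ∧ Real.log 34 ≤ 3.6 := by
  have h1 := Real.exp_one_lt_d9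
  have h2 := Real.exp_one_gt_d9
  constructor
  · have : Real.exp 1 ^ 7 ≤ 34 ^ 2 := (pow_le_pow_left₀ (Real.exp_pos 1).le h1.le 7).trans (by norm_num)
    have := Real.log_le_log (by positivity) this
    rw [Real.log_pow, Real.log_pow, Real.log_exp] at this
    push_cast at this
    linarith
  · have : 34 ^ 5 ≤ Real.exp 1 ^ 18 := le_trans (by norm_num) (pow_le_pow_left₀ (by norm_num) h2.le 18)
    have := Real.log_le_log (by positivity) this
    rw [Real.log_pow, Real.log_pow, Real.log_exp] at this
    push_cast at this
    linarith

lemma sumLogModel_add_one_le {t : ℝ} (ht : 34 ≤ t) :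
    sumLogModel (t + 1) - sumLogModel t ≤ Real.log ((t + 1) * Real.log (t + 1)) := by
  have hd (s : ℝ) (hs : 34 ≤ s) := hasDerivAt_sumLogModel (t := s) (by linarith)
  have h := (convex_Icc t (t + 1)).image_sub_le_mul_sub_of_deriv_le (f := sumLogModel)
    (C := Real.log ((t + 1) * Real.log (t + 1)))
    (fun s hs ↦ (hd s (ht.trans hs.1)).continuousAt.continuousWithinAt)
    (fun s hs ↦ (hd s (ht.trans (interior_subset hs).1)).differentiableAt.differentiableWithinAt) ?_
    t ⟨le_rfl, by linarith⟩ (t + 1) ⟨by linarith, le_rfl⟩ (by linarith)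
  · simpa using h
  · intro s hs
    have hs := interior_subset hs
    have hs34 := ht.trans hs.1
    rw [(hd s hs34).deriv]
    have hl : 3.5 ≤ Real.log s := log_thirtyFour_bounds.1.trans (Real.log_le_log (by norm_num) hs34)
    have hl' : Real.log s ≤ Real.log (t + 1) := Real.log_le_log (by linarith) hs.2
    have hll := Real.log_le_log (by linarith) hl'
    rw [Real.log_mul (by linarith) (by linarith)]
    have : 1.4 / Real.log s ^ 2 ≤ 0.4 / Real.log s := by
      rw [div_le_div_iff₀ (by positivity) (by linarith)]
      nlinarith
    linarith

lemma sumLogModel_thirtyFour_le : sumLogModel 34 ≤ 135 := by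
  obtain ⟨h1, h2⟩ := log_thirtyFour_bounds
  have h3 : Real.log (Real.log 34) ≤ 1.3 := by
    have h4 : (3.6:ℝ) ^ 10 ≤ Real.exp 1 ^ 13 :=
      le_trans (by norm_num) (pow_le_pow_left₀ (by norm_num) Real.exp_one_gt_d9.le 13)
    have h5 := Real.log_le_log (by positivity) h4
    rw [Real.log_pow, Real.log_pow, Real.log_exp] at h5
    have h6 := Real.log_le_log (by linarith) h2
    push_cast at h5
    linarith
  unfold sumLogModel
  have : 0 ≤ 1.4 / Real.log 34 := by positivity
  linarith

lemma sumLogModel_le_sum_log_nth {n : ℕ} (hn : 34 ≤ n)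
    (h : ∀ i < n, ((i + 1 : ℕ) : ℝ) * Real.log (i + 1 : ℕ) < Nat.nth Nat.Prime i) :
    sumLogModel n - 135 ≤ ∑ i ∈ Finset.range n, Real.log (Nat.nth Nat.Prime i) := by
  induction n, hn using Nat.le_induction with
  | base =>
    have : 0 ≤ ∑ i ∈ Finset.range 34, Real.log (Nat.nth Nat.Prime i) :=
      Finset.sum_nonneg fun i _ ↦ Real.log_natCast_nonneg _
    have h2 := sumLogModel_thirtyFour_le
    push_cast
    linarith
  | succ n hn ih =>
    have hn' : (34:ℝ) ≤ n := by exact_mod_cast hn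
    have h1 := ih fun i hi ↦ h i (by omega)
    have h2 := sumLogModel_add_one_le hn'
    have h3 := h n (by omega)
    push_cast at h3 ⊢
    rw [Finset.sum_range_succ]
    have hl : 0 < Real.log (n + 1 : ℝ) := Real.log_pos (by linarith)
    have h4 := Real.log_le_log (by positivity) h3.le
    linarith

lemma sum_log_nth_le_theta {n : ℕ} {x : ℝ} (h : (Nat.nth Nat.Prime n : ℝ) ≤ x) :
    ∑ i ∈ Finset.range n, Real.log (Nat.nth Nat.Prime i) ≤ Chebyshev.theta x := by
  unfold Chebyshev.theta
  rw [← Finset.sum_image (f := fun p : ℕ ↦ Real.log p) (s := Finset.range n) (g := Nat.nth Nat.Prime)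
    (Nat.nth_injective Nat.infinite_setOfPred_prime).injOn]
  refine Finset.sum_le_sum_of_subset_of_nonneg (fun p hp ↦ ?_) fun p _ _ ↦ Real.log_natCast_nonneg _
  obtain ⟨i, hi, rfl⟩ := Finset.mem_image.1 hp
  have hp := Nat.prime_nth_prime i
  rw [Finset.mem_filter, Finset.mem_Ioc]
  refine ⟨⟨hp.pos, Nat.le_floor (le_trans ?_ h)⟩, hp⟩
  exact_mod_cast (Nat.nth_strictMono Nat.infinite_setOfPred_prime (Finset.mem_range.1 hi)).le

lemma log_fortyTwoThousand_bounds : 10.6 ≤ Real.log 42000 ∧ Real.log 42000 ≤ 10.7 := by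
  have h1 := Real.exp_one_lt_d9
  have h2 := Real.exp_one_gt_d9
  constructor
  · have : Real.exp 1 ^ 53 ≤ 42000 ^ 5 := (pow_le_pow_left₀ (Real.exp_pos 1).le h1.le 53).trans (by norm_num)
    have := Real.log_le_log (by positivity) this
    rw [Real.log_pow, Real.log_pow, Real.log_exp] at this
    push_cast at this
    linarith
  · have : 42000 ^ 10 ≤ Real.exp 1 ^ 107 := le_trans (by norm_num) (pow_le_pow_left₀ (by norm_num) h2.le 107)
    have := Real.log_le_log (by positivity) this
    rw [Real.log_pow, Real.log_pow, Real.log_exp] at this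
    push_cast at this
    linarith

lemma log_ge_of_ge {n : ℝ} (hn : 10.6 ≤ n) : 2.36 ≤ Real.log n := by
  have h1 : Real.exp 1 ^ 59 ≤ 10.6 ^ 25 :=
    (pow_le_pow_left₀ (Real.exp_pos 1).le Real.exp_one_lt_d9.le 59).trans (by norm_num)
  have h2 := Real.log_le_log (by positivity) h1
  rw [Real.log_pow, Real.log_pow, Real.log_exp] at h2
  have h3 := Real.log_le_log (by norm_num) hn
  push_cast at h2
  linarith

lemma log_le_of_ge {n : ℝ} (hn : 10.6 ≤ n) : Real.log n ≤ 0.24 * n := by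
  have h1 : (10.6:ℝ) ^ 100 ≤ Real.exp 1 ^ 237 :=
    le_trans (by norm_num) (pow_le_pow_left₀ (by norm_num) Real.exp_one_gt_d9.le 237)
  have h2 := Real.log_le_log (by positivity) h1
  rw [Real.log_pow, Real.log_pow, Real.log_exp] at h2
  have h3 := Real.log_le_sub_one_of_pos (show 0 < n / 10.6 by positivity)
  rw [Real.log_div (by linarith) (by norm_num)] at h3
  have h4 : n / 10.6 ≤ 0.0945 * n := by rw [div_le_iff₀ (by norm_num)]; linarith
  push_cast at h2
  linarith

lemma mul_log_lt_nth_of_large {k : ℕ} (hk : 42000 ≤ k)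
    (h : ∀ i < k - 1, ((i + 1 : ℕ) : ℝ) * Real.log (i + 1 : ℕ) < Nat.nth Nat.Prime i) :
    (k : ℝ) * Real.log k < Nat.nth Nat.Prime (k - 1) := by
  by_contra! hlt
  have hkR : (42000:ℝ) ≤ k := by exact_mod_cast hk
  have hk0 : (0:ℝ) < k := by linarith
  have h1 := sumLogModel_le_sum_log_nth (by omega) h
  have h2 := (sum_log_nth_le_theta hlt).trans (Chebyshev.theta_le_psi _)
  have h3 := sumLogModel_add_one_le (t := (k - 1 : ℕ)) (by exact_mod_cast (by omega : 34 ≤ k - 1))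
  rw [Nat.cast_sub (by omega), Nat.cast_one, sub_add_cancel] at h3
  rw [Nat.cast_sub (by omega), Nat.cast_one] at h1
  set n := Real.log k with hn
  set m := Real.log n with hm
  have hn1 : 10.6 ≤ n := log_fortyTwoThousand_bounds.1.trans (Real.log_le_log (by norm_num) hkR)
  have hm1 : 2.36 ≤ m := log_ge_of_ge hn1
  have hm2 : m ≤ 0.24 * n := log_le_of_ge hn1
  have hn0 : 0 < n := by linarith
  have hL : Real.log (k * n) = n + m := Real.log_mul hk0.ne' hn0.ne'
  have hL13 : 13 ≤ Real.log (k * n) := by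
    rw [Real.le_log_iff_exp_le (by positivity), show (13:ℝ) = (13:ℕ) by norm_num, ← Real.exp_one_pow]
    calc Real.exp 1 ^ 13 ≤ 42000 * 10.6 :=
          (pow_le_pow_left₀ (Real.exp_pos 1).le Real.exp_one_lt_d9.le 13).trans (by norm_num)
      _ ≤ _ := by gcongr
  have h4 := psi_le_of_le_log (by positivity) hL13
  rw [hL] at h3 h4 hL13
  have hlog : Real.log (n + m) ≤ m + m / n := by
    have : n + m = n * (1 + m / n) := by field_simp
    rw [this, Real.log_mul hn0.ne' (by positivity)]
    have := Real.log_le_sub_one_of_pos (show 0 < 1 + m / n by positivity)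
    linarith
  have hsq : n ^ 2 ≤ 0.0046 * k := sq_log_le_mul (a := 0.0046) 10 hk0 (by push_cast; linarith) (by norm_num) (by norm_num)
  have h5 : sumLogModel k - (n + m) - 135 ≤ (1 + (m + m / n - 1.1) / (n + m)) * (k * n) := by
    have : (1 + (Real.log (n + m) - 1.1) / (n + m)) * (k * n) ≤ (1 + (m + m / n - 1.1) / (n + m)) * (k * n) := by
      gcongr
    linarith
  rw [sumLogModel, ← hn, ← hm] at h5
  have hLpos : 0 < n + m := by linarith
  have e : (1 + (m + m / n - 1.1) / (n + m)) * (k * n) * (n + m) = k * (n * (n + m) + (n * m + m - 1.1 * n)) := by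
    field_simp
  have h6 := mul_le_mul_of_nonneg_right h5 hLpos.le
  rw [e] at h6
  have e2 : (k * (n + m - 1 - 1.4 / n) - (n + m) - 135) * (n + m) =
      k * ((n + m - 1) * (n + m) - 1.4 - 1.4 * (m / n)) - (n + m) ^ 2 - 135 * (n + m) := by
    field_simp
    ring
  rw [e2] at h6
  have h7 : m / n ≤ 0.24 := by
    rw [div_le_iff₀ hn0]
    exact hm2
  have h8 : (n + m) ^ 2 ≤ 0.0072 * k := by
    have : (n + m) ^ 2 ≤ (1.24 * n) ^ 2 := pow_le_pow_left₀ hLpos.le (by linarith) 2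
    linarith
  have h9 : 135 * (n + m) ≤ 0.075 * k := by
    have : 10.6 * n ≤ n ^ 2 := by rw [pow_two]; gcongr
    linarith
  have h10 : 0.84 + 1.06 - 1.4 - 0.336 ≤ m ^ 2 - 2 * m + 0.1 * n - 1.4 - 1.4 * (m / n) := by
    have : 0 ≤ (m - 2.36) * (m + 0.36) := mul_nonneg (by linarith) (by linarith)
    linarith
  generalize m / n = q at h6 h10
  have h11 := mul_le_mul_of_nonneg_left h10 hk0.le
  linarith

lemma mul_log_lt_nth (k : ℕ) (hk : 0 < k) : (k : ℝ) * Real.log k < Nat.nth Nat.Prime (k - 1) := by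
  induction k using Nat.strong_induction_on with
  | h k ih =>
    rcases le_or_gt 42000 k with h | h
    · exact mul_log_lt_nth_of_large h fun i hi ↦ ih (i + 1) (by omega) (by omega)
    · rcases le_or_gt (Nat.nth Nat.Prime (k - 1)) 450888 with hp | hp
      · have := verifiedUpTo_450888.2 _ (Nat.prime_nth_prime _) hp
        rwa [Nat.count_nth_of_infinite Nat.infinite_setOfPred_prime, Nat.sub_add_cancel hk] at this
      · have hp' : (450888:ℝ) < Nat.nth Nat.Prime (k - 1) := by exact_mod_cast hp
        have hk' : (k:ℝ) ≤ 42000 := by exact_mod_cast h.le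
        refine lt_of_le_of_lt ?_ hp'
        calc (k:ℝ) * Real.log k ≤ 42000 * 10.7 := by
              gcongr
              exact (Real.log_le_log (by exact_mod_cast hk) hk').trans log_fortyTwoThousand_bounds.2
          _ ≤ _ := by norm_num

/-- **Property q₁ (growth of the differences along a ray).**
For every `m ∈ M̄ = {m | 1 ≤ m ∧ ¬ m.Prime}` and every `n ≥ 1`, the difference
`d_m(n) = p^[n+1] m - p^[n] m` satisfies `d_m(n) > p^[n] m · (ln (p^[n] m) - 1)`. -/
theorem ray_difference_growth (m : ℕ) (hm : m ∈ {m : ℕ | 1 ≤ m ∧ ¬ m.Prime})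
    (n : ℕ) (hn : 1 ≤ n) :
    ((p^[n + 1] m : ℝ) - (p^[n] m : ℝ)) >
      (p^[n] m : ℝ) * (Real.log (p^[n] m) - 1) := by
  obtain ⟨n, rfl⟩ := Nat.exists_eq_add_of_le' hn
  rw [Function.iterate_succ_apply' p (n + 1) m]
  have hk : 0 < p^[n + 1] m := by
    rw [Function.iterate_succ_apply']
    exact (Nat.prime_nth_prime _).pos
  have h := mul_log_lt_nth _ hk
  rw [← p] at h
  linarith
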